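/- Assume 0 ≤ γ ≤ 2 and that the angular kernel b satisfies Grad's cutoff (H1). Then for every f₀ ∈ L¹₂(ℝ³) with 0 ≤ f₀ ≤ 1 a.e., there exists a conservative mild solution f of the Boltzmann–Fermi–Dirac equation with initial datum f₀, and it is unique: if f and g are both conservative mild solutions with the same initial datum f₀, then for every t ≥ 0, f(t,·) = g(t,·) almost everywhere. -/

import Mathlib

noncomputable section

open MeasureTheory Real Set
open scoped RealInnerProductSpace

/-- `ℝ³` as a Euclidean space. -/
abbrev R3 : Type := EuclideanSpace ℝ (Fin 3)

/-- The unit sphere `𝕊²` in `ℝ³`. -/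
abbrev S2 : Type := Metric.sphere (0 : R3) 1

/-- The surface measure on the unit sphere in `ℝ³` (total mass `4π`). -/
def sphMeasure : Measure S2 := Measure.toSphere (volume : Measure R3)

/-- Post-collision velocity `v' = (v+v_*)/2 + (|v-v_*|/2)σ`. -/
def vOut (v w : R3) (σ : S2) : R3 := (2⁻¹ : ℝ) • (v + w) + (‖v - w‖ / 2) • (σ : R3)

/-- Post-collision velocity `v'_* = (v+v_*)/2 - (|v-v_*|/2)σ`. -/
def vOutStar (v w : R3) (σ : S2) : R3 := (2⁻¹ : ℝ) • (v + w) - (‖v - w‖ / 2) • (σ : R3)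

/-- `cos θ = ((v - v_*)/|v - v_*|) · σ`. -/
def cosAngle (v w : R3) (σ : S2) : ℝ := ⟪‖v - w‖⁻¹ • (v - w), (σ : R3)⟫

/-- The collision kernel `B(v - v_*, σ) = |v - v_*|^γ b(cos θ)`. -/
def Bker (γ : ℝ) (b : ℝ → ℝ) (v w : R3) (σ : S2) : ℝ := ‖v - w‖ ^ γ * b (cosAngle v w σ)

/-- Grad's angular cutoff assumption (H1), with the standing assumptions on `b`:
`b` is measurable, nonnegative, symmetric (`b(cos(π-θ)) = b(cos θ)`), and
`0 < C_b = 2π∫₀^π b(cos θ) sin θ dθ < ∞`. -/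
structure GradCutoff (b : ℝ → ℝ) : Prop where
  measurable : Measurable b
  nonneg : ∀ x : ℝ, 0 ≤ b x
  symm : ∀ θ : ℝ, b (Real.cos (π - θ)) = b (Real.cos θ)
  integrable : IntervalIntegrable (fun θ : ℝ => b (Real.cos θ) * Real.sin θ) volume 0 π
  pos : 0 < ∫ θ in (0:ℝ)..π, b (Real.cos θ) * Real.sin θ

/-- `C_b = 2π ∫₀^π b(cos θ) sin θ dθ`. -/
def Cb (b : ℝ → ℝ) : ℝ := 2 * π * ∫ θ in (0:ℝ)..π, b (Real.cos θ) * Real.sin θ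

/-- `C_{b,2} = 2π ∫₀^π b(cos θ) sin³ θ dθ`. -/
def Cb2 (b : ℝ → ℝ) : ℝ := 2 * π * ∫ θ in (0:ℝ)..π, b (Real.cos θ) * Real.sin θ ^ 3

/-- `φ(ε) = ∫_{𝕊²} b(cos θ)(1_{0<θ<ε} + 1_{π-ε<θ<π}) dσ`,
written via the polar-angle parametrization of the sphere. -/
def phiAng (b : ℝ → ℝ) (ε : ℝ) : ℝ :=
  2 * π * ((∫ θ in (0:ℝ)..ε, b (Real.cos θ) * Real.sin θ)
    + ∫ θ in (π - ε)..π, b (Real.cos θ) * Real.sin θ)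

/-- Weighted `L¹` norm `‖f‖_{1,s} = ∫ |f(v)| (1+|v|²)^{s/2} dv`. -/
def wnorm (s : ℝ) (f : R3 → ℝ) : ℝ := ∫ v : R3, |f v| * (1 + ‖v‖ ^ 2) ^ (s / 2)

/-- Membership in the weighted space `L¹_s`. -/
def MemL1s (s : ℝ) (f : R3 → ℝ) : Prop :=
  Integrable (fun v : R3 => |f v| * (1 + ‖v‖ ^ 2) ^ (s / 2))

/-- The Boltzmann–Fermi–Dirac collision operator `Q_FD(f,f)`. -/
def QFD (γ : ℝ) (b : ℝ → ℝ) (f : R3 → ℝ) (v : R3) : ℝ :=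
  ∫ w : R3, ∫ σ : S2, Bker γ b v w σ *
      (f (vOut v w σ) * f (vOutStar v w σ) * (1 - f v) * (1 - f w)
        - f v * f w * (1 - f (vOut v w σ)) * (1 - f (vOutStar v w σ))) ∂sphMeasure

/-- `Q₁(f₁,f₂,f₃)(v) = ∫∫ B f₁(v') f₂(v'_*) f₃(v_*) dσ dv_*`. -/
def Q1 (γ : ℝ) (b : ℝ → ℝ) (f₁ f₂ f₃ : R3 → ℝ) (v : R3) : ℝ :=
  ∫ w : R3, ∫ σ : S2, Bker γ b v w σ *
      (f₁ (vOut v w σ) * f₂ (vOutStar v w σ) * f₃ w) ∂sphMeasure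

/-- `L_FD(f, 1-f, 1-f)(v) = ∫∫ B f(v_*)(1-f(v'))(1-f(v'_*)) dσ dv_*`. -/
def LFD (γ : ℝ) (b : ℝ → ℝ) (f : R3 → ℝ) (v : R3) : ℝ :=
  ∫ w : R3, ∫ σ : S2, Bker γ b v w σ *
      (f w * (1 - f (vOut v w σ)) * (1 - f (vOutStar v w σ))) ∂sphMeasure

/-- The Fermi–Dirac entropy `S(f)` (with `0·ln 0 = 0`, as `Real.log 0 = 0`). -/
def entropy (f : R3 → ℝ) : ℝ :=
  -∫ v : R3, (f v * Real.log (f v) + (1 - f v) * Real.log (1 - f v))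

/-- A conservative mild solution of the Boltzmann–Fermi–Dirac equation with
initial datum `f₀`. -/
structure IsFDSolution (γ : ℝ) (b : ℝ → ℝ) (f₀ : R3 → ℝ) (f : ℝ → R3 → ℝ) : Prop where
  measurable : ∀ t : ℝ, Measurable (f t)
  nonneg : ∀ t : ℝ, 0 ≤ t → ∀ v : R3, 0 ≤ f t v
  le_one : ∀ t : ℝ, 0 ≤ t → ∀ v : R3, f t v ≤ 1
  memL12 : ∀ t : ℝ, 0 ≤ t → MemL1s 2 (f t)
  contL12 : ∀ t : ℝ, 0 ≤ t → ∀ ε : ℝ, 0 < ε → ∃ δ > 0, ∀ s : ℝ, 0 ≤ s →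
      |s - t| < δ → wnorm 2 (fun v => f s v - f t v) < ε
  mild : ∃ Z : Set R3, volume Z = 0 ∧ ∀ t : ℝ, 0 ≤ t → ∀ v : R3, v ∉ Z →
      f t v = f₀ v + ∫ τ in (0:ℝ)..t, QFD γ b (f τ) v
  mass : ∀ t : ℝ, 0 ≤ t → ∫ v : R3, f t v = ∫ v : R3, f₀ v
  momentum : ∀ t : ℝ, 0 ≤ t → ∫ v : R3, f t v • v = ∫ v : R3, f₀ v • v
  energy : ∀ t : ℝ, 0 ≤ t → ∫ v : R3, f t v * ‖v‖ ^ 2 = ∫ v : R3, f₀ v * ‖v‖ ^ 2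

noncomputable section
open MeasureTheory Real Set
open scoped RealInnerProductSpace ENNReal

namespace BFD

instance : IsFiniteMeasure sphMeasure := by unfold sphMeasure; infer_instance

lemma polar3 (G : R3 → ℝ≥0∞) (hG : Measurable G) :
    ∫⁻ x, G x = ∫⁻ p : S2 × Ioi (0:ℝ), G ((p.2:ℝ) • (p.1:R3))
      ∂(sphMeasure.prod (Measure.volumeIoiPow 2)) := by
  have h := (volume : Measure R3).measurePreserving_homeomorphUnitSphereProd
  have hd : Module.finrank ℝ R3 - 1 = 2 := by simp
  rw [hd] at h
  have h2 := h.lintegral_comp (f := fun p : S2 × Ioi (0:ℝ) => G ((p.2:ℝ) • (p.1:R3)))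
    (hG.comp (by fun_prop))
  rw [sphMeasure, ← h2]
  have h3 : ∫⁻ x, G x = ∫⁻ x : ({0}ᶜ : Set R3), G x ∂(Measure.comap Subtype.val volume) := by
    rw [lintegral_subtype_comap (measurableSet_singleton _).compl, restrict_compl_singleton]
  rw [h3]
  refine lintegral_congr fun x => ?_
  congr 1
  simp only [homeomorphUnitSphereProd_apply_snd_coe, homeomorphUnitSphereProd_apply_fst_coe]
  rw [smul_smul, mul_inv_cancel₀ (norm_ne_zero_iff.2 x.2), one_smul]

lemma polar3' (G : R3 → ℝ≥0∞) (hG : Measurable G) :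
    ∫⁻ x, G x = ∫⁻ σ : S2, (∫⁻ r in Ioi (0:ℝ), ENNReal.ofReal (r ^ 2) * G (r • (σ:R3))) ∂sphMeasure := by
  rw [polar3 G hG, lintegral_prod _ (by fun_prop)]
  refine lintegral_congr fun σ => ?_
  have hm : Measurable fun r : ℝ => G (r • (σ:R3)) := by fun_prop
  rw [Measure.volumeIoiPow, lintegral_withDensity_eq_lintegral_mul _ (by fun_prop) (by fun_prop),
    ← lintegral_subtype_comap measurableSet_Ioi]
  rfl

/-- splitting `ℝ³` with respect to a unit vector. -/
lemma split3 (e : R3) (he : ‖e‖ = 1) (G : ℝ → ℝ → ℝ≥0∞) (hG : Measurable (Function.uncurry G)) :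
    ∫⁻ x : R3, G ⟪e, x⟫ (‖x‖ ^ 2) =
      ∫⁻ z : ℝ, ∫⁻ q : ℝ × ℝ, G z (z ^ 2 + (q.1 ^ 2 + q.2 ^ 2)) := by
  obtain ⟨B, hB⟩ := Orthonormal.exists_orthonormalBasis_extension_of_card_eq (𝕜 := ℝ) (E := R3)
    (ι := Fin 3) (by simp) (v := fun _ => e) (s := {0}) (by
      constructor
      · intro i; simpa using he
      · intro i j hij; exact absurd (Subtype.ext (i.2.trans j.2.symm)) hij)
  have hB0 : B 0 = e := hB 0 rfl
  have h1 : ∫⁻ x : R3, G ⟪e, x⟫ (‖x‖ ^ 2) = ∫⁻ y : R3, G (y 0) (y 0 ^ 2 + (y 1 ^ 2 + y 2 ^ 2)) := by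
    have hm : Measurable fun y : R3 => G (y 0) (y 0 ^ 2 + (y 1 ^ 2 + y 2 ^ 2)) :=
      hG.comp (f := fun y : R3 => (y 0, y 0 ^ 2 + (y 1 ^ 2 + y 2 ^ 2))) (by fun_prop)
    rw [← B.repr.measurePreserving.lintegral_comp hm]
    refine lintegral_congr fun x => ?_
    have e1 : B.repr x 0 = ⟪e, x⟫ := by rw [B.repr_apply_apply, hB0]
    have e2 : ‖x‖ ^ 2 = B.repr x 0 ^ 2 + (B.repr x 1 ^ 2 + B.repr x 2 ^ 2) := by
      rw [← B.repr.norm_map x, EuclideanSpace.real_norm_sq_eq, Fin.sum_univ_three]; ring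
    rw [e2, ← e1]
  have h2 : ∫⁻ y : R3, G (y 0) (y 0 ^ 2 + (y 1 ^ 2 + y 2 ^ 2)) =
      ∫⁻ y : Fin 3 → ℝ, G (y 0) (y 0 ^ 2 + (y 1 ^ 2 + y 2 ^ 2)) := by
    have hm : Measurable fun y : Fin 3 → ℝ => G (y 0) (y 0 ^ 2 + (y 1 ^ 2 + y 2 ^ 2)) :=
      hG.comp (f := fun y : Fin 3 → ℝ => (y 0, y 0 ^ 2 + (y 1 ^ 2 + y 2 ^ 2))) (by fun_prop)
    exact (PiLp.volume_preserving_ofLp (Fin 3)).lintegral_comp hm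
  have h3 : ∫⁻ y : Fin 3 → ℝ, G (y 0) (y 0 ^ 2 + (y 1 ^ 2 + y 2 ^ 2)) =
      ∫⁻ p : ℝ × (Fin 2 → ℝ), G p.1 (p.1 ^ 2 + (p.2 0 ^ 2 + p.2 1 ^ 2)) := by
    have hm : Measurable fun p : ℝ × (Fin 2 → ℝ) => G p.1 (p.1 ^ 2 + (p.2 0 ^ 2 + p.2 1 ^ 2)) :=
      hG.comp (f := fun p : ℝ × (Fin 2 → ℝ) => (p.1, p.1 ^ 2 + (p.2 0 ^ 2 + p.2 1 ^ 2))) (by fun_prop)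
    exact (volume_preserving_piFinSuccAbove (fun _ : Fin 3 => ℝ) 0).lintegral_comp hm
  rw [h1, h2, h3, Measure.volume_eq_prod, lintegral_prod]
  · refine lintegral_congr fun z => ?_
    have hm : Measurable fun q : ℝ × ℝ => G z (z ^ 2 + (q.1 ^ 2 + q.2 ^ 2)) :=
      hG.comp (f := fun q : ℝ × ℝ => (z, z ^ 2 + (q.1 ^ 2 + q.2 ^ 2))) (by fun_prop)
    exact (volume_preserving_finTwoArrow ℝ).lintegral_comp hm
  · exact (hG.comp (f := fun p : ℝ × (Fin 2 → ℝ) => (p.1, p.1 ^ 2 + (p.2 0 ^ 2 + p.2 1 ^ 2)))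
      (by fun_prop)).aemeasurable

lemma polar2_rad (H : ℝ → ℝ≥0∞) (hH : Measurable H) :
    ∫⁻ q : ℝ × ℝ, H (q.1 ^ 2 + q.2 ^ 2) =
      ENNReal.ofReal (2 * π) * ∫⁻ r in Ioi (0:ℝ), ENNReal.ofReal r * H (r ^ 2) := by
  rw [← lintegral_comp_polarCoord_symm, polarCoord_target, Measure.volume_eq_prod,
    ← Measure.prod_restrict, lintegral_prod]
  · have : ∀ r : ℝ, ∫⁻ θ in Ioo (-π) π, ENNReal.ofReal r • H ((polarCoord.symm (r, θ)).1 ^ 2 + (polarCoord.symm (r, θ)).2 ^ 2)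
        = ENNReal.ofReal (2 * π) * (ENNReal.ofReal r * H (r ^ 2)) := by
      intro r
      have h : ∀ θ : ℝ, (polarCoord.symm (r, θ)).1 ^ 2 + (polarCoord.symm (r, θ)).2 ^ 2 = r ^ 2 := by
        intro θ
        simp only [polarCoord_symm_apply]
        nlinarith [sin_sq_add_cos_sq θ]
      simp only [h, smul_eq_mul, lintegral_const, Measure.restrict_apply_univ, Real.volume_Ioo]
      rw [mul_comm]; congr 2; ring
    rw [lintegral_congr this, lintegral_const_mul]
    fun_prop
  · have : Measurable fun p : ℝ × ℝ => (polarCoord.symm p).1 ^ 2 + (polarCoord.symm p).2 ^ 2 := by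
      simp only [polarCoord_symm_apply]; fun_prop
    simp only [smul_eq_mul]
    exact (by fun_prop : Measurable _).aemeasurable

/-- Archimedes' theorem. -/
lemma arch (e : R3) (he : ‖e‖ = 1) (g : ℝ → ℝ≥0∞) (hg : Measurable g) :
    ∫⁻ σ : S2, g ⟪e, (σ:R3)⟫ ∂sphMeasure =
      ENNReal.ofReal (2 * π) * ∫⁻ θ in Ioo 0 π, ENNReal.ofReal (sin θ) * g (cos θ) := by
  set I : ℝ → ℝ≥0∞ := fun r => (Iio (1:ℝ)).indicator (fun _ => 1) r with hI
  have hIm : Measurable I := measurable_const.indicator measurableSet_Iio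
  set c : ℝ≥0∞ := ∫⁻ r in Ioi (0:ℝ), ENNReal.ofReal (r ^ 2) * I (r ^ 2) with hc
  have hc0 : c ≠ 0 := by
    intro h0
    rw [hc, lintegral_eq_zero_iff (by fun_prop), Filter.EventuallyEq,
      ae_restrict_iff' measurableSet_Ioi] at h0
    have : volume (Ioo (0:ℝ) 1) = 0 := by
      refine measure_mono_null ?_ h0
      intro r hr
      simp only [mem_compl_iff, mem_ofPred_eq, Classical.not_imp]
      refine ⟨hr.1, ?_⟩
      have : r ^ 2 < 1 := by nlinarith [hr.1, hr.2]
      have h2 : 0 < r ^ 2 := by have := hr.1; positivity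
      simp [hI, this]
      exact hr.1.ne'
    simp at this
  have hct : c ≠ ⊤ := by
    have : c ≤ ∫⁻ r in Ioo (0:ℝ) 1, 1 := by
      rw [hc, ← lintegral_indicator measurableSet_Ioi, ← lintegral_indicator measurableSet_Ioo]
      refine lintegral_mono fun r => ?_
      by_cases hr : 0 < r
      · by_cases h1 : r < 1
        · have : r ^ 2 < 1 := by nlinarith
          simp [hI, hr, h1, this, this.le]
        · have : ¬ r ^ 2 < 1 := by nlinarith
          simp only [hI]
          rw [indicator_of_mem (mem_Ioi.2 hr), indicator_of_notMem (s := Iio 1) (by simpa using this)]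
          simp
      · simp [hr]
    refine ne_top_of_le_ne_top ?_ this
    simp
  set G : ℝ → ℝ → ℝ≥0∞ := fun z s => g (z / √s) * I s with hG
  have hGm : Measurable (Function.uncurry G) := by
    simp only [hG, Function.uncurry_def]; fun_prop
  have hA : ∫⁻ x : R3, G ⟪e, x⟫ (‖x‖ ^ 2) = (∫⁻ σ : S2, g ⟪e, (σ:R3)⟫ ∂sphMeasure) * c := by
    rw [polar3' (fun x : R3 => G ⟪e, x⟫ (‖x‖ ^ 2)) (hGm.comp (f := fun x : R3 => (⟪e, x⟫, ‖x‖ ^ 2)) (by fun_prop)),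
      ← lintegral_mul_const _ (by fun_prop)]
    refine lintegral_congr fun σ => ?_
    rw [hc, ← lintegral_const_mul _ (by fun_prop)]
    refine setLIntegral_congr_fun measurableSet_Ioi fun r hr => ?_
    have hr : 0 < r := hr
    have hσ : ‖(σ:R3)‖ = 1 := by simpa using σ.2
    simp only [hG]
    rw [norm_smul, hσ, mul_one, Real.norm_eq_abs, sq_abs, inner_smul_right, Real.sqrt_sq hr.le,
      mul_div_cancel_left₀ _ hr.ne']
    ring
  have hBB : ∫⁻ x : R3, G ⟪e, x⟫ (‖x‖ ^ 2) =
      (ENNReal.ofReal (2 * π) * ∫⁻ θ in Ioo 0 π, ENNReal.ofReal (sin θ) * g (cos θ)) * c := by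
    rw [split3 e he G hGm]
    have h1 : ∀ z : ℝ, ∫⁻ q : ℝ × ℝ, G z (z ^ 2 + (q.1 ^ 2 + q.2 ^ 2)) =
        ENNReal.ofReal (2 * π) * ∫⁻ r in Ioi (0:ℝ), ENNReal.ofReal r * G z (z ^ 2 + r ^ 2) := fun z =>
      polar2_rad (fun s => G z (z ^ 2 + s)) (hGm.comp (f := fun s => (z, z ^ 2 + s)) (by fun_prop))
    have hm2 : Measurable fun p : ℝ × ℝ =>
        (Ioi (0:ℝ)).indicator (fun r => ENNReal.ofReal r * G p.1 (p.1 ^ 2 + r ^ 2)) p.2 := by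
      have : Measurable fun p : ℝ × ℝ => (Prod.snd ⁻¹' (Ioi (0:ℝ))).indicator
          (fun p : ℝ × ℝ => ENNReal.ofReal p.2 * G p.1 (p.1 ^ 2 + p.2 ^ 2)) p := by
        refine Measurable.indicator ?_ (measurable_snd measurableSet_Ioi)
        have := hGm.comp (f := fun p : ℝ × ℝ => (p.1, p.1 ^ 2 + p.2 ^ 2)) (by fun_prop)
        exact (by fun_prop : Measurable fun p : ℝ × ℝ => ENNReal.ofReal p.2).mul this
      exact this
    rw [lintegral_congr h1]
    simp_rw [← lintegral_indicator measurableSet_Ioi]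
    rw [lintegral_const_mul _ (Measurable.lintegral_prod_right' (f := fun p : ℝ × ℝ =>
        (Ioi (0:ℝ)).indicator (fun r => ENNReal.ofReal r * G p.1 (p.1 ^ 2 + r ^ 2)) p.2) hm2), mul_assoc]
    congr 1
    rw [lintegral_lintegral (f := fun z r => (Ioi (0:ℝ)).indicator (fun r => ENNReal.ofReal r * G z (z ^ 2 + r ^ 2)) r) hm2.aemeasurable,
      ← Measure.volume_eq_prod, ← lintegral_comp_polarCoord_symm,
      polarCoord_target, Measure.volume_eq_prod, ← Measure.prod_restrict, lintegral_prod]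
    · rw [hc, mul_comm, ← lintegral_mul_const _ (by fun_prop)]
      refine setLIntegral_congr_fun measurableSet_Ioi fun r hr => ?_
      have hr : 0 < r := hr
      simp only []
      rw [← lintegral_const_mul _ (by fun_prop), ← lintegral_indicator measurableSet_Ioo,
        ← lintegral_indicator measurableSet_Ioo]
      refine lintegral_congr fun θ => ?_
      by_cases hθ : θ ∈ Ioo (-π) π
      · rw [indicator_of_mem hθ]
        simp only [polarCoord_symm_apply, smul_eq_mul]
        by_cases hθ2 : 0 < θ
        · have hs : 0 < sin θ := sin_pos_of_pos_of_lt_pi hθ2 hθ.2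
          rw [indicator_of_mem (show r * sin θ ∈ Ioi (0:ℝ) from mul_pos hr hs),
            indicator_of_mem (show θ ∈ Ioo 0 π from ⟨hθ2, hθ.2⟩)]
          have : (r * cos θ) ^ 2 + (r * sin θ) ^ 2 = r ^ 2 := by nlinarith [sin_sq_add_cos_sq θ]
          rw [this]
          simp only [hG]
          rw [Real.sqrt_sq hr.le, mul_div_cancel_left₀ _ hr.ne', ENNReal.ofReal_mul hr.le, sq,
            ENNReal.ofReal_mul hr.le]
          ring
        · have hs : sin θ ≤ 0 := sin_nonpos_of_nonpos_of_neg_pi_le (not_lt.1 hθ2) hθ.1.le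
          rw [indicator_of_notMem (by simp only [mem_Ioi, not_lt]; exact mul_nonpos_of_nonneg_of_nonpos hr.le hs),
            indicator_of_notMem (fun h => hθ2 h.1)]
          simp
      · rw [indicator_of_notMem hθ, indicator_of_notMem (fun h => hθ ⟨by linarith [h.1, pi_pos], h.2⟩)]
    · have : Measurable fun p : ℝ × ℝ => polarCoord.symm p := by
        simp only [polarCoord_symm_apply]; fun_prop
      have h2 := hm2.comp this
      simp only [smul_eq_mul]
      exact ((by fun_prop : Measurable fun p : ℝ × ℝ => ENNReal.ofReal p.1).mul h2).aemeasurable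
  exact (ENNReal.mul_left_inj hc0 hct).1 (hA.symm.trans hBB)
end BFD
end

noncomputable section
open MeasureTheory Real Set
open scoped RealInnerProductSpace ENNReal

namespace BFD

section meas
variable {α : Type*} [MeasurableSpace α] {a c : α → R3} {d : α → S2}

@[fun_prop] lemma meas_vOut (ha : Measurable a) (hc : Measurable c) (hd : Measurable d) :
    Measurable fun x => vOut (a x) (c x) (d x) := by
  unfold vOut; fun_prop

@[fun_prop] lemma meas_vOutStar (ha : Measurable a) (hc : Measurable c) (hd : Measurable d) :
    Measurable fun x => vOutStar (a x) (c x) (d x) := by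
  unfold vOutStar; fun_prop

@[fun_prop] lemma meas_cosAngle (ha : Measurable a) (hc : Measurable c) (hd : Measurable d) :
    Measurable fun x => cosAngle (a x) (c x) (d x) := by
  unfold cosAngle; fun_prop
end meas

lemma norm_S2 (σ : S2) : ‖(σ:R3)‖ = 1 := by simp

lemma sph_neg : MeasurePreserving (fun σ : S2 => -σ) sphMeasure sphMeasure := by
  refine ⟨by fun_prop, ?_⟩
  ext s hs
  have hm : Measurable (fun σ : S2 => -σ) := by fun_prop
  rw [Measure.map_apply hm hs, sphMeasure, Measure.toSphere_apply' _ (hm hs),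
    Measure.toSphere_apply' _ hs]
  congr 1
  rw [← Measure.measure_neg]
  congr 1
  ext x
  simp only [mem_neg, mem_smul, mem_image]
  constructor
  · rintro ⟨r, hr, y, ⟨σ, hσ, rfl⟩, h⟩
    exact ⟨r, hr, _, ⟨-σ, hσ, rfl⟩, by
      show r • (-(σ:R3)) = x
      rw [smul_neg, h, neg_neg]⟩
  · rintro ⟨r, hr, y, ⟨σ, hσ, rfl⟩, h⟩
    exact ⟨r, hr, _, ⟨-σ, by simpa using hσ, rfl⟩, by
      show r • (-(σ:R3)) = -x
      rw [smul_neg, h]⟩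

lemma lint_sph_neg (g : S2 → ℝ≥0∞) (hg : Measurable g) :
    ∫⁻ σ, g (-σ) ∂sphMeasure = ∫⁻ σ, g σ ∂sphMeasure := sph_neg.lintegral_comp hg

lemma cosAngle_neg (v w : R3) (σ : S2) : cosAngle v w (-σ) = - cosAngle v w σ := by
  simp [cosAngle, inner_neg_right]
lemma vOut_neg (v w : R3) (σ : S2) : vOut v w (-σ) = vOutStar v w σ := by
  simp [vOut, vOutStar, sub_eq_add_neg]
lemma vOutStar_neg (v w : R3) (σ : S2) : vOutStar v w (-σ) = vOut v w σ := by
  simp [vOut, vOutStar, sub_eq_add_neg]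

lemma cosAngle_abs_le (v w : R3) (σ : S2) : |cosAngle v w σ| ≤ 1 := by
  unfold cosAngle
  refine (abs_real_inner_le_norm _ _).trans ?_
  rw [norm_S2, mul_one, norm_smul, norm_inv, norm_norm]
  by_cases h : ‖v - w‖ = 0
  · simp [h]
  · rw [inv_mul_cancel₀ h]

/-- total angular mass of `b`. -/
def Ib (b : ℝ → ℝ) : ℝ≥0∞ :=
  ENNReal.ofReal (2 * π) * ∫⁻ θ in Ioo 0 π, ENNReal.ofReal (sin θ) * ENNReal.ofReal (b (cos θ))

section b
variable {b : ℝ → ℝ} (hb : GradCutoff b)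
include hb

lemma b_symm {x : ℝ} (hx : |x| ≤ 1) : b (-x) = b x := by
  have h := hb.symm (arccos x)
  rw [cos_pi_sub, cos_arccos (abs_le.1 hx).1 (abs_le.1 hx).2] at h
  exact h

lemma Ib_lt_top : Ib b < ⊤ := by
  refine ENNReal.mul_lt_top ENNReal.ofReal_lt_top ?_
  have h := hb.integrable
  rw [intervalIntegrable_iff_integrableOn_Ioo_of_le pi_pos.le] at h
  have h2 := h.lintegral_lt_top
  refine lt_of_le_of_lt (lintegral_mono_ae ?_) h2
  filter_upwards [ae_restrict_mem measurableSet_Ioo] with θ hθ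
  rw [ENNReal.ofReal_mul (hb.nonneg _), mul_comm]

lemma lint_b (e : R3) (he : ‖e‖ = 1) :
    ∫⁻ σ : S2, ENNReal.ofReal (b ⟪e, (σ:R3)⟫) ∂sphMeasure = Ib b :=
  arch e he (fun x => ENNReal.ofReal (b x)) (by have := hb.measurable; fun_prop)

lemma half_angle_aux {f : ℝ → ℝ} {s : Set ℝ} (hs : MeasurableSet s) {c : ℝ} (hc : |c| = 2)
    (hf : ∀ x, HasDerivAt f c x) (hinj : InjOn f s) (him : f '' s = Ioo 0 π)
    (hsin : ∀ x ∈ s, |sin x * cos x| * 2 = sin (f x)) (hcos : ∀ x, cos (2 * x) = cos (f x)) :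
    ∫⁻ θ in s, ENNReal.ofReal (|sin θ * cos θ|) * ENNReal.ofReal (b (cos (2 * θ))) ≤
      ∫⁻ θ in Ioo 0 π, ENNReal.ofReal (sin θ) * ENNReal.ofReal (b (cos θ)) := by
  rw [← him, lintegral_image_eq_lintegral_abs_deriv_mul hs (fun x _ => (hf x).hasDerivWithinAt) hinj]
  refine setLIntegral_mono' hs fun x hx => ?_
  have h0 := abs_nonneg (sin x * cos x)
  rw [← hsin x hx, hcos, hc, ← mul_assoc, ← ENNReal.ofReal_mul zero_le_two]
  refine mul_le_mul_left (ENNReal.ofReal_le_ofReal ?_) _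
  linarith

lemma lint_b_half (e : R3) (he : ‖e‖ = 1) :
    ∫⁻ σ : S2, ENNReal.ofReal (b (1 - 2 * ⟪e, (σ:R3)⟫ ^ 2)) * ENNReal.ofReal |⟪e, (σ:R3)⟫| ∂sphMeasure
      ≤ 2 * Ib b := by
  have hbm := hb.measurable
  rw [arch e he (fun x => ENNReal.ofReal (b (1 - 2 * x ^ 2)) * ENNReal.ofReal |x|) (by fun_prop)]
  unfold Ib
  rw [mul_left_comm]
  gcongr
  have h1 : ∫⁻ θ in Ioo 0 π, ENNReal.ofReal (sin θ) * (ENNReal.ofReal (b (1 - 2 * cos θ ^ 2)) *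
      ENNReal.ofReal |cos θ|) = ∫⁻ θ in Ioo 0 π,
      ENNReal.ofReal (|sin θ * cos θ|) * ENNReal.ofReal (b (cos (2 * θ))) := by
    refine setLIntegral_congr_fun measurableSet_Ioo fun θ hθ => ?_
    have hs := sin_pos_of_mem_Ioo hθ
    have : b (1 - 2 * cos θ ^ 2) = b (cos (2 * θ)) := by
      rw [← hb.symm, cos_pi_sub, cos_two_mul]; ring_nf
    beta_reduce
    rw [this, abs_mul, abs_of_pos hs, ENNReal.ofReal_mul hs.le]; ring
  rw [h1]
  have h2 : Ioo 0 π ⊆ (Ioo 0 (π/2) ∪ Ioo (π/2) π) ∪ {π/2} := by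
    intro x hx
    rcases lt_trichotomy x (π/2) with h | h | h
    · exact Or.inl (Or.inl ⟨hx.1, h⟩)
    · exact Or.inr h
    · exact Or.inl (Or.inr ⟨h, hx.2⟩)
  refine (lintegral_mono_set h2).trans ((lintegral_union_le _ _ _).trans ?_)
  rw [Measure.restrict_singleton, Real.volume_singleton, zero_smul, lintegral_zero_measure, add_zero, two_mul]
  refine (lintegral_union_le _ _ _).trans (add_le_add ?_ ?_)
  · refine half_angle_aux hb (f := fun x => 2 * x) measurableSet_Ioo (c := 2) (by norm_num) (fun x => by simpa using (hasDerivAt_id x).const_mul 2)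
      (fun x _ y _ h => by simpa using h) ?_ ?_ (fun x => rfl)
    · rw [image_mul_left_Ioo (by norm_num)]; congr 1 <;> ring
    · intro x hx
      have h1 := sin_pos_of_pos_of_lt_pi hx.1 (by linarith [hx.2, pi_pos])
      have h2 := cos_pos_of_mem_Ioo ⟨by linarith [hx.1, pi_pos], hx.2⟩
      rw [abs_of_pos (by positivity), sin_two_mul]; ring
  · refine half_angle_aux hb (f := fun x => 2 * π - 2 * x) measurableSet_Ioo (c := -2) (by norm_num) (fun x => by simpa using ((hasDerivAt_id x).const_mul 2).const_sub (2 * π))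
      (fun x _ y _ h => by simpa using h) ?_ ?_ (fun x => (cos_two_pi_sub _).symm)
    · have : (fun x => 2 * π - 2 * x) = (fun x => 2 * π - x) ∘ (fun x => 2 * x) := rfl
      rw [this, image_comp, image_mul_left_Ioo (by norm_num), image_const_sub_Ioo]; congr 1 <;> ring
    · intro x hx
      have h1 := sin_pos_of_pos_of_lt_pi (by linarith [hx.1, pi_pos]) hx.2
      have h2 := cos_neg_of_pi_div_two_lt_of_lt hx.1 (by linarith [hx.2, pi_pos])
      rw [abs_of_neg (mul_neg_of_pos_of_neg h1 h2), sin_two_pi_sub, sin_two_mul]; ring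
end b
end BFD
end

noncomputable section
open MeasureTheory Real Set
open scoped RealInnerProductSpace ENNReal

namespace BFD

/-- `sin (θ/2)` -/
def sA (v w : R3) (σ : S2) : ℝ := √((1 - cosAngle v w σ) / 2)
/-- `cos (θ/2)` -/
def cA (v w : R3) (σ : S2) : ℝ := √((1 + cosAngle v w σ) / 2)

section meas
variable {α : Type*} [MeasurableSpace α] {a c : α → R3} {d : α → S2}
@[fun_prop] lemma meas_sA (ha : Measurable a) (hc : Measurable c) (hd : Measurable d) :
    Measurable fun x => sA (a x) (c x) (d x) := by
  unfold sA; fun_prop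
@[fun_prop] lemma meas_cA (ha : Measurable a) (hc : Measurable c) (hd : Measurable d) :
    Measurable fun x => cA (a x) (c x) (d x) := by
  unfold cA; fun_prop
end meas

def Phi (σ : S2) (z : R3) : R3 := (2⁻¹:ℝ) • (z + ‖z‖ • (σ:R3))

def PhiU (σ : S2) : Set R3 := {z | 0 < ‖z‖ + ⟪z, (σ:R3)⟫}

lemma PhiU_norm {σ : S2} {z : R3} (hz : z ∈ PhiU σ) : 0 < ‖z‖ := by
  rcases (norm_nonneg z).eq_or_lt with h | h
  · have : z = 0 := norm_eq_zero.1 h.symm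
    subst this; simp [PhiU] at hz
  · exact h

lemma Phi_inner (σ : S2) (z : R3) : ⟪Phi σ z, (σ:R3)⟫ = (⟪z, (σ:R3)⟫ + ‖z‖) / 2 := by
  simp only [Phi, inner_smul_left, inner_add_left, real_inner_self_eq_norm_sq, norm_S2]
  simp; ring

lemma Phi_norm_sq (σ : S2) (z : R3) : ‖Phi σ z‖ ^ 2 = ‖z‖ * ⟪Phi σ z, (σ:R3)⟫ := by
  rw [Phi_inner, Phi, norm_smul, mul_pow, norm_add_sq_real, inner_smul_right, norm_smul, norm_S2]
  simp; ring

lemma Phi_inj (σ : S2) : InjOn (Phi σ) (PhiU σ) := by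
  intro z hz z' hz' h
  have h1 := Phi_norm_sq σ z
  have h2 := Phi_norm_sq σ z'
  have h3 : 0 < ⟪Phi σ z, (σ:R3)⟫ := by
    rw [Phi_inner]; have : 0 < ‖z‖ + ⟪z, (σ:R3)⟫ := hz
    linarith
  rw [← h, h1] at h2
  have h4 : ‖z‖ = ‖z'‖ := mul_right_cancel₀ h3.ne' h2
  have h5 : z + ‖z‖ • (σ:R3) = z' + ‖z'‖ • (σ:R3) := by
    have := congrArg (fun y => (2:ℝ) • y) h
    simpa [Phi, smul_smul] using this
  rw [h4] at h5
  exact add_right_cancel h5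

def dPhi (σ : S2) (z : R3) : R3 →L[ℝ] R3 :=
  (2⁻¹:ℝ) • (ContinuousLinearMap.id ℝ R3 + ((‖z‖⁻¹) • innerSL ℝ z).smulRight (σ:R3))

lemma Phi_deriv (σ : S2) {z : R3} (hz : 0 < ‖z‖) : HasFDerivAt (Phi σ) (dPhi σ z) z := by
  have h1 : HasFDerivAt (fun z : R3 => ‖z‖) ((‖z‖⁻¹) • innerSL ℝ z) z := by
    have h := (hasStrictFDerivAt_norm_sq z).hasFDerivAt.sqrt (by positivity)
    simp only [Real.sqrt_sq (norm_nonneg _)] at h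
    refine h.congr_fderiv ?_
    ext y
    simp
    field_simp
  unfold dPhi
  exact ((hasFDerivAt_id z).add (h1.smul_const (σ:R3))).const_smul (2⁻¹:ℝ)

lemma dPhi_det (σ : S2) (z : R3) : (dPhi σ z).det = (1 + ⟪z, (σ:R3)⟫ / ‖z‖) / 8 := by
  have h : ((dPhi σ z : R3 →L[ℝ] R3) : R3 →ₗ[ℝ] R3) =
      (2⁻¹:ℝ) • LinearMap.transvection (((‖z‖⁻¹) • innerSL ℝ z : R3 →L[ℝ] ℝ) : R3 →ₗ[ℝ] ℝ) (σ:R3) := by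
    ext y : 1
    simp [dPhi, LinearMap.transvection.apply]
  rw [ContinuousLinearMap.det, h, LinearMap.det_smul, LinearMap.transvection.det]
  simp
  ring

variable {b : ℝ → ℝ} 

lemma cv_aux (hb : GradCutoff b) (σ : S2) (G : R3 → ℝ≥0∞) :
    ∫⁻ z : R3, ENNReal.ofReal (b (-(⟪z, (σ:R3)⟫ / ‖z‖))) *
        ENNReal.ofReal (√((1 + ⟪z, (σ:R3)⟫ / ‖z‖) / 2) ^ 3) * G (Phi σ z) ≤
      ∫⁻ y : R3, 4 * (ENNReal.ofReal (b (1 - 2 * (⟪y, (σ:R3)⟫ / ‖y‖) ^ 2)) *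
        ENNReal.ofReal |⟪y, (σ:R3)⟫ / ‖y‖|) * G y := by
  have hbm := hb.measurable
  have hU : MeasurableSet (PhiU σ) := measurableSet_lt (by fun_prop) (by fun_prop)
  refine le_trans ?_ (setLIntegral_le_lintegral (Phi σ '' PhiU σ) _)
  rw [lintegral_image_eq_lintegral_abs_det_fderiv_mul volume hU
    (fun z hz => (Phi_deriv σ (PhiU_norm hz)).hasFDerivWithinAt) (Phi_inj σ),
    ← lintegral_indicator hU]
  have h0 : ∀ᵐ z : R3, z ≠ 0 := by simp [ae_iff]
  refine lintegral_mono_ae ?_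
  filter_upwards [h0] with z hz
  have hzp : 0 < ‖z‖ := norm_pos_iff.2 hz
  by_cases hzU : z ∈ PhiU σ
  · rw [indicator_of_mem hzU]
    have hz' : 0 < ‖z‖ + ⟪z, (σ:R3)⟫ := hzU
    set q := ⟪z, (σ:R3)⟫ / ‖z‖ with hq
    have hq1 : 0 < 1 + q := by
      have : 1 + q = (‖z‖ + ⟪z, (σ:R3)⟫) / ‖z‖ := by rw [hq]; field_simp
      rw [this]; positivity
    set t := √((1 + q) / 2) with ht
    have ht2 : t ^ 2 = (1 + q) / 2 := Real.sq_sqrt (by positivity)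
    have htp : 0 < t := Real.sqrt_pos.2 (by positivity)
    have hin : ⟪Phi σ z, (σ:R3)⟫ = ‖z‖ * t ^ 2 := by
      rw [Phi_inner, ht2, hq]; field_simp; ring
    have hno : ‖Phi σ z‖ = ‖z‖ * t := by
      rw [← Real.sqrt_sq (norm_nonneg (Phi σ z)), Phi_norm_sq, hin,
        show ‖z‖ * (‖z‖ * t ^ 2) = (‖z‖ * t) ^ 2 by ring, Real.sqrt_sq (by positivity)]
    have hr : ⟪Phi σ z, (σ:R3)⟫ / ‖Phi σ z‖ = t := by
      rw [hin, hno]; field_simp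
    have hbq : b (1 - 2 * t ^ 2) = b (-q) := by rw [ht2]; ring_nf
    rw [hr, hbq, dPhi_det, ← hq, abs_of_pos htp, abs_of_pos (by positivity)]
    have h8 : (1 + q) / 8 = t ^ 2 / 4 := by rw [ht2]; ring
    rw [h8]
    have e4 : (4:ℝ≥0∞) = ENNReal.ofReal 4 := by norm_num
    rw [e4, ← mul_assoc, ← ENNReal.ofReal_mul (hb.nonneg _), ← ENNReal.ofReal_mul (hb.nonneg _),
      ← ENNReal.ofReal_mul (by norm_num), ← ENNReal.ofReal_mul (by positivity)]
    apply le_of_eq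
    congr 2
    ring
  · have hz' : ‖z‖ + ⟪z, (σ:R3)⟫ ≤ 0 := not_lt.1 hzU
    have : (1 + ⟪z, (σ:R3)⟫ / ‖z‖) / 2 ≤ 0 := by
      have : 1 + ⟪z, (σ:R3)⟫ / ‖z‖ = (‖z‖ + ⟪z, (σ:R3)⟫) / ‖z‖ := by field_simp
      rw [this]
      have := div_nonpos_of_nonpos_of_nonneg hz' hzp.le
      linarith
    rw [Real.sqrt_eq_zero_of_nonpos this]
    simp

/-- The constant in the change of variables estimate. -/
def Ccv (b : ℝ → ℝ) : ℝ≥0∞ := 8 * Ib b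

lemma Ccv_lt_top (hb : GradCutoff b) : Ccv b < ⊤ := ENNReal.mul_lt_top (by simp) (Ib_lt_top hb)

lemma cv_prime (hb : GradCutoff b) (v : R3) (G : R3 → ℝ≥0∞) (hG : Measurable G) :
    ∫⁻ w, ∫⁻ σ, ENNReal.ofReal (b (cosAngle v w σ)) * ENNReal.ofReal (sA v w σ ^ 3) *
      G (vOut v w σ) ∂sphMeasure ≤ Ccv b * ∫⁻ y, G y := by
  have hbm := hb.measurable
  rw [← lintegral_add_left_eq_self _ v, lintegral_lintegral_swap (by fun_prop)]
  have h1 : ∀ (z : R3) (σ : S2), cosAngle v (v + z) σ = -(⟪z, (σ:R3)⟫ / ‖z‖) := by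
    intro z σ
    simp [cosAngle, inner_smul_left, inner_neg_left]; ring
  have h2 : ∀ (z : R3) (σ : S2), vOut v (v + z) σ = v + Phi σ z := by
    intro z σ
    simp [vOut, Phi, smul_add, smul_smul]
    have : (2:ℝ)⁻¹ • v + ((2:ℝ)⁻¹ • v) = v := by rw [← add_smul]; norm_num
    nth_rw 3 [← this]
    rw [div_eq_inv_mul]
    abel
  simp only [sA, h1, h2, sub_neg_eq_add]
  calc _ ≤ ∫⁻ σ : S2, (∫⁻ y : R3, 4 * (ENNReal.ofReal (b (1 - 2 * (⟪y, (σ:R3)⟫ / ‖y‖) ^ 2)) *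
        ENNReal.ofReal |⟪y, (σ:R3)⟫ / ‖y‖|) * G (v + y)) ∂sphMeasure :=
        lintegral_mono fun σ => cv_aux hb σ (fun y => G (v + y))
    _ = ∫⁻ y : R3, ∫⁻ σ : S2, 4 * (ENNReal.ofReal (b (1 - 2 * (⟪y, (σ:R3)⟫ / ‖y‖) ^ 2)) *
        ENNReal.ofReal |⟪y, (σ:R3)⟫ / ‖y‖|) * G (v + y) ∂sphMeasure :=
        lintegral_lintegral_swap (by fun_prop)
    _ ≤ ∫⁻ y : R3, Ccv b * G (v + y) := by
        have h0 : ∀ᵐ z : R3, z ≠ 0 := by simp [ae_iff]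
        refine lintegral_mono_ae ?_
        filter_upwards [h0] with y hy
        rw [lintegral_mul_const _ (by fun_prop), lintegral_const_mul _ (by fun_prop)]
        gcongr
        have := lint_b_half hb (‖y‖⁻¹ • y) (by rw [norm_smul, norm_inv, norm_norm, inv_mul_cancel₀ (norm_ne_zero_iff.2 hy)])
        simp only [inner_smul_left, conj_trivial, ← div_eq_inv_mul] at this
        calc _ ≤ 4 * (2 * Ib b) := by gcongr
          _ = Ccv b := by rw [Ccv, ← mul_assoc]; norm_num
    _ = Ccv b * ∫⁻ y, G y := by
        rw [lintegral_const_mul _ (by fun_prop), lintegral_add_left_eq_self]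

lemma cv_star (hb : GradCutoff b) (v : R3) (G : R3 → ℝ≥0∞) (hG : Measurable G) :
    ∫⁻ w, ∫⁻ σ, ENNReal.ofReal (b (cosAngle v w σ)) * ENNReal.ofReal (cA v w σ ^ 3) *
      G (vOutStar v w σ) ∂sphMeasure ≤ Ccv b * ∫⁻ y, G y := by
  have hbm := hb.measurable
  refine le_trans (le_of_eq ?_) (cv_prime hb v G hG)
  refine lintegral_congr fun w => ?_
  rw [← lint_sph_neg _ (by fun_prop)]
  refine lintegral_congr fun σ => ?_
  rw [cosAngle_neg, b_symm hb (cosAngle_abs_le v w σ), vOutStar_neg, cA, sA, cosAngle_neg, sub_eq_add_neg]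
end BFD
end

noncomputable section
open MeasureTheory Real Set
open scoped RealInnerProductSpace ENNReal

namespace BFD

/-- The collision space. -/
abbrev Om : Type := R3 × R3 × S2

def mu0 : Measure Om := (volume : Measure R3).prod ((volume : Measure R3).prod sphMeasure)
instance : SFinite mu0 := by
  unfold mu0
  exact @Measure.prod.instSFinite _ _ _ _ inferInstance _ _ inferInstance

abbrev Q2 (p : Om) : R3 := vOut p.1 p.2.1 p.2.2
abbrev Q3 (p : Om) : R3 := vOutStar p.1 p.2.1 p.2.2

lemma lint_mu0 (H : Om → ℝ≥0∞) (hH : Measurable H) :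
    ∫⁻ p, H p ∂mu0 = ∫⁻ v, ∫⁻ w, ∫⁻ σ, H (v, w, σ) ∂sphMeasure := by
  rw [mu0, lintegral_prod _ hH.aemeasurable]
  refine lintegral_congr fun v => ?_
  rw [lintegral_prod _ (by fun_prop)]

lemma lint_shear (F : R3 → R3 → ℝ≥0∞) (hF : Measurable (Function.uncurry F)) :
    ∫⁻ v, ∫⁻ w, F v w = ∫⁻ c, ∫⁻ z : R3, F (c + (2⁻¹:ℝ) • z) (c - (2⁻¹:ℝ) • z) := by
  have m1 : ∀ {a c : R3 × R3 → R3}, Measurable a → Measurable c → Measurable fun p => F (a p) (c p) :=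
    fun ha hc => hF.comp (ha.prodMk hc)
  calc ∫⁻ v, ∫⁻ w, F v w = ∫⁻ w, ∫⁻ v, F v w :=
        lintegral_lintegral_swap hF.aemeasurable
    _ = ∫⁻ w, ∫⁻ z, F (w + z) w := by
        refine lintegral_congr fun w => ?_
        rw [lintegral_add_left_eq_self (fun v => F v w) w]
    _ = ∫⁻ z, ∫⁻ w, F (w + z) w :=
        lintegral_lintegral_swap (m1 (by fun_prop) (by fun_prop)).aemeasurable
    _ = ∫⁻ z, ∫⁻ c, F (c + (2⁻¹:ℝ) • z) (c - (2⁻¹:ℝ) • z) := by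
        refine lintegral_congr fun z => ?_
        rw [← lintegral_sub_right_eq_self (fun w => F (w + z) w) ((2⁻¹:ℝ) • z)]
        refine lintegral_congr fun c => ?_
        congr 1
        have : z = (2⁻¹:ℝ) • z + (2⁻¹:ℝ) • z := by rw [← add_smul]; norm_num
        nth_rw 2 [this]; abel
    _ = _ := lintegral_lintegral_swap (m1 (by fun_prop) (by fun_prop)).aemeasurable

lemma lint_mu0_polar (H : Om → ℝ≥0∞) (hH : Measurable H) :
    ∫⁻ p, H p ∂mu0 = ∫⁻ c : R3, ∫⁻ σ : S2, ∫⁻ p : S2 × Ioi (0:ℝ),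
      H (c + (2⁻¹:ℝ) • (p.2:ℝ) • (p.1:R3), c - (2⁻¹:ℝ) • (p.2:ℝ) • (p.1:R3), σ)
        ∂(sphMeasure.prod (Measure.volumeIoiPow 2)) ∂sphMeasure := by
  rw [lint_mu0 H hH, lint_shear (fun v w => ∫⁻ σ, H (v, w, σ) ∂sphMeasure)]
  · refine lintegral_congr fun c => ?_
    rw [lintegral_lintegral_swap (by fun_prop)]
    refine lintegral_congr fun σ => ?_
    rw [polar3 (fun z => H (c + (2⁻¹:ℝ) • z, c - (2⁻¹:ℝ) • z, σ)) (by fun_prop)]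
  · exact Measurable.lintegral_prod_right' (f := fun q : (R3 × R3) × S2 => H (q.1.1, q.1.2, q.2)) (by fun_prop)

/-- Direction of `z`, default `σ`. -/
def khat (z : R3) (σ : S2) : S2 :=
  ⟨if z = 0 then (σ:R3) else ‖z‖⁻¹ • z, by
    split_ifs with h
    · exact σ.2
    · simp [norm_smul, h]⟩

lemma khat_zero (σ : S2) : khat 0 σ = σ := by ext1; simp [khat]
lemma khat_coe {z : R3} (hz : z ≠ 0) (σ : S2) : (khat z σ : R3) = ‖z‖⁻¹ • z := by simp [khat, hz]
lemma khat_smul {r : ℝ} (hr : 0 < r) (k σ : S2) : khat (r • (k:R3)) σ = k := by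
  have hk : (k:R3) ≠ 0 := by intro h; have := norm_S2 k; rw [h] at this; simp at this
  ext1
  rw [khat_coe (smul_ne_zero hr.ne' hk), norm_smul, norm_S2, Real.norm_of_nonneg hr.le, mul_one, smul_smul,
    inv_mul_cancel₀ hr.ne', one_smul]

lemma meas_khat : Measurable fun q : R3 × S2 => khat q.1 q.2 := by
  refine Measurable.subtype_mk ?_
  exact Measurable.ite (measurableSet_eq_fun (by fun_prop) (by fun_prop)) (by fun_prop) (by fun_prop)

def Tm (p : Om) : Om := (Q2 p, Q3 p, khat (p.1 - p.2.1) p.2.2)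
def Sm (p : Om) : Om := (p.2.1, p.1, -p.2.2)
def Rm (p : Om) : Om := (p.1, p.2.1, -p.2.2)

lemma meas_Tm : Measurable Tm := by
  unfold Tm
  have := meas_khat.comp (f := fun p : Om => (p.1 - p.2.1, p.2.2)) (by fun_prop)
  exact Measurable.prodMk (by fun_prop) (Measurable.prodMk (by fun_prop) this)
lemma meas_Sm : Measurable Sm := by unfold Sm; fun_prop
lemma meas_Rm : Measurable Rm := by unfold Rm; fun_prop

lemma Q23_polar (c : R3) {r : ℝ} (hr : 0 < r) (k σ : S2) :
    Tm (c + (2⁻¹:ℝ) • r • (k:R3), c - (2⁻¹:ℝ) • r • (k:R3), σ) =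
      (c + (2⁻¹:ℝ) • r • (σ:R3), c - (2⁻¹:ℝ) • r • (σ:R3), k) := by
  have h1 : c + (2⁻¹:ℝ) • r • (k:R3) - (c - (2⁻¹:ℝ) • r • (k:R3)) = r • (k:R3) := by
    have : r • (k:R3) = (2⁻¹:ℝ) • r • (k:R3) + (2⁻¹:ℝ) • r • (k:R3) := by rw [← add_smul]; norm_num
    nth_rw 3 [this]; abel
  have h2 : (2⁻¹:ℝ) • (c + (2⁻¹:ℝ) • r • (k:R3) + (c - (2⁻¹:ℝ) • r • (k:R3))) = c := by
    rw [show c + (2⁻¹:ℝ) • r • (k:R3) + (c - (2⁻¹:ℝ) • r • (k:R3)) = c + c by abel, ← two_smul ℝ c, smul_smul]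
    norm_num
  have h3 : ‖r • (k:R3)‖ / 2 = 2⁻¹ * r := by
    rw [norm_smul, norm_S2, Real.norm_of_nonneg hr.le]; ring
  simp only [Tm, Q2, Q3, vOut, vOutStar, h1, h2, h3, khat_smul hr, mul_smul]

lemma Tm_lint (H : Om → ℝ≥0∞) (hH : Measurable H) : ∫⁻ p, H (Tm p) ∂mu0 = ∫⁻ p, H p ∂mu0 := by
  rw [lint_mu0_polar H hH, lint_mu0_polar (fun p => H (Tm p)) (hH.comp meas_Tm)]
  refine lintegral_congr fun c => ?_
  have h0 : ∀ (σ : S2) (p : S2 × Ioi (0:ℝ)), _ = _ := fun σ p => Q23_polar c p.2.2 p.1 σ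
  simp only [h0]
  have h1 : ∀ (σ : S2), ∫⁻ p : S2 × Ioi (0:ℝ), H (c + (2⁻¹:ℝ) • (p.2:ℝ) • (σ:R3), c - (2⁻¹:ℝ) • (p.2:ℝ) • (σ:R3), p.1)
      ∂(sphMeasure.prod (Measure.volumeIoiPow 2)) = ∫⁻ k : S2, (∫⁻ r : Ioi (0:ℝ),
      H (c + (2⁻¹:ℝ) • (r:ℝ) • (σ:R3), c - (2⁻¹:ℝ) • (r:ℝ) • (σ:R3), k) ∂(Measure.volumeIoiPow 2)) ∂sphMeasure :=
    fun σ => lintegral_prod _ (by fun_prop)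
  have h2 : ∀ (σ : S2), ∫⁻ p : S2 × Ioi (0:ℝ), H (c + (2⁻¹:ℝ) • (p.2:ℝ) • (p.1:R3), c - (2⁻¹:ℝ) • (p.2:ℝ) • (p.1:R3), σ)
      ∂(sphMeasure.prod (Measure.volumeIoiPow 2)) = ∫⁻ k : S2, (∫⁻ r : Ioi (0:ℝ),
      H (c + (2⁻¹:ℝ) • (r:ℝ) • (k:R3), c - (2⁻¹:ℝ) • (r:ℝ) • (k:R3), σ) ∂(Measure.volumeIoiPow 2)) ∂sphMeasure :=
    fun σ => lintegral_prod _ (by fun_prop)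
  simp only [h1, h2]
  rw [lintegral_lintegral_swap]
  refine Measurable.aemeasurable ?_
  exact Measurable.lintegral_prod_right' (f := fun q : (S2 × S2) × Ioi (0:ℝ) =>
    H (c + (2⁻¹:ℝ) • (q.2:ℝ) • (q.1.1:R3), c - (2⁻¹:ℝ) • (q.2:ℝ) • (q.1.1:R3), q.1.2)) (by fun_prop)

lemma mp_of_lint {f : Om → Om} (hf : Measurable f)
    (h : ∀ H : Om → ℝ≥0∞, Measurable H → ∫⁻ p, H (f p) ∂mu0 = ∫⁻ p, H p ∂mu0) :
    MeasurePreserving f mu0 mu0 := by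
  refine ⟨hf, Measure.ext_of_lintegral _ fun H hH => ?_⟩
  rw [lintegral_map hH hf, h H hH]

lemma Tm_mp : MeasurePreserving Tm mu0 mu0 := mp_of_lint meas_Tm Tm_lint

lemma Rm_mp : MeasurePreserving Rm mu0 mu0 := by
  refine mp_of_lint meas_Rm fun H hH => ?_
  rw [lint_mu0 (fun p => H (Rm p)) (hH.comp meas_Rm), lint_mu0 _ hH]
  refine lintegral_congr fun v => lintegral_congr fun w => ?_
  exact lint_sph_neg (fun σ => H (v, w, σ)) (by fun_prop)

lemma Sm_mp : MeasurePreserving Sm mu0 mu0 := by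
  refine mp_of_lint meas_Sm fun H hH => ?_
  rw [lint_mu0 (fun p => H (Sm p)) (hH.comp meas_Sm), lint_mu0 _ hH]
  have h : ∀ v w, ∫⁻ σ, H (Sm (v, w, σ)) ∂sphMeasure = ∫⁻ σ, H (w, v, σ) ∂sphMeasure := fun v w =>
    lint_sph_neg (fun σ => H (w, v, σ)) (by fun_prop)
  simp only [h]
  refine lintegral_lintegral_swap (Measurable.aemeasurable ?_)
  exact Measurable.lintegral_prod_right' (f := fun q : (R3 × R3) × S2 => H (q.1.2, q.1.1, q.2)) (by fun_prop)

lemma out_sub (p : Om) : Q2 p - Q3 p = ‖p.1 - p.2.1‖ • (p.2.2:R3) := by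
  simp only [vOut, vOutStar]
  rw [show ∀ a c : R3, a + c - (a - c) = c + c by intros; abel, ← add_smul]; congr 1; ring

lemma out_add (p : Om) : Q2 p + Q3 p = p.1 + p.2.1 := by
  simp only [vOut, vOutStar]
  rw [show ∀ a c : R3, a + c + (a - c) = a + a by intros; abel, ← add_smul]; norm_num

lemma norm_out_sub (p : Om) : ‖Q2 p - Q3 p‖ = ‖p.1 - p.2.1‖ := by
  rw [out_sub, norm_smul, norm_S2]; simp

lemma energy (p : Om) : ‖Q2 p‖ ^ 2 + ‖Q3 p‖ ^ 2 = ‖p.1‖ ^ 2 + ‖p.2.1‖ ^ 2 := by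
  have h1 := parallelogram_law_with_norm ℝ (Q2 p) (Q3 p)
  have h2 := parallelogram_law_with_norm ℝ p.1 p.2.1
  rw [out_add, norm_out_sub] at h1
  nlinarith

lemma half_add_sub (a c : R3) : (2⁻¹:ℝ) • (a + c) + (2⁻¹:ℝ) • (a - c) = a ∧
    (2⁻¹:ℝ) • (a + c) - (2⁻¹:ℝ) • (a - c) = c := by
  constructor
  · rw [← smul_add, show a + c + (a - c) = (2:ℝ) • a by rw [two_smul]; abel, smul_smul]; norm_num
  · rw [← smul_sub, show a + c - (a - c) = (2:ℝ) • c by rw [two_smul]; abel, smul_smul]; norm_num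

lemma khat_smul_norm (z : R3) (σ : S2) : (‖z‖ / 2) • (khat z σ : R3) = (2⁻¹:ℝ) • z := by
  by_cases h : z = 0
  · simp [h]
  · rw [khat_coe h, smul_smul]; congr 1
    have := norm_ne_zero_iff.2 h
    field_simp

@[simp] lemma Tm_fst (p : Om) : (Tm p).1 = Q2 p := rfl
@[simp] lemma Tm_snd (p : Om) : (Tm p).2.1 = Q3 p := rfl
lemma Tm_Q2 (p : Om) : Q2 (Tm p) = p.1 := by
  show (2⁻¹ : ℝ) • (Q2 p + Q3 p) + (‖Q2 p - Q3 p‖ / 2) • (khat (p.1 - p.2.1) p.2.2 : R3) = _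
  rw [out_add, norm_out_sub, khat_smul_norm, (half_add_sub _ _).1]
lemma Tm_Q3 (p : Om) : Q3 (Tm p) = p.2.1 := by
  show (2⁻¹ : ℝ) • (Q2 p + Q3 p) - (‖Q2 p - Q3 p‖ / 2) • (khat (p.1 - p.2.1) p.2.2 : R3) = _
  rw [out_add, norm_out_sub, khat_smul_norm, (half_add_sub _ _).2]
@[simp] lemma Sm_fst (p : Om) : (Sm p).1 = p.2.1 := rfl
@[simp] lemma Sm_snd (p : Om) : (Sm p).2.1 = p.1 := rfl
lemma Sm_Q2 (p : Om) : Q2 (Sm p) = Q3 p := by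
  show vOut p.2.1 p.1 (-p.2.2) = _
  rw [vOut_neg]; simp only [vOutStar, norm_sub_rev p.2.1, add_comm p.2.1]
lemma Sm_Q3 (p : Om) : Q3 (Sm p) = Q2 p := by
  show vOutStar p.2.1 p.1 (-p.2.2) = _
  rw [vOutStar_neg]; simp only [vOut, norm_sub_rev p.2.1, add_comm p.2.1]
@[simp] lemma Rm_fst (p : Om) : (Rm p).1 = p.1 := rfl
@[simp] lemma Rm_snd (p : Om) : (Rm p).2.1 = p.2.1 := rfl
lemma Rm_Q2 (p : Om) : Q2 (Rm p) = Q3 p := vOut_neg _ _ _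
lemma Rm_Q3 (p : Om) : Q3 (Rm p) = Q2 p := vOutStar_neg _ _ _

abbrev cosO (p : Om) : ℝ := cosAngle p.1 p.2.1 p.2.2

lemma Tm_cos (p : Om) : cosO (Tm p) = cosO p := by
  show ⟪‖Q2 p - Q3 p‖⁻¹ • (Q2 p - Q3 p), (khat (p.1 - p.2.1) p.2.2 : R3)⟫ = cosAngle _ _ _
  by_cases h : p.1 - p.2.1 = 0
  · rw [norm_out_sub, h]; simp [cosAngle, h]
  · rw [norm_out_sub, out_sub, smul_smul, inv_mul_cancel₀ (norm_ne_zero_iff.2 h), one_smul, khat_coe h,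
      real_inner_comm]; rfl
lemma Sm_cos (p : Om) : cosO (Sm p) = cosO p := by
  show cosAngle p.2.1 p.1 (-p.2.2) = _
  rw [cosAngle_neg]; simp only [cosAngle, norm_sub_rev p.2.1]
  rw [← neg_sub p.1 p.2.1, smul_neg, inner_neg_left, neg_neg]
lemma Rm_cos (p : Om) : cosO (Rm p) = - cosO p := cosAngle_neg _ _ _

lemma Tm_norm (p : Om) : ‖(Tm p).1 - (Tm p).2.1‖ = ‖p.1 - p.2.1‖ := norm_out_sub p
lemma Sm_norm (p : Om) : ‖(Sm p).1 - (Sm p).2.1‖ = ‖p.1 - p.2.1‖ := norm_sub_rev _ _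

/-- Bker on `Om` -/
def BO (γ : ℝ) (b : ℝ → ℝ) (p : Om) : ℝ := Bker γ b p.1 p.2.1 p.2.2

/-- Admissible kernels. -/
structure CK (γ : ℝ) (b : ℝ → ℝ) (k : Om → ℝ) : Prop where
  meas : Measurable k
  nonneg : ∀ p, 0 ≤ k p
  le : ∀ p, k p ≤ BO γ b p
  T : ∀ p, k (Tm p) = k p
  S : ∀ p, k (Sm p) = k p
  R : ∀ p, k (Rm p) = k p

lemma CK_B {γ : ℝ} {b : ℝ → ℝ} (hb : GradCutoff b) : CK γ b (BO γ b) where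
  meas := by unfold BO Bker; have := hb.measurable; fun_prop
  nonneg p := mul_nonneg (by positivity) (hb.nonneg _)
  le p := le_rfl
  T p := by
    show ‖(Tm p).1 - (Tm p).2.1‖ ^ γ * b (cosO (Tm p)) = _
    rw [Tm_norm, Tm_cos]; rfl
  S p := by
    show ‖(Sm p).1 - (Sm p).2.1‖ ^ γ * b (cosO (Sm p)) = _
    rw [Sm_norm, Sm_cos]; rfl
  R p := by
    show ‖p.1 - p.2.1‖ ^ γ * b (cosO (Rm p)) = _
    rw [Rm_cos, b_symm hb (cosAngle_abs_le _ _ _)]; rfl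

/-- cut kernels. -/
def kcut (γ : ℝ) (b : ℝ → ℝ) (n : ℕ) (p : Om) : ℝ :=
  if ‖p.1‖ ^ 2 + ‖p.2.1‖ ^ 2 ≤ (n:ℝ) ^ 2 then BO γ b p else 0

lemma CK_cut {γ : ℝ} {b : ℝ → ℝ} (hb : GradCutoff b) (n : ℕ) : CK γ b (kcut γ b n) where
  meas := Measurable.ite (measurableSet_le (by fun_prop) (by fun_prop)) (CK_B hb).meas measurable_const
  nonneg p := by unfold kcut; split_ifs; exacts [(CK_B hb).nonneg p, le_rfl]
  le p := by unfold kcut; split_ifs; exacts [le_rfl, (CK_B hb).nonneg p]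
  T p := by unfold kcut; rw [(CK_B hb).T, Tm_fst, Tm_snd, energy]
  S p := by unfold kcut; rw [(CK_B hb).S, Sm_fst, Sm_snd, add_comm]
  R p := by unfold kcut; rw [(CK_B hb).R, Rm_fst, Rm_snd]

end BFD
end

noncomputable section
open MeasureTheory Real Set
open scoped RealInnerProductSpace ENNReal

namespace BFD

/-- Weight `1+|v|²`. -/
def phi (v : R3) : ℝ := 1 + ‖v‖ ^ 2
lemma one_le_phi (v : R3) : 1 ≤ phi v := by unfold phi; nlinarith [sq_nonneg ‖v‖]
lemma phi_pos (v : R3) : 0 < phi v := lt_of_lt_of_le one_pos (one_le_phi v)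
@[fun_prop] lemma meas_phi : Measurable phi := by unfold phi; fun_prop

/-- Moments. -/
def Mom (p : ℝ) (f : R3 → ℝ) : ℝ≥0∞ := ∫⁻ v, ENNReal.ofReal (f v * phi v ^ p)

abbrev nu : Measure (R3 × S2) := (volume : Measure R3).prod sphMeasure

lemma inner_cos (v w : R3) (σ : S2) : ⟪v - w, (σ:R3)⟫ = ‖v - w‖ * cosAngle v w σ := by
  unfold cosAngle
  by_cases h : v - w = 0
  · simp [h]
  · rw [real_inner_smul_left, ← mul_assoc, mul_inv_cancel₀ (norm_ne_zero_iff.2 h), one_mul]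

lemma sA_sq (v w : R3) (σ : S2) : sA v w σ ^ 2 = (1 - cosAngle v w σ) / 2 := by
  unfold sA; rw [sq_sqrt]; have := abs_le.1 (cosAngle_abs_le v w σ); linarith
lemma cA_sq (v w : R3) (σ : S2) : cA v w σ ^ 2 = (1 + cosAngle v w σ) / 2 := by
  unfold cA; rw [sq_sqrt]; have := abs_le.1 (cosAngle_abs_le v w σ); linarith
lemma sA_nonneg (v w : R3) (σ : S2) : 0 ≤ sA v w σ := sqrt_nonneg _
lemma cA_nonneg (v w : R3) (σ : S2) : 0 ≤ cA v w σ := sqrt_nonneg _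

lemma geo_aux (z σ : R3) (hσ : ‖σ‖ = 1) (a : ℝ) :
    ‖(2⁻¹:ℝ) • z + (‖z‖ / 2 * a) • σ‖ ^ 2 = ‖z‖^2/4 + ‖z‖ ^ 2 * a^2/4 + ‖z‖ / 2 * a * ⟪z, σ⟫ := by
  rw [norm_add_sq_real, norm_smul, norm_smul, hσ, real_inner_smul_left, real_inner_smul_right]
  rw [mul_one, mul_pow, Real.norm_eq_abs, sq_abs, Real.norm_eq_abs, sq_abs]; ring

lemma geo_vOut (v w : R3) (σ : S2) : ‖vOut v w σ - v‖ ^ 2 = ‖v - w‖ ^ 2 * sA v w σ ^ 2 := by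
  have h : vOut v w σ - v = -((2⁻¹:ℝ) • (v - w) + (‖v - w‖ / 2 * (-1)) • (σ:R3)) := by
    have := (half_add_sub v w).1
    unfold vOut
    nth_rw 3 [← this]; rw [mul_neg_one, neg_smul]; abel
  rw [h, norm_neg, geo_aux _ _ (norm_S2 σ), inner_cos, sA_sq]; ring

lemma geo_vOutStar (v w : R3) (σ : S2) : ‖vOutStar v w σ - v‖ ^ 2 = ‖v - w‖ ^ 2 * cA v w σ ^ 2 := by
  rw [← vOut_neg, geo_vOut, sA_sq, cA_sq, cosAngle_neg]; ring

lemma geo_star_w (v w : R3) (σ : S2) : ‖vOutStar v w σ - w‖ ^ 2 = ‖v - w‖ ^ 2 * sA v w σ ^ 2 := by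
  have h : vOutStar v w σ - w = -(vOut v w σ - v) := by
    have := out_add (v, w, σ)
    simp only [Q2, Q3] at this
    rw [eq_sub_of_add_eq' this]; abel
  rw [h, norm_neg, geo_vOut]

lemma norm_sub_sq_le (a c : R3) : ‖a - c‖ ^ 2 ≤ 2 * ‖a‖ ^ 2 + 2 * ‖c‖ ^ 2 := by
  have := norm_sub_le a c
  nlinarith [norm_nonneg (a - c), sq_nonneg (‖a‖ - ‖c‖)]

lemma rpow_norm_eq {γ : ℝ} (v w : R3) : ‖v - w‖ ^ γ = (‖v - w‖ ^ 2) ^ (γ / 2) := by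
  rw [← rpow_natCast, ← rpow_mul (norm_nonneg _)]; congr 1; push_cast; ring

lemma rpow_le_add {g a x y : ℝ} (hg0 : 0 ≤ g) (hg1 : g ≤ 1) (hx : 0 ≤ x) (hy : 0 ≤ y) (ha : 0 ≤ a)
    (h : a ≤ 4 * x + 4 * y) : a ^ g ≤ 4 * (x ^ g + y ^ g) := by
  have h4 : (4:ℝ) ^ g ≤ 4 := by
    calc (4:ℝ) ^ g ≤ 4 ^ (1:ℝ) := rpow_le_rpow_of_exponent_le (by norm_num) hg1
      _ = 4 := rpow_one 4
  calc a ^ g ≤ (4 * x + 4 * y) ^ g := rpow_le_rpow ha h hg0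
    _ = 4 ^ g * (x + y) ^ g := by rw [← mul_add, mul_rpow (by norm_num) (by positivity)]
    _ ≤ 4 * (x ^ g + y ^ g) := by
        have := Real.rpow_add_le_add_rpow hx hy hg0 hg1
        gcongr

lemma rpow_le_self' {g x : ℝ} (hg1 : g ≤ 1) (hx : 1 ≤ x) : x ^ g ≤ x := by
  calc x ^ g ≤ x ^ (1:ℝ) := rpow_le_rpow_of_exponent_le hx hg1
    _ = x := rpow_one x

/-- Growth of the kernel. -/
lemma Aγ_le {γ : ℝ} (h0 : 0 ≤ γ) (h2 : γ ≤ 2) (v w : R3) :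
    ‖v - w‖ ^ γ ≤ 4 * (phi v ^ (γ/2) + phi w ^ (γ/2)) := by
  rw [rpow_norm_eq]
  refine rpow_le_add (by linarith) (by linarith) (phi_pos v).le (phi_pos w).le (by positivity) ?_
  have := norm_sub_sq_le v w
  unfold phi; nlinarith [sq_nonneg ‖v‖, sq_nonneg ‖w‖]

/-- scalar interpolation used in the gain estimate. -/
lemma scal_interp {g X X' s l F1 F2 : ℝ} (hg0 : 0 ≤ g) (hg1 : g ≤ 1) (hX : 1 ≤ X) (hX' : 1 ≤ X') (hXX : X ≤ 2 * X')
    (hs : 0 ≤ s) (hl : 0 < l) (h1 : 0 ≤ F1) (h1' : F1 ≤ 1) (h2 : 0 ≤ F2) (h2' : F2 ≤ 1) :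
    X ^ g * s ^ 2 * (F1 * F2) ≤ l ^ 2 * F2 + 4 * l⁻¹ * (s ^ 3 * (F1 * X' ^ (1 + g))) := by
  set z := X ^ (g/2) * s with hz
  have hz0 : 0 ≤ z := by positivity
  have hz2 : X ^ g * s ^ 2 = z ^ 2 := by
    rw [hz, mul_pow, ← rpow_natCast (X ^ (g/2)), ← rpow_mul (by linarith)]; congr 2; push_cast; ring
  have hz3 : z ^ 3 ≤ 4 * (s ^ 3 * X' ^ (1 + g)) := by
    have e1 : z ^ 3 = X ^ (3 * g / 2) * s ^ 3 := by
      rw [hz, mul_pow, ← rpow_natCast (X ^ (g/2)), ← rpow_mul (by linarith)]; congr 2; push_cast; ring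
    have e2 : X ^ (3 * g / 2) ≤ 4 * X' ^ (1 + g) := by
      calc X ^ (3 * g / 2) ≤ (2 * X') ^ (3 * g / 2) := rpow_le_rpow (by linarith) hXX (by linarith)
        _ ≤ (2 * X') ^ (1 + g) := rpow_le_rpow_of_exponent_le (by linarith) (by linarith)
        _ = 2 ^ (1 + g) * X' ^ (1 + g) := mul_rpow (by norm_num) (by linarith)
        _ ≤ 2 ^ (2:ℝ) * X' ^ (1 + g) := by
            gcongr
            · norm_num
            · linarith
        _ = 4 * X' ^ (1 + g) := by norm_num
    rw [e1]
    have := mul_le_mul_of_nonneg_right e2 (by positivity : 0 ≤ s ^ 3)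
    linarith
  rw [hz2]
  rcases le_total z l with h | h
  · have : z ^ 2 * (F1 * F2) ≤ l ^ 2 * F2 := by
      have : F1 * F2 ≤ F2 := by nlinarith
      gcongr
    have : 0 ≤ 4 * l⁻¹ * (s ^ 3 * (F1 * X' ^ (1 + g))) := by positivity
    linarith
  · have : z ^ 2 * (F1 * F2) ≤ 4 * l⁻¹ * (s ^ 3 * (F1 * X' ^ (1 + g))) := by
      calc z ^ 2 * (F1 * F2) ≤ z ^ 2 * (F1 * 1) := by gcongr
        _ ≤ (l⁻¹ * z) * (z ^ 2 * F1) := by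
          have : 1 ≤ l⁻¹ * z := by rw [inv_mul_eq_div, le_div_iff₀ hl]; linarith
          nlinarith [show 0 ≤ z ^ 2 * F1 by positivity]
        _ = l⁻¹ * F1 * z ^ 3 := by ring
        _ ≤ l⁻¹ * F1 * (4 * (s ^ 3 * X' ^ (1 + g))) := by gcongr
        _ = _ := by ring
    have : 0 ≤ l ^ 2 * F2 := by positivity
    linarith

/-- scalar gain estimate; `D = A²`. -/
lemma scal_gain {g X W X' U D s l F1 F2 : ℝ} (hg0 : 0 ≤ g) (hg1 : g ≤ 1) (hX : 1 ≤ X) (hW : 1 ≤ W) (hX' : 1 ≤ X')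
    (hU : 1 ≤ U) (hD : 0 ≤ D) (hen : X' + U = X + W) (hDU : D ≤ 4 * X + 4 * U) (hWU : W ≤ 2 * U + 2 * (D * s ^ 2))
    (hs : 0 ≤ s) (hs1 : s ≤ 1) (hl : 0 < l) (h1 : 0 ≤ F1) (h1' : F1 ≤ 1) (h2 : 0 ≤ F2) (h2' : F2 ≤ 1) :
    D ^ g * (F1 * F2 * W) ≤ 300 * ((1 + l ^ 2) * X * (F2 * U) + F2 * U ^ (1 + g) + l⁻¹ * X * (s ^ 3 * (F1 * X' ^ (1 + g)))) := by
  have hF : F1 * F2 ≤ F2 := by nlinarith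
  have hF0 : 0 ≤ F1 * F2 := by positivity
  have Ug : U ^ (1 + g) = U * U ^ g := by rw [rpow_add (by linarith), rpow_one]
  have Dg : D ^ (1 + g) = D * D ^ g := by rw [rpow_add' hD (by linarith), rpow_one]
  have hA : D ^ g * (F1 * F2 * (2 * U)) ≤ 8 * (X * (F2 * U) + F2 * U ^ (1 + g)) := by
    have := rpow_le_add hg0 hg1 (by linarith) (by linarith) hD hDU
    have hXg := rpow_le_self' hg1 hX
    calc D ^ g * (F1 * F2 * (2 * U)) ≤ (4 * (X ^ g + U ^ g)) * (F2 * (2 * U)) := by gcongr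
      _ ≤ (4 * (X + U ^ g)) * (F2 * (2 * U)) := by gcongr
      _ = _ := by rw [Ug]; ring
  have hB : D ^ g * (F1 * F2 * (2 * (D * s ^ 2))) ≤ 288 * (l ^ 2 * X * (F2 * U) + F2 * U ^ (1 + g) + l⁻¹ * X * (s ^ 3 * (F1 * X' ^ (1 + g)))) := by
    have eB : D ^ g * (F1 * F2 * (2 * (D * s ^ 2))) = 2 * D ^ (1 + g) * s ^ 2 * (F1 * F2) := by rw [Dg]; ring
    have pos1 : 0 ≤ l ^ 2 * X * (F2 * U) := by positivity
    have pos2 : 0 ≤ l⁻¹ * X * (s ^ 3 * (F1 * X' ^ (1 + g))) := by positivity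
    have pos3 : 0 ≤ F2 * U ^ (1 + g) := by positivity
    rw [eB]
    rcases le_total (X / 2) U with h | h
    · have hD12 : D ^ (1 + g) ≤ 144 * U ^ (1 + g) := by
        calc D ^ (1 + g) ≤ (12 * U) ^ (1 + g) := rpow_le_rpow hD (by linarith) (by linarith)
          _ = 12 ^ (1 + g) * U ^ (1 + g) := mul_rpow (by norm_num) (by linarith)
          _ ≤ 12 ^ (2:ℝ) * U ^ (1 + g) := by
            gcongr
            · norm_num
            · linarith
          _ = _ := by norm_num
      have hs2 : s ^ 2 ≤ 1 := by nlinarith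
      have : 2 * D ^ (1 + g) * s ^ 2 * (F1 * F2) ≤ 2 * (144 * U ^ (1 + g)) * 1 * F2 := by gcongr
      nlinarith
    · have hD6 : D ^ (1 + g) ≤ 36 * (X * X ^ g) := by
        calc D ^ (1 + g) ≤ (6 * X) ^ (1 + g) := rpow_le_rpow hD (by linarith) (by linarith)
          _ = 6 ^ (1 + g) * X ^ (1 + g) := mul_rpow (by norm_num) (by linarith)
          _ ≤ 6 ^ (2:ℝ) * X ^ (1 + g) := by
            gcongr
            · norm_num
            · linarith
          _ = _ := by rw [rpow_add (by linarith : 0 < X), rpow_one]; norm_num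
      have hint := scal_interp hg0 hg1 hX hX' (by linarith : X ≤ 2 * X') hs hl h1 h1' h2 h2'
      have : 2 * D ^ (1 + g) * s ^ 2 * (F1 * F2) ≤ 2 * (36 * (X * X ^ g)) * s ^ 2 * (F1 * F2) := by gcongr
      have h3 := mul_le_mul_of_nonneg_left hint (by linarith : 0 ≤ 72 * X)
      have h4 : 72 * X * (l ^ 2 * F2) ≤ 72 * (l ^ 2 * X * (F2 * U)) := by
        have : F2 ≤ F2 * U := by nlinarith
        have := mul_le_mul_of_nonneg_left this (by positivity : 0 ≤ 72 * X * l ^ 2)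
        linarith
      nlinarith
  have : D ^ g * (F1 * F2 * W) ≤ D ^ g * (F1 * F2 * (2 * U)) + D ^ g * (F1 * F2 * (2 * (D * s ^ 2))) := by
    rw [← mul_add, ← mul_add]; gcongr
  have p3 : 0 ≤ X * (F2 * U) := by positivity
  have p4 : 0 ≤ l ^ 2 * X * (F2 * U) := by positivity
  have p5 : 0 ≤ F2 * U ^ (1 + g) := by positivity
  have p6 : 0 ≤ l⁻¹ * X * (s ^ 3 * (F1 * X' ^ (1 + g))) := by positivity
  nlinarith

lemma half_red (v w : R3) {H G : S2 → ℝ≥0∞} (hG : Measurable G) (hsym : ∀ σ, H (-σ) = H σ)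
    (hle : ∀ σ, 0 ≤ cosAngle v w σ → H σ ≤ G σ) :
    ∫⁻ σ, H σ ∂sphMeasure ≤ 2 * ∫⁻ σ, G σ ∂sphMeasure := by
  calc ∫⁻ σ, H σ ∂sphMeasure ≤ ∫⁻ σ, (G σ + G (-σ)) ∂sphMeasure := by
        refine lintegral_mono fun σ => ?_
        rcases le_total 0 (cosAngle v w σ) with h | h
        · exact (hle σ h).trans le_self_add
        · rw [← hsym σ]
          exact (hle (-σ) (by rw [cosAngle_neg]; linarith)).trans le_add_self
    _ = _ := by rw [lintegral_add_left hG, lint_sph_neg G hG, two_mul]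

/-- pointwise geometry gathered, at `cos θ ≥ 0`. -/
lemma geo_facts (v w : R3) (σ : S2) (hc : 0 ≤ cosAngle v w σ) :
    phi (vOut v w σ) + phi (vOutStar v w σ) = phi v + phi w ∧
    ‖v - w‖ ^ 2 ≤ 4 * phi v + 4 * phi (vOutStar v w σ) ∧
    phi w ≤ 2 * phi (vOutStar v w σ) + 2 * (‖v - w‖ ^ 2 * sA v w σ ^ 2) ∧ sA v w σ ≤ 1 ∧ 1 ≤ 3 * cA v w σ ^ 3 := by
  have he := energy (v, w, σ)
  simp only [Q2, Q3] at he
  have hcs := cA_sq v w σ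
  have hss := sA_sq v w σ
  have hab := abs_le.1 (cosAngle_abs_le v w σ)
  refine ⟨?_, ?_, ?_, ?_, ?_⟩
  · unfold phi; linarith
  · have h1 := geo_vOutStar v w σ
    have h2 := norm_sub_sq_le (vOutStar v w σ) v
    have h3 : ‖v - w‖ ^ 2 * (1/2) ≤ ‖v - w‖ ^ 2 * cA v w σ ^ 2 := by
      rw [hcs]; gcongr; linarith
    unfold phi; linarith
  · have h1 := geo_star_w v w σ
    have h2 := norm_sub_sq_le (vOutStar v w σ) (vOutStar v w σ - w)
    rw [sub_sub_cancel] at h2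
    unfold phi; linarith
  · have := sA_nonneg v w σ
    nlinarith
  · have h0 := cA_nonneg v w σ
    have h1 : 1/2 ≤ cA v w σ ^ 2 := by rw [hcs]; linarith
    have h2 : 2/3 ≤ cA v w σ := by nlinarith
    nlinarith

end BFD
end

noncomputable section
open MeasureTheory Real Set
open scoped RealInnerProductSpace ENNReal

namespace BFD

/-- Admissible densities. -/
structure UF (f : R3 → ℝ) : Prop where
  meas : Measurable f
  nonneg : ∀ v, 0 ≤ f v
  le_one : ∀ v, f v ≤ 1

variable {γ : ℝ} {b : ℝ → ℝ}

lemma lint_b_ang (hb : GradCutoff b) {v w : R3} (h : v ≠ w) :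
    ∫⁻ σ, ENNReal.ofReal (b (cosAngle v w σ)) ∂sphMeasure = Ib b := by
  refine lint_b hb (‖v - w‖⁻¹ • (v - w)) ?_
  have := norm_ne_zero_iff.2 (sub_ne_zero.2 h)
  rw [norm_smul, norm_inv, norm_norm, inv_mul_cancel₀ this]

lemma ae_ne (v : R3) : ∀ᵐ w : R3, v ≠ w := by
  have h : ∀ᵐ w : R3, w ∉ ({v} : Set R3) := measure_eq_zero_iff_ae_notMem.1 (measure_singleton v)
  filter_upwards [h] with w hw
  intro h; exact hw (by simp [h])

lemma lint_ang (hb : GradCutoff b) (v : R3) (G : R3 → ℝ≥0∞) :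
    ∫⁻ w, ∫⁻ σ, ENNReal.ofReal (b (cosAngle v w σ)) * G w ∂sphMeasure = Ib b * ∫⁻ w, G w := by
  rw [← lintegral_const_mul' _ _ (Ib_lt_top hb).ne]
  refine lintegral_congr_ae ?_
  filter_upwards [ae_ne v] with w hw
  have hbm := hb.measurable
  rw [lintegral_mul_const _ (by fun_prop), lint_b_ang hb hw]

lemma Mom_mono {p q : ℝ} (h : p ≤ q) {f : R3 → ℝ} (hf : ∀ v, 0 ≤ f v) : Mom p f ≤ Mom q f := by
  refine lintegral_mono fun v => ENNReal.ofReal_le_ofReal ?_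
  exact mul_le_mul_of_nonneg_left (rpow_le_rpow_of_exponent_le (one_le_phi v) h) (hf v)

lemma Mom_one (f : R3 → ℝ) : Mom 1 f = ∫⁻ v, ENNReal.ofReal (f v * phi v) := by simp [Mom]
lemma Mom_zero (f : R3 → ℝ) : Mom 0 f = ∫⁻ v, ENNReal.ofReal (f v) := by simp [Mom]

/-- The constant of the basic estimates. -/
def KJ (b : ℝ → ℝ) : ℝ≥0∞ := 1800 * Ccv b + 8 * Ib b
lemma KJ_lt_top (hb : GradCutoff b) : KJ b < ⊤ :=
  ENNReal.add_lt_top.2 ⟨ENNReal.mul_lt_top (by simp) (Ccv_lt_top hb), ENNReal.mul_lt_top (by simp) (Ib_lt_top hb)⟩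

lemma lint_loss (hγ0 : 0 ≤ γ) (hγ2 : γ ≤ 2) (hb : GradCutoff b) {F : R3 → ℝ} (hF : UF F) (v : R3) (p : ℝ) :
    ∫⁻ w, ∫⁻ σ, ENNReal.ofReal (BO γ b (v, w, σ) * (F w * phi w ^ p)) ∂sphMeasure ≤
      4 * Ib b * (ENNReal.ofReal (phi v ^ (γ/2)) * Mom p F + Mom (p + γ/2) F) := by
  have hFm := hF.meas
  have h1 : ∀ w σ, ENNReal.ofReal (BO γ b (v, w, σ) * (F w * phi w ^ p)) ≤ ENNReal.ofReal (b (cosAngle v w σ)) *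
      (4 * (ENNReal.ofReal (phi v ^ (γ/2)) * ENNReal.ofReal (F w * phi w ^ p) + ENNReal.ofReal (F w * phi w ^ (p + γ/2)))) := by
    intro w σ
    have hφ := phi_pos v; have hφw := phi_pos w; have hFw := hF.nonneg w
    rw [show (4:ℝ≥0∞) = ENNReal.ofReal 4 by simp, ← ENNReal.ofReal_mul (by positivity),
      ← ENNReal.ofReal_add (by positivity) (by positivity), ← ENNReal.ofReal_mul (by positivity),
      ← ENNReal.ofReal_mul (hb.nonneg _)]
    refine ENNReal.ofReal_le_ofReal ?_
    have := mul_le_mul_of_nonneg_right (Aγ_le hγ0 hγ2 v w) (show 0 ≤ b (cosAngle v w σ) * (F w * phi w ^ p) from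
      mul_nonneg (hb.nonneg _) (by positivity))
    simp only [BO, Bker]
    rw [rpow_add hφw]
    calc _ = _ := mul_assoc _ _ _
      _ ≤ _ := this
      _ = _ := by ring
  refine (lintegral_mono fun w => lintegral_mono fun σ => h1 w σ).trans ?_
  rw [lint_ang hb v (fun w => _), lintegral_const_mul _ (by fun_prop), lintegral_add_left (by fun_prop),
    lintegral_const_mul _ (by fun_prop)]
  simp only [Mom]
  rw [← mul_assoc, mul_comm (Ib b)]

lemma BO_sym (hb : GradCutoff b) (v w : R3) (σ : S2) : BO γ b (v, w, -σ) = BO γ b (v, w, σ) := (CK_B hb).R (v, w, σ)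

lemma lint_gain (hγ0 : 0 ≤ γ) (hγ2 : γ ≤ 2) (hb : GradCutoff b) {F : R3 → ℝ} (hF : UF F) (v : R3) {l : ℝ} (hl : 0 < l) :
    ∫⁻ w, ∫⁻ σ, ENNReal.ofReal (BO γ b (v, w, σ) * (F (vOut v w σ) * F (vOutStar v w σ) * phi w)) ∂sphMeasure ≤
      1800 * Ccv b * ((ENNReal.ofReal (1 + l ^ 2) * Mom 1 F + ENNReal.ofReal l⁻¹ * Mom (1 + γ/2) F) *
        ENNReal.ofReal (phi v) + Mom (1 + γ/2) F) := by
  have hFm := hF.meas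
  have hbm := hb.measurable
  have hφ := phi_pos v
  set G1 : R3 → ℝ≥0∞ := fun u => ENNReal.ofReal (900 * ((1 + l^2) * phi v * (F u * phi u) + F u * phi u ^ (1 + γ/2))) with hG1
  set G2 : R3 → ℝ≥0∞ := fun y => ENNReal.ofReal (300 * l⁻¹ * phi v * (F y * phi y ^ (1 + γ/2))) with hG2
  have mG1 : Measurable G1 := by fun_prop
  have mG2 : Measurable G2 := by fun_prop
  have key : ∀ w, ∫⁻ σ, ENNReal.ofReal (BO γ b (v, w, σ) * (F (vOut v w σ) * F (vOutStar v w σ) * phi w)) ∂sphMeasure ≤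
      2 * ∫⁻ σ, (ENNReal.ofReal (b (cosAngle v w σ)) * ENNReal.ofReal (cA v w σ ^ 3) * G1 (vOutStar v w σ) +
        ENNReal.ofReal (b (cosAngle v w σ)) * ENNReal.ofReal (sA v w σ ^ 3) * G2 (vOut v w σ)) ∂sphMeasure := by
    intro w
    refine half_red v w (by fun_prop) ?_ ?_
    · intro σ
      rw [BO_sym hb, vOut_neg, vOutStar_neg, mul_comm (F (vOutStar v w σ))]
    · intro σ hc
      obtain ⟨g1, g2, g3, g4, g5⟩ := geo_facts v w σ hc
      have hu := phi_pos (vOutStar v w σ); have hy := phi_pos (vOut v w σ)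
      have f1 := hF.nonneg (vOut v w σ); have f2 := hF.nonneg (vOutStar v w σ)
      have hs := sA_nonneg v w σ; have hcc := cA_nonneg v w σ
      have hbb := hb.nonneg (cosAngle v w σ)
      have sg := scal_gain (by linarith : 0 ≤ γ/2) (by linarith) (one_le_phi v) (one_le_phi w) (one_le_phi (vOut v w σ))
        (one_le_phi (vOutStar v w σ)) (by positivity) g1 g2 g3 hs g4 hl f1 (hF.le_one _) f2 (hF.le_one _)
      simp only [hG1, hG2]
      rw [← ENNReal.ofReal_mul hbb, ← ENNReal.ofReal_mul (by positivity), ← ENNReal.ofReal_mul hbb,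
        ← ENNReal.ofReal_mul (by positivity), ← ENNReal.ofReal_add (by positivity) (by positivity)]
      refine ENNReal.ofReal_le_ofReal ?_
      rw [BO, Bker, rpow_norm_eq]
      simp only
      set P := (1 + l ^ 2) * phi v * (F (vOutStar v w σ) * phi (vOutStar v w σ)) + F (vOutStar v w σ) * phi (vOutStar v w σ) ^ (1 + γ/2) with hP
      have hP0 : 0 ≤ P := by positivity
      have h3 : P ≤ 3 * cA v w σ ^ 3 * P := by nlinarith
      have := mul_le_mul_of_nonneg_left sg hbb
      calc _ = b (cosAngle v w σ) * ((‖v - w‖ ^ 2) ^ (γ / 2) * (F (vOut v w σ) * F (vOutStar v w σ) * phi w)) := by ring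
        _ ≤ _ := this
        _ = b (cosAngle v w σ) * (300 * P) + b (cosAngle v w σ) * sA v w σ ^ 3 * (300 * l⁻¹ * phi v * (F (vOut v w σ) * phi (vOut v w σ) ^ (1 + γ/2))) := by rw [hP]; ring
        _ ≤ b (cosAngle v w σ) * (300 * (3 * cA v w σ ^ 3 * P)) + b (cosAngle v w σ) * sA v w σ ^ 3 * (300 * l⁻¹ * phi v * (F (vOut v w σ) * phi (vOut v w σ) ^ (1 + γ/2))) := by gcongr
        _ = _ := by ring
  calc _ ≤ ∫⁻ w, 2 * ∫⁻ σ, (ENNReal.ofReal (b (cosAngle v w σ)) * ENNReal.ofReal (cA v w σ ^ 3) * G1 (vOutStar v w σ) +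
        ENNReal.ofReal (b (cosAngle v w σ)) * ENNReal.ofReal (sA v w σ ^ 3) * G2 (vOut v w σ)) ∂sphMeasure := lintegral_mono key
    _ = 2 * ((∫⁻ w, ∫⁻ σ, ENNReal.ofReal (b (cosAngle v w σ)) * ENNReal.ofReal (cA v w σ ^ 3) * G1 (vOutStar v w σ) ∂sphMeasure) +
        ∫⁻ w, ∫⁻ σ, ENNReal.ofReal (b (cosAngle v w σ)) * ENNReal.ofReal (sA v w σ ^ 3) * G2 (vOut v w σ) ∂sphMeasure) := by
        have m1 : Measurable fun w => ∫⁻ σ, ENNReal.ofReal (b (cosAngle v w σ)) * ENNReal.ofReal (cA v w σ ^ 3) * G1 (vOutStar v w σ) ∂sphMeasure :=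
          Measurable.lintegral_prod_right' (f := fun q : R3 × S2 => ENNReal.ofReal (b (cosAngle v q.1 q.2)) * ENNReal.ofReal (cA v q.1 q.2 ^ 3) * G1 (vOutStar v q.1 q.2)) (by fun_prop)
        rw [lintegral_const_mul' _ _ (by simp), ← lintegral_add_left m1]
        congr 1
        refine lintegral_congr fun w => ?_
        rw [lintegral_add_left (by fun_prop)]
    _ ≤ 2 * (Ccv b * (∫⁻ u, G1 u) + Ccv b * ∫⁻ y, G2 y) := by
        gcongr
        · exact cv_star hb v G1 mG1
        · exact cv_prime hb v G2 mG2
    _ ≤ _ := by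
        have e1 : ∫⁻ u, G1 u = 900 * (ENNReal.ofReal (1 + l^2) * ENNReal.ofReal (phi v) * Mom 1 F + Mom (1 + γ/2) F) := by
          rw [Mom_one, Mom, ← lintegral_const_mul _ (by fun_prop), ← lintegral_add_left (by fun_prop), ← lintegral_const_mul _ (by fun_prop)]
          refine lintegral_congr fun u => ?_
          have hu := phi_pos u; have fu := hF.nonneg u
          rw [hG1, show (900:ℝ≥0∞) = ENNReal.ofReal 900 by simp, ← ENNReal.ofReal_mul (by positivity), ← ENNReal.ofReal_mul (by positivity),
            ← ENNReal.ofReal_add (by positivity) (by positivity), ← ENNReal.ofReal_mul (by positivity)]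
        have e2 : ∫⁻ y, G2 y = 300 * ENNReal.ofReal l⁻¹ * ENNReal.ofReal (phi v) * Mom (1 + γ/2) F := by
          rw [Mom, ← lintegral_const_mul _ (by fun_prop)]
          refine lintegral_congr fun u => ?_
          rw [hG2, show (300:ℝ≥0∞) = ENNReal.ofReal 300 by simp, ← ENNReal.ofReal_mul (by positivity), ← ENNReal.ofReal_mul (by positivity),
            ← ENNReal.ofReal_mul (by positivity)]
        rw [e1, e2]
        have : (300:ℝ≥0∞) ≤ 900 := by norm_num
        calc _ ≤ 2 * (Ccv b * (900 * (ENNReal.ofReal (1 + l^2) * ENNReal.ofReal (phi v) * Mom 1 F + Mom (1 + γ/2) F)) +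
              Ccv b * (900 * ENNReal.ofReal l⁻¹ * ENNReal.ofReal (phi v) * Mom (1 + γ/2) F)) := by gcongr
          _ = _ := by ring

/-- JL: weighted estimate. -/
lemma JL (hγ0 : 0 ≤ γ) (hγ2 : γ ≤ 2) (hb : GradCutoff b) {F : R3 → ℝ} (hF : UF F) (v : R3) {l : ℝ} (hl : 0 < l) :
    ∫⁻ w, ∫⁻ σ, ENNReal.ofReal (BO γ b (v, w, σ) * ((F w + F (vOut v w σ) * F (vOutStar v w σ)) * phi w)) ∂sphMeasure ≤
      KJ b * ((ENNReal.ofReal (1 + l ^ 2) * Mom 1 F + ENNReal.ofReal l⁻¹ * Mom (1 + γ/2) F) *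
        ENNReal.ofReal (phi v) + Mom (1 + γ/2) F) := by
  have hFm := hF.meas
  have hB := (CK_B (γ := γ) hb).meas
  have hsplit : ∀ w σ, ENNReal.ofReal (BO γ b (v, w, σ) * ((F w + F (vOut v w σ) * F (vOutStar v w σ)) * phi w)) =
      ENNReal.ofReal (BO γ b (v, w, σ) * (F w * phi w ^ (1:ℝ))) +
      ENNReal.ofReal (BO γ b (v, w, σ) * (F (vOut v w σ) * F (vOutStar v w σ) * phi w)) := by
    intro w σ
    have := (CK_B (γ := γ) hb).nonneg (v, w, σ)
    have := hF.nonneg w; have := hF.nonneg (vOut v w σ); have := hF.nonneg (vOutStar v w σ); have := phi_pos w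
    rw [← ENNReal.ofReal_add (by positivity) (by positivity), rpow_one]; congr 1; ring
  have m1 : Measurable fun w => ∫⁻ σ, ENNReal.ofReal (BO γ b (v, w, σ) * (F w * phi w ^ (1:ℝ))) ∂sphMeasure :=
    Measurable.lintegral_prod_right' (f := fun q : R3 × S2 => ENNReal.ofReal (BO γ b (v, q) * (F q.1 * phi q.1 ^ (1:ℝ)))) (by fun_prop)
  calc _ = (∫⁻ w, ∫⁻ σ, ENNReal.ofReal (BO γ b (v, w, σ) * (F w * phi w ^ (1:ℝ))) ∂sphMeasure) +
        ∫⁻ w, ∫⁻ σ, ENNReal.ofReal (BO γ b (v, w, σ) * (F (vOut v w σ) * F (vOutStar v w σ) * phi w)) ∂sphMeasure := by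
        rw [← lintegral_add_left m1]
        refine lintegral_congr fun w => ?_
        simp only [hsplit]
        rw [lintegral_add_left (by fun_prop)]
    _ ≤ 4 * Ib b * (ENNReal.ofReal (phi v ^ (γ/2)) * Mom 1 F + Mom (1 + γ/2) F) + 1800 * Ccv b * ((ENNReal.ofReal (1 + l ^ 2) * Mom 1 F + ENNReal.ofReal l⁻¹ * Mom (1 + γ/2) F) *
        ENNReal.ofReal (phi v) + Mom (1 + γ/2) F) := add_le_add (lint_loss hγ0 hγ2 hb hF v 1) (lint_gain hγ0 hγ2 hb hF v hl)
    _ ≤ 8 * Ib b * ((ENNReal.ofReal (1 + l ^ 2) * Mom 1 F + ENNReal.ofReal l⁻¹ * Mom (1 + γ/2) F) *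
        ENNReal.ofReal (phi v) + Mom (1 + γ/2) F) + 1800 * Ccv b * ((ENNReal.ofReal (1 + l ^ 2) * Mom 1 F + ENNReal.ofReal l⁻¹ * Mom (1 + γ/2) F) *
        ENNReal.ofReal (phi v) + Mom (1 + γ/2) F) := by
        gcongr ?_ + _
        have h48 : (4:ℝ≥0∞) ≤ 8 := by norm_num
        have hx : ENNReal.ofReal (phi v ^ (γ/2)) ≤ ENNReal.ofReal (phi v) := ENNReal.ofReal_le_ofReal (rpow_le_self' (by linarith) (one_le_phi v))
        have h1 : (1:ℝ≥0∞) ≤ ENNReal.ofReal (1 + l^2) := by rw [← ENNReal.ofReal_one]; exact ENNReal.ofReal_le_ofReal (by nlinarith)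
        refine mul_le_mul (by gcongr) (add_le_add_left ?_ _) (by positivity) (by positivity)
        calc ENNReal.ofReal (phi v ^ (γ/2)) * Mom 1 F ≤ ENNReal.ofReal (phi v) * (ENNReal.ofReal (1 + l^2) * Mom 1 F) := by
              gcongr
              calc Mom 1 F = 1 * Mom 1 F := (one_mul _).symm
                _ ≤ _ := by gcongr
          _ ≤ _ := by rw [mul_comm]; gcongr; exact le_self_add
    _ = _ := by rw [KJ]; ring

end BFD
end

noncomputable section
open MeasureTheory Real Set
open scoped RealInnerProductSpace ENNReal

namespace BFD
variable {γ : ℝ} {b : ℝ → ℝ}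

/-- weight-one estimate -/
lemma JL0 (hγ0 : 0 ≤ γ) (hγ2 : γ ≤ 2) (hb : GradCutoff b) {F : R3 → ℝ} (hF : UF F) (v : R3) :
    ∫⁻ w, ∫⁻ σ, ENNReal.ofReal (BO γ b (v, w, σ) * (F w + F (vOut v w σ) * F (vOutStar v w σ))) ∂sphMeasure ≤
      KJ b * (Mom 1 F * ENNReal.ofReal (phi v)) := by
  have hFm := hF.meas
  have hbm := hb.measurable
  have hφ := phi_pos v
  have hB := (CK_B (γ := γ) hb).meas
  have hsplit : ∀ w σ, ENNReal.ofReal (BO γ b (v, w, σ) * (F w + F (vOut v w σ) * F (vOutStar v w σ))) =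
      ENNReal.ofReal (BO γ b (v, w, σ) * (F w * phi w ^ (0:ℝ))) +
      ENNReal.ofReal (BO γ b (v, w, σ) * (F (vOut v w σ) * F (vOutStar v w σ))) := by
    intro w σ
    have := (CK_B (γ := γ) hb).nonneg (v, w, σ)
    have := hF.nonneg w; have := hF.nonneg (vOut v w σ); have := hF.nonneg (vOutStar v w σ); have := phi_pos w
    rw [← ENNReal.ofReal_add (by positivity) (by positivity), rpow_zero]; congr 1; ring
  have m1 : Measurable fun w => ∫⁻ σ, ENNReal.ofReal (BO γ b (v, w, σ) * (F w * phi w ^ (0:ℝ))) ∂sphMeasure :=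
    Measurable.lintegral_prod_right' (f := fun q : R3 × S2 => ENNReal.ofReal (BO γ b (v, q) * (F q.1 * phi q.1 ^ (0:ℝ)))) (by fun_prop)
  set G1 : R3 → ℝ≥0∞ := fun u => ENNReal.ofReal (24 * phi v * (F u * phi u)) with hG1
  have mG1 : Measurable G1 := by fun_prop
  have hgain : ∫⁻ w, ∫⁻ σ, ENNReal.ofReal (BO γ b (v, w, σ) * (F (vOut v w σ) * F (vOutStar v w σ))) ∂sphMeasure ≤
      2 * (Ccv b * ∫⁻ u, G1 u) := by
    calc _ ≤ ∫⁻ w, 2 * ∫⁻ σ, ENNReal.ofReal (b (cosAngle v w σ)) * ENNReal.ofReal (cA v w σ ^ 3) * G1 (vOutStar v w σ) ∂sphMeasure := by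
          refine lintegral_mono fun w => half_red v w (by fun_prop) ?_ ?_
          · intro σ
            rw [BO_sym hb, vOut_neg, vOutStar_neg, mul_comm (F (vOutStar v w σ))]
          · intro σ hc
            obtain ⟨g1, g2, g3, g4, g5⟩ := geo_facts v w σ hc
            have hu := phi_pos (vOutStar v w σ); have hu1 := one_le_phi (vOutStar v w σ); have hv1 := one_le_phi v
            have f1 := hF.nonneg (vOut v w σ); have f2 := hF.nonneg (vOutStar v w σ); have f1' := hF.le_one (vOut v w σ)
            have hbb := hb.nonneg (cosAngle v w σ); have hcc := cA_nonneg v w σ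
            simp only [hG1]
            rw [← ENNReal.ofReal_mul hbb, ← ENNReal.ofReal_mul (by positivity)]
            refine ENNReal.ofReal_le_ofReal ?_
            rw [BO, Bker, rpow_norm_eq]
            simp only
            have a1 := rpow_le_add (by linarith : 0 ≤ γ/2) (by linarith) hφ.le hu.le (by positivity) g2
            have a2 := rpow_le_self' (by linarith : γ/2 ≤ 1) hv1
            have a3 := rpow_le_self' (by linarith : γ/2 ≤ 1) hu1
            have a4 : (‖v - w‖ ^ 2) ^ (γ / 2) ≤ 8 * (phi v * phi (vOutStar v w σ)) := by nlinarith
            calc _ ≤ 8 * (phi v * phi (vOutStar v w σ)) * b (cosAngle v w σ) * (1 * F (vOutStar v w σ)) := by gcongr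
              _ = b (cosAngle v w σ) * 1 * (8 * phi v * (F (vOutStar v w σ) * phi (vOutStar v w σ))) := by ring
              _ ≤ b (cosAngle v w σ) * (3 * cA v w σ ^ 3) * (8 * phi v * (F (vOutStar v w σ) * phi (vOutStar v w σ))) := by gcongr
              _ = _ := by ring
      _ ≤ _ := by
          rw [lintegral_const_mul' _ _ (by simp)]
          gcongr
          exact cv_star hb v G1 mG1
  calc _ = (∫⁻ w, ∫⁻ σ, ENNReal.ofReal (BO γ b (v, w, σ) * (F w * phi w ^ (0:ℝ))) ∂sphMeasure) +
        ∫⁻ w, ∫⁻ σ, ENNReal.ofReal (BO γ b (v, w, σ) * (F (vOut v w σ) * F (vOutStar v w σ))) ∂sphMeasure := by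
        rw [← lintegral_add_left m1]
        refine lintegral_congr fun w => ?_
        simp only [hsplit]
        rw [lintegral_add_left (by fun_prop)]
    _ ≤ 4 * Ib b * (ENNReal.ofReal (phi v ^ (γ/2)) * Mom 0 F + Mom (0 + γ/2) F) + 2 * (Ccv b * ∫⁻ u, G1 u) :=
        add_le_add (lint_loss hγ0 hγ2 hb hF v 0) hgain
    _ ≤ 4 * Ib b * (ENNReal.ofReal (phi v) * Mom 1 F + ENNReal.ofReal (phi v) * Mom 1 F) + 2 * (Ccv b * (24 * ENNReal.ofReal (phi v) * Mom 1 F)) := by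
        have e1 : ∫⁻ u, G1 u = 24 * ENNReal.ofReal (phi v) * Mom 1 F := by
          rw [Mom_one, ← lintegral_const_mul _ (by fun_prop)]
          refine lintegral_congr fun u => ?_
          rw [hG1, show (24:ℝ≥0∞) = ENNReal.ofReal 24 by simp, ← ENNReal.ofReal_mul (by positivity), ← ENNReal.ofReal_mul (by positivity)]
        rw [e1]
        have hx : ENNReal.ofReal (phi v ^ (γ/2)) ≤ ENNReal.ofReal (phi v) := ENNReal.ofReal_le_ofReal (rpow_le_self' (by linarith) (one_le_phi v))
        have h1 : (1:ℝ≥0∞) ≤ ENNReal.ofReal (phi v) := by rw [← ENNReal.ofReal_one]; exact ENNReal.ofReal_le_ofReal (one_le_phi v)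
        have h2 : Mom (0 + γ/2) F ≤ ENNReal.ofReal (phi v) * Mom 1 F := by
          calc Mom (0 + γ/2) F ≤ Mom 1 F := Mom_mono (by linarith) hF.nonneg
            _ = 1 * Mom 1 F := (one_mul _).symm
            _ ≤ _ := by gcongr
        have h3 : Mom 0 F ≤ Mom 1 F := Mom_mono (by linarith) hF.nonneg
        gcongr
    _ = (48 * Ccv b + 8 * Ib b) * (Mom 1 F * ENNReal.ofReal (phi v)) := by ring
    _ ≤ _ := by
        unfold KJ
        have : (48:ℝ≥0∞) ≤ 1800 := by norm_num
        gcongr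

/-- The collision bracket. -/
def GG (f : R3 → ℝ) (p : Om) : ℝ :=
  f (Q2 p) * f (Q3 p) * (1 - f p.1) * (1 - f p.2.1) - f p.1 * f p.2.1 * (1 - f (Q2 p)) * (1 - f (Q3 p))

/-- Collision operator with kernel `k`. -/
def Qk (k : Om → ℝ) (f : R3 → ℝ) (v : R3) : ℝ := ∫ q, k (v, q) * GG f (v, q) ∂nu

lemma GG_T (f : R3 → ℝ) (p : Om) : GG f (Tm p) = - GG f p := by
  unfold GG; rw [Tm_Q2, Tm_Q3, Tm_fst, Tm_snd]; ring
lemma GG_S (f : R3 → ℝ) (p : Om) : GG f (Sm p) = GG f p := by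
  unfold GG; rw [Sm_Q2, Sm_Q3, Sm_fst, Sm_snd]; ring

lemma meas_GG {f : R3 → ℝ} (hf : Measurable f) : Measurable (GG f) := by unfold GG; fun_prop

lemma mul4_bd {a c d e : ℝ} (ha : 0 ≤ a) (hd0 : 0 ≤ d) (hd : d ≤ 1) (he0 : 0 ≤ e) (he : e ≤ 1) (hc : 0 ≤ c) :
    0 ≤ a * c * (1 - d) * (1 - e) ∧ a * c * (1 - d) * (1 - e) ≤ a * c := by
  have h1 : 0 ≤ a * c := mul_nonneg ha hc
  have h2 : 0 ≤ (1 - d) * (1 - e) := mul_nonneg (by linarith) (by linarith)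
  have h3 : (1 - d) * (1 - e) ≤ 1 := by nlinarith
  constructor
  · rw [mul_assoc]; exact mul_nonneg h1 h2
  · rw [mul_assoc]; nlinarith

lemma GG_abs_le {f : R3 → ℝ} (hf : UF f) (p : Om) : |GG f p| ≤ f (Q2 p) * f (Q3 p) + f p.1 * f p.2.1 := by
  have h1 := mul4_bd (hf.nonneg (Q2 p)) (hf.nonneg p.1) (hf.le_one p.1) (hf.nonneg p.2.1) (hf.le_one p.2.1) (hf.nonneg (Q3 p))
  have h2 := mul4_bd (hf.nonneg p.1) (hf.nonneg (Q2 p)) (hf.le_one _) (hf.nonneg (Q3 p)) (hf.le_one _) (hf.nonneg p.2.1)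
  unfold GG; rw [abs_le]; constructor <;> linarith

lemma GG_abs_le' {f : R3 → ℝ} (hf : UF f) (p : Om) : |GG f p| ≤ f p.2.1 + f (Q2 p) * f (Q3 p) := by
  have := GG_abs_le hf p
  nlinarith [hf.nonneg p.1, hf.le_one p.1, hf.nonneg p.2.1]

lemma meas_Qk {k : Om → ℝ} (hk : Measurable k) {f : R3 → ℝ} (hf : Measurable f) : Measurable (Qk k f) := by
  have h : StronglyMeasurable (fun p : R3 × (R3 × S2) => k p * GG f p) := (hk.mul (meas_GG hf)).stronglyMeasurable
  exact h.integral_prod_right'.measurable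

lemma lint_nu (H : R3 × S2 → ℝ≥0∞) (hH : Measurable H) :
    ∫⁻ q, H q ∂nu = ∫⁻ w, ∫⁻ σ, H (w, σ) ∂sphMeasure := lintegral_prod _ hH.aemeasurable

lemma lint_mu0' (H : Om → ℝ≥0∞) (hH : Measurable H) : ∫⁻ p, H p ∂mu0 = ∫⁻ v, ∫⁻ q, H (v, q) ∂nu :=
  lintegral_prod _ hH.aemeasurable

section fixedk
variable {k : Om → ℝ} (hγ0 : 0 ≤ γ) (hγ2 : γ ≤ 2) (hb : GradCutoff b) (hk : CK γ b k)
include hγ0 hγ2 hb hk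

/-- Absolute bound on the collision integrand, every `v`. -/
lemma lint_GG_le {f : R3 → ℝ} (hf : UF f) (v : R3) :
    ∫⁻ q, ENNReal.ofReal |k (v, q) * GG f (v, q)| ∂nu ≤ KJ b * (Mom 1 f * ENNReal.ofReal (phi v)) := by
  have hfm := hf.meas
  have hkm := hk.meas
  have := meas_GG hfm
  rw [lint_nu _ (by fun_prop)]
  refine le_trans (lintegral_mono fun w => lintegral_mono fun σ => ENNReal.ofReal_le_ofReal ?_) (JL0 hγ0 hγ2 hb hf v)
  rw [abs_mul, abs_of_nonneg (hk.nonneg _)]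
  have h1 := GG_abs_le' hf (v, w, σ)
  exact mul_le_mul (hk.le _) h1 (abs_nonneg _) ((CK_B hb).nonneg _)

lemma integrable_Q {f : R3 → ℝ} (hf : UF f) (hE : Mom 1 f < ⊤) (v : R3) :
    Integrable (fun q => k (v, q) * GG f (v, q)) nu := by
  have hfm := hf.meas
  have hkm := hk.meas
  have hG := meas_GG hfm
  refine ⟨Measurable.aestronglyMeasurable (by fun_prop), ?_⟩
  rw [hasFiniteIntegral_iff_norm]
  refine lt_of_le_of_lt (lint_GG_le hγ0 hγ2 hb hk hf v) ?_
  exact ENNReal.mul_lt_top (KJ_lt_top hb) (ENNReal.mul_lt_top hE ENNReal.ofReal_lt_top)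

lemma Qk_abs_le {f : R3 → ℝ} (hf : UF f) (v : R3) :
    ENNReal.ofReal |Qk k f v| ≤ KJ b * (Mom 1 f * ENNReal.ofReal (phi v)) := by
  refine le_trans ?_ (lint_GG_le hγ0 hγ2 hb hk hf v)
  rw [Qk, ← Real.norm_eq_abs, ofReal_norm]
  refine (enorm_integral_le_lintegral_enorm _).trans (le_of_eq ?_)
  refine lintegral_congr fun q => ?_
  rw [← Real.norm_eq_abs, ofReal_norm]

end fixedk

lemma QFD_eq_Qk (hγ0 : 0 ≤ γ) (hγ2 : γ ≤ 2) (hb : GradCutoff b) {f : R3 → ℝ} (hf : UF f) (hE : Mom 1 f < ⊤) (v : R3) :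
    QFD γ b f v = Qk (BO γ b) f v := by
  rw [Qk, integral_prod _ (integrable_Q hγ0 hγ2 hb (CK_B hb) hf hE v)]
  rfl

end BFD
end

noncomputable section
open MeasureTheory Real Set
open scoped RealInnerProductSpace ENNReal

namespace BFD
variable {γ : ℝ} {b : ℝ → ℝ}

lemma mp_integral {e : Om → Om} (he : MeasurePreserving e mu0 mu0) {F : Om → ℝ} (hF : AEStronglyMeasurable F mu0) :
    ∫ p, F (e p) ∂mu0 = ∫ p, F p ∂mu0 := by
  have h := integral_map (μ := mu0) he.measurable.aemeasurable (f := F) (by rw [he.map_eq]; exact hF)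
  rw [he.map_eq] at h; exact h.symm

lemma mp_integrable {e : Om → Om} (he : MeasurePreserving e mu0 mu0) {F : Om → ℝ} (hF : Integrable F mu0) :
    Integrable (fun p => F (e p)) mu0 := (he.integrable_comp hF.aestronglyMeasurable).2 hF

/-- Symmetrization. -/
lemma sym4 {G : Om → ℝ} {ψ : R3 → ℝ} (hT : ∀ p, G (Tm p) = - G p) (hS : ∀ p, G (Sm p) = G p)
    (hi : Integrable (fun p => G p * ψ p.1) mu0) :
    Integrable (fun p => G p * (ψ p.1 + ψ p.2.1 - ψ (Q2 p) - ψ (Q3 p))) mu0 ∧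
    ∫ p, G p * ψ p.1 ∂mu0 = (∫ p, G p * (ψ p.1 + ψ p.2.1 - ψ (Q2 p) - ψ (Q3 p)) ∂mu0) / 4 := by
  have i1 : Integrable (fun p => G p * ψ p.2.1) mu0 := by
    refine (mp_integrable Sm_mp hi).congr (ae_of_all _ fun p => ?_)
    simp only [hS, Sm_fst]
  have i2 : Integrable (fun p => G p * ψ (Q2 p)) mu0 := by
    refine (mp_integrable Tm_mp hi).neg.congr (ae_of_all _ fun p => ?_)
    simp only [Pi.neg_apply, hT, Tm_fst]; ring
  have i3 : Integrable (fun p => G p * ψ (Q3 p)) mu0 := by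
    refine (mp_integrable Tm_mp i1).neg.congr (ae_of_all _ fun p => ?_)
    simp only [Pi.neg_apply, hT, Tm_snd]; ring
  have e1 : ∫ p, G p * ψ p.2.1 ∂mu0 = ∫ p, G p * ψ p.1 ∂mu0 := by
    rw [← mp_integral Sm_mp hi.aestronglyMeasurable]
    refine integral_congr_ae (ae_of_all _ fun p => ?_)
    simp only [hS, Sm_fst]
  have e2 : ∫ p, G p * ψ (Q2 p) ∂mu0 = - ∫ p, G p * ψ p.1 ∂mu0 := by
    rw [← mp_integral Tm_mp hi.aestronglyMeasurable, ← integral_neg]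
    refine integral_congr_ae (ae_of_all _ fun p => ?_)
    simp only [hT, Tm_fst]; ring
  have e3 : ∫ p, G p * ψ (Q3 p) ∂mu0 = - ∫ p, G p * ψ p.1 ∂mu0 := by
    rw [← e1, ← mp_integral Tm_mp i1.aestronglyMeasurable, ← integral_neg]
    refine integral_congr_ae (ae_of_all _ fun p => ?_)
    simp only [hT, Tm_snd]; ring
  have hexp : (fun p => G p * (ψ p.1 + ψ p.2.1 - ψ (Q2 p) - ψ (Q3 p))) =
      fun p => G p * ψ p.1 + G p * ψ p.2.1 - G p * ψ (Q2 p) - G p * ψ (Q3 p) := by funext p; ring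
  rw [hexp]
  have i01 : Integrable (fun p => G p * ψ p.1 + G p * ψ p.2.1) mu0 := hi.add i1
  have i012 : Integrable (fun p => G p * ψ p.1 + G p * ψ p.2.1 - G p * ψ (Q2 p)) mu0 := i01.sub i2
  refine ⟨i012.sub i3, ?_⟩
  rw [integral_sub i012 i3, integral_sub i01 i2, integral_add hi i1, e1, e2, e3]
  ring

/-- bilinear control quantity -/
def Lbil (γ : ℝ) (b : ℝ → ℝ) (ω : R3 → ℝ) (f : R3 → ℝ) : ℝ≥0∞ :=
  ∫⁻ p, ENNReal.ofReal (BO γ b p * (f p.1 * f p.2.1 * ω p.1)) ∂mu0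

lemma Lbil_phi (hγ0 : 0 ≤ γ) (hγ2 : γ ≤ 2) (hb : GradCutoff b) {f : R3 → ℝ} (hf : UF f) (p : ℝ) (hp : 0 ≤ p) :
    Lbil γ b (fun v => phi v ^ p) f ≤ 8 * Ib b * (Mom 1 f * Mom (p + γ/2) f) := by
  have hfm := hf.meas
  have hB := (CK_B (γ := γ) hb).meas
  rw [Lbil, lint_mu0' _ (by fun_prop)]
  have h1 : ∀ v, ∫⁻ q, ENNReal.ofReal (BO γ b (v, q) * (f v * f q.1 * phi v ^ p)) ∂nu ≤
      ENNReal.ofReal (f v * phi v ^ p) * (4 * Ib b * (ENNReal.ofReal (phi v ^ (γ/2)) * Mom 0 f + Mom (0 + γ/2) f)) := by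
    intro v
    have hv := hf.nonneg v; have hφ := phi_pos v
    rw [lint_nu _ (by fun_prop)]
    refine le_trans (le_of_eq ?_) (mul_le_mul_right (lint_loss hγ0 hγ2 hb hf v 0) _)
    have m1 : Measurable fun w => ∫⁻ σ, ENNReal.ofReal (BO γ b (v, w, σ) * (f w * phi w ^ (0:ℝ))) ∂sphMeasure :=
      Measurable.lintegral_prod_right' (f := fun q : R3 × S2 => ENNReal.ofReal (BO γ b (v, q) * (f q.1 * phi q.1 ^ (0:ℝ)))) (by fun_prop)
    rw [← lintegral_const_mul _ m1]
    refine lintegral_congr fun w => ?_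
    rw [← lintegral_const_mul _ (by fun_prop)]
    refine lintegral_congr fun σ => ?_
    rw [← ENNReal.ofReal_mul (by positivity), rpow_zero]; congr 1; ring
  refine (lintegral_mono h1).trans ?_
  calc _ ≤ ∫⁻ v, (4 * Ib b * Mom 1 f) * (ENNReal.ofReal (f v * phi v ^ (p + γ/2)) + ENNReal.ofReal (f v * phi v ^ (p + γ/2))) := by
        refine lintegral_mono fun v => ?_
        have hv := hf.nonneg v; have hφ := phi_pos v
        have a1 : Mom 0 f ≤ Mom 1 f := Mom_mono (by linarith) hf.nonneg
        have a2 : Mom (0 + γ/2) f ≤ Mom 1 f := Mom_mono (by linarith) hf.nonneg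
        have a3 : ENNReal.ofReal (f v * phi v ^ (p + γ/2)) = ENNReal.ofReal (f v * phi v ^ p) * ENNReal.ofReal (phi v ^ (γ/2)) := by
          rw [← ENNReal.ofReal_mul (by positivity), rpow_add hφ]; congr 1; ring
        have a4 : ENNReal.ofReal (f v * phi v ^ p) ≤ ENNReal.ofReal (f v * phi v ^ (p + γ/2)) := by
          refine ENNReal.ofReal_le_ofReal (mul_le_mul_of_nonneg_left (rpow_le_rpow_of_exponent_le (one_le_phi v) (by linarith)) hv)
        calc _ ≤ ENNReal.ofReal (f v * phi v ^ p) * (4 * Ib b * (ENNReal.ofReal (phi v ^ (γ/2)) * Mom 1 f + Mom 1 f)) := by gcongr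
          _ = (4 * Ib b * Mom 1 f) * (ENNReal.ofReal (f v * phi v ^ p) * ENNReal.ofReal (phi v ^ (γ/2)) + ENNReal.ofReal (f v * phi v ^ p)) := by ring
          _ ≤ _ := by rw [← a3]; gcongr
    _ = _ := by
        rw [lintegral_const_mul _ (by fun_prop), lintegral_add_left (by fun_prop)]
        simp only [Mom]; ring

/-- Weights. -/
structure WT (ω : R3 → ℝ) : Prop where
  meas : Measurable ω
  nonneg : ∀ v, 0 ≤ ω v
  cons : ∀ p : Om, ω (Q2 p) + ω (Q3 p) = ω p.1 + ω p.2.1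

lemma WT_one : WT (fun _ => 1) := ⟨by fun_prop, fun _ => by norm_num, fun _ => rfl⟩
lemma WT_phi : WT phi := ⟨by fun_prop, fun v => (phi_pos v).le, fun p => by
  have := energy p; unfold phi; linarith⟩

section fixedk
variable {k : Om → ℝ} (hb : GradCutoff b) (hk : CK γ b k) {ω : R3 → ℝ} (hω : WT ω)
include hb hk hω

lemma lint_GG_mu0' {f : R3 → ℝ} (hf : UF f) :
    ∫⁻ p, ENNReal.ofReal (k p * (f (Q2 p) * f (Q3 p) + f p.1 * f p.2.1) * ω p.1) ∂mu0 ≤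
      3 * ∫⁻ p, ENNReal.ofReal (k p * (f p.1 * f p.2.1) * ω p.1) ∂mu0 := by
  have hfm := hf.meas; have hkm := hk.meas; have hωm := hω.meas
  have hB := (CK_B (γ := γ) hb).meas
  set H : Om → ℝ≥0∞ := fun p => ENNReal.ofReal (k p * (f p.1 * f p.2.1) * ω p.1) with hH
  have mH : Measurable H := by fun_prop
  have hpt : ∀ p, ENNReal.ofReal (k p * (f (Q2 p) * f (Q3 p) + f p.1 * f p.2.1) * ω p.1) ≤ H p + (H (Tm p) + H (Tm (Sm p))) := by
    intro p
    have h0 := hk.nonneg p; have a1 := hf.nonneg p.1; have a2 := hf.nonneg p.2.1; have a3 := hf.nonneg (Q2 p); have a4 := hf.nonneg (Q3 p)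
    have w1 := hω.nonneg p.1; have w2 := hω.nonneg p.2.1; have w3 := hω.nonneg (Q2 p); have w4 := hω.nonneg (Q3 p)
    simp only [hH, hk.T, hk.S, Tm_fst, Tm_snd, Sm_Q2, Sm_Q3]
    rw [← ENNReal.ofReal_add (by positivity) (by positivity), ← ENNReal.ofReal_add (by positivity) (by positivity)]
    refine ENNReal.ofReal_le_ofReal ?_
    have := hω.cons p
    have h5 : 0 ≤ k p * (f (Q2 p) * f (Q3 p)) * ω p.2.1 := by positivity
    have h6 : k p * (f (Q2 p) * f (Q3 p)) * ω (Q2 p) + k p * (f (Q2 p) * f (Q3 p)) * ω (Q3 p) =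
      k p * (f (Q2 p) * f (Q3 p)) * ω p.1 + k p * (f (Q2 p) * f (Q3 p)) * ω p.2.1 := by rw [← mul_add, this, mul_add]
    nlinarith
  refine (lintegral_mono hpt).trans ?_
  have mT : Measurable fun p => H (Tm p) := mH.comp meas_Tm
  rw [lintegral_add_left mH, lintegral_add_left mT, Tm_mp.lintegral_comp mH]
  have : ∫⁻ p, H (Tm (Sm p)) ∂mu0 = ∫⁻ p, H p ∂mu0 := by
    rw [Sm_mp.lintegral_comp (f := fun p => H (Tm p)) mT, Tm_mp.lintegral_comp mH]
  rw [this]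
  exact le_of_eq (by ring)

lemma lint_GG_mu0 {f : R3 → ℝ} (hf : UF f) :
    ∫⁻ p, ENNReal.ofReal (k p * (f (Q2 p) * f (Q3 p) + f p.1 * f p.2.1) * ω p.1) ∂mu0 ≤ 3 * Lbil γ b ω f := by
  refine (lint_GG_mu0' hb hk hω hf).trans (mul_le_mul_right (lintegral_mono fun p => ENNReal.ofReal_le_ofReal ?_) 3)
  rw [mul_assoc]
  exact mul_le_mul_of_nonneg_right (hk.le p) (mul_nonneg (mul_nonneg (hf.nonneg _) (hf.nonneg _)) (hω.nonneg _))

lemma integrable_GGψ {f : R3 → ℝ} (hf : UF f) (hL : Lbil γ b ω f < ⊤) {ψ : R3 → ℝ} (hψ : Measurable ψ) {C : ℝ}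
    (hψω : ∀ v, |ψ v| ≤ C * ω v) : Integrable (fun p => k p * GG f p * ψ p.1) mu0 := by
  have hkm := hk.meas
  have hG := meas_GG hf.meas
  refine ⟨Measurable.aestronglyMeasurable (by fun_prop), ?_⟩
  rw [hasFiniteIntegral_iff_norm]
  have : ∀ p, ENNReal.ofReal ‖k p * GG f p * ψ p.1‖ ≤ ENNReal.ofReal |C| * ENNReal.ofReal (k p * (f (Q2 p) * f (Q3 p) + f p.1 * f p.2.1) * ω p.1) := by
    intro p
    have h0 := hk.nonneg p; have a1 := hf.nonneg p.1; have a2 := hf.nonneg p.2.1; have a3 := hf.nonneg (Q2 p); have a4 := hf.nonneg (Q3 p)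
    have w1 := hω.nonneg p.1
    rw [← ENNReal.ofReal_mul (abs_nonneg _)]
    refine ENNReal.ofReal_le_ofReal ?_
    rw [Real.norm_eq_abs, abs_mul, abs_mul, abs_of_nonneg h0]
    calc _ ≤ k p * (f (Q2 p) * f (Q3 p) + f p.1 * f p.2.1) * (|C| * ω p.1) := by
          gcongr
          · exact GG_abs_le hf p
          · exact (hψω _).trans (mul_le_mul_of_nonneg_right (le_abs_self C) w1)
      _ = _ := by ring
  refine lt_of_le_of_lt (lintegral_mono this) ?_
  rw [lintegral_const_mul' _ _ ENNReal.ofReal_ne_top]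
  exact ENNReal.mul_lt_top ENNReal.ofReal_lt_top (lt_of_le_of_lt (lint_GG_mu0 hb hk hω hf) (ENNReal.mul_lt_top (by simp) hL))

lemma Qk_integral {f : R3 → ℝ} (hf : UF f) (hL : Lbil γ b ω f < ⊤) {ψ : R3 → ℝ} (hψ : Measurable ψ) {C : ℝ}
    (hψω : ∀ v, |ψ v| ≤ C * ω v) : Integrable (fun v => Qk k f v * ψ v) ∧
      ∫ v, Qk k f v * ψ v = ∫ p, k p * GG f p * ψ p.1 ∂mu0 := by
  have hi := integrable_GGψ hb hk hω hf hL hψ hψω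
  have h1 : ∀ v, ∫ q, k (v, q) * GG f (v, q) * ψ v ∂nu = Qk k f v * ψ v := fun v => integral_mul_const _ _
  constructor
  · refine (Integrable.integral_prod_left hi).congr (ae_of_all _ fun v => ?_)
    exact h1 v
  · rw [mu0, integral_prod _ hi]
    exact (integral_congr_ae (ae_of_all _ fun v => h1 v)).symm

/-- loss density of collisions. -/
def HL (k : Om → ℝ) (f : R3 → ℝ) (p : Om) : ℝ := k p * (f p.1 * f p.2.1 * (1 - f (Q2 p)) * (1 - f (Q3 p)))

/-- Weak form. -/
lemma weak_form {f : R3 → ℝ} (hf : UF f) (hL : Lbil γ b ω f < ⊤) {ψ : R3 → ℝ} (hψ : Measurable ψ) {C : ℝ}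
    (hψω : ∀ v, |ψ v| ≤ C * ω v) :
    Integrable (fun p => HL k f p * (ψ (Q2 p) + ψ (Q3 p) - ψ p.1 - ψ p.2.1)) mu0 ∧
    ∫ v, Qk k f v * ψ v = (∫ p, HL k f p * (ψ (Q2 p) + ψ (Q3 p) - ψ p.1 - ψ p.2.1) ∂mu0) / 2 := by
  have hfm := hf.meas; have hkm := hk.meas; have hωm := hω.meas
  set Ψ : Om → ℝ := fun p => ψ (Q2 p) + ψ (Q3 p) - ψ p.1 - ψ p.2.1 with hΨ
  have ΨT : ∀ p, Ψ (Tm p) = - Ψ p := by intro p; simp only [hΨ, Tm_Q2, Tm_Q3, Tm_fst, Tm_snd]; ring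
  have hi : Integrable (fun p => HL k f p * Ψ p) mu0 := by
    have hmaj : Integrable (fun p => 2 * |C| * (k p * (f (Q2 p) * f (Q3 p) + f p.1 * f p.2.1) * ω p.1) +
        2 * |C| * (k (Sm p) * (f (Q2 (Sm p)) * f (Q3 (Sm p)) + f (Sm p).1 * f (Sm p).2.1) * ω (Sm p).1)) mu0 := by
      have i1 : Integrable (fun p => k p * (f (Q2 p) * f (Q3 p) + f p.1 * f p.2.1) * ω p.1) mu0 := by
        refine ⟨Measurable.aestronglyMeasurable (by fun_prop), ?_⟩
        rw [hasFiniteIntegral_iff_norm]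
        refine lt_of_le_of_lt (le_trans (le_of_eq ?_) (lint_GG_mu0 hb hk hω hf)) (ENNReal.mul_lt_top (by simp) hL)
        refine lintegral_congr fun p => ?_
        have h0 := hk.nonneg p; have a1 := hf.nonneg p.1; have a2 := hf.nonneg p.2.1; have a3 := hf.nonneg (Q2 p); have a4 := hf.nonneg (Q3 p)
        have w1 := hω.nonneg p.1
        rw [Real.norm_of_nonneg (by positivity)]
      exact (i1.const_mul _).add ((mp_integrable Sm_mp i1).const_mul _)
    refine hmaj.mono' (Measurable.aestronglyMeasurable (by unfold HL; fun_prop)) (ae_of_all _ fun p => ?_)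
    have h0 := hk.nonneg p; have a1 := hf.nonneg p.1; have a2 := hf.nonneg p.2.1; have a3 := hf.nonneg (Q2 p); have a4 := hf.nonneg (Q3 p)
    have w1 := hω.nonneg p.1; have w2 := hω.nonneg p.2.1; have w3 := hω.nonneg (Q2 p); have w4 := hω.nonneg (Q3 p)
    have hC : ∀ v, |ψ v| ≤ |C| * ω v := fun v => (hψω v).trans (mul_le_mul_of_nonneg_right (le_abs_self C) (hω.nonneg v))
    simp only [hk.S, Sm_Q2, Sm_Q3, Sm_fst, Sm_snd]
    have h4 := mul4_bd a1 a3 (hf.le_one _) a4 (hf.le_one _) a2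
    have hΨb : |Ψ p| ≤ 2 * |C| * (ω p.1 + ω p.2.1) := by
      have e1 := abs_le.1 (hC (Q2 p)); have e2 := abs_le.1 (hC (Q3 p)); have e3 := abs_le.1 (hC p.1); have e4 := abs_le.1 (hC p.2.1)
      have hc := congrArg (fun x => |C| * x) (hω.cons p)
      simp only [mul_add] at hc
      rw [abs_le]; constructor <;> simp only [hΨ] <;> linarith [e1.1,e1.2,e2.1,e2.2,e3.1,e3.2,e4.1,e4.2]
    rw [Real.norm_eq_abs, HL, abs_mul, abs_mul, abs_of_nonneg h0, abs_of_nonneg h4.1]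
    calc _ ≤ k p * (f (Q2 p) * f (Q3 p) + f p.1 * f p.2.1) * (2 * |C| * (ω p.1 + ω p.2.1)) := by
          gcongr
          have : 0 ≤ f (Q2 p) * f (Q3 p) := by positivity
          linarith [h4.2]
      _ = _ := by ring
  refine ⟨hi, ?_⟩
  rw [(Qk_integral hb hk hω hf hL hψ hψω).2]
  have hs := (sym4 (G := fun p => k p * GG f p) (ψ := ψ) (fun p => by rw [hk.T, GG_T]; ring) (fun p => by rw [hk.S, GG_S])
    (integrable_GGψ hb hk hω hf hL hψ hψω)).2
  rw [hs]
  have hTi := mp_integrable Tm_mp hi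
  have e1 : (fun p => k p * GG f p * (ψ p.1 + ψ p.2.1 - ψ (Q2 p) - ψ (Q3 p))) =
      fun p => HL k f (Tm p) * Ψ (Tm p) + HL k f p * Ψ p := by
    funext p
    rw [ΨT]; simp only [HL, hk.T, Tm_Q2, Tm_Q3, Tm_fst, Tm_snd, GG, hΨ]; ring
  rw [e1, integral_add hTi hi, mp_integral Tm_mp hi.aestronglyMeasurable]; ring

end fixedk

/-- Scalar inequality behind the difference estimate. -/
lemma DL_scalar {f0 f1 f2 f3 g0 g1 g2 g3 F0 F1 F2 F3 s0 s1 s2 s3 w0 w1 w2 w3 : ℝ}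
    (hf0 : 0 ≤ f0 ∧ f0 ≤ 1) (hf1 : 0 ≤ f1 ∧ f1 ≤ 1) (hf2 : 0 ≤ f2 ∧ f2 ≤ 1)
    (hg1 : 0 ≤ g1 ∧ g1 ≤ 1) (hg2 : 0 ≤ g2 ∧ g2 ≤ 1) (hg3 : 0 ≤ g3 ∧ g3 ≤ 1)
    (hF0 : f0 ≤ F0) (hF1 : f1 ≤ F1) (hF2 : f2 ≤ F2) (hG1 : g1 ≤ F1) (hG2 : g2 ≤ F2) (hG3 : g3 ≤ F3)
    (hs0 : |s0| ≤ 1) (hs1 : |s1| ≤ 1) (hs2 : |s2| ≤ 1) (hs3 : |s3| ≤ 1)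
    (e0 : s0 * (f0 - g0) = |f0 - g0|) (e1 : s1 * (f1 - g1) = |f1 - g1|) (e2 : s2 * (f2 - g2) = |f2 - g2|) (e3 : s3 * (f3 - g3) = |f3 - g3|)
    (hw0 : 0 ≤ w0) (hw1 : 0 ≤ w1) (hw2 : 0 ≤ w2) (hw3 : 0 ≤ w3) (hc : w2 + w3 = w0 + w1) :
    ((f2 * f3 * (1 - f0) * (1 - f1) - f0 * f1 * (1 - f2) * (1 - f3)) - (g2 * g3 * (1 - g0) * (1 - g1) - g0 * g1 * (1 - g2) * (1 - g3)))
      * (s0 * w0 + s1 * w1 - s2 * w2 - s3 * w3) ≤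
    2 * ((F1 + F2 * F3) * |f0 - g0| * w1) + 2 * ((F0 + F2 * F3) * |f1 - g1| * w0) + 2 * ((F3 + F0 * F1) * |f2 - g2| * w3)
      + 2 * ((F2 + F0 * F1) * |f3 - g3| * w2) := by
  have gen : ∀ {c C h s x y z t p q r : ℝ}, 0 ≤ c → c ≤ C → s * h = |h| → |p| ≤ 1 → |q| ≤ 1 → |r| ≤ 1 → 0 ≤ x → 0 ≤ y → 0 ≤ z → 0 ≤ t →
      y + z + t - x = 2 * y → -(c * h) * (s * x + p * y + q * z + r * t) ≤ 2 * (C * |h| * y) := by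
    intro c C h s x y z t p q r hc0 hcC hsh hp hq hr hx hy hz ht hxy
    have aux : ∀ {p y : ℝ}, |p| ≤ 1 → 0 ≤ y → -(h * (p * y)) ≤ |h| * y := by
      intro p y hp hy
      calc -(h * (p * y)) ≤ |h * (p * y)| := neg_le_abs _
        _ = |h| * (|p| * y) := by rw [abs_mul, abs_mul, abs_of_nonneg hy]
        _ ≤ |h| * (1 * y) := by gcongr
        _ = _ := by ring
    have h1 := aux hp hy; have h2 := aux hq hz; have h3 := aux hr ht
    have h4 : -(h * (s * x + p * y + q * z + r * t)) ≤ 2 * (|h| * y) := by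
      have : h * (s * x) = |h| * x := by rw [← hsh]; ring
      have h5 : |h| * (y + z + t - x) = |h| * (2 * y) := by rw [hxy]
      have h6 : |h| * y + |h| * z + |h| * t - |h| * x = 2 * (|h| * y) := by linarith
      have h7 : h * (s * x + p * y + q * z + r * t) = h * (s * x) + h * (p * y) + h * (q * z) + h * (r * t) := by ring
      rw [h7]; linarith
    calc -(c * h) * (s * x + p * y + q * z + r * t) = c * (-(h * (s * x + p * y + q * z + r * t))) := by ring
      _ ≤ c * (2 * (|h| * y)) := by gcongr
      _ ≤ C * (2 * (|h| * y)) := by gcongr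
      _ = _ := by ring
  have bd : ∀ {a c d x y X A C : ℝ}, (0 ≤ a ∧ a ≤ 1) → (0 ≤ c ∧ c ≤ 1) → (0 ≤ d ∧ d ≤ 1) → a ≤ A → c ≤ C → d ≤ X →
      0 ≤ a * c * (1 - d) + d * (1 - a) * (1 - c) ∧ a * c * (1 - d) + d * (1 - a) * (1 - c) ≤ X + A * C := by
    rintro a c d x y X A C ⟨a0, a1⟩ ⟨c0, c1⟩ ⟨d0, d1⟩ hA hC hX
    have q1 : 0 ≤ a * c := mul_nonneg a0 c0
    have q2 : 0 ≤ (1 - a) * (1 - c) := mul_nonneg (by linarith) (by linarith)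
    have q3 : (1 - a) * (1 - c) ≤ 1 := mul_le_one₀ (by linarith) (by linarith) (by linarith)
    have q4 : a * c ≤ A * C := mul_le_mul hA hC c0 (by linarith)
    rw [mul_assoc d]
    have q5 : d * ((1 - a) * (1 - c)) ≤ d * 1 := mul_le_mul_of_nonneg_left q3 d0
    have q6 : a * c * (1 - d) ≤ a * c * 1 := mul_le_mul_of_nonneg_left (by linarith) q1
    have q7 := mul_nonneg q1 (by linarith : 0 ≤ 1 - d)
    have q8 := mul_nonneg d0 q2
    constructor <;> linarith
  have b0 := bd (x := 0) (y := 0) hg2 hg3 hg1 hG2 hG3 hG1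
  have b1 := bd (x := 0) (y := 0) hg2 hg3 hf0 hG2 hG3 hF0
  have b2 := bd (x := 0) (y := 0) hf0 hf1 hg3 hF0 hF1 hG3
  have b3 := bd (x := 0) (y := 0) hf0 hf1 hf2 hF0 hF1 hF2
  have n2 : |(-s2)| ≤ 1 := by rwa [abs_neg]
  have n3 : |(-s3)| ≤ 1 := by rwa [abs_neg]
  have n0 : |(-s0)| ≤ 1 := by rwa [abs_neg]
  have n1 : |(-s1)| ≤ 1 := by rwa [abs_neg]
  have k0 := gen b0.1 b0.2 e0 hs1 n2 n3 hw0 hw1 hw2 hw3 (by linarith)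
  have k1 := gen b1.1 b1.2 e1 hs0 n2 n3 hw1 hw0 hw2 hw3 (by linarith)
  have k2 := gen b2.1 b2.2 e2 hs3 n0 n1 hw2 hw3 hw0 hw1 (by linarith)
  have k3 := gen b3.1 b3.2 e3 hs2 n0 n1 hw3 hw2 hw0 hw1 (by linarith)
  have id : ((f2 * f3 * (1 - f0) * (1 - f1) - f0 * f1 * (1 - f2) * (1 - f3)) - (g2 * g3 * (1 - g0) * (1 - g1) - g0 * g1 * (1 - g2) * (1 - g3)))
      * (s0 * w0 + s1 * w1 - s2 * w2 - s3 * w3) =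
      -((g2 * g3 * (1 - g1) + g1 * (1 - g2) * (1 - g3)) * (f0 - g0)) * (s0 * w0 + s1 * w1 + -s2 * w2 + -s3 * w3) +
      -((g2 * g3 * (1 - f0) + f0 * (1 - g2) * (1 - g3)) * (f1 - g1)) * (s1 * w1 + s0 * w0 + -s2 * w2 + -s3 * w3) +
      -((f0 * f1 * (1 - g3) + g3 * (1 - f0) * (1 - f1)) * (f2 - g2)) * (s2 * w2 + s3 * w3 + -s0 * w0 + -s1 * w1) +
      -((f0 * f1 * (1 - f2) + f2 * (1 - f0) * (1 - f1)) * (f3 - g3)) * (s3 * w3 + s2 * w2 + -s0 * w0 + -s1 * w1) := by ring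
  rw [id]
  exact add_le_add (add_le_add (add_le_add k0 k1) k2) k3

end BFD
end

noncomputable section
open MeasureTheory Real Set
open scoped RealInnerProductSpace ENNReal

namespace BFD
variable {γ : ℝ} {b : ℝ → ℝ}

/-- Weighted and unweighted distances. -/
def Yp (h : R3 → ℝ) : ℝ≥0∞ := ∫⁻ v, ENNReal.ofReal (|h v| * phi v)
def Y0 (h : R3 → ℝ) : ℝ≥0∞ := ∫⁻ v, ENNReal.ofReal |h v|

lemma Y0_le_Yp (h : R3 → ℝ) : Y0 h ≤ Yp h :=
  lintegral_mono fun v => ENNReal.ofReal_le_ofReal (le_mul_of_one_le_right (abs_nonneg _) (one_le_phi v))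

lemma UF_max {f g : R3 → ℝ} (hf : UF f) (hg : UF g) : UF (fun v => max (f v) (g v)) :=
  ⟨hf.meas.max hg.meas, fun v => le_max_of_le_left (hf.nonneg v), fun v => max_le (hf.le_one v) (hg.le_one v)⟩

lemma Mom_max_le {f g : R3 → ℝ} (hf : UF f) (hg : UF g) (p : ℝ) : Mom p (fun v => max (f v) (g v)) ≤ Mom p f + Mom p g := by
  have := hf.meas; have := hg.meas
  rw [Mom, Mom, Mom, ← lintegral_add_left (by fun_prop)]
  refine lintegral_mono fun v => ?_
  have h1 := hf.nonneg v; have h2 := hg.nonneg v; have h3 := phi_pos v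
  rw [← ENNReal.ofReal_add (by positivity) (by positivity), ← add_mul]
  exact ENNReal.ofReal_le_ofReal (mul_le_mul_of_nonneg_right (max_le (by linarith) (by linarith)) (by positivity))

def HW (k : Om → ℝ) (F h ω : R3 → ℝ) (p : Om) : ℝ := k p * ((F p.2.1 + F (Q2 p) * F (Q3 p)) * |h p.1| * ω p.2.1)

section
variable {k : Om → ℝ} (hk : CK γ b k) {F h : R3 → ℝ} (hF : UF F) (hh : Measurable h) {ω : R3 → ℝ} (hω : WT ω)
include hk hF hh hω

lemma meas_HW : Measurable (HW k F h ω) := by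
  have := hk.meas; have := hF.meas; have := hω.meas
  unfold HW; fun_prop

lemma HW_nonneg (p : Om) : 0 ≤ HW k F h ω p := by
  have := hk.nonneg p; have := hF.nonneg p.2.1; have := hF.nonneg (Q2 p); have := hF.nonneg (Q3 p); have := hω.nonneg p.2.1
  unfold HW; positivity

lemma HW_fact (hb : GradCutoff b) : ∫⁻ p, ENNReal.ofReal (HW k F h ω p) ∂mu0 ≤
    ∫⁻ v, ENNReal.ofReal |h v| * ∫⁻ w, ∫⁻ σ, ENNReal.ofReal (BO γ b (v, w, σ) * ((F w + F (vOut v w σ) * F (vOutStar v w σ)) * ω w)) ∂sphMeasure := by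
  have hm := meas_HW hk hF hh hω
  have := hk.meas; have hFm := hF.meas; have hωm := hω.meas
  have hB := (CK_B (γ := γ) hb).meas
  rw [lint_mu0' _ (by fun_prop)]
  refine lintegral_mono fun v => ?_
  rw [lint_nu _ (by fun_prop)]
  have m1 : Measurable fun w => ∫⁻ σ, ENNReal.ofReal (BO γ b (v, w, σ) * ((F w + F (vOut v w σ) * F (vOutStar v w σ)) * ω w)) ∂sphMeasure :=
      Measurable.lintegral_prod_right' (f := fun q : R3 × S2 => ENNReal.ofReal (BO γ b (v, q) * ((F q.1 + F (vOut v q.1 q.2) * F (vOutStar v q.1 q.2)) * ω q.1))) (by fun_prop)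
  rw [← lintegral_const_mul _ m1]
  refine lintegral_mono fun w => ?_
  rw [← lintegral_const_mul _ (by fun_prop)]
  refine lintegral_mono fun σ => ?_
  rw [← ENNReal.ofReal_mul (abs_nonneg _)]
  refine ENNReal.ofReal_le_ofReal ?_
  have a1 := hF.nonneg w; have a2 := hF.nonneg (vOut v w σ); have a3 := hF.nonneg (vOutStar v w σ); have a4 := hω.nonneg w
  have := hk.le (v, w, σ)
  calc HW k F h ω (v, w, σ) = |h v| * (k (v, w, σ) * ((F w + F (vOut v w σ) * F (vOutStar v w σ)) * ω w)) := by
        unfold HW; simp only [Q2, Q3]; ring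
    _ ≤ _ := by gcongr
end

section
variable {k : Om → ℝ} (hγ0 : 0 ≤ γ) (hγ2 : γ ≤ 2) (hb : GradCutoff b) (hk : CK γ b k)
include hγ0 hγ2 hb hk

lemma HW_phi_le {F h : R3 → ℝ} (hF : UF F) (hh : Measurable h) {l : ℝ} (hl : 0 < l) :
    ∫⁻ p, ENNReal.ofReal (HW k F h phi p) ∂mu0 ≤
    KJ b * ((ENNReal.ofReal (1 + l ^ 2) * Mom 1 F + ENNReal.ofReal l⁻¹ * Mom (1 + γ/2) F) * Yp h + Mom (1 + γ/2) F * Y0 h) := by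
  refine (HW_fact hk hF hh WT_phi hb).trans ?_
  set c := ENNReal.ofReal (1 + l ^ 2) * Mom 1 F + ENNReal.ofReal l⁻¹ * Mom (1 + γ/2) F
  set N := Mom (1 + γ/2) F
  calc _ ≤ ∫⁻ v, ENNReal.ofReal |h v| * (KJ b * (c * ENNReal.ofReal (phi v) + N)) :=
        lintegral_mono fun v => mul_le_mul_right (JL hγ0 hγ2 hb hF v hl) _
    _ = ∫⁻ v, KJ b * (c * ENNReal.ofReal (|h v| * phi v) + N * ENNReal.ofReal |h v|) := by
        refine lintegral_congr fun v => ?_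
        rw [ENNReal.ofReal_mul (abs_nonneg _)]; ring
    _ = _ := by
        rw [lintegral_const_mul _ (by fun_prop), lintegral_add_left (by fun_prop), lintegral_const_mul _ (by fun_prop),
          lintegral_const_mul _ (by fun_prop)]; rfl

lemma HW_one_le {F h : R3 → ℝ} (hF : UF F) (hh : Measurable h) :
    ∫⁻ p, ENNReal.ofReal (HW k F h (fun _ => 1) p) ∂mu0 ≤ KJ b * (Mom 1 F * Yp h) := by
  refine (HW_fact hk hF hh WT_one hb).trans ?_
  simp only [mul_one]
  calc _ ≤ ∫⁻ v, ENNReal.ofReal |h v| * (KJ b * (Mom 1 F * ENNReal.ofReal (phi v))) :=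
        lintegral_mono fun v => mul_le_mul_right (JL0 hγ0 hγ2 hb hF v) _
    _ = ∫⁻ v, KJ b * (Mom 1 F * ENNReal.ofReal (|h v| * phi v)) := by
        refine lintegral_congr fun v => ?_
        rw [ENNReal.ofReal_mul (abs_nonneg _)]; ring
    _ = _ := by
        rw [lintegral_const_mul _ (by fun_prop), lintegral_const_mul _ (by fun_prop)]; rfl
end

lemma ofReal_int_le {α : Type*} [MeasurableSpace α] (μ : Measure α) (F : α → ℝ) :
    ENNReal.ofReal (∫ x, F x ∂μ) ≤ ∫⁻ x, ENNReal.ofReal (F x) ∂μ := by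
  by_cases hF : Integrable F μ
  · rw [integral_eq_lintegral_pos_part_sub_lintegral_neg_part hF]
    refine (ENNReal.ofReal_le_ofReal (sub_le_self _ ENNReal.toReal_nonneg)).trans ENNReal.ofReal_toReal_le
  · rw [integral_undef hF]; simp

lemma four_lint {H : Om → ℝ≥0∞} (mH : Measurable H) :
    ∫⁻ p, (H p + H (Sm p) + H (Tm p) + H (Sm (Tm p))) ∂mu0 = 4 * ∫⁻ p, H p ∂mu0 := by
  have mT : Measurable fun p => H (Tm p) := mH.comp meas_Tm
  have mS : Measurable fun p => H (Sm p) := mH.comp meas_Sm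
  have mST : Measurable fun p => H (Sm (Tm p)) := mS.comp meas_Tm
  have e : ∫⁻ p, H (Sm (Tm p)) ∂mu0 = ∫⁻ p, H p ∂mu0 := by
    rw [Tm_mp.lintegral_comp (f := fun p => H (Sm p)) mS, Sm_mp.lintegral_comp mH]
  rw [lintegral_add_right _ mST, lintegral_add_right _ mT, lintegral_add_right _ mS, e,
    Tm_mp.lintegral_comp mH, Sm_mp.lintegral_comp mH]; ring

/-- Scalar inequality, absolute version. -/
lemma DLabs_scalar {f0 f1 f2 f3 g0 g1 g2 g3 F0 F1 F2 F3 : ℝ}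
    (hf0 : 0 ≤ f0 ∧ f0 ≤ 1) (hf1 : 0 ≤ f1 ∧ f1 ≤ 1) (hf2 : 0 ≤ f2 ∧ f2 ≤ 1)
    (hg1 : 0 ≤ g1 ∧ g1 ≤ 1) (hg2 : 0 ≤ g2 ∧ g2 ≤ 1) (hg3 : 0 ≤ g3 ∧ g3 ≤ 1)
    (hF0 : f0 ≤ F0) (hF1 : f1 ≤ F1) (hF2 : f2 ≤ F2) (hG1 : g1 ≤ F1) (hG2 : g2 ≤ F2) (hG3 : g3 ≤ F3) :
    |(f2 * f3 * (1 - f0) * (1 - f1) - f0 * f1 * (1 - f2) * (1 - f3)) - (g2 * g3 * (1 - g0) * (1 - g1) - g0 * g1 * (1 - g2) * (1 - g3))|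
      ≤ (F1 + F2 * F3) * |f0 - g0| + (F0 + F2 * F3) * |f1 - g1| + (F3 + F0 * F1) * |f2 - g2| + (F2 + F0 * F1) * |f3 - g3| := by
  have bd : ∀ {a c d X A C : ℝ} (h : ℝ), (0 ≤ a ∧ a ≤ 1) → (0 ≤ c ∧ c ≤ 1) → (0 ≤ d ∧ d ≤ 1) → a ≤ A → c ≤ C → d ≤ X →
      |(a * c * (1 - d) + d * ((1 - a) * (1 - c))) * h| ≤ (X + A * C) * |h| := by
    rintro a c d X A C h ⟨a0, a1⟩ ⟨c0, c1⟩ ⟨d0, d1⟩ hA hC hX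
    have q1 : 0 ≤ a * c := mul_nonneg a0 c0
    have q2 : 0 ≤ (1 - a) * (1 - c) := mul_nonneg (by linarith) (by linarith)
    have q3 : (1 - a) * (1 - c) ≤ 1 := mul_le_one₀ (by linarith) (by linarith) (by linarith)
    have q4 : a * c ≤ A * C := mul_le_mul hA hC c0 (by linarith)
    have q5 : d * ((1 - a) * (1 - c)) ≤ d * 1 := mul_le_mul_of_nonneg_left q3 d0
    have q6 : a * c * (1 - d) ≤ a * c * 1 := mul_le_mul_of_nonneg_left (by linarith) q1
    have q7 := mul_nonneg q1 (by linarith : 0 ≤ 1 - d)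
    have q8 := mul_nonneg d0 q2
    rw [abs_mul, abs_of_nonneg (by linarith)]
    exact mul_le_mul_of_nonneg_right (by linarith) (abs_nonneg _)
  have b0 := bd (f0 - g0) hg2 hg3 hg1 hG2 hG3 hG1
  have b1 := bd (f1 - g1) hg2 hg3 hf0 hG2 hG3 hF0
  have b2 := bd (f2 - g2) hf0 hf1 hg3 hF0 hF1 hG3
  have b3 := bd (f3 - g3) hf0 hf1 hf2 hF0 hF1 hF2
  have id : ((f2 * f3 * (1 - f0) * (1 - f1) - f0 * f1 * (1 - f2) * (1 - f3)) - (g2 * g3 * (1 - g0) * (1 - g1) - g0 * g1 * (1 - g2) * (1 - g3))) =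
      (f0 * f1 * (1 - g3) + g3 * ((1 - f0) * (1 - f1))) * (f2 - g2) + (f0 * f1 * (1 - f2) + f2 * ((1 - f0) * (1 - f1))) * (f3 - g3)
      - (g2 * g3 * (1 - g1) + g1 * ((1 - g2) * (1 - g3))) * (f0 - g0) -
      (g2 * g3 * (1 - f0) + f0 * ((1 - g2) * (1 - g3))) * (f1 - g1) +
      ((f2 * f3 - g2 * g3) * 0) := by ring
  rw [id, mul_zero, add_zero]
  refine (abs_sub _ _).trans ?_
  have t1 := abs_sub ((f0 * f1 * (1 - g3) + g3 * ((1 - f0) * (1 - f1))) * (f2 - g2) + (f0 * f1 * (1 - f2) + f2 * ((1 - f0) * (1 - f1))) * (f3 - g3))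
    ((g2 * g3 * (1 - g1) + g1 * ((1 - g2) * (1 - g3))) * (f0 - g0))
  have t2 := abs_add_le ((f0 * f1 * (1 - g3) + g3 * ((1 - f0) * (1 - f1))) * (f2 - g2)) ((f0 * f1 * (1 - f2) + f2 * ((1 - f0) * (1 - f1))) * (f3 - g3))
  linarith

section
variable {k : Om → ℝ} (hγ0 : 0 ≤ γ) (hγ2 : γ ≤ 2) (hb : GradCutoff b) (hk : CK γ b k)
  {f g : R3 → ℝ} (hf : UF f) (hg : UF g)
include hγ0 hγ2 hb hk hf hg

/-- `L¹` Lipschitz estimate. -/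
lemma diff0_abs (hfE : Mom 1 f < ⊤) (hgE : Mom 1 g < ⊤) :
    ∫⁻ v, ENNReal.ofReal |Qk k f v - Qk k g v| ≤
      4 * (KJ b * (Mom 1 (fun v => max (f v) (g v)) * Yp (fun v => f v - g v))) := by
  have hfm := hf.meas; have hgm := hg.meas; have hkm := hk.meas
  have hGf := meas_GG hfm; have hGg := meas_GG hgm
  set F : R3 → ℝ := fun v => max (f v) (g v) with hFdef
  set h : R3 → ℝ := fun v => f v - g v with hhdef
  have hF : UF F := UF_max hf hg
  have hh : Measurable h := by fun_prop
  have mH : Measurable fun p => ENNReal.ofReal (HW k F h (fun _ => 1) p) := (meas_HW hk hF hh WT_one).ennreal_ofReal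
  have s1 : ∀ v, ENNReal.ofReal |Qk k f v - Qk k g v| ≤ ∫⁻ q, ENNReal.ofReal |k (v, q) * (GG f (v, q) - GG g (v, q))| ∂nu := by
    intro v
    rw [Qk, Qk, ← integral_sub (integrable_Q hγ0 hγ2 hb hk hf hfE v) (integrable_Q hγ0 hγ2 hb hk hg hgE v), ← Real.norm_eq_abs, ofReal_norm]
    refine (enorm_integral_le_lintegral_enorm _).trans (le_of_eq ?_)
    refine lintegral_congr fun q => ?_
    rw [← mul_sub, ← Real.norm_eq_abs, ofReal_norm]
  refine (lintegral_mono s1).trans ?_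
  rw [← lint_mu0' (fun p => ENNReal.ofReal |k p * (GG f p - GG g p)|) (by fun_prop)]
  refine le_trans ?_ (mul_le_mul_right (HW_one_le hγ0 hγ2 hb hk hF hh) 4)
  rw [← four_lint mH]
  refine lintegral_mono fun p => ?_
  have n := HW_nonneg hk hF hh WT_one
  rw [← ENNReal.ofReal_add (n _) (n _), ← ENNReal.ofReal_add (add_nonneg (n _) (n _)) (n _), ← ENNReal.ofReal_add (add_nonneg (add_nonneg (n _) (n _)) (n _)) (n _)]
  refine ENNReal.ofReal_le_ofReal ?_
  rw [abs_mul, abs_of_nonneg (hk.nonneg p)]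
  have bf : ∀ v, 0 ≤ f v ∧ f v ≤ 1 := fun v => ⟨hf.nonneg v, hf.le_one v⟩
  have bg : ∀ v, 0 ≤ g v ∧ g v ≤ 1 := fun v => ⟨hg.nonneg v, hg.le_one v⟩
  have lf : ∀ v, f v ≤ F v := fun v => le_max_left _ _
  have lg : ∀ v, g v ≤ F v := fun v => le_max_right _ _
  have key := DLabs_scalar (f3 := f (Q3 p)) (g0 := g p.1) (bf p.1) (bf p.2.1) (bf (Q2 p)) (bg p.2.1) (bg (Q2 p)) (bg (Q3 p))
    (lf p.1) (lf p.2.1) (lf (Q2 p)) (lg p.2.1) (lg (Q2 p)) (lg (Q3 p))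
  refine (mul_le_mul_of_nonneg_left key (hk.nonneg p)).trans (le_of_eq ?_)
  simp only [HW, hk.T, hk.S, Tm_fst, Tm_snd, Tm_Q2, Tm_Q3, Sm_fst, Sm_snd, Sm_Q2, Sm_Q3, hhdef]
  ring

/-- Signed weighted estimate. -/
lemma diff_phi (hfE : Mom (1 + γ/2) f < ⊤) (hgE : Mom (1 + γ/2) g < ⊤) {s : R3 → ℝ} (hs : Measurable s)
    (hs1 : ∀ v, |s v| ≤ 1) (hsh : ∀ v, s v * (f v - g v) = |f v - g v|) {l : ℝ} (hl : 0 < l) :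
    Integrable (fun v => (Qk k f v - Qk k g v) * (s v * phi v)) ∧
    ENNReal.ofReal (∫ v, (Qk k f v - Qk k g v) * (s v * phi v)) ≤
      2 * (KJ b * ((ENNReal.ofReal (1 + l ^ 2) * Mom 1 (fun v => max (f v) (g v)) + ENNReal.ofReal l⁻¹ * Mom (1 + γ/2) (fun v => max (f v) (g v))) *
        Yp (fun v => f v - g v) + Mom (1 + γ/2) (fun v => max (f v) (g v)) * Y0 (fun v => f v - g v))) := by
  have hfm := hf.meas; have hgm := hg.meas; have hkm := hk.meas
  have hGf := meas_GG hfm; have hGg := meas_GG hgm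
  set F : R3 → ℝ := fun v => max (f v) (g v) with hFdef
  set h : R3 → ℝ := fun v => f v - g v with hhdef
  have hF : UF F := UF_max hf hg
  have hh : Measurable h := by fun_prop
  have hψ : Measurable fun v => s v * phi v := by fun_prop
  have hψb : ∀ v, |s v * phi v| ≤ 1 * phi v := fun v => by
    rw [abs_mul, abs_of_pos (phi_pos v)]; exact mul_le_mul_of_nonneg_right (hs1 v) (phi_pos v).le
  have Lfin : ∀ {f : R3 → ℝ}, UF f → Mom (1 + γ/2) f < ⊤ → Lbil γ b phi f < ⊤ := by
    intro f hf hE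
    have := Lbil_phi hγ0 hγ2 hb hf 1 zero_le_one
    simp only [rpow_one] at this
    refine lt_of_le_of_lt this (ENNReal.mul_lt_top (ENNReal.mul_lt_top (by simp) (Ib_lt_top hb)) (ENNReal.mul_lt_top ?_ hE))
    exact lt_of_le_of_lt (Mom_mono (by linarith) hf.nonneg) hE
  have qf := Qk_integral hb hk WT_phi hf (Lfin hf hfE) hψ hψb
  have qg := Qk_integral hb hk WT_phi hg (Lfin hg hgE) hψ hψb
  have if' := integrable_GGψ hb hk WT_phi hf (Lfin hf hfE) hψ hψb
  have ig' := integrable_GGψ hb hk WT_phi hg (Lfin hg hgE) hψ hψb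
  have e1 : (fun v => (Qk k f v - Qk k g v) * (s v * phi v)) = fun v => Qk k f v * (s v * phi v) - Qk k g v * (s v * phi v) := by
    funext v; ring
  rw [e1]
  refine ⟨qf.1.sub qg.1, ?_⟩
  rw [integral_sub qf.1 qg.1, qf.2, qg.2, ← integral_sub if' ig']
  have hi : Integrable (fun p => (k p * (GG f p - GG g p)) * (s p.1 * phi p.1)) mu0 :=
    (if'.sub ig').congr (ae_of_all _ fun p => by simp only [Pi.sub_apply]; ring)
  have e2 : ∫ p, (k p * GG f p * (s p.1 * phi p.1) - k p * GG g p * (s p.1 * phi p.1)) ∂mu0 =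
      ∫ p, (k p * (GG f p - GG g p)) * (s p.1 * phi p.1) ∂mu0 := integral_congr_ae (ae_of_all _ fun p => by simp only; ring)
  rw [e2]
  have hsym := sym4 (G := fun p => k p * (GG f p - GG g p)) (ψ := fun v => s v * phi v)
    (fun p => by rw [hk.T, GG_T, GG_T]; ring) (fun p => by rw [hk.S, GG_S, GG_S]) hi
  rw [hsym.2]
  refine le_trans ?_ (mul_le_mul_right (HW_phi_le hγ0 hγ2 hb hk hF hh hl) 2)
  have mH : Measurable fun p => ENNReal.ofReal (HW k F h phi p) := (meas_HW hk hF hh WT_phi).ennreal_ofReal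
  have n := HW_nonneg hk hF hh WT_phi
  have key : ∀ p, ENNReal.ofReal (k p * (GG f p - GG g p) * (s p.1 * phi p.1 + s p.2.1 * phi p.2.1 - s (Q2 p) * phi (Q2 p) - s (Q3 p) * phi (Q3 p))) ≤
      2 * (ENNReal.ofReal (HW k F h phi p) + ENNReal.ofReal (HW k F h phi (Sm p)) + ENNReal.ofReal (HW k F h phi (Tm p)) + ENNReal.ofReal (HW k F h phi (Sm (Tm p)))) := by
    intro p
    rw [← ENNReal.ofReal_add (n _) (n _), ← ENNReal.ofReal_add (add_nonneg (n _) (n _)) (n _), ← ENNReal.ofReal_add (add_nonneg (add_nonneg (n _) (n _)) (n _)) (n _),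
      show (2:ℝ≥0∞) = ENNReal.ofReal 2 by simp, ← ENNReal.ofReal_mul (by norm_num)]
    refine ENNReal.ofReal_le_ofReal ?_
    have bf : ∀ v, 0 ≤ f v ∧ f v ≤ 1 := fun v => ⟨hf.nonneg v, hf.le_one v⟩
    have bg : ∀ v, 0 ≤ g v ∧ g v ≤ 1 := fun v => ⟨hg.nonneg v, hg.le_one v⟩
    have lf : ∀ v, f v ≤ F v := fun v => le_max_left _ _
    have lg : ∀ v, g v ≤ F v := fun v => le_max_right _ _
    have key := DL_scalar (f3 := f (Q3 p)) (g0 := g p.1) (bf p.1) (bf p.2.1) (bf (Q2 p)) (bg p.2.1) (bg (Q2 p)) (bg (Q3 p))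
      (lf p.1) (lf p.2.1) (lf (Q2 p)) (lg p.2.1) (lg (Q2 p)) (lg (Q3 p)) (hs1 p.1) (hs1 p.2.1) (hs1 (Q2 p)) (hs1 (Q3 p))
      (hsh _) (hsh _) (hsh _) (hsh _) (phi_pos p.1).le (phi_pos p.2.1).le (phi_pos (Q2 p)).le (phi_pos (Q3 p)).le (WT_phi.cons p)
    rw [mul_assoc]
    refine (mul_le_mul_of_nonneg_left key (hk.nonneg p)).trans (le_of_eq ?_)
    simp only [HW, hk.T, hk.S, Tm_fst, Tm_snd, Tm_Q2, Tm_Q3, Sm_fst, Sm_snd, Sm_Q2, Sm_Q3, hhdef]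
    ring
  have h1 : ENNReal.ofReal (∫ p, k p * (GG f p - GG g p) * (s p.1 * phi p.1 + s p.2.1 * phi p.2.1 - s (Q2 p) * phi (Q2 p) - s (Q3 p) * phi (Q3 p)) ∂mu0) ≤
      8 * ∫⁻ p, ENNReal.ofReal (HW k F h phi p) ∂mu0 := by
    refine (ofReal_int_le _ _).trans ((lintegral_mono key).trans (le_of_eq ?_))
    rw [lintegral_const_mul' _ _ (by simp), four_lint mH, ← mul_assoc]; norm_num
  rw [div_eq_inv_mul, ENNReal.ofReal_mul (by norm_num)]
  refine (mul_le_mul_right h1 _).trans (le_of_eq ?_)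
  rw [← mul_assoc]; congr 1
  rw [show (8:ℝ≥0∞) = ENNReal.ofReal 8 by simp, ← ENNReal.ofReal_mul (by norm_num), show (2:ℝ≥0∞) = ENNReal.ofReal 2 by simp]
  norm_num
end

/-- Kernel differences. -/
lemma CK_sub (hb : GradCutoff b) {k k' : Om → ℝ} (hk : CK γ b k) (hk' : CK γ b k') (hle : ∀ p, k' p ≤ k p) : CK γ b (fun p => k p - k' p) where
  meas := hk.meas.sub hk'.meas
  nonneg p := sub_nonneg.2 (hle p)
  le p := by have := hk.le p; have := hk'.nonneg p; linarith
  T p := by rw [hk.T, hk'.T]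
  S p := by rw [hk.S, hk'.S]
  R p := by rw [hk.R, hk'.R]

/-- Absolute weighted bound of `Qk`, high energy kernels. -/
lemma Qk_tail (hγ0 : 0 ≤ γ) (hγ2 : γ ≤ 2) (hb : GradCutoff b) {k : Om → ℝ} (hk : CK γ b k) {f : R3 → ℝ} (hf : UF f)
    {ρ : ℝ} (hρ : 0 < ρ) (hkρ : ∀ p : Om, ‖p.1‖ ^ 2 + ‖p.2.1‖ ^ 2 ≤ ρ → k p = 0) :
    Yp (Qk k f) ≤ ENNReal.ofReal (9 / ρ) * (8 * Ib b * (Mom 1 f * Mom (2 + γ/2) f)) := by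
  have hfm := hf.meas; have hkm := hk.meas
  have hG := meas_GG hfm
  have hB := (CK_B (γ := γ) hb).meas
  have s1 : ∀ v, ENNReal.ofReal (|Qk k f v| * phi v) ≤ ∫⁻ q, ENNReal.ofReal (k (v, q) * (f (Q2 (v, q)) * f (Q3 (v, q)) + f v * f q.1) * phi v) ∂nu := by
    intro v
    have hφ := phi_pos v
    have h0 : ENNReal.ofReal |Qk k f v| ≤ ∫⁻ q, ENNReal.ofReal (k (v, q) * (f (Q2 (v, q)) * f (Q3 (v, q)) + f v * f q.1)) ∂nu := by
      rw [Qk, ← Real.norm_eq_abs, ofReal_norm]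
      refine (enorm_integral_le_lintegral_enorm _).trans (lintegral_mono fun q => ?_)
      rw [← ofReal_norm, Real.norm_eq_abs, abs_mul, abs_of_nonneg (hk.nonneg _)]
      exact ENNReal.ofReal_le_ofReal (mul_le_mul_of_nonneg_left (GG_abs_le hf _) (hk.nonneg _))
    rw [ENNReal.ofReal_mul (abs_nonneg _)]
    refine (mul_le_mul_left h0 _).trans (le_of_eq ?_)
    rw [← lintegral_mul_const _ (by fun_prop)]
    refine lintegral_congr fun q => ?_
    rw [ENNReal.ofReal_mul' hφ.le]
  refine (lintegral_mono s1).trans ?_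
  rw [← lint_mu0' (fun p => ENNReal.ofReal (k p * (f (Q2 p) * f (Q3 p) + f p.1 * f p.2.1) * phi p.1)) (by fun_prop)]
  refine (lint_GG_mu0' hb hk WT_phi hf).trans ?_
  have e2 : Lbil γ b (fun v => phi v ^ (2:ℝ)) f = ∫⁻ p, ENNReal.ofReal (BO γ b p * (f p.1 * f p.2.1 * phi p.2.1 ^ (2:ℝ))) ∂mu0 := by
    rw [Lbil, ← Sm_mp.lintegral_comp (by fun_prop)]
    refine lintegral_congr fun p => ?_
    rw [(CK_B hb).S, Sm_fst, Sm_snd, mul_comm (f p.2.1)]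
  have pt : ∀ p : Om, ENNReal.ofReal (k p * (f p.1 * f p.2.1) * phi p.1) ≤ ENNReal.ofReal (1 / ρ) *
      (2 * ENNReal.ofReal (BO γ b p * (f p.1 * f p.2.1 * phi p.1 ^ (2:ℝ))) + ENNReal.ofReal (BO γ b p * (f p.1 * f p.2.1 * phi p.2.1 ^ (2:ℝ)))) := by
    intro p
    have h0 := hk.nonneg p; have a1 := hf.nonneg p.1; have a2 := hf.nonneg p.2.1
    have hB0 := (CK_B (γ := γ) hb).nonneg p
    have w1 := phi_pos p.1; have w2 := phi_pos p.2.1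
    rw [show (2:ℝ≥0∞) = ENNReal.ofReal 2 by simp, ← ENNReal.ofReal_mul (by norm_num), ← ENNReal.ofReal_add (by positivity) (by positivity), ← ENNReal.ofReal_mul (by positivity)]
    refine ENNReal.ofReal_le_ofReal ?_
    rw [rpow_two, rpow_two]
    by_cases hc : ‖p.1‖ ^ 2 + ‖p.2.1‖ ^ 2 ≤ ρ
    · rw [hkρ p hc]; simp only [zero_mul]; positivity
    · have hc' : ρ ≤ phi p.1 + phi p.2.1 := by unfold phi; linarith
      have : phi p.1 * ρ ≤ 2 * phi p.1 ^ 2 + phi p.2.1 ^ 2 := by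
        nlinarith [mul_le_mul_of_nonneg_left hc' w1.le, sq_nonneg (phi p.1 - phi p.2.1), sq_nonneg (phi p.1 + phi p.2.1)]
      have h3 : phi p.1 ≤ 1 / ρ * (2 * phi p.1 ^ 2 + phi p.2.1 ^ 2) := by
        rw [one_div, ← div_eq_inv_mul, le_div_iff₀ hρ]; exact this
      calc k p * (f p.1 * f p.2.1) * phi p.1 ≤ BO γ b p * (f p.1 * f p.2.1) * (1 / ρ * (2 * phi p.1 ^ 2 + phi p.2.1 ^ 2)) := by
            gcongr; exact hk.le p
        _ = _ := by ring
  refine (mul_le_mul_right (lintegral_mono pt) 3).trans ?_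
  rw [lintegral_const_mul' _ _ (by simp), lintegral_add_left (by fun_prop), lintegral_const_mul' _ _ (by simp), ← e2]
  change 3 * (ENNReal.ofReal (1 / ρ) * (2 * Lbil γ b (fun v => phi v ^ (2:ℝ)) f + Lbil γ b (fun v => phi v ^ (2:ℝ)) f)) ≤ _
  calc _ = (9 * ENNReal.ofReal (1 / ρ)) * Lbil γ b (fun v => phi v ^ (2:ℝ)) f := by ring
    _ = ENNReal.ofReal (9 / ρ) * Lbil γ b (fun v => phi v ^ (2:ℝ)) f := by
        rw [show (9:ℝ≥0∞) = ENNReal.ofReal 9 by simp, ← ENNReal.ofReal_mul (by norm_num)]; congr 2; ring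
    _ ≤ _ := by gcongr; exact Lbil_phi hγ0 hγ2 hb hf 2 (by norm_num)

end BFD
end

noncomputable section
open MeasureTheory Real Set
open scoped RealInnerProductSpace ENNReal NNReal Topology

namespace BFD
variable {γ : ℝ} {b : ℝ → ℝ}

/-- sign function -/
def sgn (x : ℝ) : ℝ := if 0 < x then 1 else if x < 0 then -1 else 0

@[fun_prop] lemma meas_sgn : Measurable sgn :=
  Measurable.ite (measurableSet_lt measurable_const measurable_id) measurable_const
    (Measurable.ite (measurableSet_lt measurable_id measurable_const) measurable_const measurable_const)

lemma sgn_abs_le (x : ℝ) : |sgn x| ≤ 1 := by unfold sgn; split_ifs <;> simp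
lemma sgn_mul (x : ℝ) : sgn x * x = |x| := by
  unfold sgn; split_ifs with h1 h2
  · rw [abs_of_pos h1, one_mul]
  · rw [abs_of_neg h2]; ring
  · have : x = 0 := le_antisymm (not_lt.1 h1) (not_lt.1 h2); simp [this]

lemma ii_of_bdd {d : ℝ → ℝ} (hd : Measurable d) {M a t : ℝ} (hM : ∀ τ ∈ Icc a t, |d τ| ≤ M) (hat : a ≤ t) :
    IntervalIntegrable d volume a t := by
  rw [intervalIntegrable_iff_integrableOn_Icc_of_le hat]
  exact Measure.integrableOn_of_bounded (M := M) (by simp) hd.aestronglyMeasurable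
    ((ae_restrict_iff' measurableSet_Icc).2 (ae_of_all _ fun x hx => by simpa using hM x hx))

/-- Derivative of the absolute value along an absolutely continuous function. -/
lemma abs_lemma {d : ℝ → ℝ} (hd : Measurable d) {M a t h0 : ℝ} (hM : ∀ τ ∈ Icc a t, |d τ| ≤ M) (hat : a ≤ t) :
    |h0 + ∫ x in a..t, d x| = |h0| + ∫ τ in a..t, sgn (h0 + ∫ x in a..τ, d x) * d τ := by
  have hi := ii_of_bdd hd hM hat
  have hM0 : 0 ≤ M := (abs_nonneg _).trans (hM a ⟨le_rfl, hat⟩)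
  set h : ℝ → ℝ := fun τ => h0 + ∫ x in a..τ, d x with hh
  have hlip : LipschitzOnWith ⟨M, hM0⟩ (fun τ => |h τ|) (uIcc a t) := by
    refine LipschitzOnWith.of_dist_le_mul fun x hx y hy => ?_
    rw [uIcc_of_le hat] at hx hy
    have ix : IntervalIntegrable d volume a x := hi.mono_set (by rw [uIcc_of_le hat, uIcc_of_le hx.1]; exact Icc_subset_Icc_right hx.2)
    have iy : IntervalIntegrable d volume a y := hi.mono_set (by rw [uIcc_of_le hat, uIcc_of_le hy.1]; exact Icc_subset_Icc_right hy.2)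
    rw [Real.dist_eq, Real.dist_eq]
    refine (abs_abs_sub_abs_le_abs_sub _ _).trans ?_
    have : h x - h y = ∫ τ in y..x, d τ := by
      simp only [hh]; rw [add_sub_add_left_eq_sub, intervalIntegral.integral_interval_sub_left ix iy]
    rw [this, ← Real.norm_eq_abs, ← Real.norm_eq_abs]
    refine intervalIntegral.norm_integral_le_of_norm_le_const (f := d) (C := M) fun τ hτ => ?_
    rw [Real.norm_eq_abs]
    refine hM τ ?_
    have := uIoc_subset_uIcc hτ
    rcases le_total y x with hxy | hxy
    · rw [uIcc_of_le hxy] at this; exact ⟨hy.1.trans this.1, this.2.trans hx.2⟩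
    · rw [uIcc_of_ge hxy] at this; exact ⟨hx.1.trans this.1, this.2.trans hy.2⟩
  have hac := hlip.absolutelyContinuousOnInterval
  have e := hac.integral_deriv_eq_sub
  have h_a : h a = h0 := by simp [hh]
  have h1 : ∫ x in a..t, deriv (fun τ => |h τ|) x = ∫ x in a..t, sgn (h x) * d x := by
    refine intervalIntegral.integral_congr_ae ?_
    filter_upwards [hi.ae_hasDerivAt_integral] with x hx hxm
    have hd1 : HasDerivAt h (d x) x := (hx (uIoc_subset_uIcc hxm) a left_mem_uIcc).const_add h0
    rcases lt_trichotomy (h x) 0 with hn | hn | hn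
    · have ev : (fun τ => |h τ|) =ᶠ[𝓝 x] fun τ => - h τ := by
        filter_upwards [hd1.continuousAt.eventually (gt_mem_nhds hn)] with τ hτ; exact abs_of_neg hτ
      rw [ev.deriv_eq, hd1.fun_neg.deriv]; simp [sgn, hn, hn.le]
    · have : IsLocalMin (fun τ => |h τ|) x := Filter.Eventually.of_forall fun τ => by simp [hn]
      rw [this.deriv_eq_zero, hn]; simp [sgn]
    · have ev : (fun τ => |h τ|) =ᶠ[𝓝 x] h := by
        filter_upwards [hd1.continuousAt.eventually (lt_mem_nhds hn)] with τ hτ; exact abs_of_pos hτ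
      rw [ev.deriv_eq, hd1.deriv]; simp [sgn, hn]
  rw [h1] at e
  simp only [h_a] at e
  change |h t| = |h0| + ∫ x in a..t, sgn (h x) * d x
  rw [e]; ring

lemma meas_Qk_joint {k : Om → ℝ} (hk : Measurable k) {f : ℝ → R3 → ℝ} (hf : Measurable (fun p : ℝ × R3 => f p.1 p.2)) :
    Measurable (fun p : ℝ × R3 => Qk k (f p.1) p.2) := by
  have h1 : ∀ e : (ℝ × R3) × (R3 × S2) → R3, Measurable e → Measurable fun x : (ℝ × R3) × (R3 × S2) => f x.1.1 (e x) :=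
    fun e he => hf.comp (f := fun x : (ℝ × R3) × (R3 × S2) => (x.1.1, e x)) (by fun_prop)
  have h : StronglyMeasurable (fun x : (ℝ × R3) × (R3 × S2) => k (x.1.2, x.2) * GG (f x.1.1) (x.1.2, x.2)) := by
    refine Measurable.stronglyMeasurable (Measurable.mul (by fun_prop) ?_)
    unfold GG
    have a1 := h1 (fun x => Q2 (x.1.2, x.2)) (by fun_prop)
    have a2 := h1 (fun x => Q3 (x.1.2, x.2)) (by fun_prop)
    have a3 := h1 (fun x => x.1.2) (by fun_prop)
    have a4 := h1 (fun x => x.2.1) (by fun_prop)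
    exact ((((a1.mul a2).mul (measurable_const.sub a3)).mul (measurable_const.sub a4))).sub ((((a3.mul a4).mul (measurable_const.sub a1)).mul (measurable_const.sub a2)))
  exact h.integral_prod_right'.measurable

lemma meas_int0 {q : ℝ × R3 → ℝ} (hq : Measurable q) : Measurable fun p : ℝ × R3 => ∫ τ in (0:ℝ)..(max p.1 0), q (τ, p.2) := by
  have h : StronglyMeasurable (fun x : (ℝ × R3) × ℝ => (if 0 < x.2 ∧ x.2 ≤ max x.1.1 0 then q (x.2, x.1.2) else 0)) := by
    refine Measurable.stronglyMeasurable (Measurable.ite ?_ (by fun_prop) (by fun_prop))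
    exact (measurableSet_lt (f := fun _ => (0:ℝ)) (g := fun x : (ℝ × R3) × ℝ => x.2) (by fun_prop) (by fun_prop)).inter
      (measurableSet_le (f := fun x : (ℝ × R3) × ℝ => x.2) (g := fun x : (ℝ × R3) × ℝ => max x.1.1 0) (by fun_prop) (by fun_prop))
  have e := (h.integral_prod_right' (ν := volume)).measurable
  suffices hs : (fun p : ℝ × R3 => ∫ τ in (0:ℝ)..(max p.1 0), q (τ, p.2)) = fun p : ℝ × R3 => ∫ τ, (if 0 < τ ∧ τ ≤ max p.1 0 then q (τ, p.2) else 0) by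
    rw [hs]; exact e
  funext p
  rw [intervalIntegral.integral_of_le (le_max_right _ _), ← integral_indicator measurableSet_Ioc]
  refine integral_congr_ae (ae_of_all _ fun τ => ?_)
  simp [indicator, mem_Ioc]

/-- Collision invariants. -/
def CI : Set (R3 → ℝ) := {ψ | ψ = (fun _ => 1) ∨ ψ = (fun v => ‖v‖ ^ 2) ∨ ∃ i, ψ = fun v => v i}

lemma CI_meas {ψ : R3 → ℝ} (h : ψ ∈ CI) : Measurable ψ := by
  rcases h with rfl | rfl | ⟨i, rfl⟩ <;> fun_prop
lemma CI_le {ψ : R3 → ℝ} (h : ψ ∈ CI) (v : R3) : |ψ v| ≤ phi v := by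
  rcases h with rfl | rfl | ⟨i, rfl⟩
  · simp [one_le_phi]
  · rw [abs_of_nonneg (by positivity)]; unfold phi; linarith
  · have h1 : |v i| ≤ ‖v‖ := by simpa using PiLp.norm_apply_le v i
    unfold phi; nlinarith [sq_nonneg (‖v‖ - 1)]
lemma CI_cons {ψ : R3 → ℝ} (h : ψ ∈ CI) (p : Om) : ψ (Q2 p) + ψ (Q3 p) = ψ p.1 + ψ p.2.1 := by
  rcases h with rfl | rfl | ⟨i, rfl⟩
  · rfl
  · exact energy p
  · have := congrArg (fun x : R3 => x i) (out_add p); simpa using this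
lemma CI_one : (fun _ => 1) ∈ CI := Or.inl rfl
lemma CI_sq : (fun v : R3 => ‖v‖ ^ 2) ∈ CI := Or.inr (Or.inl rfl)

/-- Nice solutions. -/
structure NS (k : Om → ℝ) (f : ℝ → R3 → ℝ) : Prop where
  meas : Measurable (fun p : ℝ × R3 => f p.1 p.2)
  nonneg : ∀ t v, 0 ≤ f t v
  le_one : ∀ t v, f t v ≤ 1
  fin : ∀ t, 0 ≤ t → Mom 1 (f t) < ⊤
  cons : ∀ ψ ∈ CI, ∀ t, 0 ≤ t → ∫ v, f t v * ψ v = ∫ v, f 0 v * ψ v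
  mild : ∀ᵐ v, ∀ t, 0 ≤ t → f t v = f 0 v + ∫ τ in (0:ℝ)..t, Qk k (f τ) v

lemma int_of_Mom {f : R3 → ℝ} (hf : UF f) (hE : Mom 1 f < ⊤) {ψ : R3 → ℝ} (hψ : Measurable ψ) {C : ℝ} (hb : ∀ v, |ψ v| ≤ C * phi v) :
    Integrable fun v => f v * ψ v := by
  have hfm := hf.meas
  have h1 : Integrable fun v => C * (f v * phi v) := by
    refine Integrable.const_mul ⟨Measurable.aestronglyMeasurable (by fun_prop), ?_⟩ _
    rw [hasFiniteIntegral_iff_norm]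
    rw [Mom_one] at hE
    refine lt_of_eq_of_lt (lintegral_congr fun v => ?_) hE
    rw [Real.norm_of_nonneg (mul_nonneg (hf.nonneg v) (phi_pos v).le)]
  refine h1.mono' (Measurable.aestronglyMeasurable (by fun_prop)) (ae_of_all _ fun v => ?_)
  rw [Real.norm_eq_abs, abs_mul, abs_of_nonneg (hf.nonneg v)]
  nlinarith [mul_le_mul_of_nonneg_left (hb v) (hf.nonneg v)]

namespace NS
variable {k : Om → ℝ} {f : ℝ → R3 → ℝ}

lemma uf (h : NS k f) (t : ℝ) : UF (f t) := ⟨h.meas.comp (f := fun v : R3 => (t, v)) (by fun_prop), h.nonneg t, h.le_one t⟩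

lemma cons_phi (h : NS k f) {t : ℝ} (ht : 0 ≤ t) : ∫ v, f t v * phi v = ∫ v, f 0 v * phi v := by
  have e : ∀ s, 0 ≤ s → ∫ v, f s v * phi v = (∫ v, f s v * 1) + ∫ v, f s v * ‖v‖ ^ 2 := by
    intro s hs
    rw [← integral_add (int_of_Mom (h.uf s) (h.fin s hs) (C := 1) (CI_meas CI_one) fun v => by rw [one_mul]; exact CI_le CI_one v)
      (int_of_Mom (h.uf s) (h.fin s hs) (C := 1) (CI_meas CI_sq) fun v => by rw [one_mul]; exact CI_le CI_sq v)]
    refine integral_congr_ae (ae_of_all _ fun v => ?_)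
    simp only [phi]; ring
  rw [e t ht, e 0 le_rfl, h.cons _ CI_one t ht, h.cons _ CI_sq t ht]

lemma Mom_ofReal {f : R3 → ℝ} (hf : UF f) (hE : Mom 1 f < ⊤) : Mom 1 f = ENNReal.ofReal (∫ v, f v * phi v) := by
  rw [Mom_one, ← ofReal_integral_eq_lintegral_ofReal]
  · exact int_of_Mom hf hE (C := 1) meas_phi fun v => by rw [one_mul, abs_of_pos (phi_pos v)]
  · exact ae_of_all _ fun v => mul_nonneg (hf.nonneg v) (phi_pos v).le

lemma en (h : NS k f) {t : ℝ} (ht : 0 ≤ t) : Mom 1 (f t) = Mom 1 (f 0) := by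
  rw [Mom_ofReal (h.uf t) (h.fin t ht), Mom_ofReal (h.uf 0) (h.fin 0 le_rfl), h.cons_phi ht]

lemma Mom0_ofReal {f : R3 → ℝ} (hf : UF f) (hE : Mom 1 f < ⊤) : Mom 0 f = ENNReal.ofReal (∫ v, f v * 1) := by
  have hi : Integrable (fun v => f v * 1) := int_of_Mom hf hE (C := 1) (CI_meas CI_one) fun v => by rw [one_mul]; exact CI_le CI_one v
  simp only [mul_one] at hi ⊢
  rw [Mom_zero, ← ofReal_integral_eq_lintegral_ofReal hi]
  · exact ae_of_all _ fun v => by simpa using hf.nonneg v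

lemma mass (h : NS k f) {t : ℝ} (ht : 0 ≤ t) : Mom 0 (f t) = Mom 0 (f 0) := by
  rw [Mom0_ofReal (h.uf t) (h.fin t ht), Mom0_ofReal (h.uf 0) (h.fin 0 le_rfl), h.cons _ CI_one t ht]

lemma measQ (h : NS k f) (hk : CK γ b k) : Measurable (fun p : ℝ × R3 => Qk k (f p.1) p.2) := meas_Qk_joint hk.meas h.meas

lemma Qbd (h : NS k f) (hγ0 : 0 ≤ γ) (hγ2 : γ ≤ 2) (hb : GradCutoff b) (hk : CK γ b k) {t : ℝ} (ht : 0 ≤ t) (v : R3) :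
    |Qk k (f t) v| ≤ (KJ b * Mom 1 (f 0)).toReal * phi v := by
  have h1 := Qk_abs_le hγ0 hγ2 hb hk (h.uf t) v
  rw [h.en ht, ← mul_assoc] at h1
  have hfin : KJ b * Mom 1 (f 0) ≠ ⊤ := (ENNReal.mul_lt_top (KJ_lt_top hb) (h.fin 0 le_rfl)).ne
  have := ENNReal.toReal_mono (ENNReal.mul_ne_top hfin ENNReal.ofReal_ne_top) h1
  rwa [ENNReal.toReal_mul, ENNReal.toReal_ofReal (abs_nonneg _), ENNReal.toReal_ofReal (phi_pos v).le] at this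

lemma iiQ (h : NS k f) (hγ0 : 0 ≤ γ) (hγ2 : γ ≤ 2) (hb : GradCutoff b) (hk : CK γ b k) {s t : ℝ} (hs : 0 ≤ s) (ht : 0 ≤ t) (v : R3) :
    IntervalIntegrable (fun τ => Qk k (f τ) v) volume s t := by
  have hm : Measurable fun τ => Qk k (f τ) v := (h.measQ hk).comp (f := fun τ : ℝ => (τ, v)) (by fun_prop)
  have : ∀ {t : ℝ}, 0 ≤ t → IntervalIntegrable (fun τ => Qk k (f τ) v) volume 0 t := fun {t} ht =>
    ii_of_bdd hm (fun τ hτ => h.Qbd hγ0 hγ2 hb hk hτ.1 v) ht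
  exact (this hs).symm.trans (this ht)

lemma mild' (h : NS k f) (hγ0 : 0 ≤ γ) (hγ2 : γ ≤ 2) (hb : GradCutoff b) (hk : CK γ b k) :
    ∀ᵐ v, ∀ s t, 0 ≤ s → 0 ≤ t → f t v = f s v + ∫ τ in s..t, Qk k (f τ) v := by
  filter_upwards [h.mild] with v hv s t hs ht
  rw [hv t ht, hv s hs, add_assoc, intervalIntegral.integral_add_adjacent_intervals (h.iiQ hγ0 hγ2 hb hk le_rfl hs v) (h.iiQ hγ0 hγ2 hb hk hs ht v)]

/-- Time shift. -/
lemma shift (h : NS k f) (hγ0 : 0 ≤ γ) (hγ2 : γ ≤ 2) (hb : GradCutoff b) (hk : CK γ b k) {s : ℝ} (hs : 0 ≤ s) : NS k (fun t => f (s + t)) where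
  meas := h.meas.comp (f := fun p : ℝ × R3 => (s + p.1, p.2)) (by fun_prop)
  nonneg t := h.nonneg _
  le_one t := h.le_one _
  fin t ht := h.fin _ (by linarith)
  cons ψ hψ t ht := (h.cons ψ hψ (s + t) (by linarith)).trans (h.cons ψ hψ (s + 0) (by linarith)).symm
  mild := by
    filter_upwards [h.mild' hγ0 hγ2 hb hk] with v hv t ht
    rw [hv s (s + t) hs (by linarith), add_zero]
    congr 1
    rw [intervalIntegral.integral_comp_add_left (fun τ => Qk k (f τ) v), add_zero]

end NS

end BFD
end

noncomputable section
open MeasureTheory Real Set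
open scoped RealInnerProductSpace ENNReal NNReal Topology

namespace BFD
variable {γ : ℝ} {b : ℝ → ℝ}

def NN (γ : ℝ) (f g : ℝ → R3 → ℝ) (τ : ℝ) : ℝ≥0∞ := Mom (1 + γ/2) (f τ) + Mom (1 + γ/2) (g τ)
def EE (f g : ℝ → R3 → ℝ) : ℝ≥0∞ := Mom 1 (f 0) + Mom 1 (g 0)
def YY (f g : ℝ → R3 → ℝ) (τ : ℝ) : ℝ≥0∞ := Yp (fun v => f τ v - g τ v)
def YZ (f g : ℝ → R3 → ℝ) (τ : ℝ) : ℝ≥0∞ := Y0 (fun v => f τ v - g τ v)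

lemma YZ_le_YY (f g : ℝ → R3 → ℝ) (τ : ℝ) : YZ f g τ ≤ YY f g τ := Y0_le_Yp _

lemma Yp_add_le {f g : R3 → ℝ} (hf : Measurable f) : Yp (fun v => f v + g v) ≤ Yp f + Yp g := by
  rw [Yp, Yp, Yp, ← lintegral_add_left (by fun_prop)]
  refine lintegral_mono fun v => ?_
  have := phi_pos v
  rw [← ENNReal.ofReal_add (by positivity) (by positivity), ← add_mul]
  exact ENNReal.ofReal_le_ofReal (mul_le_mul_of_nonneg_right (abs_add_le _ _) this.le)

lemma Yp_sub_le {f g : R3 → ℝ} (hf : Measurable f) : Yp (fun v => f v - g v) ≤ Yp f + Yp g := by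
  have := Yp_add_le (g := fun v => - g v) hf
  simpa [Yp, sub_eq_add_neg] using this

lemma Y0_add_le {f g : R3 → ℝ} (hf : Measurable f) : Y0 (fun v => f v + g v) ≤ Y0 f + Y0 g := by
  rw [Y0, Y0, Y0, ← lintegral_add_left (by fun_prop)]
  refine lintegral_mono fun v => ?_
  rw [← ENNReal.ofReal_add (by positivity) (by positivity)]
  exact ENNReal.ofReal_le_ofReal (abs_add_le _ _)

lemma Yp_uf {f : R3 → ℝ} (hf : UF f) : Yp f = Mom 1 f := by
  rw [Mom_one, Yp]; refine lintegral_congr fun v => ?_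
  rw [abs_of_nonneg (hf.nonneg v)]

lemma Yp_comm (f g : R3 → ℝ) : Yp (fun v => f v - g v) = Yp (fun v => g v - f v) := by
  simp only [Yp, abs_sub_comm]

lemma Yp_tri {f g h : R3 → ℝ} (hf : Measurable f) (hg : Measurable g) : Yp (fun v => f v - h v) ≤ Yp (fun v => f v - g v) + Yp (fun v => g v - h v) := by
  have := Yp_add_le (f := fun v => f v - g v) (g := fun v => g v - h v) (by fun_prop)
  simpa using this

lemma YY_le_EE {k k' : Om → ℝ} {f g : ℝ → R3 → ℝ} (hf : NS k f) (hg : NS k' g) {t : ℝ} (ht : 0 ≤ t) : YY f g t ≤ EE f g := by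
  refine (Yp_sub_le (hf.uf t).meas).trans ?_
  rw [Yp_uf (hf.uf t), Yp_uf (hg.uf t), hf.en ht, hg.en ht]; rfl

lemma EE_lt_top {k k' : Om → ℝ} {f g : ℝ → R3 → ℝ} (hf : NS k f) (hg : NS k' g) : EE f g < ⊤ :=
  ENNReal.add_lt_top.2 ⟨hf.fin 0 le_rfl, hg.fin 0 le_rfl⟩

lemma meas_Mom {f : ℝ → R3 → ℝ} (hf : Measurable (fun p : ℝ × R3 => f p.1 p.2)) (p : ℝ) : Measurable fun τ => Mom p (f τ) := by
  have : Measurable (fun q : ℝ × R3 => ENNReal.ofReal (f q.1 q.2 * phi q.2 ^ p)) := by fun_prop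
  exact this.lintegral_prod_right'

lemma meas_NN {k k' : Om → ℝ} {f g : ℝ → R3 → ℝ} (hf : NS k f) (hg : NS k' g) : Measurable (NN γ f g) :=
  (meas_Mom hf.meas _).add (meas_Mom hg.meas _)

lemma meas_YY {k k' : Om → ℝ} {f g : ℝ → R3 → ℝ} (hf : NS k f) (hg : NS k' g) : Measurable (YY f g) := by
  have h1 := hf.meas; have h2 := hg.meas
  have : Measurable (fun q : ℝ × R3 => ENNReal.ofReal (|f q.1 q.2 - g q.1 q.2| * phi q.2)) := by fun_prop
  exact this.lintegral_prod_right'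

lemma meas_YZ {k k' : Om → ℝ} {f g : ℝ → R3 → ℝ} (hf : NS k f) (hg : NS k' g) : Measurable (YZ f g) := by
  have h1 := hf.meas; have h2 := hg.meas
  have : Measurable (fun q : ℝ × R3 => ENNReal.ofReal (|f q.1 q.2 - g q.1 q.2|)) := by fun_prop
  exact this.lintegral_prod_right'

lemma Qk_W (hb : GradCutoff b) {k : Om → ℝ} (hk : CK γ b k) {ω : R3 → ℝ} (hω : WT ω) {f : R3 → ℝ} (hf : UF f) :
    ∫⁻ v, ENNReal.ofReal (|Qk k f v| * ω v) ≤ 3 * Lbil γ b ω f := by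
  have hfm := hf.meas; have hkm := hk.meas; have hωm := hω.meas
  have s1 : ∀ v, ENNReal.ofReal (|Qk k f v| * ω v) ≤ ∫⁻ q, ENNReal.ofReal (k (v, q) * (f (Q2 (v, q)) * f (Q3 (v, q)) + f v * f q.1) * ω v) ∂nu := by
    intro v
    have h0 : ENNReal.ofReal |Qk k f v| ≤ ∫⁻ q, ENNReal.ofReal (k (v, q) * (f (Q2 (v, q)) * f (Q3 (v, q)) + f v * f q.1)) ∂nu := by
      rw [Qk, ← Real.norm_eq_abs, ofReal_norm]
      refine (enorm_integral_le_lintegral_enorm _).trans (lintegral_mono fun q => ?_)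
      rw [← ofReal_norm, Real.norm_eq_abs, abs_mul, abs_of_nonneg (hk.nonneg _)]
      exact ENNReal.ofReal_le_ofReal (mul_le_mul_of_nonneg_left (GG_abs_le hf _) (hk.nonneg _))
    rw [ENNReal.ofReal_mul (abs_nonneg _)]
    refine (mul_le_mul_left h0 _).trans (le_of_eq ?_)
    rw [← lintegral_mul_const _ (by fun_prop)]
    refine lintegral_congr fun q => ?_
    rw [ENNReal.ofReal_mul' (hω.nonneg v)]
  refine (lintegral_mono s1).trans ?_
  rw [← lint_mu0' (fun p => ENNReal.ofReal (k p * (f (Q2 p) * f (Q3 p) + f p.1 * f p.2.1) * ω p.1)) (by fun_prop)]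
  exact lint_GG_mu0 hb hk hω hf

lemma Lbil_phi1 (hγ0 : 0 ≤ γ) (hγ2 : γ ≤ 2) (hb : GradCutoff b) {f : R3 → ℝ} (hf : UF f) :
    Lbil γ b phi f ≤ 8 * Ib b * (Mom 1 f * Mom (1 + γ/2) f) := by
  have := Lbil_phi hγ0 hγ2 hb hf 1 (by norm_num)
  simpa using this

lemma Lbil_one (hγ0 : 0 ≤ γ) (hγ2 : γ ≤ 2) (hb : GradCutoff b) {f : R3 → ℝ} (hf : UF f) :
    Lbil γ b (fun _ => 1) f ≤ 8 * Ib b * (Mom 1 f * Mom 1 f) := by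
  have := Lbil_phi hγ0 hγ2 hb hf 0 le_rfl
  simp only [rpow_zero] at this
  refine this.trans ?_
  gcongr
  exact Mom_mono (by linarith) hf.nonneg

lemma Yp_Qk (hγ0 : 0 ≤ γ) (hγ2 : γ ≤ 2) (hb : GradCutoff b) {k : Om → ℝ} (hk : CK γ b k) {f : R3 → ℝ} (hf : UF f) :
    Yp (Qk k f) ≤ 24 * Ib b * (Mom 1 f * Mom (1 + γ/2) f) := by
  refine (Qk_W hb hk WT_phi hf).trans ((mul_le_mul_right (Lbil_phi1 hγ0 hγ2 hb hf) 3).trans (le_of_eq ?_))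
  ring

lemma Y0_Qk (hγ0 : 0 ≤ γ) (hγ2 : γ ≤ 2) (hb : GradCutoff b) {k : Om → ℝ} (hk : CK γ b k) {f : R3 → ℝ} (hf : UF f) :
    Y0 (Qk k f) ≤ 24 * Ib b * (Mom 1 f * Mom 1 f) := by
  have h := Qk_W hb hk WT_one hf
  simp only [mul_one] at h
  refine h.trans ((mul_le_mul_right (Lbil_one hγ0 hγ2 hb hf) 3).trans (le_of_eq ?_))
  ring

section
variable (hγ0 : 0 ≤ γ) (hγ2 : γ ≤ 2) (hb : GradCutoff b) {k k' : Om → ℝ} (hk : CK γ b k) (hk' : CK γ b k')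
  {f g : ℝ → R3 → ℝ} (hf : NS k f) (hg : NS k' g)
include hγ0 hγ2 hb hk hk' hf hg

lemma diff_time (δ t : ℝ) (hδ : 0 ≤ δ) (hδt : δ ≤ t) : ∀ᵐ v, f t v - g t v = (f δ v - g δ v) + ∫ τ in δ..t, (Qk k (f τ) v - Qk k' (g τ) v) := by
  filter_upwards [hf.mild' hγ0 hγ2 hb hk, hg.mild' hγ0 hγ2 hb hk'] with v h1 h2
  rw [h1 δ t hδ (hδ.trans hδt), h2 δ t hδ (hδ.trans hδt), intervalIntegral.integral_sub (hf.iiQ hγ0 hγ2 hb hk hδ (hδ.trans hδt) v) (hg.iiQ hγ0 hγ2 hb hk' hδ (hδ.trans hδt) v)]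
  ring

lemma abs_time {δ t : ℝ} (hδ : 0 ≤ δ) (hδt : δ ≤ t) : ∀ᵐ v, |f t v - g t v| = |f δ v - g δ v| +
    ∫ τ in Ioc δ t, sgn (f τ v - g τ v) * (Qk k (f τ) v - Qk k' (g τ) v) := by
  filter_upwards [hf.mild' hγ0 hγ2 hb hk, hg.mild' hγ0 hγ2 hb hk'] with v h1 h2
  have hd : Measurable fun τ => Qk k (f τ) v - Qk k' (g τ) v :=
    Measurable.sub ((hf.measQ hk).comp (f := fun τ : ℝ => (τ, v)) (by fun_prop)) ((hg.measQ hk').comp (f := fun τ : ℝ => (τ, v)) (by fun_prop))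
  have e : ∀ τ, δ ≤ τ → f τ v - g τ v = (f δ v - g δ v) + ∫ τ in δ..τ, (Qk k (f τ) v - Qk k' (g τ) v) := by
    intro t hδt
    rw [h1 δ t hδ (hδ.trans hδt), h2 δ t hδ (hδ.trans hδt), intervalIntegral.integral_sub (hf.iiQ hγ0 hγ2 hb hk hδ (hδ.trans hδt) v) (hg.iiQ hγ0 hγ2 hb hk' hδ (hδ.trans hδt) v)]
    ring
  have hM : ∀ τ ∈ Icc δ t, |Qk k (f τ) v - Qk k' (g τ) v| ≤ (KJ b * Mom 1 (f 0)).toReal * phi v + (KJ b * Mom 1 (g 0)).toReal * phi v := by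
    intro τ hτ
    exact (abs_sub _ _).trans (add_le_add (hf.Qbd hγ0 hγ2 hb hk (hδ.trans hτ.1) v) (hg.Qbd hγ0 hγ2 hb hk' (hδ.trans hτ.1) v))
  rw [e t hδt, abs_lemma hd hM hδt, intervalIntegral.integral_of_le hδt]
  congr 1
  refine setIntegral_congr_fun measurableSet_Ioc fun τ hτ => ?_
  simp only [e τ hτ.1.le]

lemma MI {δ t : ℝ} (hδ : 0 ≤ δ) (hδt : δ ≤ t) (hN : ∫⁻ τ in Ioc δ t, NN γ f g τ < ⊤) (l : ℝ → ℝ) (hl : ∀ τ ∈ Ioc δ t, 0 < l τ) :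
    YY f g t ≤ YY f g δ + ∫⁻ τ in Ioc δ t, (2 * (KJ b * ((ENNReal.ofReal (1 + l τ ^ 2) * EE f g + ENNReal.ofReal (l τ)⁻¹ * NN γ f g τ) * YY f g τ
      + NN γ f g τ * YZ f g τ)) + Yp (fun v => Qk k (g τ) v - Qk k' (g τ) v)) := by
  have mf := hf.meas; have mg := hg.meas
  have mQf := hf.measQ hk; have mQg := hg.measQ hk'
  have mQg' : Measurable (fun p : ℝ × R3 => Qk k (g p.1) p.2) := meas_Qk_joint hk.meas mg
  have hE := EE_lt_top hf hg
  set X : ℝ × R3 → ℝ := fun p => sgn (f p.1 p.2 - g p.1 p.2) * (Qk k (f p.1) p.2 - Qk k' (g p.1) p.2) * phi p.2 with hX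
  have mX : Measurable X := by fun_prop
  have iX : Integrable X ((volume.restrict (Ioc δ t)).prod volume) := by
    refine ⟨mX.aestronglyMeasurable, ?_⟩
    rw [hasFiniteIntegral_iff_norm, lintegral_prod _ (by fun_prop)]
    have : ∀ τ ∈ Ioc δ t, ∫⁻ v, ENNReal.ofReal ‖X (τ, v)‖ ≤ 24 * Ib b * EE f g * NN γ f g τ := by
      intro τ hτ
      have hτ0 : 0 ≤ τ := hδ.trans hτ.1.le
      calc _ ≤ Yp (fun v => Qk k (f τ) v - Qk k' (g τ) v) := by
            refine lintegral_mono fun v => ENNReal.ofReal_le_ofReal ?_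
            simp only [hX]
            rw [Real.norm_eq_abs, abs_mul, abs_mul, abs_of_pos (phi_pos v)]
            refine mul_le_mul_of_nonneg_right ?_ (phi_pos v).le
            exact mul_le_of_le_one_left (abs_nonneg _) (sgn_abs_le _)
        _ ≤ Yp (Qk k (f τ)) + Yp (Qk k' (g τ)) := Yp_sub_le (meas_Qk hk.meas (hf.uf τ).meas)
        _ ≤ 24 * Ib b * (Mom 1 (f τ) * Mom (1 + γ/2) (f τ)) + 24 * Ib b * (Mom 1 (g τ) * Mom (1 + γ/2) (g τ)) :=
            add_le_add (Yp_Qk hγ0 hγ2 hb hk (hf.uf τ)) (Yp_Qk hγ0 hγ2 hb hk' (hg.uf τ))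
        _ ≤ 24 * Ib b * (EE f g * Mom (1 + γ/2) (f τ)) + 24 * Ib b * (EE f g * Mom (1 + γ/2) (g τ)) := by
            rw [hf.en hτ0, hg.en hτ0]; gcongr
            · exact le_self_add
            · exact le_add_self
        _ = _ := by rw [NN]; ring
    refine (setLIntegral_mono' measurableSet_Ioc this).trans_lt ?_
    have hc : 24 * Ib b * EE f g < ⊤ := ENNReal.mul_lt_top (ENNReal.mul_lt_top (by simp) (Ib_lt_top hb)) hE
    rw [lintegral_const_mul' _ _ hc.ne]
    exact ENNReal.mul_lt_top hc hN
  have hh : ∀ s, 0 ≤ s → Integrable (fun v => |f s v - g s v| * phi v) ∧ YY f g s = ENNReal.ofReal (∫ v, |f s v - g s v| * phi v) := by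
    intro s hs
    have m1 := (hf.uf s).meas; have m2 := (hg.uf s).meas
    have i : Integrable (fun v => |f s v - g s v| * phi v) := by
      refine ⟨Measurable.aestronglyMeasurable (by fun_prop), ?_⟩
      rw [hasFiniteIntegral_iff_norm]
      refine lt_of_eq_of_lt (lintegral_congr fun v => ?_) ((YY_le_EE hf hg hs).trans_lt hE)
      rw [Real.norm_of_nonneg (mul_nonneg (abs_nonneg _) (phi_pos v).le)]
    exact ⟨i, (ofReal_integral_eq_lintegral_ofReal i (ae_of_all _ fun v => mul_nonneg (abs_nonneg _) (phi_pos v).le)).symm⟩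
  obtain ⟨i1, e1⟩ := hh t (hδ.trans hδt)
  obtain ⟨i2, e2⟩ := hh δ hδ
  have key : ∫ v, |f t v - g t v| * phi v = (∫ v, |f δ v - g δ v| * phi v) + ∫ τ in Ioc δ t, ∫ v, X (τ, v) := by
    rw [integral_integral_swap (f := fun τ v => X (τ, v)) iX, ← integral_add i2 iX.integral_prod_right]
    refine integral_congr_ae ?_
    filter_upwards [abs_time hγ0 hγ2 hb hk hk' hf hg hδ hδt] with v hv
    rw [hv, add_mul, ← integral_mul_const]
  rw [e1, key, e2]
  refine ENNReal.ofReal_add_le.trans (add_le_add le_rfl ((ofReal_int_le _ _).trans ?_))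
  have hNae : ∀ᵐ τ ∂(volume.restrict (Ioc δ t)), NN γ f g τ < ⊤ := ae_lt_top (meas_NN hf hg) hN.ne
  refine lintegral_mono_ae ?_
  filter_upwards [hNae, ae_restrict_mem measurableSet_Ioc] with τ hNτ hτ
  have hτ0 : 0 ≤ τ := hδ.trans hτ.1.le
  have uf := hf.uf τ; have ug := hg.uf τ
  have m1 := uf.meas; have m2 := ug.meas
  rw [NN, ENNReal.add_lt_top] at hNτ
  obtain ⟨j1, j2⟩ := diff_phi hγ0 hγ2 hb hk uf ug hNτ.1 hNτ.2 (s := fun v => sgn (f τ v - g τ v)) (by fun_prop) (fun v => sgn_abs_le _) (fun v => sgn_mul _) (hl τ hτ)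
  have mq : Measurable (Qk k (g τ)) := meas_Qk hk.meas m2
  have mq' : Measurable (Qk k' (g τ)) := meas_Qk hk'.meas m2
  have bY : Yp (fun v => Qk k (g τ) v - Qk k' (g τ) v) < ⊤ := by
    refine (Yp_sub_le mq).trans_lt (ENNReal.add_lt_top.2 ⟨(Yp_Qk hγ0 hγ2 hb hk ug).trans_lt ?_, (Yp_Qk hγ0 hγ2 hb hk' ug).trans_lt ?_⟩) <;>
    exact ENNReal.mul_lt_top (ENNReal.mul_lt_top (by simp) (Ib_lt_top hb)) (ENNReal.mul_lt_top (hg.fin τ hτ0) hNτ.2)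
  have j3 : Integrable fun v => (Qk k (g τ) v - Qk k' (g τ) v) * (sgn (f τ v - g τ v) * phi v) := by
    refine ⟨Measurable.aestronglyMeasurable (by fun_prop), ?_⟩
    rw [hasFiniteIntegral_iff_norm]
    refine (lintegral_mono fun v => ENNReal.ofReal_le_ofReal ?_).trans_lt bY
    rw [Real.norm_eq_abs, abs_mul, abs_mul, abs_of_pos (phi_pos v)]
    refine mul_le_mul_of_nonneg_left ?_ (abs_nonneg _)
    exact mul_le_of_le_one_left (phi_pos v).le (sgn_abs_le _)
  have e3 : ∫ v, X (τ, v) = (∫ v, (Qk k (f τ) v - Qk k (g τ) v) * (sgn (f τ v - g τ v) * phi v)) + ∫ v, (Qk k (g τ) v - Qk k' (g τ) v) * (sgn (f τ v - g τ v) * phi v) := by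
    rw [← integral_add j1 j3]
    refine integral_congr_ae (ae_of_all _ fun v => ?_)
    simp only [hX]; ring
  rw [e3]
  refine ENNReal.ofReal_add_le.trans (add_le_add (j2.trans ?_) ((ofReal_int_le _ _).trans ?_))
  · have hm1 : Mom 1 (fun v => max (f τ v) (g τ v)) ≤ EE f g := by
      refine (Mom_max_le uf ug 1).trans ?_
      rw [hf.en hτ0, hg.en hτ0]; rfl
    have hm2 : Mom (1 + γ/2) (fun v => max (f τ v) (g τ v)) ≤ NN γ f g τ := Mom_max_le uf ug _
    change 2 * (KJ b * ((_ * Mom 1 _ + _ * Mom (1 + γ/2) _) * YY f g τ + Mom (1+γ/2) _ * YZ f g τ)) ≤ _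
    gcongr
  · refine lintegral_mono fun v => ENNReal.ofReal_le_ofReal ((le_abs_self _).trans ?_)
    rw [abs_mul, abs_mul, abs_of_pos (phi_pos v)]
    refine mul_le_mul_of_nonneg_left ?_ (abs_nonneg _)
    exact mul_le_of_le_one_left (phi_pos v).le (sgn_abs_le _)

/-- Unweighted difference. -/
lemma M0I {δ t : ℝ} (hδ : 0 ≤ δ) (hδt : δ ≤ t) :
    YZ f g t ≤ YZ f g δ + ∫⁻ τ in Ioc δ t, Y0 (fun v => Qk k (f τ) v - Qk k' (g τ) v) := by
  have mf := hf.meas; have mg := hg.meas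
  have mQf := hf.measQ hk; have mQg := hg.measQ hk'
  have m1 := (hf.uf δ).meas; have m2 := (hg.uf δ).meas
  calc YZ f g t ≤ ∫⁻ v, (ENNReal.ofReal |f δ v - g δ v| + ∫⁻ τ in Ioc δ t, ENNReal.ofReal |Qk k (f τ) v - Qk k' (g τ) v|) := by
        refine lintegral_mono_ae ?_
        filter_upwards [abs_time hγ0 hγ2 hb hk hk' hf hg hδ hδt] with v hv
        rw [hv]
        refine ENNReal.ofReal_add_le.trans (add_le_add le_rfl ((ofReal_int_le _ _).trans (lintegral_mono fun τ => ENNReal.ofReal_le_ofReal ((le_abs_self _).trans ?_))))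
        rw [abs_mul]
        exact mul_le_of_le_one_left (abs_nonneg _) (sgn_abs_le _)
    _ = _ := by
        rw [lintegral_add_left (by fun_prop), lintegral_lintegral_swap (f := fun v τ => ENNReal.ofReal |Qk k (f τ) v - Qk k' (g τ) v|)]
        · rfl
        · exact Measurable.aemeasurable (by
            have a1 := mQf.comp measurable_swap; have a2 := mQg.comp measurable_swap
            exact ((a1.sub a2).abs).ennreal_ofReal)

end

end BFD
end

noncomputable section
open MeasureTheory Real Set Filter
open scoped RealInnerProductSpace ENNReal NNReal Topology

namespace BFD
variable {γ : ℝ} {b : ℝ → ℝ}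

lemma lint_exp {lam t : ℝ} (hl : 0 < lam) (ht : 0 ≤ t) : ∫⁻ τ in Ioc 0 t, ENNReal.ofReal (exp (lam * τ)) ≤ ENNReal.ofReal (exp (lam * t) / lam) := by
  rw [← ofReal_integral_eq_lintegral_ofReal]
  · refine ENNReal.ofReal_le_ofReal ?_
    rw [← intervalIntegral.integral_of_le ht, intervalIntegral.integral_comp_mul_left (fun x => exp x) hl.ne', integral_exp]
    simp only [smul_eq_mul, mul_zero, exp_zero]
    rw [div_eq_inv_mul]
    exact mul_le_mul_of_nonneg_left (by linarith) (by positivity)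
  · exact (Continuous.integrableOn_Icc (by fun_prop)).mono_set Ioc_subset_Icc_self
  · exact ae_of_all _ fun τ => (exp_pos _).le

lemma gronwall {y : ℝ → ℝ≥0∞} {a B : ℝ≥0∞} {C T : ℝ} (hC : 0 ≤ C) (hB : B < ⊤) (hy : ∀ t ∈ Icc 0 T, y t ≤ B)
    (h : ∀ t ∈ Icc 0 T, y t ≤ a + ENNReal.ofReal C * ∫⁻ τ in Ioc 0 t, y τ) :
    ∀ t ∈ Icc 0 T, y t ≤ 2 * a * ENNReal.ofReal (exp ((2 * C + 1) * t)) := by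
  set lam := 2 * C + 1 with hlam
  have hl : 0 < lam := by positivity
  set M : ℝ≥0∞ := ⨆ t ∈ Icc 0 T, y t * ENNReal.ofReal (exp (- (lam * t))) with hM
  have hMB : M ≤ B := iSup₂_le fun t ht => by
    refine (mul_le_mul' (hy t ht) (ENNReal.ofReal_le_ofReal (exp_le_one_iff.2 ?_))).trans (by simp)
    have := ht.1; nlinarith
  have hinv : ∀ t : ℝ, ENNReal.ofReal (exp (- (lam * t))) * ENNReal.ofReal (exp (lam * t)) = 1 := by
    intro t; rw [← ENNReal.ofReal_mul (exp_pos _).le, ← exp_add]; simp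
  have hyM : ∀ t ∈ Icc 0 T, y t ≤ M * ENNReal.ofReal (exp (lam * t)) := by
    intro t ht
    have : y t * ENNReal.ofReal (exp (- (lam * t))) ≤ M := le_iSup₂ (f := fun t (_ : t ∈ Icc 0 T) => y t * ENNReal.ofReal (exp (- (lam * t)))) t ht
    calc y t = (y t * ENNReal.ofReal (exp (- (lam * t)))) * ENNReal.ofReal (exp (lam * t)) := by rw [mul_assoc, hinv, mul_one]
      _ ≤ _ := by gcongr
  have hM2 : M ≤ a + M / 2 := by
    refine iSup₂_le fun t ht => ?_
    have h1 : ∫⁻ τ in Ioc 0 t, y τ ≤ M * ENNReal.ofReal (exp (lam * t) / lam) := by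
      refine (setLIntegral_mono' measurableSet_Ioc fun τ hτ => hyM τ ⟨hτ.1.le, hτ.2.trans ht.2⟩).trans ?_
      rw [lintegral_const_mul' _ _ (hMB.trans_lt hB).ne]
      exact mul_le_mul_right (lint_exp hl ht.1) _
    calc y t * ENNReal.ofReal (exp (- (lam * t))) ≤ (a + ENNReal.ofReal C * (M * ENNReal.ofReal (exp (lam * t) / lam))) * ENNReal.ofReal (exp (- (lam * t))) := by
          gcongr; exact (h t ht).trans (by gcongr)
      _ = a * ENNReal.ofReal (exp (- (lam * t))) + M * (ENNReal.ofReal C * ENNReal.ofReal (exp (lam * t) / lam) * ENNReal.ofReal (exp (- (lam * t)))) := by ring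
      _ ≤ a * 1 + M * 2⁻¹ := by
          gcongr
          · refine ENNReal.ofReal_le_one.2 (exp_le_one_iff.2 ?_)
            have := ht.1; nlinarith
          · rw [← ENNReal.ofReal_mul hC, ← ENNReal.ofReal_mul (by positivity), show (2⁻¹ : ℝ≥0∞) = ENNReal.ofReal 2⁻¹ by rw [ENNReal.ofReal_inv_of_pos (by norm_num)]; simp]
            refine ENNReal.ofReal_le_ofReal ?_
            rw [exp_neg]
            have := exp_pos (lam * t)
            rw [show C * (exp (lam * t) / lam) * (exp (lam * t))⁻¹ = C / lam by field_simp, div_le_iff₀ hl]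
            rw [hlam]; linarith
      _ = _ := by rw [mul_one, div_eq_mul_inv]
  have hM3 : M ≤ 2 * a := by
    have hMt : M / 2 ≠ ⊤ := (ENNReal.div_lt_top (hMB.trans_lt hB).ne (by norm_num)).ne
    have : M / 2 + M / 2 ≤ a + M / 2 := by rwa [ENNReal.add_halves]
    have h2 : M / 2 ≤ a := (ENNReal.add_le_add_iff_right hMt).1 this
    calc M = M / 2 + M / 2 := (ENNReal.add_halves _).symm
      _ ≤ a + a := add_le_add h2 h2
      _ = _ := (two_mul a).symm
  intro t ht
  exact (hyM t ht).trans (by gcongr)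

/-- abstract limit -/
lemma lim_exists {G : ℕ → ℝ → R3 → ℝ} (hm : ∀ n, Measurable (fun p : ℝ × R3 => G n p.1 p.2)) (h0 : ∀ n t v, 0 ≤ G n t v) (h1 : ∀ n t v, G n t v ≤ 1)
    (hC : ∀ T : ℝ, ∀ ε : ℝ≥0∞, 0 < ε → ∃ n0, ∀ n m, n0 ≤ n → n0 ≤ m → ∀ t ∈ Icc 0 T, YY (G n) (G m) t ≤ ε) :
    ∃ F : ℝ → R3 → ℝ, Measurable (fun p : ℝ × R3 => F p.1 p.2) ∧ (∀ t v, 0 ≤ F t v) ∧ (∀ t v, F t v ≤ 1) ∧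
      ∀ T : ℝ, ∀ ε : ℝ≥0∞, 0 < ε → ∃ n0, ∀ n, n0 ≤ n → ∀ t ∈ Icc 0 T, YY (G n) F t ≤ ε := by
  have hmt : ∀ n t, Measurable (G n t) := fun n t => (hm n).comp (f := fun v : R3 => (t, v)) (by fun_prop)
  choose N hN using fun j : ℕ => hC j ((1/2) ^ j) (ENNReal.pow_pos (by simp) _)
  let φ : ℕ → ℕ := fun j => (Finset.range (j+1)).sup N + j
  have hφ0 : ∀ i j, i ≤ j → N i ≤ φ j := fun i j hij =>
    (Finset.le_sup (f := N) (Finset.mem_range.2 (by omega))).trans (Nat.le_add_right _ _)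
  let F : ℝ → R3 → ℝ := fun t v => max 0 (min 1 (limsup (fun j => G (φ j) t v) atTop))
  have mF : Measurable (fun p : ℝ × R3 => F p.1 p.2) := by
    refine measurable_const.max (measurable_const.min ?_)
    exact Measurable.limsup fun j => hm (φ j)
  have hconv : ∀ t, 0 ≤ t → ∀ᵐ v, Tendsto (fun j => G (φ j) t v) atTop (𝓝 (F t v)) := by
    intro t ht
    obtain ⟨J, hJ⟩ := exists_nat_ge t
    have hs : ∫⁻ v, ∑' j, ENNReal.ofReal |G (φ (J + j)) t v - G (φ (J + (j + 1))) t v| < ⊤ := by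
      rw [lintegral_tsum fun j => by have := hmt (φ (J+j)) t; have := hmt (φ (J+(j+1))) t; exact Measurable.aemeasurable (by fun_prop)]
      have hle : ∀ j, ∫⁻ v, ENNReal.ofReal |G (φ (J + j)) t v - G (φ (J + (j + 1))) t v| ≤ (1/2) ^ j := by
        intro j
        refine (YZ_le_YY (G (φ (J+j))) (G (φ (J+(j+1)))) t).trans ?_
        refine (hN (J + j) _ _ (hφ0 _ _ le_rfl) (hφ0 _ _ (by omega)) t ⟨ht, hJ.trans (by exact_mod_cast Nat.le_add_right _ _)⟩).trans ?_
        exact pow_le_pow_right_of_le_one' (by simp) (by omega)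
      refine (ENNReal.tsum_le_tsum hle).trans_lt ?_
      rw [ENNReal.tsum_geometric]; simp
    have hae := ae_lt_top (Measurable.tsum fun j => by have := hmt (φ (J+j)) t; have := hmt (φ (J+(j+1))) t; fun_prop) hs.ne
    filter_upwards [hae] with v hv
    have hsum : Summable fun j => dist (G (φ (J + j)) t v) (G (φ (J + (j + 1))) t v) := by
      refine (ENNReal.summable_toReal hv.ne).congr fun j => ?_
      rw [ENNReal.toReal_ofReal (abs_nonneg _), Real.dist_eq]
    obtain ⟨x, hx⟩ := cauchySeq_tendsto_of_complete (cauchySeq_of_summable_dist hsum)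
    have hx' : Tendsto (fun j => G (φ j) t v) atTop (𝓝 x) := by
      rw [← tendsto_add_atTop_iff_nat J]
      simpa [add_comm] using hx
    have hx0 : 0 ≤ x := ge_of_tendsto' hx' fun j => h0 _ _ _
    have hx1 : x ≤ 1 := le_of_tendsto' hx' fun j => h1 _ _ _
    have : F t v = x := by simp only [F]; rw [hx'.limsup_eq, min_eq_right hx1, max_eq_right hx0]
    rw [this]; exact hx'
  refine ⟨F, mF, fun t v => le_max_left _ _, fun t v => max_le (by norm_num) (min_le_left _ _), fun T ε hε => ?_⟩
  obtain ⟨n0, hn0⟩ := hC T ε hε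
  refine ⟨n0, fun n hn t ht => ?_⟩
  have e : YY (G n) F t ≤ liminf (fun j => YY (G n) (G (φ j)) t) atTop := by
    have hm1 : ∀ j, Measurable fun v => ENNReal.ofReal (|G n t v - G (φ j) t v| * phi v) := fun j => by
      have := hmt n t; have := hmt (φ j) t; fun_prop
    refine le_trans (le_of_eq ?_) (lintegral_liminf_le hm1)
    refine lintegral_congr_ae ?_
    filter_upwards [hconv t ht.1] with v hv
    have : Tendsto (fun j => ENNReal.ofReal (|G n t v - G (φ j) t v| * phi v)) atTop (𝓝 (ENNReal.ofReal (|G n t v - F t v| * phi v))) :=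
      (ENNReal.continuous_ofReal.tendsto _).comp (((tendsto_const_nhds.sub hv).abs).mul_const _)
    exact this.liminf_eq.symm
  refine e.trans ?_
  refine liminf_le_of_frequently_le' (Eventually.frequently ?_)
  filter_upwards [eventually_ge_atTop n0] with j hj
  exact hn0 n (φ j) hn (hj.trans (Nat.le_add_left _ _)) t ht

lemma Y0_eq_zero {h : R3 → ℝ} (hm : Measurable h) (h0 : Y0 h = 0) : ∀ᵐ v, h v = 0 := by
  have := (lintegral_eq_zero_iff (by fun_prop)).1 h0
  filter_upwards [this] with v hv
  simpa using hv

lemma Qk_congr (hγ0 : 0 ≤ γ) (hγ2 : γ ≤ 2) (hb : GradCutoff b) {k : Om → ℝ} (hk : CK γ b k) {f g : R3 → ℝ} (hf : UF f) (hg : UF g)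
    (hfE : Mom 1 f < ⊤) (hgE : Mom 1 g < ⊤) (h : f =ᵐ[volume] g) : ∀ᵐ v, Qk k f v = Qk k g v := by
  have h1 := diff0_abs hγ0 hγ2 hb hk hf hg hfE hgE
  have h2 : Yp (fun v => f v - g v) = 0 := by
    rw [Yp, ← lintegral_zero (μ := (volume : Measure R3))]
    refine lintegral_congr_ae ?_
    filter_upwards [h] with v hv; simp [hv]
  rw [h2, mul_zero, mul_zero, mul_zero] at h1
  have := Y0_eq_zero (h := fun v => Qk k f v - Qk k g v) ((meas_Qk hk.meas hf.meas).sub (meas_Qk hk.meas hg.meas)) (le_antisymm h1 zero_le)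
  filter_upwards [this] with v hv
  linarith

/-- From a weakly formulated solution to a nice solution. -/
lemma NS_of_weak (hγ0 : 0 ≤ γ) (hγ2 : γ ≤ 2) (hb : GradCutoff b) {k : Om → ℝ} (hk : CK γ b k) {F : ℝ → R3 → ℝ}
    (hm : Measurable (fun p : ℝ × R3 => F p.1 p.2)) (h0 : ∀ t v, 0 ≤ F t v) (h1 : ∀ t v, F t v ≤ 1) {E0 : ℝ≥0∞} (hE0 : E0 < ⊤)
    (hE : ∀ t, 0 ≤ t → Mom 1 (F t) ≤ E0) (hcons : ∀ ψ ∈ CI, ∀ t, 0 ≤ t → ∫ v, F t v * ψ v = ∫ v, F 0 v * ψ v)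
    (hmild : ∀ t, 0 ≤ t → ∀ᵐ v, F t v = F 0 v + ∫ τ in (0:ℝ)..t, Qk k (F τ) v) :
    ∃ f, NS k f ∧ ∀ t, 0 ≤ t → f t =ᵐ[volume] F t := by
  have uF : ∀ t, UF (F t) := fun t => ⟨hm.comp (f := fun v : R3 => (t, v)) (by fun_prop), h0 t, h1 t⟩
  have mQ := meas_Qk_joint hk.meas hm
  set G : ℝ → R3 → ℝ := fun t v => F 0 v + ∫ τ in (0:ℝ)..(max t 0), Qk k (F τ) v with hG
  have mG : Measurable (fun p : ℝ × R3 => G p.1 p.2) := by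
    refine Measurable.add ((uF 0).meas.comp measurable_snd) ?_
    exact meas_int0 mQ
  set f : ℝ → R3 → ℝ := fun t v => max 0 (min 1 (G t v)) with hf
  have mf : Measurable (fun p : ℝ × R3 => f p.1 p.2) := measurable_const.max (measurable_const.min mG)
  have uf : ∀ t, UF (f t) := fun t => ⟨mf.comp (f := fun v : R3 => (t, v)) (by fun_prop), fun v => le_max_left _ _, fun v => max_le (by norm_num) (min_le_left _ _)⟩
  have hGF : ∀ t, 0 ≤ t → ∀ᵐ v, G t v = F t v := by
    intro t ht
    filter_upwards [hmild t ht] with v hv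
    simp only [hG, max_eq_left ht, hv]
  have hfF : ∀ t, 0 ≤ t → f t =ᵐ[volume] F t := by
    intro t ht
    filter_upwards [hGF t ht] with v hv
    simp only [hf, hv]; rw [min_eq_right (h1 t v), max_eq_right (h0 t v)]
  have hME : ∀ t, 0 ≤ t → Mom 1 (f t) = Mom 1 (F t) := fun t ht => lintegral_congr_ae (by filter_upwards [hfF t ht] with v hv; rw [hv])
  have hmv : ∀ v, Measurable fun τ => Qk k (F τ) v := fun v => mQ.comp (f := fun τ : ℝ => (τ, v)) (by fun_prop)
  have hbd : ∀ v t, 0 ≤ t → |Qk k (F t) v| ≤ (KJ b * E0).toReal * phi v := by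
    intro v t ht
    have a1 := (Qk_abs_le hγ0 hγ2 hb hk (uF t) v).trans (mul_le_mul_right (mul_le_mul_left (hE t ht) _) _)
    rw [← mul_assoc] at a1
    have hfin : KJ b * E0 ≠ ⊤ := (ENNReal.mul_lt_top (KJ_lt_top hb) hE0).ne
    have := ENNReal.toReal_mono (ENNReal.mul_ne_top hfin ENNReal.ofReal_ne_top) a1
    rwa [ENNReal.toReal_mul, ENNReal.toReal_ofReal (abs_nonneg _), ENNReal.toReal_ofReal (phi_pos v).le] at this
  have hcont : ∀ v, Continuous fun t => G t v := by
    intro v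
    have : ∀ t, IntervalIntegrable (fun τ => (Ici (0:ℝ)).indicator (fun τ => Qk k (F τ) v) τ) volume 0 t := by
      have hms : Measurable (fun τ => (Ici (0:ℝ)).indicator (fun τ => Qk k (F τ) v) τ) := (hmv v).indicator measurableSet_Ici
      have hbb : ∀ τ, |(Ici (0:ℝ)).indicator (fun τ => Qk k (F τ) v) τ| ≤ (KJ b * E0).toReal * phi v := by
        intro τ
        by_cases hτ : 0 ≤ τ
        · rw [indicator_of_mem (show τ ∈ Ici (0:ℝ) from hτ)]; exact hbd v τ hτ
        · rw [indicator_of_notMem (show τ ∉ Ici (0:ℝ) from hτ), abs_zero]; have := phi_pos v; positivity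
      intro t
      rcases le_total 0 t with ht | ht
      · exact ii_of_bdd hms (fun τ _ => hbb τ) ht
      · exact (ii_of_bdd hms (fun τ _ => hbb τ) ht).symm
    have hc := intervalIntegral.continuous_primitive (fun a c => (this a).symm.trans (this c)) 0
    have e : (fun t => G t v) = fun t => F 0 v + ∫ τ in (0:ℝ)..(max t 0), (Ici (0:ℝ)).indicator (fun τ => Qk k (F τ) v) τ := by
      funext t
      simp only [hG]; congr 1
      refine intervalIntegral.integral_congr fun τ hτ => ?_
      rw [uIcc_of_le (le_max_right _ _)] at hτ
      rw [indicator_of_mem (show τ ∈ Ici (0:ℝ) from hτ.1)]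
    rw [e]
    exact continuous_const.add (hc.comp (by fun_prop))
  have hGr : ∀ᵐ v, ∀ t, 0 ≤ t → G t v = f t v := by
    have : ∀ᵐ v, ∀ r : ℚ, 0 ≤ r → G r v = F r v := by
      rw [ae_all_iff]; intro r
      by_cases hr : 0 ≤ r
      · filter_upwards [hGF r (by exact_mod_cast hr)] with v hv _; exact hv
      · exact ae_of_all _ fun v h => absurd h hr
    filter_upwards [this] with v hv t ht
    have hmem : G t v ∈ Icc (0:ℝ) 1 := by
      have hcl : IsClosed {s : ℝ | G (max s 0) v ∈ Icc (0:ℝ) 1} := by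
        have : Continuous fun s => G (max s 0) v := (hcont v).comp (by fun_prop)
        exact isClosed_Icc.preimage this
      have hden : DenseRange ((↑) : ℚ → ℝ) := Rat.denseRange_cast
      have hsub : range ((↑) : ℚ → ℝ) ⊆ {s : ℝ | G (max s 0) v ∈ Icc (0:ℝ) 1} := by
        rintro _ ⟨r, rfl⟩
        have e : max (r:ℝ) 0 = ((max r 0 : ℚ) : ℝ) := by simp
        rw [mem_ofPred_eq, e, hv _ (le_max_right _ _)]
        exact ⟨h0 _ _, h1 _ _⟩
      have := hcl.closure_subset_iff.2 hsub (hden t)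
      simpa [max_eq_left ht] using this
    simp only [hf]; rw [min_eq_right hmem.2, max_eq_right hmem.1]
  have hQ : ∀ᵐ v, ∀ᵐ τ ∂(volume.restrict (Ici (0:ℝ))), Qk k (f τ) v = Qk k (F τ) v := by
    have mQf := meas_Qk_joint hk.meas mf
    refine (Measure.ae_ae_comm (p := fun τ v => Qk k (f τ) v = Qk k (F τ) v) (measurableSet_eq_fun mQf mQ)).1 ?_
    filter_upwards [ae_restrict_mem measurableSet_Ici] with τ hτ
    exact Qk_congr hγ0 hγ2 hb hk (uf τ) (uF τ) (by rw [hME τ hτ]; exact (hE τ hτ).trans_lt hE0) ((hE τ hτ).trans_lt hE0) (hfF τ hτ)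
  refine ⟨f, ⟨mf, fun t => (uf t).nonneg, fun t => (uf t).le_one, fun t ht => by rw [hME t ht]; exact (hE t ht).trans_lt hE0, ?_, ?_⟩, hfF⟩
  · intro ψ hψ t ht
    have e : ∀ s, 0 ≤ s → ∫ v, f s v * ψ v = ∫ v, F s v * ψ v := fun s hs => integral_congr_ae (by filter_upwards [hfF s hs] with v hv; rw [hv])
    rw [e t ht, e 0 le_rfl, hcons ψ hψ t ht]
  · filter_upwards [hGr, hQ] with v h2 h3 t ht
    rw [← h2 t ht, ← h2 0 le_rfl]
    simp only [hG, max_eq_left ht, max_self, intervalIntegral.integral_same, add_zero]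
    congr 1
    rw [intervalIntegral.integral_of_le ht, intervalIntegral.integral_of_le ht]
    refine integral_congr_ae ?_
    have : volume.restrict (Ioc 0 t) ≤ volume.restrict (Ici (0:ℝ)) := Measure.restrict_mono (fun x hx => hx.1.le) le_rfl
    have h4 : ∀ᵐ τ ∂(volume.restrict (Ioc 0 t)), Qk k (f τ) v = Qk k (F τ) v := ae_mono this h3
    exact h4.mono fun τ hτ => hτ.symm

end BFD
end

noncomputable section
open MeasureTheory Real Set Filter
open scoped RealInnerProductSpace ENNReal NNReal Topology

namespace BFD
variable {γ : ℝ} {b : ℝ → ℝ}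

lemma zero_of_eps {x C : ℝ≥0∞} (hC : C < ⊤) (h : ∀ ε : ℝ≥0∞, 0 < ε → ε < ⊤ → x ≤ ε * C) : x = 0 := by
  have h1 : Tendsto (fun n : ℕ => ((n:ℝ≥0∞)⁻¹ * C)) atTop (𝓝 (0 * C)) :=
    ENNReal.Tendsto.mul_const ENNReal.tendsto_inv_nat_nhds_zero (Or.inr hC.ne)
  rw [zero_mul] at h1
  refine le_antisymm (ge_of_tendsto h1 ?_) zero_le
  filter_upwards [eventually_gt_atTop 0] with n hn
  refine h _ (ENNReal.inv_pos.2 (by simp)) (ENNReal.inv_lt_top.2 (by exact_mod_cast hn))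

lemma int_diff {f g : R3 → ℝ} (hf : UF f) (hg : UF g) (hfE : Mom 1 f < ⊤) (hgE : Mom 1 g < ⊤) {ψ : R3 → ℝ} (hψ : ψ ∈ CI) :
    ENNReal.ofReal |(∫ v, f v * ψ v) - ∫ v, g v * ψ v| ≤ Yp (fun v => f v - g v) := by
  rw [← integral_sub (int_of_Mom hf hfE (CI_meas hψ) (C := 1) fun v => by rw [one_mul]; exact CI_le hψ v)
    (int_of_Mom hg hgE (CI_meas hψ) (C := 1) fun v => by rw [one_mul]; exact CI_le hψ v), ← Real.norm_eq_abs, ofReal_norm]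
  refine (enorm_integral_le_lintegral_enorm _).trans (lintegral_mono fun v => ?_)
  rw [← ofReal_norm, Real.norm_eq_abs, ← sub_mul, abs_mul]
  exact ENNReal.ofReal_le_ofReal (mul_le_mul_of_nonneg_left (CI_le hψ v) (abs_nonneg _))

lemma YY_comm (f g : ℝ → R3 → ℝ) (t : ℝ) : YY f g t = YY g f t := Yp_comm _ _

lemma NS_limit (hγ0 : 0 ≤ γ) (hγ2 : γ ≤ 2) (hb : GradCutoff b) {k : ℕ → Om → ℝ} (hk : ∀ n, CK γ b (k n)) {K : Om → ℝ} (hK : CK γ b K)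
    {g : ℕ → ℝ → R3 → ℝ} (hg : ∀ n, NS (k n) (g n)) {E0 : ℝ≥0∞} (hE0 : E0 < ⊤) (hE : ∀ n, Mom 1 (g n 0) ≤ E0)
    (hC : ∀ T : ℝ, ∀ ε : ℝ≥0∞, 0 < ε → ∃ n0, ∀ n m, n0 ≤ n → n0 ≤ m → ∀ t ∈ Icc 0 T, YY (g n) (g m) t ≤ ε)
    (hQ : ∀ T : ℝ, ∀ ε : ℝ≥0∞, 0 < ε → ∃ n0, ∀ n, n0 ≤ n → ∀ t ∈ Icc 0 T, Y0 (fun v => Qk (k n) (g n t) v - Qk K (g n t) v) ≤ ε) :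
    ∃ f, NS K f ∧ ∀ T : ℝ, ∀ ε : ℝ≥0∞, 0 < ε → ∃ n0, ∀ n, n0 ≤ n → ∀ t ∈ Icc 0 T, YY (g n) f t ≤ ε := by
  obtain ⟨F, hm, h0, h1, hF⟩ := lim_exists (fun n => (hg n).meas) (fun n => (hg n).nonneg) (fun n => (hg n).le_one) hC
  have uF : ∀ t, UF (F t) := fun t => ⟨hm.comp (f := fun v : R3 => (t, v)) (by fun_prop), h0 t, h1 t⟩
  have hEt : ∀ n t, 0 ≤ t → Mom 1 (g n t) ≤ E0 := fun n t ht => by rw [(hg n).en ht]; exact hE n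
  have hFE : ∀ t, 0 ≤ t → Mom 1 (F t) ≤ E0 + 1 := by
    intro t ht
    obtain ⟨n, hn⟩ := hF t 1 (by norm_num)
    have h2 := hn n le_rfl t ⟨ht, le_rfl⟩
    rw [← Yp_uf (uF t)]
    have h3 := Yp_add_le (f := g n t) (g := fun v => F t v - g n t v) ((hg n).uf t).meas
    simp only [add_sub_cancel] at h3
    refine h3.trans (add_le_add ?_ ?_)
    · rw [Yp_uf ((hg n).uf t)]; exact hEt n t ht
    · rw [Yp_comm]; exact h2
  have hE1 : E0 + 1 < ⊤ := ENNReal.add_lt_top.2 ⟨hE0, by simp⟩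
  have mQ := meas_Qk_joint hK.meas hm
  have hmain : ∀ t, 0 ≤ t → ∀ ε : ℝ≥0∞, 0 < ε → ∃ n, (∀ τ ∈ Icc 0 t, YY (g n) F τ ≤ ε ∧
      Y0 (fun v => Qk (k n) (g n τ) v - Qk K (F τ) v) ≤ ε * (1 + 4 * (KJ b * (E0 + (E0 + 1))))) := by
    intro t ht ε hε
    obtain ⟨n1, hn1⟩ := hF t ε hε
    obtain ⟨n2, hn2⟩ := hQ t ε hε
    refine ⟨max n1 n2, fun τ hτ => ⟨hn1 _ (le_max_left _ _) τ hτ, ?_⟩⟩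
    set n := max n1 n2
    have ug := (hg n).uf τ
    have a1 := hn2 n (le_max_right _ _) τ hτ
    have a2 := diff0_abs hγ0 hγ2 hb hK ug (uF τ) ((hg n).fin τ hτ.1) ((hFE τ hτ.1).trans_lt hE1)
    have a3 := Y0_add_le (f := fun v => Qk (k n) (g n τ) v - Qk K (g n τ) v) (g := fun v => Qk K (g n τ) v - Qk K (F τ) v)
      ((meas_Qk (hk n).meas ug.meas).sub (meas_Qk hK.meas ug.meas))
    simp only [sub_add_sub_cancel] at a3
    refine a3.trans ((add_le_add a1 a2).trans ?_)
    have a4 : Mom 1 (fun v => max (g n τ v) (F τ v)) ≤ E0 + (E0 + 1) := (Mom_max_le ug (uF τ) 1).trans (add_le_add (hEt n τ hτ.1) (hFE τ hτ.1))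
    have a5 := hn1 n (le_max_left _ _) τ hτ
    calc ε + 4 * (KJ b * (Mom 1 (fun v => max (g n τ v) (F τ v)) * Yp (fun v => g n τ v - F τ v))) ≤ ε + 4 * (KJ b * ((E0 + (E0 + 1)) * ε)) := by
          gcongr; exact a5
      _ = _ := by ring
  have hcons : ∀ ψ ∈ CI, ∀ t, 0 ≤ t → ∫ v, F t v * ψ v = ∫ v, F 0 v * ψ v := by
    intro ψ hψ t ht
    have : ENNReal.ofReal |(∫ v, F t v * ψ v) - ∫ v, F 0 v * ψ v| = 0 := by
      refine zero_of_eps (C := 2) (by simp) fun ε hε _ => ?_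
      obtain ⟨n, hn⟩ := hmain t ht ε hε
      have b1 := (int_diff ((hg n).uf t) (uF t) ((hg n).fin t ht) ((hFE t ht).trans_lt hE1) hψ).trans (hn t ⟨ht, le_rfl⟩).1
      have b2 := (int_diff ((hg n).uf 0) (uF 0) ((hg n).fin 0 le_rfl) ((hFE 0 le_rfl).trans_lt hE1) hψ).trans (hn 0 ⟨le_rfl, ht⟩).1
      rw [(hg n).cons ψ hψ t ht] at b1
      rw [mul_two]
      refine le_trans ?_ (add_le_add b1 b2)
      rw [← ENNReal.ofReal_add (abs_nonneg _) (abs_nonneg _)]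
      refine ENNReal.ofReal_le_ofReal ?_
      rw [abs_sub_comm (∫ v, g n 0 v * ψ v) (∫ v, F t v * ψ v)]
      exact abs_sub_le _ _ _
    rw [ENNReal.ofReal_eq_zero] at this
    have := abs_nonpos_iff.1 this
    linarith
  have hbd : ∀ v t, 0 ≤ t → |Qk K (F t) v| ≤ (KJ b * (E0 + 1)).toReal * phi v := by
    intro v t ht
    have a1 := (Qk_abs_le hγ0 hγ2 hb hK (uF t) v).trans (mul_le_mul_right (mul_le_mul_left (hFE t ht) _) _)
    rw [← mul_assoc] at a1
    have hfin : KJ b * (E0 + 1) ≠ ⊤ := (ENNReal.mul_lt_top (KJ_lt_top hb) hE1).ne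
    have := ENNReal.toReal_mono (ENNReal.mul_ne_top hfin ENNReal.ofReal_ne_top) a1
    rwa [ENNReal.toReal_mul, ENNReal.toReal_ofReal (abs_nonneg _), ENNReal.toReal_ofReal (phi_pos v).le] at this
  have hmild : ∀ t, 0 ≤ t → ∀ᵐ v, F t v = F 0 v + ∫ τ in (0:ℝ)..t, Qk K (F τ) v := by
    intro t ht
    have mI : Measurable fun v => ∫ τ in (0:ℝ)..t, Qk K (F τ) v := by
      have := (meas_int0 mQ).comp (f := fun v : R3 => (t, v)) (by fun_prop)
      simpa [Function.comp_def, max_eq_left ht] using this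
    have m1 := (uF t).meas; have m2 := (uF 0).meas
    have : Y0 (fun v => F t v - (F 0 v + ∫ τ in (0:ℝ)..t, Qk K (F τ) v)) = 0 := by
      have hCf : 2 + (1 + 4 * (KJ b * (E0 + (E0 + 1)))) * ENNReal.ofReal t < ⊤ := by
        have := KJ_lt_top hb
        have h5 : 4 * (KJ b * (E0 + (E0 + 1))) < ⊤ := ENNReal.mul_lt_top (by simp) (ENNReal.mul_lt_top this (ENNReal.add_lt_top.2 ⟨hE0, hE1⟩))
        exact ENNReal.add_lt_top.2 ⟨by simp, ENNReal.mul_lt_top (ENNReal.add_lt_top.2 ⟨by simp, h5⟩) ENNReal.ofReal_lt_top⟩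
      refine zero_of_eps hCf fun ε hε hε' => ?_
      obtain ⟨n, hn⟩ := hmain t ht ε hε
      have m3 := ((hg n).uf t).meas; have m4 := ((hg n).uf 0).meas
      have mQn := (hg n).measQ (hk n)
      have pw : ∀ᵐ v, ENNReal.ofReal |F t v - (F 0 v + ∫ τ in (0:ℝ)..t, Qk K (F τ) v)| ≤ ENNReal.ofReal |g n t v - F t v| + ENNReal.ofReal |g n 0 v - F 0 v| +
          ∫⁻ τ in Ioc 0 t, ENNReal.ofReal |Qk (k n) (g n τ) v - Qk K (F τ) v| := by
        filter_upwards [(hg n).mild] with v hv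
        have iF : IntervalIntegrable (fun τ => Qk K (F τ) v) volume 0 t :=
          ii_of_bdd (mQ.comp (f := fun τ : ℝ => (τ, v)) (by fun_prop)) (fun τ hτ => hbd v τ hτ.1) ht
        have ig := (hg n).iiQ hγ0 hγ2 hb (hk n) le_rfl ht v
        have e : F t v - (F 0 v + ∫ τ in (0:ℝ)..t, Qk K (F τ) v) = -(g n t v - F t v) + (g n 0 v - F 0 v) + ∫ τ in (0:ℝ)..t, (Qk (k n) (g n τ) v - Qk K (F τ) v) := by
          rw [intervalIntegral.integral_sub ig iF, hv t ht]; ring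
        rw [e]
        have t3 : ENNReal.ofReal |∫ τ in (0:ℝ)..t, (Qk (k n) (g n τ) v - Qk K (F τ) v)| ≤ ∫⁻ τ in Ioc 0 t, ENNReal.ofReal |Qk (k n) (g n τ) v - Qk K (F τ) v| := by
          rw [intervalIntegral.integral_of_le ht, ← Real.norm_eq_abs, ofReal_norm]
          refine (enorm_integral_le_lintegral_enorm _).trans (le_of_eq (lintegral_congr fun τ => ?_))
          rw [← ofReal_norm, Real.norm_eq_abs]
        refine le_trans (ENNReal.ofReal_le_ofReal ((abs_add_le _ _).trans (add_le_add (abs_add_le _ _) le_rfl))) ?_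
        rw [abs_neg]
        exact ENNReal.ofReal_add_le.trans (add_le_add ENNReal.ofReal_add_le t3)
      refine (lintegral_mono_ae pw).trans ?_
      rw [lintegral_add_left (by fun_prop), lintegral_add_left (by fun_prop), lintegral_lintegral_swap (f := fun v τ => ENNReal.ofReal |Qk (k n) (g n τ) v - Qk K (F τ) v|)
        (Measurable.aemeasurable (by
            have a1 := mQn.comp measurable_swap; have a2 := mQ.comp measurable_swap
            exact ((a1.sub a2).abs).ennreal_ofReal))]
      have t1 : ∫⁻ v, ENNReal.ofReal |g n t v - F t v| ≤ ε := (YZ_le_YY _ _ _).trans (hn t ⟨ht, le_rfl⟩).1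
      have t2 : ∫⁻ v, ENNReal.ofReal |g n 0 v - F 0 v| ≤ ε := (YZ_le_YY _ _ _).trans (hn 0 ⟨le_rfl, ht⟩).1
      have t3 : ∫⁻ τ in Ioc 0 t, ∫⁻ v, ENNReal.ofReal |Qk (k n) (g n τ) v - Qk K (F τ) v| ≤ ε * (1 + 4 * (KJ b * (E0 + (E0 + 1)))) * ENNReal.ofReal t := by
        refine (setLIntegral_mono' measurableSet_Ioc fun τ hτ => (hn τ ⟨hτ.1.le, hτ.2⟩).2).trans ?_
        simp
      refine (add_le_add (add_le_add t1 t2) t3).trans (le_of_eq ?_)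
      ring
    filter_upwards [Y0_eq_zero (by fun_prop) this] with v hv
    linarith
  obtain ⟨f, hf, hfF⟩ := NS_of_weak hγ0 hγ2 hb hK hm h0 h1 hE1 hFE hcons hmild
  refine ⟨f, hf, fun T ε hε => ?_⟩
  obtain ⟨n0, hn0⟩ := hF T ε hε
  refine ⟨n0, fun n hn t ht => le_trans (le_of_eq ?_) (hn0 n hn t ht)⟩
  refine lintegral_congr_ae ?_
  filter_upwards [hfF t ht.1] with v hv
  simp only [hv]

end BFD
end

noncomputable section
open MeasureTheory Real Set Filter
open scoped RealInnerProductSpace ENNReal NNReal Topology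

namespace BFD
variable {γ : ℝ} {b : ℝ → ℝ}

/-- A bounded-kernel constant. -/
lemma kcut_bd (hγ0 : 0 ≤ γ) (hb : GradCutoff b) (n : ℕ) :
    ∃ Λ : ℝ, 0 ≤ Λ ∧ ∀ v, ∫⁻ q, ENNReal.ofReal (kcut γ b n (v, q)) ∂nu ≤ ENNReal.ofReal Λ := by
  have hkm := (CK_cut (γ := γ) hb n).meas
  set G : R3 → ℝ≥0∞ := (Metric.closedBall (0:R3) n).indicator fun _ => ENNReal.ofReal ((2 * (n:ℝ)) ^ γ) with hG
  have hfin : Ib b * ∫⁻ w, G w < ⊤ := by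
    refine ENNReal.mul_lt_top (Ib_lt_top hb) ?_
    rw [hG, lintegral_indicator Metric.isClosed_closedBall.measurableSet, lintegral_const]
    refine ENNReal.mul_lt_top ENNReal.ofReal_lt_top ?_
    rw [Measure.restrict_apply_univ]
    exact measure_closedBall_lt_top
  refine ⟨(Ib b * ∫⁻ w, G w).toReal, ENNReal.toReal_nonneg, fun v => ?_⟩
  rw [ENNReal.ofReal_toReal hfin.ne, ← lint_ang hb v G, lint_nu _ (by fun_prop)]
  refine lintegral_mono fun w => lintegral_mono fun σ => ?_
  show ENNReal.ofReal (if ‖v‖ ^ 2 + ‖w‖ ^ 2 ≤ (n:ℝ) ^ 2 then BO γ b (v, w, σ) else 0) ≤ _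
  split_ifs with h
  · have hn : (0:ℝ) ≤ n := Nat.cast_nonneg n
    have hv : ‖v‖ ≤ n := by nlinarith [norm_nonneg v, norm_nonneg w]
    have hw : ‖w‖ ≤ n := by nlinarith [norm_nonneg v, norm_nonneg w]
    have hwm : w ∈ Metric.closedBall (0:R3) n := by simpa using hw
    rw [hG, indicator_of_mem hwm, ← ENNReal.ofReal_mul (hb.nonneg _)]
    refine ENNReal.ofReal_le_ofReal ?_
    show ‖v - w‖ ^ γ * b (cosAngle v w σ) ≤ _
    rw [mul_comm]
    refine mul_le_mul_of_nonneg_left (rpow_le_rpow (norm_nonneg _) ?_ hγ0) (hb.nonneg _)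
    linarith [norm_sub_le v w]
  · simp

/-- clamp -/
def cl (x : ℝ) : ℝ := max 0 (min x 1)
lemma cl_nonneg (x : ℝ) : 0 ≤ cl x := le_max_left _ _
lemma cl_le (x : ℝ) : cl x ≤ 1 := max_le (by norm_num) (min_le_right _ _)
lemma cl_lip (x y : ℝ) : |cl x - cl y| ≤ |x - y| := by
  unfold cl
  refine (abs_max_sub_max_le_max _ _ _ _).trans ?_
  rw [sub_self, abs_zero]
  refine max_le (abs_nonneg _) ((abs_min_sub_min_le_max _ _ _ _).trans ?_)
  simp
lemma cl_eq {x : ℝ} (h0 : 0 ≤ x) (h1 : x ≤ 1) : cl x = x := by unfold cl; rw [min_eq_left h1, max_eq_right h0]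
@[fun_prop] lemma meas_cl : Measurable cl := by unfold cl; fun_prop

lemma UF_cl {f : R3 → ℝ} (hf : Measurable f) : UF (fun w => cl (f w)) :=
  ⟨by fun_prop, fun _ => cl_nonneg _, fun _ => cl_le _⟩

section bddk
variable {k : Om → ℝ} (hk : CK γ b k) {Λ : ℝ} (hΛ0 : 0 ≤ Λ) (hΛ : ∀ v, ∫⁻ q, ENNReal.ofReal (k (v, q)) ∂nu ≤ ENNReal.ofReal Λ)
include hk hΛ0 hΛ

lemma k_int (v : R3) : Integrable (fun q => k (v, q)) nu ∧ ∫ q, k (v, q) ∂nu ≤ Λ := by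
  have hkm := hk.meas
  have h1 : Integrable (fun q => k (v, q)) nu := by
    refine ⟨Measurable.aestronglyMeasurable (by fun_prop), ?_⟩
    rw [hasFiniteIntegral_iff_norm]
    refine lt_of_le_of_lt ?_ (lt_of_le_of_lt (hΛ v) ENNReal.ofReal_lt_top)
    refine lintegral_mono fun q => ?_
    rw [Real.norm_of_nonneg (hk.nonneg _)]
  refine ⟨h1, ?_⟩
  rw [← ENNReal.ofReal_le_ofReal_iff hΛ0, ofReal_integral_eq_lintegral_ofReal h1 (ae_of_all _ fun q => hk.nonneg _)]
  exact hΛ v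

lemma k_mul_int (v : R3) {H : R3 × S2 → ℝ} (hH : Measurable H) {C : ℝ} (hC : ∀ q, |H q| ≤ C) :
    Integrable (fun q => k (v, q) * H q) nu ∧ |∫ q, k (v, q) * H q ∂nu| ≤ Λ * C := by
  obtain ⟨h1, h2⟩ := k_int hk hΛ0 hΛ v
  have hkm := hk.meas
  have hle : ∀ q, ‖k (v, q) * H q‖ ≤ k (v, q) * C := fun q => by
    rw [norm_mul, Real.norm_of_nonneg (hk.nonneg _)]
    exact mul_le_mul_of_nonneg_left (hC q) (hk.nonneg _)
  refine ⟨Integrable.mono' (h1.mul_const C) (Measurable.aestronglyMeasurable (by fun_prop)) (ae_of_all _ hle), ?_⟩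
  have hC0 : 0 ≤ C := by
    have : Nonempty (R3 × S2) := ⟨(0, ⟨EuclideanSpace.single 0 1, by simp⟩)⟩
    exact (abs_nonneg _).trans (hC this.some)
  rw [← Real.norm_eq_abs]
  refine (norm_integral_le_of_norm_le (h1.mul_const C) (ae_of_all _ hle)).trans ?_
  rw [integral_mul_const]
  exact mul_le_mul_of_nonneg_right h2 hC0

lemma GG_le_one {f : R3 → ℝ} (hf : UF f) (p : Om) : |GG f p| ≤ 1 := by
  have h1 := mul4_bd (hf.nonneg (Q2 p)) (hf.nonneg p.1) (hf.le_one p.1) (hf.nonneg p.2.1) (hf.le_one p.2.1) (hf.nonneg (Q3 p))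
  have h2 := mul4_bd (hf.nonneg p.1) (hf.nonneg (Q2 p)) (hf.le_one _) (hf.nonneg (Q3 p)) (hf.le_one _) (hf.nonneg p.2.1)
  have h3 : f (Q2 p) * f (Q3 p) ≤ 1 := mul_le_one₀ (hf.le_one _) (hf.nonneg _) (hf.le_one _)
  have h4 : f p.1 * f p.2.1 ≤ 1 := mul_le_one₀ (hf.le_one _) (hf.nonneg _) (hf.le_one _)
  unfold GG; rw [abs_le]; constructor <;> linarith

lemma Qk_bdd {f : R3 → ℝ} (hf : UF f) (v : R3) : |Qk k f v| ≤ Λ := by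
  have := meas_GG hf.meas
  have := (k_mul_int hk hΛ0 hΛ v (H := fun q => GG f (v, q)) (by fun_prop) (C := 1) fun q => GG_le_one hk hΛ0 hΛ hf _).2
  rwa [mul_one] at this

lemma Qk_lip {f g : R3 → ℝ} (hf : UF f) (hg : UF g) {ε : ℝ} (h : ∀ w, |f w - g w| ≤ ε) (v : R3) :
    |Qk k f v - Qk k g v| ≤ 8 * Λ * ε := by
  have m1 := meas_GG hf.meas
  have m2 := meas_GG hg.meas
  have i1 := (k_mul_int hk hΛ0 hΛ v (H := fun q => GG f (v, q)) (by fun_prop) (C := 1) fun q => GG_le_one hk hΛ0 hΛ hf _).1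
  have i2 := (k_mul_int hk hΛ0 hΛ v (H := fun q => GG g (v, q)) (by fun_prop) (C := 1) fun q => GG_le_one hk hΛ0 hΛ hg _).1
  unfold Qk
  rw [← integral_sub i1 i2]
  have hle : ∀ q : R3 × S2, |GG f (v, q) - GG g (v, q)| ≤ 8 * ε := by
    intro q
    have := DLabs_scalar (f3 := f (Q3 (v, q))) (g0 := g v) ⟨hf.nonneg v, hf.le_one v⟩ ⟨hf.nonneg q.1, hf.le_one q.1⟩ ⟨hf.nonneg (Q2 (v, q)), hf.le_one (Q2 (v, q))⟩
      ⟨hg.nonneg q.1, hg.le_one q.1⟩ ⟨hg.nonneg (Q2 (v, q)), hg.le_one (Q2 (v, q))⟩ ⟨hg.nonneg (Q3 (v, q)), hg.le_one (Q3 (v, q))⟩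
      (hf.le_one _) (hf.le_one _) (hf.le_one _) (hg.le_one _) (hg.le_one _) (hg.le_one _)
    refine this.trans ?_
    have a0 := h v; have a1 := h q.1; have a2 := h (Q2 (v, q)); have a3 := h (Q3 (v, q))
    linarith
  have := (k_mul_int hk hΛ0 hΛ v (H := fun q => GG f (v, q) - GG g (v, q)) (by fun_prop) hle).2
  simp only [mul_sub] at this
  linarith

lemma Qk_gain {f : R3 → ℝ} (hf : UF f) {v : R3} (h : f v = 0) : 0 ≤ Qk k f v := by
  refine integral_nonneg fun q => mul_nonneg (hk.nonneg _) ?_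
  have h1 := mul4_bd (hf.nonneg (Q2 (v,q))) (hf.nonneg v) (hf.le_one v) (hf.nonneg q.1) (hf.le_one q.1) (hf.nonneg (Q3 (v,q)))
  unfold GG; rw [h] at *; linarith

lemma Qk_lossy {f : R3 → ℝ} (hf : UF f) {v : R3} (h : f v = 1) : Qk k f v ≤ 0 := by
  refine integral_nonpos fun q => mul_nonpos_of_nonneg_of_nonpos (hk.nonneg _) ?_
  have h1 := mul4_bd (hf.nonneg v) (hf.nonneg (Q2 (v,q))) (hf.le_one _) (hf.nonneg (Q3 (v,q))) (hf.le_one _) (hf.nonneg q.1)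
  unfold GG; rw [h] at *; linarith

end bddk

/-- A scalar invariance lemma. -/
lemma stay {q : ℝ → ℝ} (hq : Measurable q) {M u0 : ℝ} (hM : ∀ τ, |q τ| ≤ M) {u : ℝ → ℝ} (hu : ∀ t, 0 ≤ t → u t = u0 + ∫ τ in (0:ℝ)..t, q τ)
    (h0 : 0 ≤ u0) (hs : ∀ τ, u τ < 0 → 0 ≤ q τ) {t : ℝ} (ht : 0 ≤ t) : 0 ≤ u t := by
  have ii : ∀ a c : ℝ, IntervalIntegrable q volume a c := fun a c => by
    rcases le_total a c with h | h
    · exact ii_of_bdd hq (fun τ _ => hM τ) h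
    · exact (ii_of_bdd hq (fun τ _ => hM τ) h).symm
  by_contra hneg
  have hc : Continuous fun t => u0 + ∫ τ in (0:ℝ)..t, q τ := continuous_const.add (intervalIntegral.continuous_primitive ii 0)
  set S : Set ℝ := Icc 0 t ∩ {s | 0 ≤ u0 + ∫ τ in (0:ℝ)..s, q τ} with hS
  have hSc : IsCompact S := isCompact_Icc.inter_right (isClosed_le continuous_const hc)
  have hSn : S.Nonempty := ⟨0, ⟨le_rfl, ht⟩, by simpa using h0⟩
  obtain ⟨s, hsS, hmax⟩ := hSc.exists_isGreatest hSn
  have hst : s ≤ t := hsS.1.2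
  have hs0 : 0 ≤ s := hsS.1.1
  have : u t = (u0 + ∫ τ in (0:ℝ)..s, q τ) + ∫ τ in s..t, q τ := by
    rw [hu t ht, add_assoc, intervalIntegral.integral_add_adjacent_intervals (ii _ _) (ii _ _)]
  have h2 : 0 ≤ ∫ τ in s..t, q τ := by
    rw [intervalIntegral.integral_of_le hst]
    refine setIntegral_nonneg measurableSet_Ioc fun τ hτ => hs τ ?_
    by_contra hc
    push Not at hc
    rw [hu τ (hs0.trans hτ.1.le)] at hc
    have : τ ≤ s := hmax ⟨⟨hs0.trans hτ.1.le, hτ.2⟩, hc⟩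
    exact absurd hτ.1 (not_lt.2 this)
  have h3 : 0 ≤ u0 + ∫ τ in (0:ℝ)..s, q τ := hsS.2
  linarith

/-- Picard iterates. -/
def pic (k : Om → ℝ) (f0 : R3 → ℝ) : ℕ → ℝ → R3 → ℝ
  | 0 => fun _ v => f0 v
  | j + 1 => fun t v => f0 v + ∫ τ in (0:ℝ)..max t 0, Qk k (fun w => cl (pic k f0 j τ w)) v

lemma meas_Qcl {k : Om → ℝ} (hk : Measurable k) {F : ℝ → R3 → ℝ} (hF : Measurable fun p : ℝ × R3 => F p.1 p.2) :
    Measurable fun p : ℝ × R3 => Qk k (fun w => cl (F p.1 w)) p.2 :=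
  meas_Qk_joint hk (f := fun t w => cl (F t w)) (by fun_prop)

lemma meas_pic {k : Om → ℝ} (hk : Measurable k) {f0 : R3 → ℝ} (hf : Measurable f0) (j : ℕ) : Measurable fun p : ℝ × R3 => pic k f0 j p.1 p.2 := by
  induction j with
  | zero => simp only [pic]; fun_prop
  | succ j ih =>
    simp only [pic]
    have := meas_int0 (meas_Qcl hk ih)
    fun_prop

lemma ii_Qcl {k : Om → ℝ} (hk : CK γ b k) {Λ : ℝ} (hΛ0 : 0 ≤ Λ) (hΛ : ∀ v, ∫⁻ q, ENNReal.ofReal (k (v, q)) ∂nu ≤ ENNReal.ofReal Λ)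
    {F : ℝ → R3 → ℝ} (hF : Measurable fun p : ℝ × R3 => F p.1 p.2) (v : R3) {t : ℝ} (ht : 0 ≤ t) :
    IntervalIntegrable (fun τ => Qk k (fun w => cl (F τ w)) v) volume 0 t :=
  ii_of_bdd ((meas_Qcl hk.meas hF).comp (f := fun τ : ℝ => (τ, v)) (by fun_prop))
    (fun τ _ => Qk_bdd hk hΛ0 hΛ (UF_cl (hF.comp (f := fun w : R3 => (τ, w)) (by fun_prop))) v) ht

lemma int_exp_bd {L M ε t : ℝ} (hL : 0 ≤ L) (hM : 0 < M) (hε : 0 ≤ ε) (ht : 0 ≤ t) (h : 2 * L ≤ M) {q : ℝ → ℝ} 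
    (hq : ∀ τ ∈ Ioc 0 t, |q τ| ≤ L * (ε * exp (M * max τ 0))) : |∫ τ in (0:ℝ)..t, q τ| ≤ ε / 2 * exp (M * t) := by
  have hd : ∫ τ in (0:ℝ)..t, L * (ε * exp (M * τ)) = L * (ε * (exp (M * t) - 1) / M) := by
    have : ∀ τ, HasDerivAt (fun τ => L * (ε * exp (M * τ) / M)) (L * (ε * exp (M * τ))) τ := by
      intro τ
      have h1 : HasDerivAt (fun τ => exp (M * τ)) (exp (M * τ) * (M * 1)) τ := ((hasDerivAt_id τ).const_mul M).exp
      have h2 := ((h1.const_mul ε).div_const M).const_mul L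
      exact h2.congr_deriv (by field_simp)
    rw [intervalIntegral.integral_eq_sub_of_hasDerivAt (fun τ _ => this τ) (Continuous.intervalIntegrable (by fun_prop) _ _)]
    simp; ring
  rw [← Real.norm_eq_abs]
  refine (intervalIntegral.norm_integral_le_of_norm_le (g := fun τ => L * (ε * exp (M * τ))) ht (ae_of_all _ fun τ hτ => ?_) (Continuous.intervalIntegrable (by fun_prop) _ _)).trans ?_
  · have := hq τ hτ
    rwa [max_eq_left hτ.1.le] at this
  · rw [hd]
    have e : 0 < exp (M * t) := exp_pos _
    rw [mul_div_assoc', div_le_iff₀ hM]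
    have a1 : ε * (exp (M * t) - 1) ≤ ε * exp (M * t) := by nlinarith
    have a2 : 0 ≤ ε * exp (M * t) := by positivity
    nlinarith [mul_le_mul_of_nonneg_left a1 hL, mul_le_mul_of_nonneg_right h a2]

lemma pic_sol {k : Om → ℝ} (hk : CK γ b k) {Λ : ℝ} (hΛ0 : 0 ≤ Λ) (hΛ : ∀ v, ∫⁻ q, ENNReal.ofReal (k (v, q)) ∂nu ≤ ENNReal.ofReal Λ)
    {f0 : R3 → ℝ} (hf : UF f0) : ∃ F : ℝ → R3 → ℝ, Measurable (fun p : ℝ × R3 => F p.1 p.2) ∧ (∀ t v, 0 ≤ F t v) ∧ (∀ t v, F t v ≤ 1) ∧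
      ∀ t v, F t v = f0 v + ∫ τ in (0:ℝ)..max t 0, Qk k (F τ) v := by
  have hkm := hk.meas
  have mp := meas_pic hkm hf.meas
  set M : ℝ := 16 * Λ + 1 with hM
  have hMp : 0 < M := by positivity
  have umeas : ∀ {G : ℝ → R3 → ℝ}, Measurable (fun p : ℝ × R3 => G p.1 p.2) → ∀ t, UF (fun w => cl (G t w)) := fun hG t =>
    UF_cl (hG.comp (f := fun w : R3 => (t, w)) (by fun_prop))
  -- contraction
  have hcontr : ∀ (G H : ℝ → R3 → ℝ) (_ : Measurable fun p : ℝ × R3 => G p.1 p.2) (_ : Measurable fun p : ℝ × R3 => H p.1 p.2) (ε : ℝ), 0 ≤ ε →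
      (∀ t v, |G t v - H t v| ≤ ε * exp (M * max t 0)) → ∀ t v,
      |(f0 v + ∫ τ in (0:ℝ)..max t 0, Qk k (fun w => cl (G τ w)) v) - (f0 v + ∫ τ in (0:ℝ)..max t 0, Qk k (fun w => cl (H τ w)) v)| ≤
        ε / 2 * exp (M * max t 0) := by
    intro G H hG hH ε hε hGH t v
    rw [add_sub_add_left_eq_sub, ← intervalIntegral.integral_sub (ii_Qcl hk hΛ0 hΛ hG v (le_max_right _ _)) (ii_Qcl hk hΛ0 hΛ hH v (le_max_right _ _))]
    refine int_exp_bd (L := 8 * Λ) (by positivity) hMp hε (le_max_right _ _) (by rw [hM]; linarith) fun τ _ => ?_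
    exact Qk_lip hk hΛ0 hΛ (umeas hG τ) (umeas hH τ) (fun w => (cl_lip _ _).trans (hGH τ w)) v
  have step : ∀ j t v, |pic k f0 j t v - pic k f0 (j+1) t v| ≤ (1/2)^j * exp (M * max t 0) := by
    intro j
    induction j with
    | zero =>
      intro t v
      simp only [pic, pow_zero, one_mul]
      rw [sub_add_cancel_left, abs_neg, ← Real.norm_eq_abs]
      have h1 : ∀ τ ∈ Set.uIoc 0 (max t 0), ‖Qk k (fun w => cl (f0 w)) v‖ ≤ Λ := fun τ _ => Qk_bdd hk hΛ0 hΛ (UF_cl hf.meas) v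
      refine (intervalIntegral.norm_integral_le_of_norm_le_const h1).trans ?_
      rw [sub_zero, abs_of_nonneg (le_max_right _ _)]
      have h0 : 0 ≤ max t 0 := le_max_right _ _
      have := add_one_le_exp (M * max t 0)
      nlinarith [mul_nonneg hΛ0 h0]
    | succ j ih =>
      intro t v
      have := hcontr (pic k f0 j) (pic k f0 (j+1)) (mp j) (mp (j+1)) ((1/2)^j) (by positivity) ih t v
      rw [show ((1:ℝ)/2)^(j+1) = (1/2)^j/2 by ring]
      exact this
  have hcs : ∀ t v, ∃ x, Tendsto (fun j => pic k f0 j t v) atTop (𝓝 x) := fun t v => by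
    refine cauchySeq_tendsto_of_complete (cauchySeq_of_le_geometric (1/2) (exp (M * max t 0)) (by norm_num) fun j => ?_)
    rw [Real.dist_eq, mul_comm]; exact step j t v
  choose F hF using hcs
  have hFm : Measurable (fun p : ℝ × R3 => F p.1 p.2) := 
    measurable_of_tendsto_metrizable mp (tendsto_pi_nhds.2 fun p => hF p.1 p.2)
  have hd : ∀ j t v, |pic k f0 j t v - F t v| ≤ (2 * (1/2)^j) * exp (M * max t 0) := fun j t v => by
    have := dist_le_of_le_geometric_of_tendsto (1/2) (exp (M * max t 0)) (by norm_num) (fun j => by rw [Real.dist_eq, mul_comm]; exact step j t v) (hF t v) j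
    rw [Real.dist_eq] at this
    refine this.trans (le_of_eq ?_)
    ring
  have hfix : ∀ t v, F t v = f0 v + ∫ τ in (0:ℝ)..max t 0, Qk k (fun w => cl (F τ w)) v := by
    intro t v
    refine tendsto_nhds_unique ((tendsto_add_atTop_iff_nat 1).2 (hF t v)) ?_
    refine tendsto_iff_dist_tendsto_zero.2 (squeeze_zero (fun _ => dist_nonneg) (g := fun j => (1/2)^j * exp (M * max t 0)) (fun j => ?_) ?_)
    · rw [Real.dist_eq]
      have := hcontr (pic k f0 j) F (mp j) hFm (2 * (1/2)^j) (by positivity) (hd j) t v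
      refine le_trans this (le_of_eq (by ring))
    · have := (tendsto_pow_atTop_nhds_zero_of_lt_one (r := (1/2:ℝ)) (by norm_num) (by norm_num)).mul_const (exp (M * max t 0))
      rwa [zero_mul] at this
  have qm : ∀ v, Measurable fun τ => Qk k (fun w => cl (F τ w)) v := fun v => (meas_Qcl hkm hFm).comp (f := fun τ : ℝ => (τ, v)) (by fun_prop)
  have qb : ∀ v τ, |Qk k (fun w => cl (F τ w)) v| ≤ Λ := fun v τ => Qk_bdd hk hΛ0 hΛ (umeas hFm τ) v
  have p0 : ∀ t, 0 ≤ t → ∀ v, 0 ≤ F t v := fun t ht v => by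
    refine stay (qm v) (qb v) (u := fun t => F t v) (fun t ht => by rw [hfix, max_eq_left ht]) (hf.nonneg v) (fun τ hτ => ?_) ht
    refine Qk_gain hk hΛ0 hΛ (umeas hFm τ) ?_
    show max 0 (min (F τ v) 1) = 0
    exact max_eq_left ((min_le_left _ _).trans hτ.le)
  have p1 : ∀ t, 0 ≤ t → ∀ v, 0 ≤ 1 - F t v := fun t ht v => by
    refine stay (qm v).neg (fun τ => by rw [Pi.neg_apply, abs_neg]; exact qb v τ) (u := fun t => 1 - F t v) (u0 := 1 - f0 v)
      (fun t ht => by simp only [Pi.neg_apply]; rw [intervalIntegral.integral_neg, hfix, max_eq_left ht]; ring) (by linarith [hf.le_one v]) (fun τ hτ => ?_) ht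
    have := Qk_lossy hk hΛ0 hΛ (umeas hFm τ) (v := v) (by
      show max 0 (min (F τ v) 1) = 1
      rw [min_eq_right (by linarith)]; norm_num)
    simp only [Pi.neg_apply]; linarith
  have heq : ∀ t v, F t v = F (max t 0) v := fun t v => by rw [hfix t v, hfix (max t 0) v, max_eq_left (le_max_right t 0)]
  refine ⟨F, hFm, fun t v => by rw [heq]; exact p0 _ (le_max_right _ _) v, fun t v => by rw [heq]; linarith [p1 _ (le_max_right t 0) v], fun t v => ?_⟩
  have e : ∀ τ, (fun w => cl (F τ w)) = F τ := fun τ => by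
    funext w
    refine cl_eq ?_ ?_
    · rw [heq]; exact p0 _ (le_max_right _ _) w
    · rw [heq]; linarith [p1 _ (le_max_right τ 0) w]
  have := hfix t v
  simp only [e] at this
  exact this

end BFD
end

noncomputable section
open MeasureTheory Real Set Filter
open scoped RealInnerProductSpace ENNReal NNReal Topology

namespace BFD
variable {γ : ℝ} {b : ℝ → ℝ}

/-- Time evolution of a moment. -/
lemma evol {q : ℝ × R3 → ℝ} (hq : Measurable q) {s t : ℝ} (hst : s ≤ t) {F0 Ft ψ : R3 → ℝ} (hψ : Measurable ψ)
    (hev : ∀ᵐ v, Ft v = F0 v + ∫ τ in s..t, q (τ, v))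
    (hfin : ∫⁻ τ in Ioc s t, (∫⁻ v, ENNReal.ofReal |q (τ, v) * ψ v|) < ⊤) (hi : Integrable fun v => F0 v * ψ v) :
    Integrable (fun v => Ft v * ψ v) ∧ (IntegrableOn (fun τ => ∫ v, q (τ, v) * ψ v) (Ioc s t)) ∧
      ∫ v, Ft v * ψ v = (∫ v, F0 v * ψ v) + ∫ τ in Ioc s t, (∫ v, q (τ, v) * ψ v) := by
  have hint : Integrable (fun p : ℝ × R3 => q p * ψ p.2) ((volume.restrict (Ioc s t)).prod volume) := by
    refine ⟨Measurable.aestronglyMeasurable (by fun_prop), ?_⟩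
    rw [hasFiniteIntegral_iff_norm, lintegral_prod _ (Measurable.aemeasurable (by fun_prop))]
    exact hfin
  have h1 : ∀ᵐ v, Ft v * ψ v = F0 v * ψ v + ∫ τ in Ioc s t, q (τ, v) * ψ v := by
    filter_upwards [hev] with v hv
    rw [hv, intervalIntegral.integral_of_le hst, integral_mul_const]; ring
  have h2 := hint.integral_prod_right
  refine ⟨(hi.add h2).congr (h1.mono fun v hv => hv.symm), hint.integral_prod_left, ?_⟩
  rw [integral_congr_ae h1, integral_add hi h2, ← integral_integral_swap (f := fun τ v => q (τ, v) * ψ v) hint]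

lemma kcut_zero {n : ℕ} {v : R3} (hv : (n:ℝ) < ‖v‖) (q : R3 × S2) : kcut γ b n (v, q) = 0 := by
  unfold kcut
  rw [if_neg]
  have : (0:ℝ) ≤ n := Nat.cast_nonneg n
  simp only [not_le]
  nlinarith [sq_nonneg ‖q.1‖]

lemma cut_Q_zero {n : ℕ} (f : R3 → ℝ) {v : R3} (hv : (n:ℝ) < ‖v‖) : Qk (kcut γ b n) f v = 0 := by
  unfold Qk; simp [kcut_zero hv]

lemma Mom_cut (n : ℕ) (p : ℝ) (hp : 0 ≤ p) {f0 : R3 → ℝ} (hf0 : UF f0) {f : R3 → ℝ} (hf : UF f) (h : ∀ v, (n:ℝ) < ‖v‖ → f v = f0 v) :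
    Mom p f ≤ Mom p f0 + ENNReal.ofReal ((1 + (n:ℝ)^2)^p) * volume (Metric.closedBall (0:R3) n) := by
  have hm := hf0.meas
  have : ENNReal.ofReal ((1 + (n:ℝ)^2)^p) * volume (Metric.closedBall (0:R3) n) = ∫⁻ v, (Metric.closedBall (0:R3) n).indicator (fun _ => ENNReal.ofReal ((1 + (n:ℝ)^2)^p)) v := by
    rw [lintegral_indicator Metric.isClosed_closedBall.measurableSet, lintegral_const, Measure.restrict_apply_univ]
  rw [this, Mom, Mom, ← lintegral_add_left (by fun_prop)]
  refine lintegral_mono fun v => ?_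
  by_cases hv : ‖v‖ ≤ n
  · have hvm : v ∈ Metric.closedBall (0:R3) n := by simpa using hv
    rw [indicator_of_mem hvm]
    refine le_trans (ENNReal.ofReal_le_ofReal ?_) le_add_self
    have h1 : phi v ^ p ≤ (1 + (n:ℝ)^2)^p := by
      refine rpow_le_rpow (phi_pos v).le ?_ hp
      unfold phi; gcongr
    have h2 : 0 ≤ phi v ^ p := rpow_nonneg (phi_pos v).le _
    nlinarith [hf.nonneg v, hf.le_one v]
  · rw [h v (not_le.1 hv)]; exact le_self_add

/-- Solutions with cut kernels. -/
lemma cut_sol (hγ0 : 0 ≤ γ) (hγ2 : γ ≤ 2) (hb : GradCutoff b) (n : ℕ) {f0 : R3 → ℝ} (hf0 : UF f0) (hM : Mom 3 f0 < ⊤) :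
    ∃ f, NS (kcut γ b n) f ∧ f 0 = f0 ∧ ∀ t v, (n:ℝ) < ‖v‖ → f t v = f0 v := by
  obtain ⟨Λ, hΛ0, hΛ⟩ := kcut_bd hγ0 hb n
  have hk := CK_cut (γ := γ) hb n
  obtain ⟨f, hm, h0, h1, hfix⟩ := pic_sol hk hΛ0 hΛ hf0
  have uf : ∀ t, UF (f t) := fun t => ⟨hm.comp (f := fun v : R3 => (t, v)) (by fun_prop), h0 t, h1 t⟩
  have hz : f 0 = f0 := by funext v; rw [hfix]; simp
  have hout : ∀ t v, (n:ℝ) < ‖v‖ → f t v = f0 v := by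
    intro t v hv; rw [hfix]; simp [cut_Q_zero _ hv]
  set C : ℝ≥0∞ := Mom 3 f0 + ENNReal.ofReal ((1 + (n:ℝ)^2)^(3:ℝ)) * volume (Metric.closedBall (0:R3) n) with hC
  have hCt : C < ⊤ := ENNReal.add_lt_top.2 ⟨hM, ENNReal.mul_lt_top ENNReal.ofReal_lt_top measure_closedBall_lt_top⟩
  have hM3 : ∀ t, Mom 3 (f t) ≤ C := fun t => Mom_cut n 3 (by norm_num) hf0 (uf t) (hout t)
  have hMp : ∀ p, p ≤ 3 → ∀ t, Mom p (f t) ≤ C := fun p hp t => (Mom_mono hp (h0 t)).trans (hM3 t)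
  have hfin : ∀ t, 0 ≤ t → Mom 1 (f t) < ⊤ := fun t _ => (hMp 1 (by norm_num) t).trans_lt hCt
  refine ⟨f, ⟨hm, h0, h1, hfin, ?_, ae_of_all _ fun v t ht => ?_⟩, hz, hout⟩
  · intro ψ hψ t ht
    have hψm := CI_meas hψ
    have hψ1 : ∀ v, |ψ v| ≤ 1 * phi v := fun v => by rw [one_mul]; exact CI_le hψ v
    have hQ := meas_Qk_joint hk.meas hm
    have := (evol hQ ht (ψ := ψ) hψm (F0 := f 0) (Ft := f t) (ae_of_all _ fun v => by rw [hfix t v, hz, max_eq_left ht]) ?_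
      (int_of_Mom (uf 0) (hfin 0 le_rfl) hψm hψ1)).2.2
    · rw [this]
      suffices hs : ∀ τ, ∫ v, Qk (kcut γ b n) (f τ) v * ψ v = 0 by simp [hs]
      intro τ
      have hL : Lbil γ b phi (f τ) < ⊤ := (Lbil_phi1 hγ0 hγ2 hb (uf τ)).trans_lt
        (ENNReal.mul_lt_top (ENNReal.mul_lt_top (by simp) (Ib_lt_top hb)) (ENNReal.mul_lt_top ((hMp 1 (by norm_num) τ).trans_lt hCt) ((hMp _ (by linarith) τ).trans_lt hCt)))
      rw [(weak_form hb hk WT_phi (uf τ) hL hψm hψ1).2]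
      have : ∀ p : Om, ψ (Q2 p) + ψ (Q3 p) - ψ p.1 - ψ p.2.1 = 0 := fun p => by have := CI_cons hψ p; linarith
      simp [this]
    · have hle : ∀ τ, ∫⁻ v, ENNReal.ofReal |Qk (kcut γ b n) (f τ) v * ψ v| ≤ 24 * Ib b * (C * C) := by
        intro τ
        refine le_trans (lintegral_mono fun v => ENNReal.ofReal_le_ofReal ?_) ((Yp_Qk hγ0 hγ2 hb hk (uf τ)).trans ?_)
        · rw [abs_mul]; exact mul_le_mul_of_nonneg_left (CI_le hψ v) (abs_nonneg _)
        · gcongr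
          · exact hMp _ (by norm_num) τ
          · exact hMp _ (by linarith) τ
      refine (lintegral_mono hle).trans_lt ?_
      rw [lintegral_const]
      refine ENNReal.mul_lt_top (ENNReal.mul_lt_top (ENNReal.mul_lt_top (by simp) (Ib_lt_top hb)) (ENNReal.mul_lt_top hCt hCt)) ?_
      simp
  · rw [hfix, hz, max_eq_left ht]

lemma lint_tens (hb : GradCutoff b) {X Y : R3 → ℝ≥0∞} (hX : Measurable X) (hY : Measurable Y) :
    ∫⁻ p, ENNReal.ofReal (b (cosO p)) * (X p.1 * Y p.2.1) ∂mu0 = Ib b * ((∫⁻ v, X v) * ∫⁻ w, Y w) := by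
  have hbm := hb.measurable
  rw [lint_mu0' _ (by fun_prop)]
  have : ∀ v, ∫⁻ q, ENNReal.ofReal (b (cosO (v, q))) * (X v * Y q.1) ∂nu = X v * (Ib b * ∫⁻ w, Y w) := by
    intro v
    rw [lint_nu _ (by fun_prop), ← lint_ang hb v Y, ← lintegral_const_mul _ (Measurable.lintegral_prod_right' (f := fun q : R3 × S2 => ENNReal.ofReal (b (cosAngle v q.1 q.2)) * Y q.1) (by fun_prop))]
    refine lintegral_congr fun w => ?_
    rw [← lintegral_const_mul _ (by fun_prop)]
    refine lintegral_congr fun σ => ?_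
    show ENNReal.ofReal (b (cosAngle v w σ)) * (X v * Y w) = _
    ring
  simp only [this]
  rw [lintegral_mul_const _ hX]; ring

end BFD
end

noncomputable section
open MeasureTheory Real Set Filter
open scoped RealInnerProductSpace ENNReal NNReal Topology

namespace BFD
variable {γ : ℝ} {b : ℝ → ℝ}

lemma Mom_three (f : R3 → ℝ) : Mom 3 f = ∫⁻ v, ENNReal.ofReal (f v * phi v ^ 3) := by
  unfold Mom
  refine lintegral_congr fun v => ?_
  norm_num

lemma HL_nonneg {k : Om → ℝ} (hk : CK γ b k) {f : R3 → ℝ} (hf : UF f) (p : Om) : 0 ≤ HL k f p ∧ HL k f p ≤ k p * (f p.1 * f p.2.1) := by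
  have h2 := mul4_bd (hf.nonneg p.1) (hf.nonneg (Q2 p)) (hf.le_one _) (hf.nonneg (Q3 p)) (hf.le_one _) (hf.nonneg p.2.1)
  exact ⟨mul_nonneg (hk.nonneg p) h2.1, mul_le_mul_of_nonneg_left h2.2 (hk.nonneg p)⟩

lemma BO_le_phi (hγ0 : 0 ≤ γ) (hγ2 : γ ≤ 2) (hb : GradCutoff b) (p : Om) : BO γ b p ≤ b (cosO p) * (4 * (phi p.1 + phi p.2.1)) := by
  have h := Aγ_le hγ0 hγ2 p.1 p.2.1
  have h1 : phi p.1 ^ (γ/2) ≤ phi p.1 := rpow_le_self' (by linarith) (one_le_phi _)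
  have h2 : phi p.2.1 ^ (γ/2) ≤ phi p.2.1 := rpow_le_self' (by linarith) (one_le_phi _)
  show ‖p.1 - p.2.1‖ ^ γ * b (cosO p) ≤ _
  rw [mul_comm]
  exact mul_le_mul_of_nonneg_left (by linarith) (hb.nonneg _)

lemma cube_scalar {a c a' c' : ℝ} (ha : 1 ≤ a') (hc : 1 ≤ c') (h : a' + c' = a + c) (ha0 : 1 ≤ a) (hc0 : 1 ≤ c) :
    a' ^ 3 + c' ^ 3 - a ^ 3 - c ^ 3 ≤ 3 * (a + c) * (a * c) := by
  have e : a' ^ 3 + c' ^ 3 = (a' + c') ^ 3 - 3 * (a' + c') * (a' * c') := by ring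
  rw [e, h]
  have : 0 ≤ (a + c) * (a' * c') := by positivity
  nlinarith

lemma cut_M3_rate (hγ0 : 0 ≤ γ) (hγ2 : γ ≤ 2) (hb : GradCutoff b) (n : ℕ) {f : R3 → ℝ} (hf : UF f) (hM : Mom 3 f < ⊤) :
    ENNReal.ofReal (∫ v, Qk (kcut γ b n) f v * phi v ^ 3) ≤ 24 * Ib b * (Mom 1 f * Mom 3 f) := by
  have hk := CK_cut (γ := γ) hb n
  have hfm := hf.meas; have hkm := hk.meas; have hbm := hb.measurable
  set N : ℝ := 1 + (n:ℝ)^2 with hN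
  have hN1 : 1 ≤ N := by rw [hN]; nlinarith [sq_nonneg (n:ℝ)]
  set ψ : R3 → ℝ := fun v => (min (phi v) N) ^ 3 with hψ
  have hψm : Measurable ψ := by fun_prop
  have hψb : ∀ v, |ψ v| ≤ N ^ 2 * phi v := by
    intro v
    have h1 := one_le_phi v
    have h2 : 0 ≤ min (phi v) N := le_min (by linarith) (by linarith)
    rw [hψ, abs_of_nonneg (by positivity)]
    have h3 : (min (phi v) N) ^ 2 ≤ N ^ 2 := pow_le_pow_left₀ h2 (min_le_right _ _) 2
    calc (min (phi v) N) ^ 3 = (min (phi v) N) ^ 2 * min (phi v) N := by ring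
      _ ≤ N ^ 2 * phi v := mul_le_mul h3 (min_le_left _ _) h2 (by positivity)
  have e1 : ∫ v, Qk (kcut γ b n) f v * phi v ^ 3 = ∫ v, Qk (kcut γ b n) f v * ψ v := by
    refine integral_congr_ae (ae_of_all _ fun v => ?_)
    by_cases hv : ‖v‖ ≤ n
    · have : phi v ≤ N := by unfold phi; rw [hN]; gcongr
      simp only [hψ]; rw [min_eq_left this]
    · simp [cut_Q_zero (γ := γ) (b := b) f (not_le.1 hv)]
  have hfin : ∀ p, p ≤ 3 → Mom p f < ⊤ := fun p hp => (Mom_mono hp hf.nonneg).trans_lt hM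
  have hL : Lbil γ b phi f < ⊤ := (Lbil_phi1 hγ0 hγ2 hb hf).trans_lt
        (ENNReal.mul_lt_top (ENNReal.mul_lt_top (by simp) (Ib_lt_top hb)) (ENNReal.mul_lt_top (hfin 1 (by norm_num)) (hfin _ (by linarith))))
  rw [e1, (weak_form hb hk WT_phi hf hL hψm hψb).2, ENNReal.ofReal_div_of_pos (by norm_num)]
  have hpt : ∀ p : Om, HL (kcut γ b n) f p * (ψ (Q2 p) + ψ (Q3 p) - ψ p.1 - ψ p.2.1) ≤
      24 * (b (cosO p) * ((f p.1 * phi p.1) * (f p.2.1 * phi p.2.1 ^ 3)) + b (cosO p) * ((f p.1 * phi p.1 ^ 3) * (f p.2.1 * phi p.2.1))) := by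
    intro p
    have f1 := hf.nonneg p.1; have f2 := hf.nonneg p.2.1
    have h1 := one_le_phi p.1; have h2 := one_le_phi p.2.1
    have hb0 := hb.nonneg (cosO p)
    by_cases hp : ‖p.1‖ ^ 2 + ‖p.2.1‖ ^ 2 ≤ (n:ℝ)^2
    · have hen := energy p
      have hle : ∀ v : R3, ‖v‖ ^ 2 ≤ (n:ℝ)^2 → ψ v = phi v ^ 3 := fun v hv => by
        simp only [hψ]; rw [min_eq_left]; unfold phi; linarith
      rw [hle (Q2 p) (by nlinarith [sq_nonneg ‖Q3 p‖]), hle (Q3 p) (by nlinarith [sq_nonneg ‖Q2 p‖]), hle p.1 (by nlinarith [sq_nonneg ‖p.2.1‖]),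
        hle p.2.1 (by nlinarith [sq_nonneg ‖p.1‖])]
      have hcs := cube_scalar (one_le_phi (Q2 p)) (one_le_phi (Q3 p)) (WT_phi.cons p) h1 h2
      obtain ⟨hl0, hl1⟩ := HL_nonneg hk hf p
      have hk1 : kcut γ b n p ≤ b (cosO p) * (4 * (phi p.1 + phi p.2.1)) := (hk.le p).trans (BO_le_phi hγ0 hγ2 hb p)
      have hff : 0 ≤ f p.1 * f p.2.1 := mul_nonneg f1 f2
      have hpos : 0 ≤ 3 * (phi p.1 + phi p.2.1) * (phi p.1 * phi p.2.1) := by positivity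
      calc _ ≤ HL (kcut γ b n) f p * (3 * (phi p.1 + phi p.2.1) * (phi p.1 * phi p.2.1)) := mul_le_mul_of_nonneg_left hcs hl0
        _ ≤ (b (cosO p) * (4 * (phi p.1 + phi p.2.1)) * (f p.1 * f p.2.1)) * (3 * (phi p.1 + phi p.2.1) * (phi p.1 * phi p.2.1)) :=
            mul_le_mul_of_nonneg_right (hl1.trans (mul_le_mul_of_nonneg_right hk1 hff)) hpos
        _ = 12 * (b (cosO p) * (f p.1 * f p.2.1) * (phi p.1 * phi p.2.1)) * (phi p.1 + phi p.2.1) ^ 2 := by ring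
        _ ≤ 12 * (b (cosO p) * (f p.1 * f p.2.1) * (phi p.1 * phi p.2.1)) * (2 * (phi p.1 ^ 2 + phi p.2.1 ^ 2)) := by
            refine mul_le_mul_of_nonneg_left ?_ (by positivity)
            nlinarith [sq_nonneg (phi p.1 - phi p.2.1)]
        _ = _ := by ring
    · have : HL (kcut γ b n) f p = 0 := by unfold HL kcut; rw [if_neg hp, zero_mul]
      rw [this, zero_mul]; positivity
  have h2 : ENNReal.ofReal (∫ p, HL (kcut γ b n) f p * (ψ (Q2 p) + ψ (Q3 p) - ψ p.1 - ψ p.2.1) ∂mu0) ≤ 48 * Ib b * (Mom 1 f * Mom 3 f) := by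
    refine (ofReal_int_le _ _).trans ((lintegral_mono fun p => ENNReal.ofReal_le_ofReal (hpt p)).trans (le_of_eq ?_))
    set X1 : R3 → ℝ≥0∞ := fun v => ENNReal.ofReal (f v * phi v) with hX1
    set X3 : R3 → ℝ≥0∞ := fun v => ENNReal.ofReal (f v * phi v ^ 3) with hX3
    have m1 : Measurable X1 := by fun_prop
    have m3 : Measurable X3 := by fun_prop
    have : ∀ p : Om, ENNReal.ofReal (24 * (b (cosO p) * ((f p.1 * phi p.1) * (f p.2.1 * phi p.2.1 ^ 3)) + b (cosO p) * ((f p.1 * phi p.1 ^ 3) * (f p.2.1 * phi p.2.1))))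
        = 24 * (ENNReal.ofReal (b (cosO p)) * (X1 p.1 * X3 p.2.1) + ENNReal.ofReal (b (cosO p)) * (X3 p.1 * X1 p.2.1)) := by
      intro p
      have f1 := hf.nonneg p.1; have f2 := hf.nonneg p.2.1
      have h1 := (phi_pos p.1); have h2 := phi_pos p.2.1
      have hb0 := hb.nonneg (cosO p)
      rw [ENNReal.ofReal_mul (by norm_num), ENNReal.ofReal_add (by positivity) (by positivity), ENNReal.ofReal_mul hb0, ENNReal.ofReal_mul hb0,
        ENNReal.ofReal_mul (p := f p.1 * phi p.1) (by positivity), ENNReal.ofReal_mul (p := f p.1 * phi p.1 ^ 3) (by positivity)]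
      simp [hX1, hX3]
    simp only [this]
    rw [lintegral_const_mul _ (by fun_prop), lintegral_add_left (by fun_prop), lint_tens hb m1 m3, lint_tens hb m3 m1, Mom_one, Mom_three]
    ring
  calc _ ≤ (48 * Ib b * (Mom 1 f * Mom 3 f)) / ENNReal.ofReal 2 := ENNReal.div_le_div_right h2 _
    _ = (24 * Ib b * (Mom 1 f * Mom 3 f)) * 2 / 2 := by
        rw [show ENNReal.ofReal 2 = 2 by simp]; congr 1; ring
    _ = _ := ENNReal.mul_div_cancel_right (by simp) (by simp)

lemma cut_M3 (hγ0 : 0 ≤ γ) (hγ2 : γ ≤ 2) (hb : GradCutoff b) (n : ℕ) {f0 : R3 → ℝ} (hf0 : UF f0) (hM : Mom 3 f0 < ⊤)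
    {f : ℝ → R3 → ℝ} (h : NS (kcut γ b n) f) (hz : f 0 = f0) (hout : ∀ t v, (n:ℝ) < ‖v‖ → f t v = f0 v) {T t : ℝ} (ht : t ∈ Icc 0 T) :
    Mom 3 (f t) ≤ 2 * Mom 3 f0 * ENNReal.ofReal (exp ((2 * (24 * Ib b * Mom 1 f0).toReal + 1) * t)) := by
  have hk := CK_cut (γ := γ) hb n
  set C : ℝ≥0∞ := Mom 3 f0 + ENNReal.ofReal ((1 + (n:ℝ)^2)^(3:ℝ)) * volume (Metric.closedBall (0:R3) n) with hC
  have hCt : C < ⊤ := ENNReal.add_lt_top.2 ⟨hM, ENNReal.mul_lt_top ENNReal.ofReal_lt_top measure_closedBall_lt_top⟩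
  have hM3 : ∀ t, Mom 3 (f t) ≤ C := fun t => Mom_cut n 3 (by norm_num) hf0 (h.uf t) (hout t)
  have hMp : ∀ p, p ≤ 3 → ∀ t, Mom p (f t) ≤ C := fun p hp t => (Mom_mono hp (h.nonneg t)).trans (hM3 t)
  have hM1 : Mom 1 f0 < ⊤ := (Mom_mono (by norm_num) hf0.nonneg).trans_lt hM
  have i3 : ∀ t, Integrable fun v => f t v * phi v ^ 3 := fun t => by
    have := (h.uf t).meas
    refine ⟨Measurable.aestronglyMeasurable (by fun_prop), ?_⟩
    rw [hasFiniteIntegral_iff_norm]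
    refine lt_of_eq_of_lt ?_ ((hM3 t).trans_lt hCt)
    rw [Mom_three]
    refine lintegral_congr fun v => ?_
    rw [Real.norm_of_nonneg (mul_nonneg (h.nonneg t v) (pow_nonneg (phi_pos v).le _))]
  have e3 : ∀ t, Mom 3 (f t) = ENNReal.ofReal (∫ v, f t v * phi v ^ 3) := fun t => by
    rw [Mom_three, ofReal_integral_eq_lintegral_ofReal (i3 t) (ae_of_all _ fun v => mul_nonneg (h.nonneg t v) (pow_nonneg (phi_pos v).le _))]
  refine gronwall (y := fun t => Mom 3 (f t)) (a := Mom 3 f0) ENNReal.toReal_nonneg hCt (fun t _ => hM3 t) (fun t ht => ?_) t ht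
  have hQ := h.measQ hk
  have hev := (evol hQ ht.1 (ψ := fun v => phi v ^ 3) (by fun_prop) (F0 := f 0) (Ft := f t) (h.mild.mono fun v hv => hv t ht.1) ?_ (i3 0)).2.2
  · rw [e3, hev]
    refine ENNReal.ofReal_add_le.trans ?_
    rw [← e3 0, hz]
    gcongr
    refine (ofReal_int_le _ _).trans ?_
    rw [ENNReal.ofReal_toReal (ENNReal.mul_lt_top (ENNReal.mul_lt_top (by simp) (Ib_lt_top hb)) hM1).ne, ← lintegral_const_mul _ (meas_Mom h.meas 3)]
    refine setLIntegral_mono (by have := meas_Mom h.meas 3; fun_prop) fun τ hτ => ?_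
    refine (cut_M3_rate hγ0 hγ2 hb n (h.uf τ) ((hM3 τ).trans_lt hCt)).trans (le_of_eq ?_)
    rw [h.en hτ.1.le, hz]; ring
  · have hle : ∀ τ, ∫⁻ v, ENNReal.ofReal |Qk (kcut γ b n) (f τ) v * phi v ^ 3| ≤ ENNReal.ofReal ((1 + (n:ℝ)^2)^2) * (24 * Ib b * (C * C)) := by
      intro τ
      calc ∫⁻ v, ENNReal.ofReal |Qk (kcut γ b n) (f τ) v * phi v ^ 3| ≤ ∫⁻ v, ENNReal.ofReal ((1 + (n:ℝ)^2)^2) * ENNReal.ofReal (|Qk (kcut γ b n) (f τ) v| * phi v) := by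
            refine lintegral_mono fun v => ?_
            rw [← ENNReal.ofReal_mul (by positivity)]
            refine ENNReal.ofReal_le_ofReal ?_
            have hφ := phi_pos v
            rw [abs_mul, abs_of_nonneg (by positivity : 0 ≤ phi v ^ 3)]
            by_cases hv : ‖v‖ ≤ n
            · have h1 : phi v ≤ 1 + (n:ℝ)^2 := by unfold phi; gcongr
              have h2 : phi v ^ 2 ≤ (1 + (n:ℝ)^2)^2 := by gcongr
              calc _ = phi v ^ 2 * (|Qk (kcut γ b n) (f τ) v| * phi v) := by ring
                _ ≤ _ := mul_le_mul_of_nonneg_right h2 (by positivity)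
            · rw [cut_Q_zero _ (not_le.1 hv)]; simp
        _ = ENNReal.ofReal ((1 + (n:ℝ)^2)^2) * Yp (Qk (kcut γ b n) (f τ)) := lintegral_const_mul' _ _ ENNReal.ofReal_ne_top
        _ ≤ _ := by
            gcongr
            refine (Yp_Qk hγ0 hγ2 hb hk (h.uf τ)).trans ?_
            gcongr
            · exact hMp _ (by norm_num) τ
            · exact hMp _ (by linarith) τ
    refine (lintegral_mono hle).trans_lt ?_
    rw [lintegral_const]
    refine ENNReal.mul_lt_top (ENNReal.mul_lt_top ENNReal.ofReal_lt_top (ENNReal.mul_lt_top (ENNReal.mul_lt_top (by simp) (Ib_lt_top hb)) (ENNReal.mul_lt_top hCt hCt))) ?_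
    simp

end BFD
end

noncomputable section
open MeasureTheory Real Set Filter
open scoped RealInnerProductSpace ENNReal NNReal Topology

namespace BFD
variable {γ : ℝ} {b : ℝ → ℝ}

lemma cut_err (hγ0 : 0 ≤ γ) (hγ2 : γ ≤ 2) (hb : GradCutoff b) {n : ℕ} (hn : 0 < n) {K : Om → ℝ} (hK : CK γ b K) (hle : ∀ p, kcut γ b n p ≤ K p)
    (heq : ∀ p : Om, ‖p.1‖ ^ 2 + ‖p.2.1‖ ^ 2 ≤ (n:ℝ)^2 → kcut γ b n p = K p) {f : R3 → ℝ} (hf : UF f) (hE : Mom 1 f < ⊤) :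
    Yp (fun v => Qk (kcut γ b n) f v - Qk K f v) ≤ ENNReal.ofReal (9 / (n:ℝ)^2) * (8 * Ib b * (Mom 1 f * Mom 3 f)) := by
  have hk := CK_cut (γ := γ) hb n
  have e : ∀ v, Qk K f v - Qk (kcut γ b n) f v = Qk (fun p => K p - kcut γ b n p) f v := fun v => by
    unfold Qk
    rw [← integral_sub (integrable_Q hγ0 hγ2 hb hK hf hE v) (integrable_Q hγ0 hγ2 hb hk hf hE v)]
    simp only [sub_mul]
  rw [Yp_comm]
  simp only [e]
  have hn' : (0:ℝ) < (n:ℝ)^2 := by positivity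
  refine (Qk_tail hγ0 hγ2 hb (CK_sub hb hK hk hle) hf hn' fun p hp => ?_).trans ?_
  · rw [heq p hp, sub_self]
  · gcongr
    exact Mom_mono (by linarith) hf.nonneg

lemma cut_le (hb : GradCutoff b) {n m : ℕ} (h : n ≤ m) (p : Om) : kcut γ b n p ≤ kcut γ b m p := by
  have hB := (CK_B (γ := γ) hb).nonneg p
  have h2 : (n:ℝ)^2 ≤ (m:ℝ)^2 := by gcongr
  unfold kcut
  split_ifs <;> first | linarith | exact hB | exact le_rfl

lemma cut_eq_cut {n m : ℕ} (h : n ≤ m) (p : Om) (hp : ‖p.1‖ ^ 2 + ‖p.2.1‖ ^ 2 ≤ (n:ℝ)^2) : kcut γ b n p = kcut γ b m p := by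
  have h2 : (n:ℝ)^2 ≤ (m:ℝ)^2 := by gcongr
  unfold kcut
  rw [if_pos hp, if_pos (hp.trans h2)]

lemma small_seq {X ε : ℝ≥0∞} (hX : X < ⊤) (hε : 0 < ε) : ∃ n0 : ℕ, 0 < n0 ∧ ∀ n, n0 ≤ n → ENNReal.ofReal (9 / (n:ℝ)^2) * X ≤ ε := by
  have h0 : Tendsto (fun n : ℕ => (9:ℝ) / (n:ℝ)^2) atTop (𝓝 0) :=
    tendsto_const_nhds.div_atTop ((tendsto_pow_atTop (by norm_num)).comp tendsto_natCast_atTop_atTop)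
  have h1 : Tendsto (fun n : ℕ => ENNReal.ofReal (9 / (n:ℝ)^2) * X) atTop (𝓝 (0 * X)) :=
    ENNReal.Tendsto.mul_const (by simpa using ENNReal.tendsto_ofReal h0) (Or.inr hX.ne)
  rw [zero_mul] at h1
  obtain ⟨n0, hn0⟩ := eventually_atTop.1 ((tendsto_order.1 h1).2 ε hε)
  exact ⟨n0 + 1, by omega, fun n hn => (hn0 n (by omega)).le⟩

/-- Step 1: solutions for data with three finite `phi`-moments. -/
lemma step1 (hγ0 : 0 ≤ γ) (hγ2 : γ ≤ 2) (hb : GradCutoff b) {f0 : R3 → ℝ} (hf0 : UF f0) (hM : Mom 3 f0 < ⊤) :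
    ∃ f, NS (BO γ b) f ∧ Yp (fun v => f 0 v - f0 v) = 0 := by
  choose g hg hgz hgo using fun n => cut_sol hγ0 hγ2 hb n hf0 hM
  have hk : ∀ n, CK γ b (kcut γ b n) := fun n => CK_cut hb n
  have hM1 : Mom 1 f0 < ⊤ := (Mom_mono (by norm_num) hf0.nonneg).trans_lt hM
  set E := Mom 1 f0 with hE
  have hgE : ∀ n t, 0 ≤ t → Mom 1 (g n t) = E := fun n t ht => by rw [(hg n).en ht, hgz n]
  set c : ℝ := 2 * (24 * Ib b * E).toReal + 1 with hc
  have hc0 : 0 ≤ c := by positivity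
  set BT : ℝ → ℝ≥0∞ := fun T => 2 * Mom 3 f0 * ENNReal.ofReal (exp (c * T)) with hBT
  have hBt : ∀ T, BT T < ⊤ := fun T => ENNReal.mul_lt_top (ENNReal.mul_lt_top (by simp) hM) ENNReal.ofReal_lt_top
  have hg3 : ∀ T n t, t ∈ Icc 0 T → Mom 3 (g n t) ≤ BT T := fun T n t ht => by
    refine (cut_M3 hγ0 hγ2 hb n hf0 hM (hg n) (hgz n) (hgo n) ht).trans ?_
    have : c * t ≤ c * T := mul_le_mul_of_nonneg_left ht.2 hc0
    simp only [hBT]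
    gcongr
  set D : ℝ → ℝ≥0∞ := fun T => 8 * Ib b * (E * BT T) with hD
  have hDt : ∀ T, D T < ⊤ := fun T => ENNReal.mul_lt_top (ENNReal.mul_lt_top (by simp) (Ib_lt_top hb)) (ENNReal.mul_lt_top hM1 (hBt T))
  have herr : ∀ T, ∀ n m t, 0 < n → n ≤ m → t ∈ Icc 0 T → Yp (fun v => Qk (kcut γ b n) (g m t) v - Qk (kcut γ b m) (g m t) v) ≤ ENNReal.ofReal (9 / (n:ℝ)^2) * D T := by
    intro T n m t hn hnm ht
    have h1 : Mom 1 (g m t) < ⊤ := by rw [hgE m t ht.1]; exact hM1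
    refine (cut_err hγ0 hγ2 hb hn (hk m) (cut_le hb hnm) (cut_eq_cut hnm) ((hg m).uf t) h1).trans ?_
    rw [hgE m t ht.1]
    simp only [hD]
    gcongr
    exact hg3 T m t ht
  have hErr2 : ∀ T, ∀ n t, 0 < n → t ∈ Icc 0 T → Yp (fun v => Qk (kcut γ b n) (g n t) v - Qk (BO γ b) (g n t) v) ≤ ENNReal.ofReal (9 / (n:ℝ)^2) * D T := by
    intro T n t hn ht
    have h1 : Mom 1 (g n t) < ⊤ := by rw [hgE n t ht.1]; exact hM1
    refine (cut_err hγ0 hγ2 hb hn (CK_B hb) (hk n).le (fun p hp => by unfold kcut; rw [if_pos hp]) ((hg n).uf t) h1).trans ?_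
    rw [hgE n t ht.1]
    simp only [hD]
    gcongr
    exact hg3 T n t ht
  set CC : ℝ → ℝ≥0∞ := fun T => 2 * (KJ b * (4 * E + 4 * BT T)) with hCC
  have hCt : ∀ T, CC T < ⊤ := fun T => ENNReal.mul_lt_top (by simp) (ENNReal.mul_lt_top (KJ_lt_top hb)
    (ENNReal.add_lt_top.2 ⟨ENNReal.mul_lt_top (by simp) hM1, ENNReal.mul_lt_top (by simp) (hBt T)⟩))
  have hcau : ∀ T : ℝ, ∀ n m, 0 < n → n ≤ m → ∀ t ∈ Icc 0 T, YY (g n) (g m) t ≤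
      ENNReal.ofReal (9 / (n:ℝ)^2) * (2 * D T * ENNReal.ofReal T * ENNReal.ofReal (exp ((2 * (CC T).toReal + 1) * T))) := by
    intro T n m hn hnm t ht
    have hEE : EE (g n) (g m) = 2 * E := by unfold EE; rw [hgE n 0 le_rfl, hgE m 0 le_rfl]; ring
    have hNN : ∀ τ ∈ Icc 0 T, NN γ (g n) (g m) τ ≤ 2 * BT T := fun τ hτ => by
      unfold NN; rw [two_mul]
      exact add_le_add ((Mom_mono (by linarith) ((hg n).nonneg τ)).trans (hg3 T n τ hτ)) ((Mom_mono (by linarith) ((hg m).nonneg τ)).trans (hg3 T m τ hτ))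
    have h0 : YY (g n) (g m) 0 = 0 := by unfold YY Yp; rw [hgz, hgz]; simp
    have mY := meas_YY (hg n) (hg m)
    have hgr := gronwall (y := YY (g n) (g m)) (a := ENNReal.ofReal (9 / (n:ℝ)^2) * D T * ENNReal.ofReal T) (B := 2 * E) (C := (CC T).toReal) (T := T) ENNReal.toReal_nonneg
      (ENNReal.mul_lt_top (by simp) hM1) (fun s hs => hEE ▸ YY_le_EE (hg n) (hg m) hs.1) (fun s hs => ?_) t ht
    · refine hgr.trans ?_
      have : (2 * (CC T).toReal + 1) * t ≤ (2 * (CC T).toReal + 1) * T := mul_le_mul_of_nonneg_left ht.2 (by positivity)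
      calc _ ≤ 2 * (ENNReal.ofReal (9 / (n:ℝ)^2) * D T * ENNReal.ofReal T) * ENNReal.ofReal (exp ((2 * (CC T).toReal + 1) * T)) := by gcongr
        _ = _ := by ring
    · have hsub : ∀ τ ∈ Ioc 0 s, τ ∈ Icc 0 T := fun τ hτ => ⟨hτ.1.le, hτ.2.trans hs.2⟩
      have hNf : ∫⁻ τ in Ioc 0 s, NN γ (g n) (g m) τ < ⊤ := by
        refine (setLIntegral_mono measurable_const fun τ hτ => hNN τ (hsub τ hτ)).trans_lt ?_
        rw [lintegral_const]
        exact ENNReal.mul_lt_top (ENNReal.mul_lt_top (by simp) (hBt T)) (by simp)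
      refine (MI hγ0 hγ2 hb (hk n) (hk m) (hg n) (hg m) le_rfl hs.1 hNf (fun _ => 1) (fun _ _ => one_pos)).trans ?_
      rw [h0, zero_add]
      calc _ ≤ ∫⁻ τ in Ioc 0 s, (CC T * YY (g n) (g m) τ + ENNReal.ofReal (9 / (n:ℝ)^2) * D T) := by
            refine setLIntegral_mono (by fun_prop) fun τ hτ => ?_
            have hN := hNN τ (hsub τ hτ)
            refine add_le_add ?_ (herr T n m τ hn hnm (hsub τ hτ))
            rw [hEE]
            have hyz := YZ_le_YY (g n) (g m) τ
            calc _ ≤ 2 * (KJ b * ((ENNReal.ofReal (1 + 1 ^ 2) * (2 * E) + ENNReal.ofReal (1:ℝ)⁻¹ * (2 * BT T)) * YY (g n) (g m) τ + (2 * BT T) * YY (g n) (g m) τ)) := by gcongr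
              _ = _ := by
                simp only [hCC]
                rw [show ENNReal.ofReal (1 + 1 ^ 2) = 2 by norm_num, show ENNReal.ofReal (1:ℝ)⁻¹ = 1 by simp]
                ring
        _ = CC T * (∫⁻ τ in Ioc 0 s, YY (g n) (g m) τ) + ENNReal.ofReal (9 / (n:ℝ)^2) * D T * ENNReal.ofReal s := by
            rw [lintegral_add_right _ measurable_const, lintegral_const_mul _ mY, setLIntegral_const]
            simp
        _ ≤ _ := by
            rw [ENNReal.ofReal_toReal (hCt T).ne, add_comm]
            have := hs.2
            gcongr
  obtain ⟨f, hf, hfl⟩ := NS_limit hγ0 hγ2 hb hk (CK_B hb) hg hM1 (fun n => (hgE n 0 le_rfl).le) (fun T ε hε => by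
      obtain ⟨n0, hn0, hn⟩ := small_seq (X := 2 * D T * ENNReal.ofReal T * ENNReal.ofReal (exp ((2 * (CC T).toReal + 1) * T)))
        (ENNReal.mul_lt_top (ENNReal.mul_lt_top (ENNReal.mul_lt_top (by simp) (hDt T)) ENNReal.ofReal_lt_top) ENNReal.ofReal_lt_top) hε
      refine ⟨n0, fun n m h1 h2 t ht => ?_⟩
      rcases le_total n m with h | h
      · exact (hcau T n m (hn0.trans_le h1) h t ht).trans (hn n h1)
      · rw [YY_comm]; exact (hcau T m n (hn0.trans_le h2) h t ht).trans (hn m h2))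
    (fun T ε hε => by
      obtain ⟨n0, hn0, hn⟩ := small_seq (hDt T) hε
      exact ⟨n0, fun n h1 t ht => (Y0_le_Yp _).trans ((hErr2 T n t (hn0.trans_le h1) ht).trans (hn n h1))⟩)
  refine ⟨f, hf, ?_⟩
  refine zero_of_eps (C := 1) (by simp) fun ε hε _ => ?_
  obtain ⟨n0, hn⟩ := hfl 0 ε hε
  have := hn n0 le_rfl 0 ⟨le_rfl, le_rfl⟩
  rw [YY_comm] at this
  unfold YY at this
  rw [hgz] at this
  rwa [mul_one]

end BFD
end

noncomputable section
open MeasureTheory Real Set Filter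
open scoped RealInnerProductSpace ENNReal NNReal Topology

namespace BFD
variable {γ : ℝ} {b : ℝ → ℝ}

/-- `b` restricted to angles away from `0, π`. -/
def bmid (b : ℝ → ℝ) (d : ℝ) (t : ℝ) : ℝ := if |t| ≤ 1 - d then b t else 0

lemma bmid_le (hb : GradCutoff b) (d t : ℝ) : 0 ≤ bmid b d t ∧ bmid b d t ≤ b t := by
  unfold bmid; split_ifs
  · exact ⟨hb.nonneg _, le_rfl⟩
  · exact ⟨le_rfl, hb.nonneg _⟩

lemma meas_bmid (hb : GradCutoff b) (d : ℝ) : Measurable (bmid b d) :=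
  Measurable.ite (measurableSet_le (by fun_prop) (by fun_prop)) hb.measurable measurable_const

lemma exists_bmid (hb : GradCutoff b) : ∃ d : ℝ, 0 < d ∧ d ≤ 1 ∧ GradCutoff (bmid b d) := by
  have hint : ∀ d, IntervalIntegrable (fun θ : ℝ => bmid b d (cos θ) * sin θ) volume 0 π := fun d => by
    have h := hb.integrable
    refine h.mono_fun (Measurable.aestronglyMeasurable ?_) (Eventually.of_forall fun θ => ?_)
    · have := meas_bmid hb d; fun_prop
    · simp only [norm_mul, Real.norm_eq_abs]
      have := bmid_le hb d (cos θ)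
      rw [abs_of_nonneg this.1, abs_of_nonneg (hb.nonneg _)]
      exact mul_le_mul_of_nonneg_right this.2 (abs_nonneg _)
  have key : ∃ n : ℕ, 0 < ∫ θ in (0:ℝ)..π, bmid b (1 / ((n:ℝ) + 1)) (cos θ) * sin θ := by
    by_contra hc
    push Not at hc
    have hz : ∀ n : ℕ, ∀ᵐ θ ∂(volume.restrict (Ioc 0 π)), bmid b (1 / ((n:ℝ) + 1)) (cos θ) * sin θ = 0 := fun n => by
      have h1 := hint (1 / ((n:ℝ) + 1))
      rw [intervalIntegrable_iff_integrableOn_Ioc_of_le pi_pos.le] at h1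
      have h2 := hc n
      rw [intervalIntegral.integral_of_le pi_pos.le] at h2
      have hnn : 0 ≤ᵐ[volume.restrict (Ioc 0 π)] fun θ => bmid b (1 / ((n:ℝ) + 1)) (cos θ) * sin θ := by
        filter_upwards [ae_restrict_mem measurableSet_Ioc] with θ hθ
        exact mul_nonneg (bmid_le hb _ _).1 (sin_nonneg_of_nonneg_of_le_pi hθ.1.le hθ.2)
      exact (integral_eq_zero_iff_of_nonneg_ae hnn h1).1 (le_antisymm h2 (integral_nonneg_of_ae hnn))
    have hp := hb.pos
    rw [intervalIntegral.integral_of_le pi_pos.le] at hp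
    refine hp.ne' (integral_eq_zero_of_ae ?_)
    filter_upwards [ae_restrict_mem measurableSet_Ioc, ae_all_iff.2 hz] with θ hθ h
    rcases eq_or_lt_of_le hθ.2 with he | he
    · simp [he]
    · have hs := sin_pos_of_pos_of_lt_pi hθ.1 he
      have hc1 : |cos θ| < 1 := by
        rw [← sq_lt_one_iff_abs_lt_one]; nlinarith [sin_sq_add_cos_sq θ, sq_pos_of_pos hs]
      obtain ⟨n, hn⟩ := exists_nat_one_div_lt (sub_pos.2 hc1)
      have := h n
      rw [bmid, if_pos (by linarith)] at this
      exact this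
  obtain ⟨n, hn⟩ := key
  have h1 : (0:ℝ) < (n:ℝ) + 1 := by positivity
  refine ⟨1 / ((n:ℝ) + 1), by positivity, by rw [div_le_one h1]; linarith [(Nat.cast_nonneg n : (0:ℝ) ≤ n)], meas_bmid hb _,
    fun x => (bmid_le hb _ _).1, fun θ => ?_, hint _, hn⟩
  unfold bmid; rw [hb.symm, cos_pi_sub, abs_neg]

lemma Ib_pos (hb : GradCutoff b) : 0 < Ib b := by
  refine ENNReal.mul_pos (by simp [pi_pos]) ?_
  intro h
  have hbm := hb.measurable
  rw [lintegral_eq_zero_iff (by fun_prop)] at h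
  have hp := hb.pos
  rw [intervalIntegral.integral_of_le pi_pos.le, integral_Ioc_eq_integral_Ioo] at hp
  refine hp.ne' (integral_eq_zero_of_ae ?_)
  filter_upwards [ae_restrict_mem measurableSet_Ioo, h] with θ hθ h
  have hs := sin_pos_of_pos_of_lt_pi hθ.1 hθ.2
  simp only [Pi.zero_apply, mul_eq_zero, ENNReal.ofReal_eq_zero] at h ⊢
  rcases h with h | h
  · exact absurd h (not_le.2 hs)
  · left; exact le_antisymm h (hb.nonneg _)

/-- Geometry of good collisions. -/
lemma good_geo {M d : ℝ} (hM : 0 < M) (hd : 0 < d) (hd1 : d ≤ 1) (v w : R3) (σ : S2) (hw : ‖w‖ ^ 2 ≤ M)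
    (hc : |cosAngle v w σ| ≤ 1 - d) (hx : 32 * M / d ≤ ‖v‖ ^ 2) :
    ‖v‖ ^ 2 / 4 ≤ ‖v - w‖ ^ 2 ∧ ‖v‖ ^ 2 * d / 32 ≤ ‖vOut v w σ‖ ^ 2 ∧ ‖v‖ ^ 2 * d / 32 ≤ ‖vOutStar v w σ‖ ^ 2 ∧
    1 ≤ 4 / d ^ 2 * sA v w σ ^ 3 ∧ 1 ≤ 4 / d ^ 2 * cA v w σ ^ 3 := by
  rw [div_le_iff₀ hd] at hx
  have hc' := abs_le.1 hc
  have hs := sA_sq v w σ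
  have hcs := cA_sq v w σ
  have hA : ‖v‖ ^ 2 / 4 ≤ ‖v - w‖ ^ 2 := by
    have h1 : ‖v‖ ^ 2 ≤ 2 * ‖v - w‖ ^ 2 + 2 * ‖w‖ ^ 2 := by
      have := norm_sub_sq_le (v - w) (-w); simpa using this
    nlinarith [sq_nonneg ‖v‖]
  have g1 := geo_star_w v w σ
  have g2 := geo_vOutStar v w σ
  have h3 : vOut v w σ - w = -(vOutStar v w σ - v) := by
    have := out_add (v, w, σ)
    simp only [Q2, Q3] at this
    rw [eq_sub_of_add_eq this]; abel
  rw [← norm_neg, ← h3] at g2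
  have n1 := norm_sub_sq_le (vOut v w σ) w
  have n2 := norm_sub_sq_le (vOutStar v w σ) w
  have aux : ∀ s : ℝ, 0 ≤ s → d / 2 ≤ s ^ 2 → s ^ 2 ≤ 1 → 1 ≤ 4 / d ^ 2 * s ^ 3 := fun s h0 h1 h2 => by
    have hs1 : s ≤ 1 := by nlinarith
    have : d ^ 2 / 4 ≤ s ^ 3 := by nlinarith [mul_nonneg (pow_nonneg h0 3) (sub_nonneg.2 hs1)]
    calc (1:ℝ) = 4 / d ^ 2 * (d ^ 2 / 4) := by field_simp
      _ ≤ _ := by gcongr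
  have p1 : ‖v‖ ^ 2 / 4 * (d / 2) ≤ ‖v - w‖ ^ 2 * sA v w σ ^ 2 :=
    mul_le_mul hA (by rw [hs]; linarith) (by positivity) (by positivity)
  have p2 : ‖v‖ ^ 2 / 4 * (d / 2) ≤ ‖v - w‖ ^ 2 * cA v w σ ^ 2 :=
    mul_le_mul hA (by rw [hcs]; linarith) (by positivity) (by positivity)
  refine ⟨hA, by nlinarith, by nlinarith, aux _ (sA_nonneg _ _ _) (by rw [hs]; linarith) (by rw [hs]; linarith),
    aux _ (cA_nonneg _ _ _) (by rw [hcs]; linarith) (by rw [hcs]; linarith)⟩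

end BFD
end

noncomputable section
open MeasureTheory Real Set Filter
open scoped RealInnerProductSpace ENNReal NNReal Topology

namespace BFD
variable {γ : ℝ} {b : ℝ → ℝ}

/-- indicator of good collisions -/
def gi (M d : ℝ) (p : Om) : ℝ := if ‖p.2.1‖ ^ 2 ≤ M ∧ |cosO p| ≤ 1 - d then 1 else 0

lemma meas_cosO : Measurable cosO := by unfold cosO; fun_prop
lemma meas_gi (M d : ℝ) : Measurable (gi M d) := by
  have := meas_cosO
  have h1 : MeasurableSet {p : Om | ‖p.2.1‖ ^ 2 ≤ M} := measurableSet_le (by fun_prop) (by fun_prop)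
  have h2 : MeasurableSet {p : Om | |cosO p| ≤ 1 - d} := measurableSet_le (by fun_prop) (by fun_prop)
  exact Measurable.ite (h1.inter h2) measurable_const measurable_const
lemma gi_nonneg (M d : ℝ) (p : Om) : 0 ≤ gi M d p := by unfold gi; split_ifs <;> norm_num

lemma low_scal {s0 x d s y F : ℝ} (hx : 0 < x) (hd : 0 < d) (hs : 1 ≤ 4 / d ^ 2 * s) (hy : x * d / 32 ≤ y) (hF : 0 ≤ F) (h0 : 0 ≤ s0) :
    s0 * F ≤ s0 * s * (128 / (d ^ 3 * x) * (F * y)) := by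
  have h1 : 1 ≤ 32 / (x * d) * y := by
    rw [div_mul_eq_mul_div, le_div_iff₀ (by positivity)]; linarith
  have h2 : 1 ≤ (4 / d ^ 2 * s) * (32 / (x * d) * y) := one_le_mul_of_one_le_of_one_le hs h1
  calc s0 * F = s0 * F * 1 := by ring
    _ ≤ s0 * F * ((4 / d ^ 2 * s) * (32 / (x * d) * y)) := mul_le_mul_of_nonneg_left h2 (by positivity)
    _ = _ := by field_simp; ring

lemma half_mass {m0 E0 : ℝ} (hm0 : 0 < m0) (hE0 : 0 < E0) {f : R3 → ℝ} (hf : UF f) (h0 : ENNReal.ofReal m0 ≤ Mom 0 f)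
    (h1 : Mom 1 f ≤ ENNReal.ofReal E0) :
    ENNReal.ofReal (m0 / 2) ≤ ∫⁻ w, ENNReal.ofReal ((if ‖w‖ ^ 2 ≤ 2 * E0 / m0 then 1 else 0) * f w) := by
  have hfm := hf.meas
  set M := 2 * E0 / m0 with hM
  have hMp : 0 < M := by positivity
  have h2 : Mom 0 f ≤ (∫⁻ w, ENNReal.ofReal ((if ‖w‖ ^ 2 ≤ M then 1 else 0) * f w)) + ENNReal.ofReal M⁻¹ * Mom 1 f := by
    rw [Mom, Mom, ← lintegral_const_mul' _ _ ENNReal.ofReal_ne_top]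
    rw [← lintegral_add_right _ (by fun_prop)]
    refine lintegral_mono fun w => ?_
    have hn := hf.nonneg w
    have hp := one_le_phi w
    rw [← ENNReal.ofReal_mul (by positivity), ← ENNReal.ofReal_add (by split_ifs <;> simp [hn]) (by positivity)]
    refine ENNReal.ofReal_le_ofReal ?_
    rw [rpow_zero, rpow_one]
    split_ifs with h
    · have : 0 ≤ M⁻¹ * (f w * phi w) := by positivity
      linarith
    · push Not at h
      have : 1 ≤ M⁻¹ * phi w := by
        rw [inv_mul_eq_div, le_div_iff₀ hMp]; unfold phi; linarith
      nlinarith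
  have h3 : ENNReal.ofReal M⁻¹ * Mom 1 f ≤ ENNReal.ofReal (m0 / 2) := by
    calc _ ≤ ENNReal.ofReal M⁻¹ * ENNReal.ofReal E0 := by gcongr
      _ = _ := by rw [← ENNReal.ofReal_mul (by positivity)]; congr 1; rw [hM]; field_simp
  have h4 : ENNReal.ofReal (m0 / 2) + ENNReal.ofReal (m0 / 2) ≤
      (∫⁻ w, ENNReal.ofReal ((if ‖w‖ ^ 2 ≤ M then 1 else 0) * f w)) + ENNReal.ofReal (m0 / 2) := by
    rw [← ENNReal.ofReal_add (by positivity) (by positivity), add_halves]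
    exact h0.trans (h2.trans (by gcongr))
  exact (ENNReal.add_le_add_iff_right ENNReal.ofReal_ne_top).1 h4

lemma low_pt (hγ0 : 0 ≤ γ) (hγ2 : γ ≤ 2) (hb : GradCutoff b) {d : ℝ} (hd : 0 < d) (hd1 : d ≤ 1) (hb' : GradCutoff (bmid b d))
    {m0 E0 : ℝ} (hm0 : 0 < m0) (hE0 : 0 < E0) : ∃ M X1 c : ℝ, 0 < M ∧ 1 ≤ X1 ∧ 32 * M / d ≤ X1 ∧ 0 < c ∧
      ∀ f : R3 → ℝ, UF f → ENNReal.ofReal m0 ≤ Mom 0 f → Mom 1 f ≤ ENNReal.ofReal E0 → ∀ v, X1 ≤ ‖v‖ ^ 2 →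
        ENNReal.ofReal (c * (‖v‖ ^ 2) ^ (γ / 2)) ≤ ∫⁻ w, ∫⁻ σ, ENNReal.ofReal (BO γ b (v, w, σ) * gi M d (v, w, σ) *
          (f w * (1 - f (vOut v w σ)) * (1 - f (vOutStar v w σ)))) ∂sphMeasure := by
  have hbm := meas_bmid hb d
  set I := (Ib (bmid b d)).toReal with hI
  set κ := (Ccv (bmid b d)).toReal with hκ
  have hIe : Ib (bmid b d) = ENNReal.ofReal I := (ENNReal.ofReal_toReal (Ib_lt_top hb').ne).symm
  have hκe : Ccv (bmid b d) = ENNReal.ofReal κ := (ENNReal.ofReal_toReal (Ccv_lt_top hb').ne).symm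
  have hIp : 0 < I := ENNReal.toReal_pos (Ib_pos hb').ne' (Ib_lt_top hb').ne
  have hκp : 0 ≤ κ := ENNReal.toReal_nonneg
  set M := 2 * E0 / m0 with hM
  have hMp : 0 < M := by positivity
  set K := 128 / d ^ 3 * κ * E0 with hK
  have hKp : 0 ≤ K := by positivity
  refine ⟨M, max (max 1 (32 * M / d)) (8 * K / (I * m0)), I * m0 / 16, hMp, (le_max_left _ _).trans (le_max_left _ _),
    (le_max_right _ _).trans (le_max_left _ _), by positivity, fun f hf h0 h1 v hv => ?_⟩
  have hv1 : 1 ≤ ‖v‖ ^ 2 := ((le_max_left _ _).trans (le_max_left _ _)).trans hv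
  have hv2 : 32 * M / d ≤ ‖v‖ ^ 2 := ((le_max_right _ _).trans (le_max_left _ _)).trans hv
  have hv3 : 8 * K / (I * m0) ≤ ‖v‖ ^ 2 := (le_max_right _ _).trans hv
  set x := ‖v‖ ^ 2 with hx
  have hxp : 0 < x := by linarith
  have hfm := hf.meas
  set J : ℝ≥0∞ := ∫⁻ w, ∫⁻ σ, ENNReal.ofReal (bmid b d (cosAngle v w σ) * ((if ‖w‖ ^ 2 ≤ M then 1 else 0) *
          (f w * (1 - f (vOut v w σ)) * (1 - f (vOutStar v w σ))))) ∂sphMeasure with hJ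
  set G : R3 → ℝ≥0∞ := fun y => ENNReal.ofReal (128 / (d ^ 3 * x) * (f y * ‖y‖ ^ 2)) with hG
  have hGm : Measurable G := by fun_prop
  have hGi : Ccv (bmid b d) * ∫⁻ y, G y ≤ ENNReal.ofReal (K / x) := by
    have : ∫⁻ y, G y ≤ ENNReal.ofReal (128 / (d ^ 3 * x)) * Mom 1 f := by
      rw [Mom, ← lintegral_const_mul' _ _ ENNReal.ofReal_ne_top]
      refine lintegral_mono fun y => ?_
      rw [hG, ← ENNReal.ofReal_mul (by positivity)]
      refine ENNReal.ofReal_le_ofReal ?_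
      have hn := hf.nonneg y
      rw [rpow_one]; unfold phi
      gcongr; linarith
    calc _ ≤ ENNReal.ofReal κ * (ENNReal.ofReal (128 / (d ^ 3 * x)) * ENNReal.ofReal E0) := by
          rw [hκe]; gcongr; exact this.trans (by gcongr)
      _ = _ := by
          rw [← ENNReal.ofReal_mul (by positivity), ← ENNReal.ofReal_mul (by positivity)]
          congr 1; rw [hK]; field_simp
  have hS : ENNReal.ofReal (I * m0 / 2) ≤ J + ENNReal.ofReal (2 * (K / x)) := by
    calc ENNReal.ofReal (I * m0 / 2) = ENNReal.ofReal I * ENNReal.ofReal (m0 / 2) := by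
          rw [← ENNReal.ofReal_mul hIp.le]; congr 1; ring
      _ ≤ Ib (bmid b d) * ∫⁻ w, ENNReal.ofReal ((if ‖w‖ ^ 2 ≤ M then 1 else 0) * f w) := by
          rw [hIe]; gcongr; exact half_mass hm0 hE0 hf h0 h1
      _ = ∫⁻ w, ∫⁻ σ, ENNReal.ofReal (bmid b d (cosAngle v w σ)) * ENNReal.ofReal ((if ‖w‖ ^ 2 ≤ M then 1 else 0) * f w) ∂sphMeasure :=
          (lint_ang hb' v _).symm
      _ ≤ ∫⁻ w, ∫⁻ σ, (ENNReal.ofReal (bmid b d (cosAngle v w σ) * ((if ‖w‖ ^ 2 ≤ M then 1 else 0) *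
          (f w * (1 - f (vOut v w σ)) * (1 - f (vOutStar v w σ))))) +
          (ENNReal.ofReal (bmid b d (cosAngle v w σ)) * ENNReal.ofReal (sA v w σ ^ 3) * G (vOut v w σ) +
          ENNReal.ofReal (bmid b d (cosAngle v w σ)) * ENNReal.ofReal (cA v w σ ^ 3) * G (vOutStar v w σ))) ∂sphMeasure := by
          refine lintegral_mono fun w => lintegral_mono fun σ => ?_
          simp only
          have hbn := (bmid_le hb d (cosAngle v w σ)).1
          by_cases hw : ‖w‖ ^ 2 ≤ M
          swap
          · simp [hw]
          by_cases hc : |cosAngle v w σ| ≤ 1 - d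
          swap
          · simp [bmid, hc]
          obtain ⟨g1, g2, g3, g4, g5⟩ := good_geo hMp hd hd1 v w σ hw hc hv2
          simp only [hw, if_true, one_mul, hG]
          have e1 := hf.nonneg w; have e2 := hf.nonneg (vOut v w σ); have e3 := hf.nonneg (vOutStar v w σ)
          have l1 := hf.le_one w; have l2 := hf.le_one (vOut v w σ); have l3 := hf.le_one (vOutStar v w σ)
          have s1 := sA_nonneg v w σ; have s2 := cA_nonneg v w σ
          have n1 : 0 ≤ f w * (1 - f (vOut v w σ)) * (1 - f (vOutStar v w σ)) :=
            mul_nonneg (mul_nonneg e1 (by linarith)) (by linarith)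
          rw [← ENNReal.ofReal_mul hbn, ← ENNReal.ofReal_mul hbn, ← ENNReal.ofReal_mul hbn, ← ENNReal.ofReal_mul (by positivity),
            ← ENNReal.ofReal_mul (by positivity), ← ENNReal.ofReal_add (by positivity) (by positivity),
            ← ENNReal.ofReal_add (by positivity) (by positivity)]
          refine ENNReal.ofReal_le_ofReal ?_
          have c1 := low_scal hxp hd g4 g2 e2 hbn
          have c2 := low_scal hxp hd g5 g3 e3 hbn
          have c3 : f w ≤ f w * (1 - f (vOut v w σ)) * (1 - f (vOutStar v w σ)) + (f (vOut v w σ) + f (vOutStar v w σ)) := by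
            nlinarith [mul_nonneg e2 e3, mul_nonneg (mul_nonneg e1 e2) e3, mul_nonneg (sub_nonneg.2 l1) e2, mul_nonneg (sub_nonneg.2 l1) e3]
          have c4 := mul_le_mul_of_nonneg_left c3 hbn
          rw [mul_add, mul_add] at c4
          linarith
      _ ≤ J + (ENNReal.ofReal (K / x) + ENNReal.ofReal (K / x)) := by
          have hadd : ∀ w, ∫⁻ σ, (ENNReal.ofReal (bmid b d (cosAngle v w σ) * ((if ‖w‖ ^ 2 ≤ M then 1 else 0) *
            (f w * (1 - f (vOut v w σ)) * (1 - f (vOutStar v w σ))))) +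
            (ENNReal.ofReal (bmid b d (cosAngle v w σ)) * ENNReal.ofReal (sA v w σ ^ 3) * G (vOut v w σ) +
            ENNReal.ofReal (bmid b d (cosAngle v w σ)) * ENNReal.ofReal (cA v w σ ^ 3) * G (vOutStar v w σ))) ∂sphMeasure =
            (∫⁻ σ, ENNReal.ofReal (bmid b d (cosAngle v w σ) * ((if ‖w‖ ^ 2 ≤ M then 1 else 0) *
              (f w * (1 - f (vOut v w σ)) * (1 - f (vOutStar v w σ))))) ∂sphMeasure) +
            ((∫⁻ σ, ENNReal.ofReal (bmid b d (cosAngle v w σ)) * ENNReal.ofReal (sA v w σ ^ 3) * G (vOut v w σ) ∂sphMeasure) +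
            ∫⁻ σ, ENNReal.ofReal (bmid b d (cosAngle v w σ)) * ENNReal.ofReal (cA v w σ ^ 3) * G (vOutStar v w σ) ∂sphMeasure) := fun w => by
            rw [lintegral_add_right _ (by fun_prop), lintegral_add_right _ (by fun_prop)]
          simp only [hadd]
          rw [lintegral_add_right _ (by fun_prop), lintegral_add_right _ (by fun_prop)]
          gcongr
          · exact (cv_prime hb' v G hGm).trans hGi
          · exact (cv_star hb' v G hGm).trans hGi
      _ = _ := by rw [← ENNReal.ofReal_add (by positivity) (by positivity)]; congr 2; ring
  have hJl : ENNReal.ofReal (I * m0 / 4) ≤ J := by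
    have h2 : 2 * (K / x) ≤ I * m0 / 4 := by
      rw [div_le_iff₀ (by positivity)] at hv3
      rw [← mul_div_assoc, div_le_iff₀ hxp]; linarith
    have h3 : ENNReal.ofReal (I * m0 / 4) + ENNReal.ofReal (I * m0 / 4) ≤ J + ENNReal.ofReal (I * m0 / 4) := by
      rw [← ENNReal.ofReal_add (by positivity) (by positivity)]
      refine le_trans (le_of_eq ?_) (hS.trans (by gcongr))
      congr 1; ring
    exact (ENNReal.add_le_add_iff_right ENNReal.ofReal_ne_top).1 h3
  calc ENNReal.ofReal (I * m0 / 16 * x ^ (γ / 2)) = ENNReal.ofReal (x ^ (γ / 2) / 4) * ENNReal.ofReal (I * m0 / 4) := by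
        rw [← ENNReal.ofReal_mul (by positivity)]; congr 1; ring
    _ ≤ ENNReal.ofReal (x ^ (γ / 2) / 4) * J := by gcongr
    _ ≤ _ := by
        rw [hJ, ← lintegral_const_mul' _ _ ENNReal.ofReal_ne_top]
        refine lintegral_mono fun w => ?_
        rw [← lintegral_const_mul' _ _ ENNReal.ofReal_ne_top]
        refine lintegral_mono fun σ => ?_
        rw [← ENNReal.ofReal_mul (by positivity)]
        by_cases hw : ‖w‖ ^ 2 ≤ M
        swap
        · simp [hw]
        by_cases hc : |cosAngle v w σ| ≤ 1 - d
        swap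
        · simp [bmid, hc]
        obtain ⟨g1, -⟩ := good_geo hMp hd hd1 v w σ hw hc hv2
        refine ENNReal.ofReal_le_ofReal ?_
        have hgi : gi M d (v, w, σ) = 1 := by unfold gi; rw [if_pos ⟨hw, hc⟩]
        have hbe : bmid b d (cosAngle v w σ) = b (cosAngle v w σ) := by unfold bmid; rw [if_pos hc]
        simp only [hw, if_true, one_mul, hgi, hbe, mul_one, BO, Bker]
        have e1 := hf.nonneg w
        have l2 := hf.le_one (vOut v w σ); have l3 := hf.le_one (vOutStar v w σ)
        have n1 : 0 ≤ f w * (1 - f (vOut v w σ)) * (1 - f (vOutStar v w σ)) :=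
          mul_nonneg (mul_nonneg e1 (by linarith)) (by linarith)
        rw [← mul_assoc]
        refine mul_le_mul_of_nonneg_right (mul_le_mul_of_nonneg_right ?_ (hb.nonneg _)) n1
        rw [rpow_norm_eq]
        calc x ^ (γ / 2) / 4 ≤ (x / 4) ^ (γ / 2) := by
              rw [div_rpow hxp.le (by norm_num)]
              gcongr
              calc (4:ℝ) ^ (γ / 2) ≤ 4 ^ (1:ℝ) := rpow_le_rpow_of_exponent_le (by norm_num) (by linarith)
                _ = 4 := rpow_one _
          _ ≤ _ := rpow_le_rpow (by positivity) g1 (by linarith)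

/-- lower bound for the loss on good collisions. -/
lemma low_W {M d c X1 : ℝ} (hb : GradCutoff b) {f : R3 → ℝ} (hf : UF f)
    (h : ∀ v, X1 ≤ ‖v‖ ^ 2 → ENNReal.ofReal (c * (‖v‖ ^ 2) ^ (γ / 2)) ≤ ∫⁻ w, ∫⁻ σ, ENNReal.ofReal (BO γ b (v, w, σ) * gi M d (v, w, σ) *
          (f w * (1 - f (vOut v w σ)) * (1 - f (vOutStar v w σ)))) ∂sphMeasure)
    {W : R3 → ℝ} (hW : Measurable W) (hW0 : ∀ v, 0 ≤ W v) (hWX : ∀ v, ‖v‖ ^ 2 < X1 → W v = 0) :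
    ∫⁻ v, ENNReal.ofReal (f v * W v) * ENNReal.ofReal (c * (‖v‖ ^ 2) ^ (γ / 2)) ≤
      ∫⁻ p, ENNReal.ofReal (HL (BO γ b) f p * (gi M d p * W p.1)) ∂mu0 := by
  have hfm := hf.meas
  have hB := (CK_B (γ := γ) hb).meas
  have hg := meas_gi M d
  rw [lint_mu0 _ (by unfold HL Q2 Q3; fun_prop)]
  refine lintegral_mono fun v => ?_
  simp only
  by_cases hv : ‖v‖ ^ 2 < X1
  · simp [hWX v hv]
  · refine (mul_le_mul_right (h v (not_lt.1 hv)) _).trans ?_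
    rw [← lintegral_const_mul' _ _ ENNReal.ofReal_ne_top]
    refine lintegral_mono fun w => ?_
    rw [← lintegral_const_mul' _ _ ENNReal.ofReal_ne_top]
    refine lintegral_mono fun σ => ?_
    rw [← ENNReal.ofReal_mul (mul_nonneg (hf.nonneg _) (hW0 _))]
    refine ENNReal.ofReal_le_ofReal (le_of_eq ?_)
    simp only [HL, Q2, Q3]; ring

end BFD
end

noncomputable section
open MeasureTheory Real Set Filter
open scoped RealInnerProductSpace ENNReal NNReal Topology

namespace BFD
variable {γ : ℝ} {b : ℝ → ℝ}

lemma abs_ineq {α : Type*} [MeasurableSpace α] {μ : Measure α} {L H G : α → ℝ} (hLm : Measurable L) (hGm : Measurable G)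
    (hH : Integrable H μ) (hL : ∀ᵐ x ∂μ, 0 ≤ L x) (hG : ∀ᵐ x ∂μ, 0 ≤ G x) (h : ∀ᵐ x ∂μ, L x ≤ H x + G x) :
    ∫⁻ x, ENNReal.ofReal (L x) ∂μ ≤ ∫⁻ x, ENNReal.ofReal (G x) ∂μ + ENNReal.ofReal (∫ x, H x ∂μ) := by
  by_cases ht : ∫⁻ x, ENNReal.ofReal (G x) ∂μ = ⊤
  · simp [ht]
  have hGi : Integrable G μ := (lintegral_ofReal_ne_top_iff_integrable hGm.aestronglyMeasurable hG).1 ht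
  have hLi : Integrable L μ := by
    refine (hH.norm.add hGi).mono' hLm.aestronglyMeasurable ?_
    filter_upwards [hL, hG, h] with x h1 h2 h3
    rw [Real.norm_eq_abs, abs_of_nonneg h1]
    exact h3.trans (add_le_add (le_abs_self _) le_rfl)
  rw [← ofReal_integral_eq_lintegral_ofReal hLi hL, ← ofReal_integral_eq_lintegral_ofReal hGi hG, add_comm]
  refine le_trans (ENNReal.ofReal_le_ofReal ?_) ENNReal.ofReal_add_le
  rw [← integral_add hH hGi]
  exact integral_mono_ae hLi (hH.add hGi) h

/-- collision increment -/
def PP (ψ : R3 → ℝ) (p : Om) : ℝ := ψ (Q2 p) + ψ (Q3 p) - ψ p.1 - ψ p.2.1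

lemma meas_HLt {f : ℝ → R3 → ℝ} (hb : GradCutoff b) (h : NS (BO γ b) f) :
    Measurable fun z : ℝ × Om => HL (BO γ b) (f z.1) z.2 := by
  have hB := (CK_B (γ := γ) hb).meas
  have hf := h.meas
  have e : ∀ {u : ℝ × Om → R3}, Measurable u → Measurable fun z : ℝ × Om => f z.1 (u z) := fun {u} hu =>
    hf.comp (measurable_fst.prodMk hu)
  have h1 := e (u := fun z => z.2.1) (by fun_prop)
  have h2 := e (u := fun z => z.2.2.1) (by fun_prop)
  have h3 := e (u := fun z => Q2 z.2) (by unfold Q2; fun_prop)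
  have h4 := e (u := fun z => Q3 z.2) (by unfold Q3; fun_prop)
  unfold HL
  fun_prop

lemma meas_PP {ψ : R3 → ℝ} (hψ : Measurable ψ) : Measurable (PP ψ) := by
  unfold PP Q2 Q3; fun_prop

lemma time_weak (hγ0 : 0 ≤ γ) (hγ2 : γ ≤ 2) (hb : GradCutoff b) {f : ℝ → R3 → ℝ} (h : NS (BO γ b) f) {s t : ℝ} (hs : 0 ≤ s) (hst : s ≤ t)
    {ψ : R3 → ℝ} (hψ : Measurable ψ) {C : ℝ} (hC : ∀ v, |ψ v| ≤ C) :
    Integrable (fun z : ℝ × Om => HL (BO γ b) (f z.1) z.2 * PP ψ z.2) ((volume.restrict (Ioc s t)).prod mu0) ∧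
    ∫ z, HL (BO γ b) (f z.1) z.2 * PP ψ z.2 ∂((volume.restrict (Ioc s t)).prod mu0) =
      2 * ((∫ v, f t v * ψ v) - ∫ v, f s v * ψ v) := by
  have hk := CK_B (γ := γ) hb
  have hm := meas_HLt hb h
  have hP := meas_PP hψ
  have hC0 : 0 ≤ C := (abs_nonneg _).trans (hC 0)
  set E := Mom 1 (f 0) with hE
  have hEt : E < ⊤ := h.fin 0 le_rfl
  have hI := Ib_lt_top hb
  have hLb : ∀ τ, 0 ≤ τ → Lbil γ b (fun _ => 1) (f τ) ≤ 8 * Ib b * (E * E) := fun τ hτ => by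
    rw [hE, ← h.en hτ]; exact Lbil_one hγ0 hγ2 hb (h.uf τ)
  have hLt : 8 * Ib b * (E * E) < ⊤ := ENNReal.mul_lt_top (ENNReal.mul_lt_top (by simp) hI) (ENNReal.mul_lt_top hEt hEt)
  have hint : Integrable (fun z : ℝ × Om => HL (BO γ b) (f z.1) z.2 * PP ψ z.2) ((volume.restrict (Ioc s t)).prod mu0) := by
    refine ⟨Measurable.aestronglyMeasurable (by fun_prop), ?_⟩
    rw [hasFiniteIntegral_iff_norm, lintegral_prod _ (Measurable.aemeasurable (by fun_prop))]
    calc _ ≤ ∫⁻ τ in Ioc s t, ENNReal.ofReal (4 * C) * (8 * Ib b * (E * E)) := by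
          refine setLIntegral_mono measurable_const fun τ hτ => ?_
          refine le_trans ?_ (mul_le_mul_right (hLb τ (hs.trans hτ.1.le)) _)
          rw [Lbil, ← lintegral_const_mul' _ _ ENNReal.ofReal_ne_top]
          refine lintegral_mono fun p => ?_
          rw [← ENNReal.ofReal_mul (by positivity)]
          refine ENNReal.ofReal_le_ofReal ?_
          have h1 := HL_nonneg hk (h.uf τ) p
          rw [norm_mul, Real.norm_eq_abs, Real.norm_eq_abs, abs_of_nonneg h1.1, mul_one, mul_comm]
          refine mul_le_mul ?_ h1.2 h1.1 (by positivity)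
          unfold PP
          have a1 := abs_le.1 (hC (Q2 p)); have a2 := abs_le.1 (hC (Q3 p)); have a3 := abs_le.1 (hC p.1); have a4 := abs_le.1 (hC p.2.1)
          rw [abs_le]; constructor <;> linarith
      _ < ⊤ := by
          rw [setLIntegral_const]
          exact ENNReal.mul_lt_top (ENNReal.mul_lt_top ENNReal.ofReal_lt_top hLt) (by simp)
  refine ⟨hint, ?_⟩
  have hev := (evol (h.measQ hk) hst hψ (F0 := f s) (Ft := f t) ((h.mild' hγ0 hγ2 hb hk).mono fun v hv => hv s t hs (hs.trans hst)) ?_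
    (int_of_Mom (h.uf s) (h.fin s hs) hψ (C := C) fun v => (hC v).trans (le_mul_of_one_le_right hC0 (one_le_phi v)))).2.2
  · rw [integral_prod _ hint, hev, add_sub_cancel_left, ← integral_const_mul]
    refine setIntegral_congr_fun measurableSet_Ioc fun τ hτ => ?_
    have := (weak_form hb hk WT_one (h.uf τ) ((hLb τ (hs.trans hτ.1.le)).trans_lt hLt) hψ (C := C) (fun v => by simpa using hC v)).2
    simp only
    rw [this]
    simp only [PP]
    ring
  · calc _ ≤ ∫⁻ τ in Ioc s t, ENNReal.ofReal C * (24 * Ib b * (E * E)) := by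
          refine setLIntegral_mono measurable_const fun τ hτ => ?_
          have h1 := Y0_Qk hγ0 hγ2 hb hk (h.uf τ)
          rw [h.en (hs.trans hτ.1.le)] at h1
          refine le_trans ?_ (mul_le_mul_right h1 _)
          rw [Y0, ← lintegral_const_mul' _ _ ENNReal.ofReal_ne_top]
          refine lintegral_mono fun v => ?_
          rw [← ENNReal.ofReal_mul (by positivity)]
          refine ENNReal.ofReal_le_ofReal ?_
          rw [abs_mul, mul_comm]
          exact mul_le_mul_of_nonneg_right (hC v) (abs_nonneg _)
      _ < ⊤ := by
          rw [setLIntegral_const]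
          exact ENNReal.mul_lt_top (ENNReal.mul_lt_top ENNReal.ofReal_lt_top (ENNReal.mul_lt_top (ENNReal.mul_lt_top (by simp) hI) (ENNReal.mul_lt_top hEt hEt))) (by simp)

/-- Abstract Povzner estimate. -/
lemma povz (hγ0 : 0 ≤ γ) (hγ2 : γ ≤ 2) (hb : GradCutoff b) {f : ℝ → R3 → ℝ} (h : NS (BO γ b) f) {s t : ℝ} (hs : 0 ≤ s) (hst : s ≤ t)
    {ψ : R3 → ℝ} (hψ : Measurable ψ) {C : ℝ} (hC : ∀ v, |ψ v| ≤ C) {L G : Om → ℝ} (hL : Measurable L) (hG : Measurable G)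
    (hL0 : ∀ p, 0 ≤ L p) (hG0 : ∀ p, 0 ≤ G p) (hLG : ∀ p, L p ≤ PP ψ p + G p) :
    ∫⁻ τ in Ioc s t, (∫⁻ p, ENNReal.ofReal (HL (BO γ b) (f τ) p * L p) ∂mu0) ≤
      (∫⁻ τ in Ioc s t, (∫⁻ p, ENNReal.ofReal (HL (BO γ b) (f τ) p * G p) ∂mu0)) +
        ENNReal.ofReal (2 * ((∫ v, f t v * ψ v) - ∫ v, f s v * ψ v)) := by
  have hk := CK_B (γ := γ) hb
  have hm := meas_HLt hb h
  have hP := meas_PP hψ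
  obtain ⟨h1, h2⟩ := time_weak hγ0 hγ2 hb h hs hst hψ hC
  rw [← h2]
  have hn : ∀ z : ℝ × Om, 0 ≤ HL (BO γ b) (f z.1) z.2 := fun z => (HL_nonneg hk (h.uf _) _).1
  have := abs_ineq (μ := (volume.restrict (Ioc s t)).prod mu0) (L := fun z => HL (BO γ b) (f z.1) z.2 * L z.2)
    (G := fun z => HL (BO γ b) (f z.1) z.2 * G z.2) (by fun_prop) (by fun_prop) h1
    (ae_of_all _ fun z => mul_nonneg (hn z) (hL0 _)) (ae_of_all _ fun z => mul_nonneg (hn z) (hG0 _))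
    (ae_of_all _ fun z => by rw [← mul_add]; exact mul_le_mul_of_nonneg_left (hLG _) (hn z))
  rw [lintegral_prod _ (Measurable.aemeasurable (by fun_prop)), lintegral_prod _ (Measurable.aemeasurable (by fun_prop))] at this
  exact this

end BFD
end

noncomputable section
open MeasureTheory Real Set Filter
open scoped RealInnerProductSpace ENNReal NNReal Topology

namespace BFD

lemma min_subadd {R p a c : ℝ} (ha : 0 ≤ a) (hc : 0 ≤ c) (hR : 0 ≤ R) (hp0 : 0 ≤ p) (hp1 : p ≤ 1) :
    min (a + c) R ^ p ≤ min a R ^ p + min c R ^ p := by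
  refine le_trans (rpow_le_rpow (by positivity) ?_ hp0) (rpow_add_le_add_rpow (by positivity) (by positivity) hp0 hp1)
  rcases min_cases a R with h | h <;> rcases min_cases c R with h' | h' <;> rcases min_cases (a+c) R with h'' | h'' <;> linarith

/-- concave weights, general bound -/
lemma unt_gen {R p x y x' y' : ℝ} (hx : 0 ≤ x) (hy : 0 ≤ y) (hx' : 0 ≤ x') (hy' : 0 ≤ y') (he : x' + y' = x + y) (hR : 0 ≤ R)
    (hp0 : 0 ≤ p) (hp1 : p ≤ 1) :
    0 ≤ min x' R ^ p + min y' R ^ p - min x R ^ p - min y R ^ p + min x y ^ p := by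
  have h1 := min_subadd hx' hy' hR hp0 hp1
  rw [he] at h1
  have m : ∀ u w : ℝ, 0 ≤ u → u ≤ w → min u R ^ p ≤ min w R ^ p := fun u w h0 h =>
    rpow_le_rpow (le_min h0 hR) (min_le_min_right _ h) hp0
  have h2 := m x (x + y) hx (by linarith)
  have h3 := m y (x + y) hy (by linarith)
  rcases le_total x y with h | h
  · rw [min_eq_left h]
    have : min x R ^ p ≤ x ^ p := rpow_le_rpow (le_min hx hR) (min_le_left _ _) hp0
    linarith
  · rw [min_eq_right h]
    have : min y R ^ p ≤ y ^ p := rpow_le_rpow (le_min hy hR) (min_le_left _ _) hp0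
    linarith

lemma unt_good {R p x y x' y' δ : ℝ} (hx : 0 < x) (hy : 0 ≤ y) (he : x' + y' = x + y) (heR : x + y ≤ R) (hδ : 0 < δ) (hδ1 : δ < 1)
    (hp0 : 0 < p) (hp1 : p ≤ 1) (h1 : δ * (x + y) ≤ x') (h2 : δ * (x + y) ≤ y') (hyx : y ≤ x) :
    ((1 - δ) ^ (p - 1) - 1) * x ^ p ≤ min x' R ^ p + min y' R ^ p - min x R ^ p - min y R ^ p + min x y ^ p := by
  have hep : 0 < x + y := by linarith
  have hx' : 0 < x' := lt_of_lt_of_le (by positivity) h1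
  have hy' : 0 < y' := lt_of_lt_of_le (by positivity) h2
  rw [min_eq_left (by linarith : x' ≤ R), min_eq_left (by linarith : y' ≤ R), min_eq_left (by linarith : x ≤ R),
    min_eq_left (by linarith : y ≤ R), min_eq_right hyx]
  have hc : 0 < (1 - δ) * (x + y) := mul_pos (by linarith) hep
  have aux : ∀ u, 0 < u → u ≤ (1 - δ) * (x + y) → u * ((1 - δ) * (x + y)) ^ (p - 1) ≤ u ^ p := fun u hu hle => by
    calc u * ((1 - δ) * (x + y)) ^ (p - 1) ≤ u * u ^ (p - 1) := by
          have hz : p - 1 ≤ 0 := by linarith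
          exact mul_le_mul_of_nonneg_left (rpow_le_rpow_of_nonpos hu hle hz) hu.le
      _ = u ^ p := by rw [← rpow_one_add' hu.le (y := p - 1) (by rw [add_sub_cancel]; exact hp0.ne')]; congr 1; ring
  have a1 := aux x' hx' (by linarith)
  have a2 := aux y' hy' (by linarith)
  have a3 : (1 - δ) ^ (p - 1) * x ^ p ≤ (x' + y') * ((1 - δ) * (x + y)) ^ (p - 1) := by
    rw [he, mul_rpow (by linarith) hep.le]
    have : (x + y) * (x + y) ^ (p - 1) = (x + y) ^ p := by
      rw [← rpow_one_add' hep.le (y := p - 1) (by rw [add_sub_cancel]; exact hp0.ne')]; congr 1; ring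
    calc (1 - δ) ^ (p - 1) * x ^ p ≤ (1 - δ) ^ (p - 1) * (x + y) ^ p := by
          have : 0 ≤ 1 - δ := by linarith
          gcongr; linarith
      _ = _ := by rw [← this]; ring
  nlinarith

lemma unt_kap {p δ : ℝ} (hδ : 0 < δ) (hδ1 : δ < 1) (hp1 : p < 1) : 0 < (1 - δ) ^ (p - 1) - 1 := by
  have := one_lt_rpow_of_pos_of_lt_one_of_neg (by linarith : 0 < 1 - δ) (by linarith) (by linarith : p - 1 < 0)
  linarith

/-- convex weights: general bound -/
lemma tim_gen {R η x y x' y' : ℝ} (hx : 0 ≤ x) (hy : 0 ≤ y) (hx' : 0 ≤ x') (hy' : 0 ≤ y') (he : x' + y' = x + y) (hR : 0 ≤ R)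
    (hη : 0 < η) (hη1 : η ≤ 1) :
    x' * min x' R ^ η + y' * min y' R ^ η - x * min x R ^ η - y * min y R ^ η ≤ 3 * (min x y * max x y ^ η) := by
  have m : ∀ u w : ℝ, 0 ≤ u → u ≤ w → min u R ^ η ≤ min w R ^ η := fun u w h0 h =>
    rpow_le_rpow (le_min h0 hR) (min_le_min_right _ h) hη.le
  have h1 : x' * min x' R ^ η + y' * min y' R ^ η ≤ (x + y) * min (x + y) R ^ η := by
    have a := mul_le_mul_of_nonneg_left (m x' (x + y) hx' (by linarith)) hx'
    have c := mul_le_mul_of_nonneg_left (m y' (x + y) hy' (by linarith)) hy'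
    rw [← he] at *; linarith
  have key : ∀ X u : ℝ, 0 ≤ u → u ≤ X → (X + u) * min (X + u) R ^ η - X * min X R ^ η ≤ 3 * (u * X ^ η) := fun X u hu huX => by
    rcases eq_or_lt_of_le (hu.trans huX) with h0 | h0
    · have : u = 0 := by linarith
      simp [← h0, this]
    · have ht : 1 ≤ (X + u) / X := by rw [le_div_iff₀ h0]; linarith
      have hmin : min (X + u) R ≤ (X + u) / X * min X R := by
        rcases min_cases X R with ⟨h, -⟩ | ⟨h, -⟩
        · rw [h, div_mul_cancel₀ _ h0.ne']; exact min_le_left _ _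
        · rw [h]; exact (min_le_right _ _).trans (le_mul_of_one_le_left hR ht)
      have h2 : min (X + u) R ^ η ≤ (X + u) / X * min X R ^ η := by
        refine (rpow_le_rpow (le_min (by linarith) hR) hmin hη.le).trans ?_
        rw [mul_rpow (by positivity) (le_min h0.le hR)]
        refine mul_le_mul_of_nonneg_right ?_ (rpow_nonneg (le_min h0.le hR) _)
        calc ((X + u) / X) ^ η ≤ ((X + u) / X) ^ (1:ℝ) := rpow_le_rpow_of_exponent_le ht hη1
          _ = _ := rpow_one _
      have h3 : min X R ^ η ≤ X ^ η := rpow_le_rpow (le_min h0.le hR) (min_le_left _ _) hη.le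
      have h4 : 0 ≤ min X R ^ η := rpow_nonneg (le_min h0.le hR) _
      have h5 : (X + u) * min (X + u) R ^ η ≤ (X + u) * ((X + u) / X) * min X R ^ η := by
        rw [mul_assoc]; gcongr
      have h6 : (X + u) * ((X + u) / X) ≤ X + 3 * u := by
        rw [← mul_div_assoc, div_le_iff₀ h0]; nlinarith
      have h7 := mul_le_mul_of_nonneg_right h6 h4
      have h8 := mul_le_mul_of_nonneg_left h3 hu
      linarith
  have n1 : 0 ≤ x * min x R ^ η := mul_nonneg hx (rpow_nonneg (le_min hx hR) _)
  have n2 : 0 ≤ y * min y R ^ η := mul_nonneg hy (rpow_nonneg (le_min hy hR) _)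
  rcases le_total x y with h | h
  · rw [min_eq_left h, max_eq_right h]
    have := key y x hx h
    rw [add_comm y x] at this
    linarith
  · rw [min_eq_right h, max_eq_left h]
    have := key x y hy h
    linarith

lemma tim_good {R η x y x' y' δ M : ℝ} (hx : 0 < x) (hy : 0 ≤ y) (hyM : y ≤ M) (he : x' + y' = x + y) (heR : x + y ≤ R) (hδ : 0 < δ) (hδ1 : δ < 1)
    (hη : 0 < η) (hη1 : η ≤ 1) (h1 : δ * (x + y) ≤ x') (h2 : δ * (x + y) ≤ y') (hMx : M ≤ x) (hX : 6 * M / (1 - (1 - δ) ^ η) ≤ x) :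
    (1 - (1 - δ) ^ η) / 2 * x ^ (1 + η) ≤ -(x' * min x' R ^ η + y' * min y' R ^ η - x * min x R ^ η - y * min y R ^ η) := by
  set q := (1 - δ) ^ η with hq
  have hq1 : q < 1 := rpow_lt_one (by linarith) (by linarith) hη
  have hq0 : 0 ≤ q := rpow_nonneg (by linarith) _
  have hep : 0 < x + y := by linarith
  have hx' : 0 < x' := lt_of_lt_of_le (by positivity) h1
  have hy' : 0 < y' := lt_of_lt_of_le (by positivity) h2
  rw [min_eq_left (by linarith : x' ≤ R), min_eq_left (by linarith : y' ≤ R), min_eq_left (by linarith : x ≤ R),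
    min_eq_left (by linarith : y ≤ R)]
  have aux : ∀ u, 0 < u → u ≤ (1 - δ) * (x + y) → u ^ η ≤ q * (x + y) ^ η := fun u hu hle => by
    rw [hq, ← mul_rpow (by linarith) hep.le]
    exact rpow_le_rpow hu.le hle hη.le
  have a1 := mul_le_mul_of_nonneg_left (aux x' hx' (by linarith)) hx'.le
  have a2 := mul_le_mul_of_nonneg_left (aux y' hy' (by linarith)) hy'.le
  have a3 : x' * (q * (x + y) ^ η) + y' * (q * (x + y) ^ η) = q * ((x + y) * (x + y) ^ η) := by rw [← he]; ring
  rw [div_le_iff₀ (by linarith)] at hX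
  have hyx : y ≤ x := hyM.trans hMx
  have a4 : (x + y) ^ η ≤ (1 + y / x) * x ^ η := by
    have e : x + y = (1 + y / x) * x := by field_simp
    have h1' : 1 ≤ 1 + y / x := by have : 0 ≤ y / x := by positivity
                                   linarith
    rw [e, mul_rpow (by positivity) hx.le]
    gcongr
    calc (1 + y / x) ^ η ≤ (1 + y / x) ^ (1:ℝ) := rpow_le_rpow_of_exponent_le h1' hη1
      _ = _ := rpow_one _
  have hxη : 0 < x ^ η := rpow_pos_of_pos hx _
  have a5 : (x + y) * (x + y) ^ η ≤ (x + 3 * y) * x ^ η := by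
    calc _ ≤ (x + y) * ((1 + y / x) * x ^ η) := by gcongr
      _ = ((x + y) * (1 + y / x)) * x ^ η := by ring
      _ ≤ _ := by
        gcongr
        have : (x + y) * (1 + y / x) = x + 2 * y + y * (y / x) := by field_simp; ring
        rw [this]
        have : y / x ≤ 1 := by rw [div_le_one hx]; exact hyx
        nlinarith
  have a6 : q * (x + 3 * y) ≤ (1 + q) / 2 * x := by nlinarith
  have a7 := mul_le_mul_of_nonneg_right a6 hxη.le
  have a8 := mul_le_mul_of_nonneg_left a5 hq0
  have e2 : x ^ (1 + η) = x * x ^ η := by rw [rpow_one_add' hx.le (by positivity)]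
  have n2 : 0 ≤ y * y ^ η := mul_nonneg hy (rpow_nonneg hy _)
  rw [e2]
  nlinarith

/-- interpolation in time -/
lemma tim_interp {s y η : ℝ} (hs : 0 < s) (hy : 1 ≤ y) : s ^ (-(3/4) : ℝ) * y ^ (1 + η) ≤ s ^ (-(7/8):ℝ) * y + y ^ (1 + 7 * η) := by
  have hyp : 0 < y := by linarith
  have e1 : s ^ (-(7/8):ℝ) = s ^ (-(1/8):ℝ) * s ^ (-(3/4):ℝ) := by rw [← rpow_add hs]; norm_num
  have e2 : s ^ (-(3/4):ℝ) = (s ^ (-(1/8):ℝ)) ^ 6 := by rw [← rpow_natCast, ← rpow_mul hs.le]; norm_num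
  have e3 : y ^ (1 + η) = y * y ^ η := by rw [rpow_add hyp, rpow_one]
  have e4 : y ^ (1 + 7 * η) = y * (y ^ η) ^ 7 := by
    rw [rpow_add hyp, rpow_one, ← rpow_natCast (y ^ η), ← rpow_mul hyp.le]; congr 2; push_cast; ring
  rw [e1, e3, e4, e2]
  set u := s ^ (-(1/8):ℝ); set w := y ^ η
  have hu : 0 < u := rpow_pos_of_pos hs _
  have hw : 0 < w := rpow_pos_of_pos hyp _
  rcases le_total w u with h | h
  · have : u ^ 6 * (y * w) ≤ u * u ^ 6 * y := by
      calc u ^ 6 * (y * w) ≤ u ^ 6 * (y * u) := by gcongr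
        _ = _ := by ring
    have : 0 ≤ y * w ^ 7 := by positivity
    linarith
  · have : u ^ 6 * (y * w) ≤ w ^ 6 * (y * w) := by gcongr
    have : 0 ≤ u * u ^ 6 * y := by positivity
    nlinarith

/-- moments vs. truncated moments -/
def TX (X r : ℝ) (v : R3) : ℝ := if X ≤ ‖v‖ ^ 2 then (‖v‖ ^ 2) ^ r else 0
lemma meas_TX (X r : ℝ) : Measurable (TX X r) :=
  Measurable.ite (measurableSet_le (by fun_prop) (by fun_prop)) (by fun_prop) measurable_const
lemma TX_nonneg (X r : ℝ) (v : R3) : 0 ≤ TX X r v := by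
  unfold TX; split_ifs
  · positivity
  · exact le_rfl

lemma phi_TX {X r r' : ℝ} (hX : 1 ≤ X) (hr : 0 ≤ r) (hrr : r ≤ r') (v : R3) : phi v ^ r ≤ (1 + X) ^ r * phi v + 2 ^ r' * TX X r' v := by
  unfold TX
  have hp := one_le_phi v
  split_ifs with h
  · have h1 : phi v ^ r ≤ 2 ^ r' * (‖v‖ ^ 2) ^ r' := by
      rw [← mul_rpow (by norm_num) (by positivity)]
      refine (rpow_le_rpow_of_exponent_le hp hrr).trans (rpow_le_rpow (by linarith) ?_ (by linarith))
      unfold phi; linarith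
    have : 0 ≤ (1 + X) ^ r * phi v := by positivity
    linarith
  · push Not at h
    have h1 : phi v ^ r ≤ (1 + X) ^ r := rpow_le_rpow (by linarith) (by unfold phi; linarith) hr
    have : 0 ≤ (1 + X) ^ r := by positivity
    nlinarith

lemma Mom_TX {X r r' : ℝ} (hX : 1 ≤ X) (hr : 0 ≤ r) (hrr : r ≤ r') {f : R3 → ℝ} (hf : UF f) :
    Mom r f ≤ ENNReal.ofReal ((1 + X) ^ r) * Mom 1 f + ENNReal.ofReal (2 ^ r') * ∫⁻ v, ENNReal.ofReal (f v * TX X r' v) := by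
  have hfm := hf.meas
  have := meas_TX X r'
  rw [Mom_one, Mom, ← lintegral_const_mul' _ _ ENNReal.ofReal_ne_top, ← lintegral_const_mul' _ _ ENNReal.ofReal_ne_top,
    ← lintegral_add_left (by fun_prop)]
  refine lintegral_mono fun v => ?_
  have h0 := hf.nonneg v
  have h1 := TX_nonneg X r' v
  have hp := phi_pos v
  rw [← ENNReal.ofReal_mul (by positivity), ← ENNReal.ofReal_mul (by positivity), ← ENNReal.ofReal_add (by positivity) (by positivity)]
  refine ENNReal.ofReal_le_ofReal ?_
  have := mul_le_mul_of_nonneg_left (phi_TX hX hr hrr v) h0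
  linarith

lemma lint_le_of_seq {α : Type*} [MeasurableSpace α] {μ : Measure α} {F : ℕ → α → ℝ≥0∞} (hm : ∀ n, Measurable (F n)) (hmono : Monotone F)
    {F' : α → ℝ≥0∞} (h : ∀ z, ∃ n, F' z ≤ F n z) {D : ℝ≥0∞} (hD : ∀ n, ∫⁻ z, F n z ∂μ ≤ D) : ∫⁻ z, F' z ∂μ ≤ D := by
  calc ∫⁻ z, F' z ∂μ ≤ ∫⁻ z, ⨆ n, F n z ∂μ := lintegral_mono fun z => by
        obtain ⟨n, hn⟩ := h z
        exact hn.trans (le_iSup (fun n => F n z) n)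
    _ = ⨆ n, ∫⁻ z, F n z ∂μ := lintegral_iSup hm hmono
    _ ≤ D := iSup_le hD

end BFD
end

noncomputable section
open MeasureTheory Real Set Filter
open scoped RealInnerProductSpace ENNReal NNReal Topology

namespace BFD
variable {γ : ℝ} {b : ℝ → ℝ}

/-- the lower bound hypothesis -/
def LowH (γ : ℝ) (b : ℝ → ℝ) (M d X c : ℝ) (f : R3 → ℝ) : Prop :=
  ∀ v, X ≤ ‖v‖ ^ 2 → ENNReal.ofReal (c * (‖v‖ ^ 2) ^ (γ / 2)) ≤ ∫⁻ w, ∫⁻ σ, ENNReal.ofReal (BO γ b (v, w, σ) * gi M d (v, w, σ) *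
          (f w * (1 - f (vOut v w σ)) * (1 - f (vOutStar v w σ)))) ∂sphMeasure

lemma povz_core (hγ0 : 0 ≤ γ) (hγ2 : γ ≤ 2) (hb : GradCutoff b) {f : ℝ → R3 → ℝ} (h : NS (BO γ b) f) {s t : ℝ} (hs : 0 ≤ s) (hst : s ≤ t)
    {M d X c κ a : ℝ} (hX : 1 ≤ X) (hκ : 0 ≤ κ) (hlow : ∀ τ, 0 ≤ τ → LowH γ b M d X c (f τ))
    {ψ : ℕ → R3 → ℝ} (hψ : ∀ n, Measurable (ψ n)) (hC : ∀ n, ∃ C, ∀ v, |ψ n v| ≤ C) {G : Om → ℝ} (hG : Measurable G) (hG0 : ∀ p, 0 ≤ G p)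
    (hgood : ∀ (n : ℕ) (p : Om), ‖p.2.1‖ ^ 2 ≤ M → |cosO p| ≤ 1 - d → X ≤ ‖p.1‖ ^ 2 → ‖p.1‖ ^ 2 + M ≤ n → κ * (‖p.1‖ ^ 2) ^ a ≤ PP (ψ n) p + G p)
    (hgen : ∀ n p, 0 ≤ PP (ψ n) p + G p) {D : ℝ≥0∞}
    (hD : ∀ n, ENNReal.ofReal (2 * ((∫ v, f t v * ψ n v) - ∫ v, f s v * ψ n v)) ≤ D) :
    ∫⁻ τ in Ioc s t, (∫⁻ v, ENNReal.ofReal (κ * c) * ENNReal.ofReal (f τ v * TX X (a + γ / 2) v)) ≤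
      (∫⁻ τ in Ioc s t, (∫⁻ p, ENNReal.ofReal (HL (BO γ b) (f τ) p * G p) ∂mu0)) + D := by
  have hfm := h.meas
  have hT := meas_TX X (a + γ / 2)
  have hg := meas_gi M d
  set W : ℕ → R3 → ℝ := fun n v => if X ≤ ‖v‖ ^ 2 ∧ ‖v‖ ^ 2 + M ≤ n then κ * (‖v‖ ^ 2) ^ a else 0 with hW
  have hWm : ∀ n, Measurable (W n) := fun n => by
    have h1 : MeasurableSet {v : R3 | X ≤ ‖v‖ ^ 2} := measurableSet_le (by fun_prop) (by fun_prop)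
    have h2 : MeasurableSet {v : R3 | ‖v‖ ^ 2 + M ≤ n} := measurableSet_le (by fun_prop) (by fun_prop)
    exact Measurable.ite (h1.inter h2) (by fun_prop) measurable_const
  have hW0 : ∀ n v, 0 ≤ W n v := fun n v => by
    simp only [hW]; split_ifs
    · positivity
    · exact le_rfl
  have hWX : ∀ n v, ‖v‖ ^ 2 < X → W n v = 0 := fun n v hv => by
    simp only [hW]; rw [if_neg]; rintro ⟨h1, -⟩; linarith
  have e : ∀ F : ℝ → R3 → ℝ≥0∞, Measurable (fun z : ℝ × R3 => F z.1 z.2) → ∫⁻ τ in Ioc s t, (∫⁻ v, F τ v) =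
      ∫⁻ z, F z.1 z.2 ∂((volume.restrict (Ioc s t)).prod volume) := fun F hF => by
    rw [lintegral_prod _ hF.aemeasurable]
  rw [e _ (by fun_prop)]
  have hFm : ∀ n, Measurable (fun z : ℝ × R3 => ENNReal.ofReal (f z.1 z.2 * W n z.2) * ENNReal.ofReal (c * (‖z.2‖ ^ 2) ^ (γ / 2))) := fun n => by
    have := hWm n
    fun_prop
  refine lint_le_of_seq (F := fun n z => ENNReal.ofReal (f z.1 z.2 * W n z.2) * ENNReal.ofReal (c * (‖z.2‖ ^ 2) ^ (γ / 2))) hFm ?_ ?_ ?_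
  · intro n m hnm z
    refine mul_le_mul_left (ENNReal.ofReal_le_ofReal (mul_le_mul_of_nonneg_left ?_ (h.nonneg _ _))) _
    by_cases hc : X ≤ ‖z.2‖ ^ 2 ∧ ‖z.2‖ ^ 2 + M ≤ n
    · have : (n:ℝ) ≤ m := by exact_mod_cast hnm
      simp only [hW]; rw [if_pos hc, if_pos ⟨hc.1, hc.2.trans this⟩]
    · have : W n z.2 = 0 := by simp only [hW]; rw [if_neg hc]
      rw [this]; exact hW0 _ _
  · intro z
    obtain ⟨n, hn⟩ := exists_nat_ge (‖z.2‖ ^ 2 + M)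
    refine ⟨n, ?_⟩
    by_cases hx : X ≤ ‖z.2‖ ^ 2
    · have hxp : 0 < ‖z.2‖ ^ 2 := by linarith
      have hfn := h.nonneg z.1 z.2
      simp only [TX, hx, if_true, hW, hn, and_self]
      rw [← ENNReal.ofReal_mul' (by positivity), ← ENNReal.ofReal_mul (by positivity)]
      refine ENNReal.ofReal_le_ofReal (le_of_eq ?_)
      rw [rpow_add hxp]; ring
    · simp [TX, hx]
  · intro n
    rw [← e (fun τ v => ENNReal.ofReal (f τ v * W n v) * ENNReal.ofReal (c * (‖v‖ ^ 2) ^ (γ / 2))) (hFm n)]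
    obtain ⟨C, hC⟩ := hC n
    have hWn := hWm n
    have := povz hγ0 hγ2 hb h hs hst (hψ n) hC (L := fun p => gi M d p * W n p.1) (by fun_prop) hG
      (fun p => mul_nonneg (gi_nonneg _ _ _) (hW0 _ _)) hG0 (fun p => ?_)
    · refine le_trans ?_ (this.trans (by gcongr; exact hD n))
      refine setLIntegral_mono' measurableSet_Ioc fun τ hτ => ?_
      exact low_W hb (h.uf τ) (hlow τ (hs.trans hτ.1.le)) hWn (hW0 n) (hWX n)
    · by_cases h1 : (‖p.2.1‖ ^ 2 ≤ M ∧ |cosO p| ≤ 1 - d) ∧ X ≤ ‖p.1‖ ^ 2 ∧ ‖p.1‖ ^ 2 + M ≤ n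
      · have := hgood n p h1.1.1 h1.1.2 h1.2.1 h1.2.2
        simp only [gi, hW]; rw [if_pos h1.1, if_pos h1.2, one_mul]; exact this
      · have : gi M d p * W n p.1 = 0 := by
          simp only [gi, hW]
          by_cases h2 : ‖p.2.1‖ ^ 2 ≤ M ∧ |cosO p| ≤ 1 - d
          · rw [if_neg (fun h3 => h1 ⟨h2, h3⟩), mul_zero]
          · rw [if_neg h2, zero_mul]
        rw [this]; exact hgen n p

lemma BO_max (hγ0 : 0 ≤ γ) (hγ2 : γ ≤ 2) (hb : GradCutoff b) (p : Om) :
    BO γ b p ≤ b (cosO p) * (4 * (max (‖p.1‖ ^ 2) (‖p.2.1‖ ^ 2)) ^ (γ / 2)) := by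
  unfold BO Bker
  rw [mul_comm]
  refine mul_le_mul_of_nonneg_left ?_ (hb.nonneg _)
  rw [rpow_norm_eq]
  have h1 := norm_sub_sq_le p.1 p.2.1
  have h2 := le_max_left (‖p.1‖ ^ 2) (‖p.2.1‖ ^ 2)
  have h3 := le_max_right (‖p.1‖ ^ 2) (‖p.2.1‖ ^ 2)
  have h0 : 0 ≤ max (‖p.1‖ ^ 2) (‖p.2.1‖ ^ 2) := (sq_nonneg _).trans h2
  calc (‖p.1 - p.2.1‖ ^ 2) ^ (γ / 2) ≤ (4 * max (‖p.1‖ ^ 2) (‖p.2.1‖ ^ 2)) ^ (γ / 2) :=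
        rpow_le_rpow (by positivity) (by linarith) (by linarith)
    _ = 4 ^ (γ / 2) * (max (‖p.1‖ ^ 2) (‖p.2.1‖ ^ 2)) ^ (γ / 2) := mul_rpow (by norm_num) h0
    _ ≤ _ := by
      gcongr
      calc (4:ℝ) ^ (γ / 2) ≤ 4 ^ (1:ℝ) := rpow_le_rpow_of_exponent_le (by norm_num) (by linarith)
        _ = 4 := rpow_one _

lemma gain_unt (hγ0 : 0 ≤ γ) (hγ2 : γ ≤ 2) (hb : GradCutoff b) {f : R3 → ℝ} (hf : UF f) {q : ℝ} (hq0 : 0 ≤ q) (hq : q ≤ 1) :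
    ∫⁻ p, ENNReal.ofReal (HL (BO γ b) f p * (min (‖p.1‖ ^ 2) (‖p.2.1‖ ^ 2)) ^ q) ∂mu0 ≤ 4 * (Ib b * (Mom 1 f * Mom 1 f)) := by
  have hfm := hf.meas
  rw [Mom_one, ← lint_tens hb (by fun_prop) (by fun_prop), ← lintegral_const_mul' _ _ (by simp)]
  refine lintegral_mono fun p => ?_
  have h1 := HL_nonneg (CK_B (γ := γ) hb) hf p
  have h2 := BO_max hγ0 hγ2 hb p
  have n1 := hf.nonneg p.1; have n2 := hf.nonneg p.2.1; have nb := hb.nonneg (cosO p)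
  have p1 := one_le_phi p.1; have p2 := one_le_phi p.2.1
  rw [← ENNReal.ofReal_mul (mul_nonneg n1 (by linarith)), ← ENNReal.ofReal_mul nb]
  have e4 : (4:ℝ≥0∞) = ENNReal.ofReal 4 := by simp
  rw [e4, ← ENNReal.ofReal_mul (by norm_num)]
  refine ENNReal.ofReal_le_ofReal ?_
  set m := min (‖p.1‖ ^ 2) (‖p.2.1‖ ^ 2) with hm
  set X := max (‖p.1‖ ^ 2) (‖p.2.1‖ ^ 2) with hX
  have hm0 : 0 ≤ m := le_min (sq_nonneg _) (sq_nonneg _)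
  have hX0 : 0 ≤ X := (sq_nonneg ‖p.1‖).trans (le_max_left _ _)
  have pw : ∀ {y r : ℝ}, 0 ≤ y → 0 ≤ r → r ≤ 1 → y ^ r ≤ 1 + y := fun {y r} hy h0 h1 => by
    calc y ^ r ≤ (1 + y) ^ r := rpow_le_rpow hy (by linarith) h0
      _ ≤ (1 + y) ^ (1:ℝ) := rpow_le_rpow_of_exponent_le (by linarith) h1
      _ = _ := rpow_one _
  have h3 : X ^ (γ / 2) * m ^ q ≤ phi p.1 * phi p.2.1 := by
    calc X ^ (γ / 2) * m ^ q ≤ (1 + X) * (1 + m) :=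
          mul_le_mul (pw hX0 (by linarith) (by linarith)) (pw hm0 hq0 hq) (by positivity) (by positivity)
      _ = _ := by
        unfold phi
        have e1 := max_mul_min (‖p.1‖ ^ 2) (‖p.2.1‖ ^ 2)
        have e2 := max_add_min (‖p.1‖ ^ 2) (‖p.2.1‖ ^ 2)
        rw [← hm, ← hX] at e1 e2
        linarith
  calc HL (BO γ b) f p * m ^ q ≤ (b (cosO p) * (4 * X ^ (γ / 2)) * (f p.1 * f p.2.1)) * m ^ q := by
        refine mul_le_mul_of_nonneg_right (h1.2.trans ?_) (by positivity)
        exact mul_le_mul_of_nonneg_right h2 (mul_nonneg n1 n2)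
    _ = 4 * (b (cosO p) * (f p.1 * f p.2.1)) * (X ^ (γ / 2) * m ^ q) := by ring
    _ ≤ 4 * (b (cosO p) * (f p.1 * f p.2.1)) * (phi p.1 * phi p.2.1) := by gcongr
    _ = _ := by ring

lemma gain_tim (hγ0 : 0 ≤ γ) (hγ2 : γ ≤ 2) (hb : GradCutoff b) {f : R3 → ℝ} (hf : UF f) {η : ℝ} (hη : 0 ≤ η) (hη1 : η + γ / 2 ≤ 1 + γ / 4) :
    ∫⁻ p, ENNReal.ofReal (HL (BO γ b) f p * (3 * (min (‖p.1‖ ^ 2) (‖p.2.1‖ ^ 2) * (max (‖p.1‖ ^ 2) (‖p.2.1‖ ^ 2)) ^ η))) ∂mu0 ≤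
      24 * (Ib b * (Mom 1 f * Mom (1 + γ / 4) f)) := by
  have hfm := hf.meas
  have hbm := hb.measurable
  have hcm := meas_cosO
  have e : 24 * (Ib b * (Mom 1 f * Mom (1 + γ / 4) f)) = 12 * (Ib b * (Mom 1 f * Mom (1 + γ / 4) f)) + 12 * (Ib b * (Mom (1 + γ / 4) f * Mom 1 f)) := by
    rw [mul_comm (Mom (1 + γ / 4) f), ← add_mul]; norm_num
  rw [e, Mom_one, Mom, ← lint_tens hb (by fun_prop) (by fun_prop), ← lint_tens hb (by fun_prop) (by fun_prop),
    ← lintegral_const_mul' _ _ (by simp), ← lintegral_const_mul' _ _ (by simp), ← lintegral_add_left (by fun_prop)]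
  refine lintegral_mono fun p => ?_
  have h1 := HL_nonneg (CK_B (γ := γ) hb) hf p
  have h2 := BO_max hγ0 hγ2 hb p
  have n1 := hf.nonneg p.1; have n2 := hf.nonneg p.2.1; have nb := hb.nonneg (cosO p)
  have p1 := one_le_phi p.1; have p2 := one_le_phi p.2.1
  have e4 : (12:ℝ≥0∞) = ENNReal.ofReal 12 := by simp
  rw [← ENNReal.ofReal_mul (by positivity), ← ENNReal.ofReal_mul nb, ← ENNReal.ofReal_mul (by positivity), ← ENNReal.ofReal_mul nb,
    e4, ← ENNReal.ofReal_mul (by norm_num), ← ENNReal.ofReal_mul (by norm_num), ← ENNReal.ofReal_add (by positivity) (by positivity)]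
  refine ENNReal.ofReal_le_ofReal ?_
  set m := min (‖p.1‖ ^ 2) (‖p.2.1‖ ^ 2) with hm
  set X := max (‖p.1‖ ^ 2) (‖p.2.1‖ ^ 2) with hX
  have hm0 : 0 ≤ m := le_min (sq_nonneg _) (sq_nonneg _)
  have hX0 : 0 ≤ X := (sq_nonneg ‖p.1‖).trans (le_max_left _ _)
  have pw : ∀ {y : ℝ}, 0 ≤ y → y ^ (γ / 2) * y ^ η ≤ (1 + y) ^ (1 + γ / 4) := fun {y} hy => by
    rw [← rpow_add_of_nonneg hy (by linarith) hη]
    calc y ^ (γ / 2 + η) ≤ (1 + y) ^ (γ / 2 + η) := rpow_le_rpow hy (by linarith) (by linarith)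
      _ ≤ _ := rpow_le_rpow_of_exponent_le (by linarith) (by linarith)
  have h3 : X ^ (γ / 2) * (m * X ^ η) ≤ phi p.1 * phi p.2.1 ^ (1 + γ / 4) + phi p.1 ^ (1 + γ / 4) * phi p.2.1 := by
    have : X ^ (γ / 2) * (m * X ^ η) ≤ (1 + m) * (1 + X) ^ (1 + γ / 4) := by
      calc _ = m * (X ^ (γ / 2) * X ^ η) := by ring
        _ ≤ (1 + m) * (1 + X) ^ (1 + γ / 4) := mul_le_mul (by linarith) (pw hX0) (by positivity) (by positivity)
    refine this.trans ?_
    unfold phi at p1 p2 ⊢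
    rcases le_total (‖p.1‖ ^ 2) (‖p.2.1‖ ^ 2) with h | h
    · rw [hm, hX, min_eq_left h, max_eq_right h]
      have : 0 ≤ (1 + ‖p.1‖ ^ 2) ^ (1 + γ / 4) * (1 + ‖p.2.1‖ ^ 2) := by positivity
      linarith
    · rw [hm, hX, min_eq_right h, max_eq_left h]
      have : 0 ≤ (1 + ‖p.1‖ ^ 2) * (1 + ‖p.2.1‖ ^ 2) ^ (1 + γ / 4) := by positivity
      linarith
  calc HL (BO γ b) f p * (3 * (m * X ^ η)) ≤ (b (cosO p) * (4 * X ^ (γ / 2)) * (f p.1 * f p.2.1)) * (3 * (m * X ^ η)) := by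
        refine mul_le_mul_of_nonneg_right (h1.2.trans ?_) (by positivity)
        exact mul_le_mul_of_nonneg_right h2 (mul_nonneg n1 n2)
    _ = 12 * (b (cosO p) * (f p.1 * f p.2.1)) * (X ^ (γ / 2) * (m * X ^ η)) := by ring
    _ ≤ 12 * (b (cosO p) * (f p.1 * f p.2.1)) * (phi p.1 * phi p.2.1 ^ (1 + γ / 4) + phi p.1 ^ (1 + γ / 4) * phi p.2.1) := by gcongr
    _ = _ := by ring

end BFD
end

noncomputable section
open MeasureTheory Real Set Filter
open scoped RealInnerProductSpace ENNReal NNReal Topology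

namespace BFD
variable {γ : ℝ} {b : ℝ → ℝ}

lemma good2 {M d X : ℝ} (hM : 0 < M) (hd : 0 < d) (hd1 : d ≤ 1) (hX : 32 * M / d ≤ X) (p : Om) (hw : ‖p.2.1‖ ^ 2 ≤ M)
    (hc : |cosO p| ≤ 1 - d) (hx : X ≤ ‖p.1‖ ^ 2) :
    M ≤ ‖p.1‖ ^ 2 ∧ d / 64 * (‖p.1‖ ^ 2 + ‖p.2.1‖ ^ 2) ≤ ‖Q2 p‖ ^ 2 ∧ d / 64 * (‖p.1‖ ^ 2 + ‖p.2.1‖ ^ 2) ≤ ‖Q3 p‖ ^ 2 := by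
  obtain ⟨-, h1, h2, -⟩ := good_geo hM hd hd1 p.1 p.2.1 p.2.2 hw hc (hX.trans hx)
  have hMx : M ≤ ‖p.1‖ ^ 2 := by
    refine le_trans ?_ (hX.trans hx)
    rw [le_div_iff₀ hd]; nlinarith
  have : d / 64 * (‖p.1‖ ^ 2 + ‖p.2.1‖ ^ 2) ≤ ‖p.1‖ ^ 2 * d / 32 := by nlinarith
  exact ⟨hMx, this.trans h1, this.trans h2⟩

lemma inv_le_of {k a c : ℝ≥0∞} (h0 : k ≠ 0) (ht : k ≠ ⊤) (h : k * a ≤ c) : a ≤ k⁻¹ * c := by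
  calc a = k⁻¹ * (k * a) := by rw [← mul_assoc, ENNReal.inv_mul_cancel h0 ht, one_mul]
    _ ≤ _ := by gcongr

lemma meas_L {f : ℝ → R3 → ℝ} (hf : Measurable (fun p : ℝ × R3 => f p.1 p.2)) (X a : ℝ) :
    Measurable fun τ => ∫⁻ v, ENNReal.ofReal (f τ v * TX X a v) := by
  have := meas_TX X a
  have : Measurable (fun q : ℝ × R3 => ENNReal.ofReal (f q.1 q.2 * TX X a q.2)) := by fun_prop
  exact this.lintegral_prod_right'

lemma unt_bd (hγ : 0 < γ) (hγ2 : γ ≤ 2) (hb : GradCutoff b) {M d X c : ℝ} (hM : 0 < M) (hd : 0 < d) (hd1 : d ≤ 1) (hX1 : 1 ≤ X)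
    (hX : 32 * M / d ≤ X) (hc : 0 < c) (E0 : ℝ) : ∃ C : ℝ≥0∞, C < ⊤ ∧ ∀ f, NS (BO γ b) f → (∀ τ, 0 ≤ τ → LowH γ b M d X c (f τ)) →
      Mom 1 (f 0) ≤ ENNReal.ofReal E0 → ∫⁻ τ in Ioc (0:ℝ) 1, Mom (1 + γ / 4) (f τ) ≤ C := by
  set p : ℝ := 1 - γ / 4 with hp
  have hp0 : 0 < p := by rw [hp]; linarith
  have hp1 : p < 1 := by rw [hp]; linarith
  set δ : ℝ := d / 64 with hδ
  have hδ0 : 0 < δ := by positivity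
  have hδ1 : δ < 1 := by rw [hδ]; linarith
  set κ : ℝ := (1 - δ) ^ (p - 1) - 1 with hκ
  have hκ0 : 0 < κ := unt_kap hδ0 hδ1 hp1
  set E := ENNReal.ofReal E0 with hE
  have hEt : E < ⊤ := ENNReal.ofReal_lt_top
  have hIb := Ib_lt_top hb
  have hk0 : ENNReal.ofReal (κ * c) ≠ 0 := by simp only [ne_eq, ENNReal.ofReal_eq_zero, not_le]; positivity
  refine ⟨ENNReal.ofReal ((1 + X) ^ (1 + γ / 4)) * E + ENNReal.ofReal (2 ^ (1 + γ / 4)) * ((ENNReal.ofReal (κ * c))⁻¹ * (4 * (Ib b * (E * E)) + 2 * E)),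
    ?_, fun f h hlow hf => ?_⟩
  · refine ENNReal.add_lt_top.2 ⟨ENNReal.mul_lt_top ENNReal.ofReal_lt_top hEt, ENNReal.mul_lt_top ENNReal.ofReal_lt_top
      (ENNReal.mul_lt_top (by simpa [pos_iff_ne_zero] using hk0) (ENNReal.add_lt_top.2 ⟨?_, ?_⟩))⟩
    · exact ENNReal.mul_lt_top (by simp) (ENNReal.mul_lt_top hIb (ENNReal.mul_lt_top hEt hEt))
    · exact ENNReal.mul_lt_top (by simp) hEt
  have hen : ∀ τ, 0 ≤ τ → Mom 1 (f τ) ≤ E := fun τ hτ => (h.en hτ).trans_le hf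
  have hψ : ∀ n : ℕ, Measurable fun v : R3 => min (‖v‖ ^ 2) (n:ℝ) ^ p := fun n => by fun_prop
  have hψ0 : ∀ (n : ℕ) (v : R3), 0 ≤ min (‖v‖ ^ 2) (n:ℝ) ^ p := fun n v => rpow_nonneg (le_min (sq_nonneg _) (Nat.cast_nonneg _)) _
  have hψ1 : ∀ (n : ℕ) (v : R3), min (‖v‖ ^ 2) (n:ℝ) ^ p ≤ phi v := fun n v => by
    calc min (‖v‖ ^ 2) (n:ℝ) ^ p ≤ (phi v) ^ p := rpow_le_rpow (le_min (sq_nonneg _) (Nat.cast_nonneg _))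
          ((min_le_left _ _).trans (by unfold phi; linarith)) hp0.le
      _ ≤ phi v ^ (1:ℝ) := rpow_le_rpow_of_exponent_le (one_le_phi v) hp1.le
      _ = _ := rpow_one _
  have key := povz_core hγ.le hγ2 hb h le_rfl zero_le_one (M := M) (d := d) (X := X) (c := c) (κ := κ) (a := p) hX1 hκ0.le hlow hψ
    (fun n => ⟨(n:ℝ) ^ p, fun v => by
      rw [abs_of_nonneg (hψ0 n v)]
      exact rpow_le_rpow (le_min (sq_nonneg _) (Nat.cast_nonneg _)) (min_le_right _ _) hp0.le⟩)
    (G := fun q => min (‖q.1‖ ^ 2) (‖q.2.1‖ ^ 2) ^ p) (by fun_prop) (fun q => rpow_nonneg (le_min (sq_nonneg _) (sq_nonneg _)) _)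
    (fun n q hw hcq hx hn => by
      obtain ⟨g1, g2, g3⟩ := good2 hM hd hd1 hX q hw hcq hx
      exact unt_good (by linarith) (sq_nonneg _) (energy q) (by linarith) hδ0 hδ1 hp0 hp1.le g2 g3 (by linarith))
    (fun n q => unt_gen (sq_nonneg _) (sq_nonneg _) (sq_nonneg _) (sq_nonneg _) (energy q) (Nat.cast_nonneg n) hp0.le hp1.le)
    (D := 2 * E) (fun n => by
      have i0 : 0 ≤ ∫ v, f 0 v * min (‖v‖ ^ 2) (n:ℝ) ^ p := integral_nonneg fun v => mul_nonneg (h.nonneg _ _) (hψ0 n v)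
      rw [ENNReal.ofReal_mul (by norm_num), ENNReal.ofReal_ofNat]
      gcongr
      refine le_trans ?_ (hen 1 zero_le_one)
      refine (ENNReal.ofReal_le_ofReal (sub_le_self _ i0)).trans ((ofReal_int_le _ _).trans ?_)
      rw [Mom_one]
      exact lintegral_mono fun v => ENNReal.ofReal_le_ofReal (mul_le_mul_of_nonneg_left (hψ1 n v) (h.nonneg _ _)))
  have ha : p + γ / 2 = 1 + γ / 4 := by rw [hp]; ring
  rw [ha] at key
  have hL := meas_L h.meas X (1 + γ / 4)
  have h1 : ∫⁻ τ in Ioc (0:ℝ) 1, (∫⁻ p_1, ENNReal.ofReal (HL (BO γ b) (f τ) p_1 * min (‖p_1.1‖ ^ 2) (‖p_1.2.1‖ ^ 2) ^ p) ∂mu0) ≤ 4 * (Ib b * (E * E)) := by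
    calc _ ≤ ∫⁻ τ in Ioc (0:ℝ) 1, 4 * (Ib b * (E * E)) := setLIntegral_mono' measurableSet_Ioc fun τ hτ => by
          refine (gain_unt hγ.le hγ2 hb (h.uf τ) hp0.le hp1.le).trans ?_
          have := hen τ hτ.1.le
          gcongr
      _ = _ := by simp
  have h2 : ENNReal.ofReal (κ * c) * ∫⁻ τ in Ioc (0:ℝ) 1, (∫⁻ v, ENNReal.ofReal (f τ v * TX X (1 + γ / 4) v)) ≤ 4 * (Ib b * (E * E)) + 2 * E := by
    rw [← lintegral_const_mul' _ _ ENNReal.ofReal_ne_top]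
    refine le_trans (le_of_eq ?_) (key.trans (by gcongr))
    refine lintegral_congr fun τ => ?_
    rw [lintegral_const_mul' _ _ ENNReal.ofReal_ne_top]
  calc ∫⁻ τ in Ioc (0:ℝ) 1, Mom (1 + γ / 4) (f τ) ≤ ∫⁻ τ in Ioc (0:ℝ) 1, (ENNReal.ofReal ((1 + X) ^ (1 + γ / 4)) * E +
        ENNReal.ofReal (2 ^ (1 + γ / 4)) * ∫⁻ v, ENNReal.ofReal (f τ v * TX X (1 + γ / 4) v)) := setLIntegral_mono' measurableSet_Ioc fun τ hτ => by
        refine (Mom_TX hX1 (by linarith) le_rfl (h.uf τ)).trans ?_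
        have := hen τ hτ.1.le
        gcongr
    _ = ENNReal.ofReal ((1 + X) ^ (1 + γ / 4)) * E + ENNReal.ofReal (2 ^ (1 + γ / 4)) *
          ∫⁻ τ in Ioc (0:ℝ) 1, (∫⁻ v, ENNReal.ofReal (f τ v * TX X (1 + γ / 4) v)) := by
        rw [lintegral_add_left measurable_const, lintegral_const_mul _ hL]
        simp
    _ ≤ _ := by
        gcongr
        exact inv_le_of hk0 ENNReal.ofReal_ne_top h2

end BFD
end

noncomputable section
open MeasureTheory Real Set Filter
open scoped RealInnerProductSpace ENNReal NNReal Topology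

namespace BFD
variable {γ : ℝ} {b : ℝ → ℝ}

lemma tim_bdry {f : ℝ → R3 → ℝ} {k : Om → ℝ} (h : NS k f) {s t η : ℝ} (hs : 0 ≤ s) (ht : 0 ≤ t) (hη : 0 < η) (n : ℕ) :
    ENNReal.ofReal (2 * ((∫ v, f t v * (‖v‖ ^ 2 * ((n:ℝ) ^ η - min (‖v‖ ^ 2) (n:ℝ) ^ η))) -
      ∫ v, f s v * (‖v‖ ^ 2 * ((n:ℝ) ^ η - min (‖v‖ ^ 2) (n:ℝ) ^ η)))) ≤ 2 * Mom (1 + η) (f s) := by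
  have hmn : ∀ v : R3, 0 ≤ min (‖v‖ ^ 2) (n:ℝ) := fun v => le_min (sq_nonneg _) (Nat.cast_nonneg _)
  have hm0 : ∀ v : R3, 0 ≤ min (‖v‖ ^ 2) (n:ℝ) ^ η := fun v => rpow_nonneg (hmn v) _
  have hm1 : ∀ v : R3, min (‖v‖ ^ 2) (n:ℝ) ^ η ≤ (n:ℝ) ^ η := fun v => rpow_le_rpow (hmn v) (min_le_right _ _) hη.le
  have e : ∀ τ, 0 ≤ τ → ∫ v, f τ v * (‖v‖ ^ 2 * ((n:ℝ) ^ η - min (‖v‖ ^ 2) (n:ℝ) ^ η)) =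
      (n:ℝ) ^ η * (∫ v, f 0 v * ‖v‖ ^ 2) - ∫ v, f τ v * (‖v‖ ^ 2 * min (‖v‖ ^ 2) (n:ℝ) ^ η) := fun τ hτ => by
    rw [← h.cons _ CI_sq τ hτ, ← integral_const_mul, ← integral_sub]
    · congr 1; funext v; ring
    · exact (int_of_Mom (h.uf τ) (h.fin τ hτ) (C := 1) (CI_meas CI_sq) fun v => by rw [one_mul]; exact CI_le CI_sq v).const_mul _
    · refine int_of_Mom (h.uf τ) (h.fin τ hτ) (C := (n:ℝ) ^ η) (by fun_prop) fun v => ?_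
      rw [abs_of_nonneg (mul_nonneg (sq_nonneg _) (hm0 v)), mul_comm]
      exact mul_le_mul (hm1 v) (by unfold phi; linarith) (sq_nonneg _) (by positivity)
  rw [e t ht, e s hs, ENNReal.ofReal_mul (by norm_num), ENNReal.ofReal_ofNat]
  gcongr
  have i0 : 0 ≤ ∫ v, f t v * (‖v‖ ^ 2 * min (‖v‖ ^ 2) (n:ℝ) ^ η) :=
    integral_nonneg fun v => mul_nonneg (h.nonneg _ _) (mul_nonneg (sq_nonneg _) (hm0 v))
  have i1 : (n:ℝ) ^ η * (∫ v, f 0 v * ‖v‖ ^ 2) - (∫ v, f t v * (‖v‖ ^ 2 * min (‖v‖ ^ 2) (n:ℝ) ^ η)) -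
      ((n:ℝ) ^ η * (∫ v, f 0 v * ‖v‖ ^ 2) - ∫ v, f s v * (‖v‖ ^ 2 * min (‖v‖ ^ 2) (n:ℝ) ^ η)) ≤ ∫ v, f s v * (‖v‖ ^ 2 * min (‖v‖ ^ 2) (n:ℝ) ^ η) := by
    linarith
  refine (ENNReal.ofReal_le_ofReal i1).trans ((ofReal_int_le _ _).trans ?_)
  refine lintegral_mono fun v => ENNReal.ofReal_le_ofReal (mul_le_mul_of_nonneg_left ?_ (h.nonneg _ _))
  have hp := phi_pos v
  rw [rpow_add hp, rpow_one]
  exact mul_le_mul (by unfold phi; linarith) (rpow_le_rpow (hmn v) ((min_le_left _ _).trans (by unfold phi; linarith)) hη.le) (hm0 v) hp.le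

lemma tim_s (hγ : 0 < γ) (hγ2 : γ ≤ 2) (hb : GradCutoff b) {M d X c η : ℝ} (hM : 0 < M) (hd : 0 < d) (hd1 : d ≤ 1) (hX1 : 1 ≤ X)
    (hη : 0 < η) (hη1 : η ≤ 1) (hηγ : η + γ / 2 ≤ 1 + γ / 4)
    (hX : 32 * M / d ≤ X) (hX2 : 6 * M / (1 - (1 - d / 64) ^ η) ≤ X) {f : ℝ → R3 → ℝ} (h : NS (BO γ b) f)
    (hlow : ∀ τ, 0 ≤ τ → LowH γ b M d X c (f τ)) {s : ℝ} (hs : 0 ≤ s) (hs1 : s ≤ 1) :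
    ENNReal.ofReal ((1 - (1 - d / 64) ^ η) / 2 * c) * ∫⁻ τ in Ioc s 1, (∫⁻ v, ENNReal.ofReal (f τ v * TX X (1 + η + γ / 2) v)) ≤
      24 * (Ib b * (Mom 1 (f 0) * ∫⁻ τ in Ioc (0:ℝ) 1, Mom (1 + γ / 4) (f τ))) + 2 * Mom (1 + η) (f s) := by
  set δ : ℝ := d / 64 with hδ
  have hδ0 : 0 < δ := by positivity
  have hδ1 : δ < 1 := by rw [hδ]; linarith
  have hq1 : (1 - δ) ^ η ≤ 1 := rpow_le_one (by linarith) (by linarith) hη.le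
  have hmn : ∀ (n : ℕ) (v : R3), 0 ≤ min (‖v‖ ^ 2) (n:ℝ) := fun n v => le_min (sq_nonneg _) (Nat.cast_nonneg _)
  have hPP : ∀ (n : ℕ) (q : Om), PP (fun v : R3 => ‖v‖ ^ 2 * ((n:ℝ) ^ η - min (‖v‖ ^ 2) (n:ℝ) ^ η)) q =
      -(‖Q2 q‖ ^ 2 * min (‖Q2 q‖ ^ 2) (n:ℝ) ^ η + ‖Q3 q‖ ^ 2 * min (‖Q3 q‖ ^ 2) (n:ℝ) ^ η -
        ‖q.1‖ ^ 2 * min (‖q.1‖ ^ 2) (n:ℝ) ^ η - ‖q.2.1‖ ^ 2 * min (‖q.2.1‖ ^ 2) (n:ℝ) ^ η) := fun n q => by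
    have := energy q
    unfold PP
    linear_combination (n:ℝ) ^ η * this
  have key := povz_core hγ.le hγ2 hb h hs hs1 (M := M) (d := d) (X := X) (c := c) (κ := (1 - (1 - δ) ^ η) / 2) (a := 1 + η) hX1 (by linarith) hlow
    (ψ := fun n v => ‖v‖ ^ 2 * ((n:ℝ) ^ η - min (‖v‖ ^ 2) (n:ℝ) ^ η)) (fun n => by fun_prop)
    (fun n => ⟨(n:ℝ) * (n:ℝ) ^ η, fun v => by
      rcases le_total (‖v‖ ^ 2) (n:ℝ) with hv | hv
      · rw [min_eq_left hv]
        have h1 : (‖v‖ ^ 2) ^ η ≤ (n:ℝ) ^ η := rpow_le_rpow (sq_nonneg _) hv hη.le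
        have h2 : 0 ≤ (‖v‖ ^ 2) ^ η := rpow_nonneg (sq_nonneg _) _
        rw [abs_of_nonneg (mul_nonneg (sq_nonneg _) (by linarith))]
        exact mul_le_mul hv (by linarith) (by linarith) (Nat.cast_nonneg _)
      · rw [min_eq_right hv, sub_self, mul_zero, abs_zero]; positivity⟩)
    (G := fun q => 3 * (min (‖q.1‖ ^ 2) (‖q.2.1‖ ^ 2) * max (‖q.1‖ ^ 2) (‖q.2.1‖ ^ 2) ^ η)) (by fun_prop)
    (fun q => by
      have h1 : 0 ≤ min (‖q.1‖ ^ 2) (‖q.2.1‖ ^ 2) := le_min (sq_nonneg _) (sq_nonneg _)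
      have h2 : 0 ≤ max (‖q.1‖ ^ 2) (‖q.2.1‖ ^ 2) := (sq_nonneg ‖q.1‖).trans (le_max_left _ _)
      positivity)
    (fun n q hw hcq hx hn => by
      obtain ⟨g1, g2, g3⟩ := good2 hM hd hd1 hX q hw hcq hx
      have := tim_good (R := n) (by linarith) (sq_nonneg _) hw (energy q) (by linarith) hδ0 hδ1 hη hη1 g2 g3 g1 (hX2.trans hx)
      rw [hPP]
      have h1 : 0 ≤ min (‖q.1‖ ^ 2) (‖q.2.1‖ ^ 2) := le_min (sq_nonneg _) (sq_nonneg _)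
      have h2 : 0 ≤ max (‖q.1‖ ^ 2) (‖q.2.1‖ ^ 2) := (sq_nonneg ‖q.1‖).trans (le_max_left _ _)
      have h3 : 0 ≤ 3 * (min (‖q.1‖ ^ 2) (‖q.2.1‖ ^ 2) * max (‖q.1‖ ^ 2) (‖q.2.1‖ ^ 2) ^ η) := by positivity
      linarith)
    (fun n q => by
      have := tim_gen (sq_nonneg ‖q.1‖) (sq_nonneg ‖q.2.1‖) (sq_nonneg _) (sq_nonneg _) (energy q) (Nat.cast_nonneg n) hη hη1
      rw [hPP]; linarith)
    (D := 2 * Mom (1 + η) (f s)) (fun n => tim_bdry h hs zero_le_one hη n)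
  rw [← lintegral_const_mul' _ _ ENNReal.ofReal_ne_top]
  refine le_trans (le_of_eq ?_) (key.trans ?_)
  · refine lintegral_congr fun τ => ?_
    rw [lintegral_const_mul' _ _ ENNReal.ofReal_ne_top]
  · gcongr
    calc _ ≤ ∫⁻ τ in Ioc s 1, 24 * (Ib b * (Mom 1 (f 0) * Mom (1 + γ / 4) (f τ))) := setLIntegral_mono' measurableSet_Ioc fun τ hτ => by
          refine (gain_tim hγ.le hγ2 hb (h.uf τ) hη.le hηγ).trans ?_
          rw [h.en (hs.trans hτ.1.le)]
      _ = 24 * (Ib b * (Mom 1 (f 0) * ∫⁻ τ in Ioc s 1, Mom (1 + γ / 4) (f τ))) := by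
          rw [lintegral_const_mul' _ _ (by simp), lintegral_const_mul' _ _ (Ib_lt_top hb).ne, lintegral_const_mul' _ _ (h.fin 0 le_rfl).ne]
      _ ≤ _ := by
          gcongr

lemma lint_pow_fin {r : ℝ} (hr : -1 < r) : ∫⁻ s in Ioc (0:ℝ) 1, ENNReal.ofReal (s ^ r) < ⊤ := by
  have := (intervalIntegral.intervalIntegrable_rpow' (a := 0) (b := 1) hr).1
  have h2 := this.2
  rw [hasFiniteIntegral_iff_ofReal] at h2
  · exact h2
  · exact (ae_restrict_mem measurableSet_Ioc).mono fun s hs => rpow_nonneg hs.1.le _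

lemma tim_swap {L : ℝ → ℝ≥0∞} (hL : Measurable L) :
    ∫⁻ τ in Ioc (0:ℝ) 1, ENNReal.ofReal (τ ^ (1/4:ℝ)) * L τ ≤
      ∫⁻ s in Ioc (0:ℝ) 1, ENNReal.ofReal (s ^ (-(3/4):ℝ)) * ∫⁻ τ in Ioc s 1, L τ := by
  have hms : MeasurableSet {z : ℝ × ℝ | z.1 < z.2} := measurableSet_lt measurable_fst measurable_snd
  have hm : Measurable (Function.uncurry fun s τ : ℝ => {z : ℝ × ℝ | z.1 < z.2}.indicator (fun z => ENNReal.ofReal (z.1 ^ (-(3/4):ℝ)) * L z.2) (s, τ)) :=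
    Measurable.indicator (by fun_prop) hms
  have e : ∫⁻ s in Ioc (0:ℝ) 1, ENNReal.ofReal (s ^ (-(3/4):ℝ)) * ∫⁻ τ in Ioc s 1, L τ =
      ∫⁻ s in Ioc (0:ℝ) 1, ∫⁻ τ in Ioc (0:ℝ) 1, {z : ℝ × ℝ | z.1 < z.2}.indicator (fun z => ENNReal.ofReal (z.1 ^ (-(3/4):ℝ)) * L z.2) (s, τ) := by
    refine setLIntegral_congr_fun measurableSet_Ioc fun s hs => ?_
    rw [← lintegral_const_mul' _ _ ENNReal.ofReal_ne_top, ← lintegral_indicator measurableSet_Ioc, ← lintegral_indicator measurableSet_Ioc]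
    refine lintegral_congr fun τ => ?_
    simp only [indicator, mem_Ioc, mem_ofPred_eq]
    by_cases h1 : s < τ
    · have : 0 < τ := hs.1.trans h1
      simp [h1, this]
    · simp [h1]
  rw [e, lintegral_lintegral_swap hm.aemeasurable]
  refine setLIntegral_mono' measurableSet_Ioc fun τ hτ => ?_
  calc ENNReal.ofReal (τ ^ (1/4:ℝ)) * L τ = ∫⁻ s in Ioo 0 τ, ENNReal.ofReal (τ ^ (-(3/4):ℝ)) * L τ := by
        rw [lintegral_const, Measure.restrict_apply MeasurableSet.univ, univ_inter, Real.volume_Ioo, sub_zero]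
        rw [mul_right_comm, ← ENNReal.ofReal_mul (rpow_nonneg hτ.1.le _)]
        congr 2
        nth_rewrite 3 [← rpow_one τ]
        rw [← rpow_add hτ.1]; norm_num
    _ ≤ ∫⁻ s in Ioo 0 τ, {z : ℝ × ℝ | z.1 < z.2}.indicator (fun z => ENNReal.ofReal (z.1 ^ (-(3/4):ℝ)) * L z.2) (s, τ) :=
        setLIntegral_mono' measurableSet_Ioo fun s hs => by
          simp only [indicator, mem_ofPred_eq, hs.2, if_true]
          gcongr ?_ * _
          exact ENNReal.ofReal_le_ofReal (rpow_le_rpow_of_nonpos hs.1 hs.2.le (by norm_num))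
    _ ≤ _ := lintegral_mono_set (show Ioo 0 τ ⊆ Ioc 0 1 from fun s hs => ⟨hs.1, hs.2.le.trans hτ.2⟩)

end BFD
end

noncomputable section
open MeasureTheory Real Set Filter
open scoped RealInnerProductSpace ENNReal NNReal Topology

namespace BFD
variable {γ : ℝ} {b : ℝ → ℝ}

lemma Mom_interp {f : R3 → ℝ} (hf : UF f) {s η : ℝ} (hs : 0 < s) :
    ENNReal.ofReal (s ^ (-(3/4):ℝ)) * Mom (1 + η) f ≤ ENNReal.ofReal (s ^ (-(7/8):ℝ)) * Mom 1 f + Mom (1 + 7 * η) f := by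
  have hfm := hf.meas
  rw [Mom_one, Mom, Mom, ← lintegral_const_mul' _ _ ENNReal.ofReal_ne_top, ← lintegral_const_mul' _ _ ENNReal.ofReal_ne_top,
    ← lintegral_add_left (by fun_prop)]
  refine lintegral_mono fun v => ?_
  have h0 := hf.nonneg v
  have hp := phi_pos v
  rw [← ENNReal.ofReal_mul (by positivity), ← ENNReal.ofReal_mul (by positivity), ← ENNReal.ofReal_add (by positivity) (by positivity)]
  refine ENNReal.ofReal_le_ofReal ?_
  have := mul_le_mul_of_nonneg_left (tim_interp (η := η) hs (one_le_phi v)) h0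
  linarith

theorem povzner (hγ : 0 < γ) (hγ2 : γ ≤ 2) (hb : GradCutoff b) {m0 E0 : ℝ} (hm0 : 0 < m0) (hE0 : 0 < E0) :
    ∃ C : ℝ≥0∞, C < ⊤ ∧ ∀ f, NS (BO γ b) f → ENNReal.ofReal m0 ≤ Mom 0 (f 0) → Mom 1 (f 0) ≤ ENNReal.ofReal E0 →
      ∫⁻ τ in Ioc (0:ℝ) 1, ENNReal.ofReal (τ ^ (1/4:ℝ)) * Mom (1 + γ / 2) (f τ) ≤ C := by
  obtain ⟨d, hd, hd1, hb'⟩ := exists_bmid hb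
  obtain ⟨M, X1, c, hM, hX1, hX, hc, hlow⟩ := low_pt hγ.le hγ2 hb hd hd1 hb' hm0 hE0
  obtain ⟨C1, hC1, H1⟩ := unt_bd hγ hγ2 hb hM hd hd1 hX1 hX hc E0
  set η : ℝ := γ / 28 with hη
  have hη0 : 0 < η := by positivity
  have hq1 : (1 - d / 64) ^ η < 1 := rpow_lt_one (by linarith) (by linarith) hη0
  set X2 := max X1 (6 * M / (1 - (1 - d / 64) ^ η)) with hX2
  have hXX : X1 ≤ X2 := le_max_left _ _
  set K2 := ENNReal.ofReal ((1 - (1 - d / 64) ^ η) / 2 * c) with hK2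
  have hK0 : K2 ≠ 0 := by
    simp only [hK2, ne_eq, ENNReal.ofReal_eq_zero, not_le]
    have : 0 < 1 - (1 - d / 64) ^ η := by linarith
    positivity
  set E := ENNReal.ofReal E0 with hE
  have hEt : E < ⊤ := ENNReal.ofReal_lt_top
  have hIb := Ib_lt_top hb
  set W1 := ∫⁻ s in Ioc (0:ℝ) 1, ENNReal.ofReal (s ^ (-(3/4):ℝ)) with hW1
  set W2 := ∫⁻ s in Ioc (0:ℝ) 1, ENNReal.ofReal (s ^ (-(7/8):ℝ)) with hW2
  have hW1t : W1 < ⊤ := lint_pow_fin (by norm_num)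
  have hW2t : W2 < ⊤ := lint_pow_fin (by norm_num)
  set A := 24 * (Ib b * (E * C1)) with hA
  have hAt : A < ⊤ := ENNReal.mul_lt_top (by simp) (ENNReal.mul_lt_top hIb (ENNReal.mul_lt_top hEt hC1))
  refine ⟨ENNReal.ofReal ((1 + X2) ^ (1 + γ / 2)) * E + ENNReal.ofReal (2 ^ (1 + η + γ / 2)) * (K2⁻¹ * (W1 * A + 2 * (W2 * E + C1))), ?_,
    fun f h hm hE1 => ?_⟩
  · refine ENNReal.add_lt_top.2 ⟨ENNReal.mul_lt_top ENNReal.ofReal_lt_top hEt, ENNReal.mul_lt_top ENNReal.ofReal_lt_top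
      (ENNReal.mul_lt_top (by simpa [pos_iff_ne_zero] using hK0) (ENNReal.add_lt_top.2 ⟨ENNReal.mul_lt_top hW1t hAt, ENNReal.mul_lt_top (by simp)
        (ENNReal.add_lt_top.2 ⟨ENNReal.mul_lt_top hW2t hEt, hC1⟩)⟩))⟩
  have hen : ∀ τ, 0 ≤ τ → Mom 1 (f τ) ≤ E := fun τ hτ => (h.en hτ).trans_le hE1
  have hl1 : ∀ τ, 0 ≤ τ → LowH γ b M d X1 c (f τ) := fun τ hτ => hlow (f τ) (h.uf τ) (hm.trans_eq (h.mass hτ).symm) (hen τ hτ)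
  have hl2 : ∀ τ, 0 ≤ τ → LowH γ b M d X2 c (f τ) := fun τ hτ v hv => hl1 τ hτ v (hXX.trans hv)
  have hI1 := H1 f h hl1 hE1
  set L : ℝ → ℝ≥0∞ := fun τ => ∫⁻ v, ENNReal.ofReal (f τ v * TX X2 (1 + η + γ / 2) v) with hL
  have hLm : Measurable L := meas_L h.meas _ _
  have hs : ∀ s ∈ Ioc (0:ℝ) 1, ENNReal.ofReal (s ^ (-(3/4):ℝ)) * ∫⁻ τ in Ioc s 1, L τ ≤
      K2⁻¹ * (ENNReal.ofReal (s ^ (-(3/4):ℝ)) * A + 2 * (ENNReal.ofReal (s ^ (-(7/8):ℝ)) * E + Mom (1 + γ / 4) (f s))) := fun s hs => by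
    have h1 := tim_s hγ hγ2 hb hM hd hd1 (hX1.trans hXX) hη0 (by rw [hη]; linarith) (by rw [hη]; linarith) (hX.trans hXX) (le_max_right _ _) h hl2 hs.1.le hs.2
    have h2 : K2 * ∫⁻ τ in Ioc s 1, L τ ≤ A + 2 * Mom (1 + η) (f s) := h1.trans (by rw [hA]; gcongr)
    have h3 := inv_le_of hK0 ENNReal.ofReal_ne_top h2
    have h4 := Mom_interp (h.uf s) (η := η) hs.1
    rw [show 1 + 7 * η = 1 + γ / 4 by rw [hη]; ring] at h4
    have h5 := hen s hs.1.le
    calc _ ≤ ENNReal.ofReal (s ^ (-(3/4):ℝ)) * (K2⁻¹ * (A + 2 * Mom (1 + η) (f s))) := by gcongr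
      _ = K2⁻¹ * (ENNReal.ofReal (s ^ (-(3/4):ℝ)) * A + 2 * (ENNReal.ofReal (s ^ (-(3/4):ℝ)) * Mom (1 + η) (f s))) := by ring
      _ ≤ _ := by
        refine mul_le_mul_right ?_ _
        refine add_le_add_right (mul_le_mul_right (h4.trans ?_) _) _
        gcongr
  have hmm := meas_Mom h.meas (1 + γ / 4)
  have hfin : ∫⁻ τ in Ioc (0:ℝ) 1, ENNReal.ofReal (τ ^ (1/4:ℝ)) * L τ ≤ K2⁻¹ * (W1 * A + 2 * (W2 * E + C1)) := by
    refine (tim_swap hLm).trans ((setLIntegral_mono' measurableSet_Ioc hs).trans ?_)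
    rw [lintegral_const_mul' _ _ (by simpa using hK0)]
    gcongr
    rw [lintegral_add_left (by fun_prop), lintegral_mul_const' _ _ hAt.ne, lintegral_const_mul' _ _ (by simp), lintegral_add_left (by fun_prop),
      lintegral_mul_const' _ _ hEt.ne]
    gcongr
  calc _ ≤ ∫⁻ τ in Ioc (0:ℝ) 1, (ENNReal.ofReal ((1 + X2) ^ (1 + γ / 2)) * E +
        ENNReal.ofReal (2 ^ (1 + η + γ / 2)) * (ENNReal.ofReal (τ ^ (1/4:ℝ)) * L τ)) := setLIntegral_mono' measurableSet_Ioc fun τ hτ => by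
        have h1 := Mom_TX (X := X2) (r := 1 + γ / 2) (r' := 1 + η + γ / 2) (hX1.trans hXX) (by linarith) (by linarith) (h.uf τ)
        have h2 := hen τ hτ.1.le
        have h3 : ENNReal.ofReal (τ ^ (1/4:ℝ)) ≤ 1 := by
          rw [ENNReal.ofReal_le_one]; exact rpow_le_one hτ.1.le hτ.2 (by norm_num)
        calc _ ≤ ENNReal.ofReal (τ ^ (1/4:ℝ)) * (ENNReal.ofReal ((1 + X2) ^ (1 + γ / 2)) * E + ENNReal.ofReal (2 ^ (1 + η + γ / 2)) * L τ) := by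
              refine mul_le_mul_right (h1.trans ?_) _
              gcongr
          _ = ENNReal.ofReal (τ ^ (1/4:ℝ)) * (ENNReal.ofReal ((1 + X2) ^ (1 + γ / 2)) * E) +
              ENNReal.ofReal (2 ^ (1 + η + γ / 2)) * (ENNReal.ofReal (τ ^ (1/4:ℝ)) * L τ) := by ring
          _ ≤ _ := by
              exact add_le_add_left (mul_le_of_le_one_left' h3) _
    _ = ENNReal.ofReal ((1 + X2) ^ (1 + γ / 2)) * E + ENNReal.ofReal (2 ^ (1 + η + γ / 2)) * ∫⁻ τ in Ioc (0:ℝ) 1, (ENNReal.ofReal (τ ^ (1/4:ℝ)) * L τ) := by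
        rw [lintegral_add_left measurable_const, lintegral_const_mul (f := fun τ => ENNReal.ofReal (τ ^ (1/4:ℝ)) * L τ) _ (by fun_prop)]
        simp
    _ ≤ _ := by gcongr

end BFD
end

noncomputable section
open MeasureTheory Real Set Filter
open scoped RealInnerProductSpace ENNReal NNReal Topology

namespace BFD
variable {γ : ℝ} {b : ℝ → ℝ}

theorem povzner' (hγ0 : 0 ≤ γ) (hγ2 : γ ≤ 2) (hb : GradCutoff b) {m0 E0 : ℝ} (hm0 : 0 < m0) (hE0 : 0 < E0) :
    ∃ C : ℝ≥0∞, C < ⊤ ∧ ∀ f, NS (BO γ b) f → ENNReal.ofReal m0 ≤ Mom 0 (f 0) → Mom 1 (f 0) ≤ ENNReal.ofReal E0 →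
      ∫⁻ τ in Ioc (0:ℝ) 1, ENNReal.ofReal (τ ^ (1/4:ℝ)) * Mom (1 + γ / 2) (f τ) ≤ C := by
  rcases hγ0.eq_or_lt with rfl | hγ
  · refine ⟨ENNReal.ofReal E0, ENNReal.ofReal_lt_top, fun f h _ hE => ?_⟩
    calc _ ≤ ∫⁻ τ in Ioc (0:ℝ) 1, ENNReal.ofReal E0 := setLIntegral_mono' measurableSet_Ioc fun τ hτ => by
          have h3 : ENNReal.ofReal (τ ^ (1/4:ℝ)) ≤ 1 := by
            rw [ENNReal.ofReal_le_one]; exact rpow_le_one hτ.1.le hτ.2 (by norm_num)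
          rw [zero_div, add_zero, h.en hτ.1.le]
          exact (mul_le_of_le_one_left' h3).trans hE
      _ = _ := by simp
  · exact povzner hγ hγ2 hb hm0 hE0

lemma time_lip (hγ0 : 0 ≤ γ) (hγ2 : γ ≤ 2) (hb : GradCutoff b) {k : Om → ℝ} (hk : CK γ b k) {f : ℝ → R3 → ℝ} (h : NS k f) {t : ℝ} (ht : 0 ≤ t) :
    Y0 (fun v => f t v - f 0 v) ≤ 24 * Ib b * (Mom 1 (f 0) * Mom 1 (f 0)) * ENNReal.ofReal t := by
  have mQ := h.measQ hk
  have pw : ∀ᵐ v, ENNReal.ofReal |f t v - f 0 v| ≤ ∫⁻ τ in Ioc 0 t, ENNReal.ofReal |Qk k (f τ) v| := by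
    filter_upwards [h.mild] with v hv
    rw [hv t ht, add_sub_cancel_left, intervalIntegral.integral_of_le ht, ← Real.norm_eq_abs, ofReal_norm]
    refine (enorm_integral_le_lintegral_enorm _).trans (le_of_eq (lintegral_congr fun τ => ?_))
    rw [← ofReal_norm, Real.norm_eq_abs]
  refine (lintegral_mono_ae pw).trans ?_
  rw [lintegral_lintegral_swap (f := fun v τ => ENNReal.ofReal |Qk k (f τ) v|)
    (Measurable.aemeasurable ((mQ.comp measurable_swap).abs.ennreal_ofReal))]
  calc _ ≤ ∫⁻ τ in Ioc 0 t, 24 * Ib b * (Mom 1 (f 0) * Mom 1 (f 0)) := setLIntegral_mono' measurableSet_Ioc fun τ hτ => by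
        rw [← h.en hτ.1.le]; exact Y0_Qk hγ0 hγ2 hb hk (h.uf τ)
    _ = _ := by simp

lemma Yp_tail {f g : R3 → ℝ} (hf : UF f) (hg : UF g) (hE : Mom 1 f = Mom 1 g) (hfin : Mom 1 g < ⊤) {R : ℝ} (hR : 0 ≤ R) :
    Yp (fun v => f v - g v) ≤ 2 * (ENNReal.ofReal R * Y0 (fun v => f v - g v)) + 2 * ∫⁻ v, ENNReal.ofReal (if R < phi v then g v * phi v else 0) := by
  have hfm := hf.meas; have hgm := hg.meas
  have hms : MeasurableSet {v : R3 | R < phi v} := measurableSet_lt measurable_const meas_phi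
  have hT : Measurable fun v => (if R < phi v then g v * phi v else 0) := Measurable.ite hms (by fun_prop) measurable_const
  refine (ENNReal.add_le_add_iff_right hfin.ne).1 (?_ : _ + Mom 1 g ≤ _ + Mom 1 g)
  nth_rewrite 2 [← hE]
  rw [Mom_one, Mom_one, Yp, Y0, ← lintegral_add_left (by fun_prop), ← lintegral_const_mul' _ _ ENNReal.ofReal_ne_top,
    ← lintegral_const_mul' _ _ (by simp), ← lintegral_const_mul' _ _ (by simp), ← lintegral_add_left (by fun_prop), ← lintegral_add_left (by fun_prop)]
  refine lintegral_mono fun v => ?_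
  have h1 := hf.nonneg v; have h2 := hg.nonneg v; have hp := phi_pos v
  have h3 : 0 ≤ (if R < phi v then g v * phi v else 0) := by split_ifs <;> positivity
  rw [← ENNReal.ofReal_add (by positivity) (by positivity), ← ENNReal.ofReal_mul hR]
  rw [← ENNReal.ofReal_ofNat 2, ← ENNReal.ofReal_mul (by norm_num), ← ENNReal.ofReal_mul (by norm_num), ← ENNReal.ofReal_add (by positivity) (by positivity),
    ← ENNReal.ofReal_add (by positivity) (by positivity)]
  refine ENNReal.ofReal_le_ofReal ?_
  rcases le_or_gt (phi v) R with h | h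
  · rw [if_neg (not_lt.2 h)]
    have h4 := neg_abs_le (f v - g v)
    have h5 := mul_le_mul_of_nonneg_right h4 hp.le
    have h6 := mul_le_mul_of_nonneg_left h (abs_nonneg (f v - g v))
    nlinarith
  · rw [if_pos h]
    have h7 : 0 ≤ R * |f v - g v| := by positivity
    have h4 : |f v - g v| ≤ f v + g v := by rw [abs_le]; constructor <;> linarith
    have h5 := mul_le_mul_of_nonneg_right h4 hp.le
    linarith

lemma tau_facts {τ ρ : ℝ} (hτ : 0 < τ) (hτ1 : τ ≤ 1) (hρ : τ ^ (1/12:ℝ) ≤ ρ) :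
    1 + (τ ^ (-(1/3):ℝ)) ^ 2 ≤ ρ * (2 * τ ^ (-(3/4):ℝ)) ∧ (τ ^ (-(1/3):ℝ))⁻¹ ≤ ρ * τ ^ (1/4:ℝ) ∧ τ ≤ ρ * τ ^ (1/4:ℝ) := by
  have h1 : 0 < τ ^ (-(3/4):ℝ) := rpow_pos_of_pos hτ _
  have h2 : 0 < τ ^ (1/4:ℝ) := rpow_pos_of_pos hτ _
  have e1 : (τ ^ (-(1/3):ℝ)) ^ 2 = τ ^ (1/12:ℝ) * τ ^ (-(3/4):ℝ) := by
    rw [← rpow_natCast, ← rpow_mul hτ.le, ← rpow_add hτ]; norm_num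
  have e2 : (τ ^ (-(1/3):ℝ))⁻¹ = τ ^ (1/12:ℝ) * τ ^ (1/4:ℝ) := by
    rw [← rpow_neg hτ.le, ← rpow_add hτ]; norm_num
  have e3 : τ ^ (3/4:ℝ) ≤ τ ^ (1/12:ℝ) := rpow_le_rpow_of_exponent_ge hτ hτ1 (by norm_num)
  have e4 : 1 = τ ^ (3/4:ℝ) * τ ^ (-(3/4):ℝ) := by rw [← rpow_add hτ]; norm_num
  have e5 : τ = τ ^ (3/4:ℝ) * τ ^ (1/4:ℝ) := by rw [← rpow_add hτ]; norm_num
  refine ⟨?_, ?_, ?_⟩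
  · rw [e1]; nth_rewrite 1 [e4]; nlinarith
  · rw [e2]; gcongr
  · nth_rewrite 1 [e5]; gcongr; linarith

end BFD
end

noncomputable section
open MeasureTheory Real Set Filter
open scoped RealInnerProductSpace ENNReal NNReal Topology

namespace BFD
variable {γ : ℝ} {b : ℝ → ℝ}

/-- admissible solutions -/
def Adm (γ : ℝ) (b : ℝ → ℝ) (m0 E0 : ℝ) (f : ℝ → R3 → ℝ) : Prop :=
  NS (BO γ b) f ∧ ENNReal.ofReal m0 ≤ Mom 0 (f 0) ∧ Mom 1 (f 0) ≤ ENNReal.ofReal E0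

theorem stab_step (hγ0 : 0 ≤ γ) (hγ2 : γ ≤ 2) (hb : GradCutoff b) {m0 E0 : ℝ} (hm0 : 0 < m0) (hE0 : 0 < E0) :
    ∃ t1 : ℝ, 0 < t1 ∧ t1 ≤ 1 ∧ ∀ δ, 0 < δ → δ ≤ t1 → ∃ A : ℝ≥0∞, A < ⊤ ∧ ∀ f g, Adm γ b m0 E0 f → Adm γ b m0 E0 g → ∀ ω : ℝ≥0∞,
      (∀ t ∈ Icc 0 δ, YY f g t ≤ ω) → ∀ t ∈ Icc 0 t1, YY f g t ≤ 2 * (ω + A * YY f g 0) := by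
  obtain ⟨C, hC, HP⟩ := povzner' hγ0 hγ2 hb hm0 hE0
  have hKJ := KJ_lt_top hb
  have hB := CK_B (γ := γ) hb
  set E := ENNReal.ofReal E0 + ENNReal.ofReal E0 with hE
  have hEt : E < ⊤ := ENNReal.add_lt_top.2 ⟨ENNReal.ofReal_lt_top, ENNReal.ofReal_lt_top⟩
  set W1 := ∫⁻ s in Ioc (0:ℝ) 1, ENNReal.ofReal (s ^ (-(3/4):ℝ)) with hW1
  have hW1t : W1 < ⊤ := lint_pow_fin (by norm_num)
  have h4 : 1 + 4 * (KJ b * E) < ⊤ := ENNReal.add_lt_top.2 ⟨by simp, ENNReal.mul_lt_top (by simp) (ENNReal.mul_lt_top hKJ hEt)⟩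
  have hCC : C + C < ⊤ := ENNReal.add_lt_top.2 ⟨hC, hC⟩
  set K := 2 * (KJ b * (2 * E * W1 + (1 + 4 * (KJ b * E)) * (C + C))) with hK
  have hKt : K < ⊤ := ENNReal.mul_lt_top (by simp) (ENNReal.mul_lt_top hKJ (ENNReal.add_lt_top.2
    ⟨ENNReal.mul_lt_top (ENNReal.mul_lt_top (by simp) hEt) hW1t, ENNReal.mul_lt_top h4 hCC⟩))
  obtain ⟨ρ, hρ0, hρ1, hρ⟩ : ∃ ρ : ℝ, 0 < ρ ∧ ρ ≤ 1 ∧ ENNReal.ofReal ρ * K ≤ 1 / 2 := by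
    have hk : 0 ≤ K.toReal := ENNReal.toReal_nonneg
    refine ⟨1 / (2 * (K.toReal + 1)), by positivity, by rw [div_le_one (by positivity)]; linarith, ?_⟩
    rw [← ENNReal.ofReal_toReal hKt.ne, ← ENNReal.ofReal_mul (by positivity)]
    have : (1:ℝ≥0∞) / 2 = ENNReal.ofReal (1 / 2) := by rw [ENNReal.ofReal_div_of_pos (by norm_num)]; simp
    rw [this]
    refine ENNReal.ofReal_le_ofReal ?_
    rw [ENNReal.toReal_ofReal hk, div_mul_eq_mul_div, one_mul, div_le_div_iff₀ (by positivity) (by norm_num)]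
    linarith
  have ht10 : 0 < ρ ^ 12 := by positivity
  have ht11 : ρ ^ 12 ≤ 1 := pow_le_one₀ hρ0.le hρ1
  refine ⟨ρ ^ 12, ht10, ht11, fun δ hδ hδ1 => ?_⟩
  refine ⟨2 * (KJ b * (ENNReal.ofReal (δ ^ (-(1/4):ℝ)) * (C + C))), ENNReal.mul_lt_top (by simp) (ENNReal.mul_lt_top hKJ
    (ENNReal.mul_lt_top ENNReal.ofReal_lt_top hCC)), fun f g ⟨hf, hfm, hfE⟩ ⟨hg, hgm, hgE⟩ ω hω => ?_⟩
  set A := 2 * (KJ b * (ENNReal.ofReal (δ ^ (-(1/4):ℝ)) * (C + C))) with hA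
  set m : ℝ≥0∞ := ⨆ t ∈ Icc 0 (ρ ^ 12), YY f g t with hm
  have hle : ∀ t ∈ Icc 0 (ρ ^ 12), YY f g t ≤ m := fun t ht => le_iSup₂ (f := fun t _ => YY f g t) t ht
  have hEE : EE f g ≤ E := add_le_add hfE hgE
  have hmt : m < ⊤ := lt_of_le_of_lt (iSup₂_le fun t ht => (YY_le_EE hf hg ht.1).trans hEE) hEt
  have hNm := meas_NN (γ := γ) hf hg
  have hN2 : ∫⁻ τ in Ioc (0:ℝ) 1, ENNReal.ofReal (τ ^ (1/4:ℝ)) * NN γ f g τ ≤ C + C := by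
    refine le_trans (le_of_eq ?_) (add_le_add (HP f hf hfm hfE) (HP g hg hgm hgE))
    have := meas_Mom hf.meas (1 + γ / 2)
    rw [← lintegral_add_left (by fun_prop)]
    refine lintegral_congr fun τ => ?_
    rw [NN, mul_add]
  have hNδ : ∀ τ ∈ Ioc δ (ρ ^ 12), NN γ f g τ ≤ ENNReal.ofReal (δ ^ (-(1/4):ℝ)) * (ENNReal.ofReal (τ ^ (1/4:ℝ)) * NN γ f g τ) := fun τ hτ => by
    rw [← mul_assoc, ← ENNReal.ofReal_mul (by positivity)]
    refine le_mul_of_one_le_left' ?_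
    rw [← ENNReal.ofReal_one]
    refine ENNReal.ofReal_le_ofReal ?_
    rw [rpow_neg hδ.le, ← div_eq_inv_mul, one_le_div (by positivity)]
    exact rpow_le_rpow hδ.le hτ.1.le (by norm_num)
  have hsub : ∀ t ∈ Icc δ (ρ ^ 12), Ioc δ t ⊆ Ioc 0 1 := fun t ht => Ioc_subset_Ioc hδ.le (ht.2.trans ht11)
  have hNt : ∀ t ∈ Icc δ (ρ ^ 12), ∫⁻ τ in Ioc δ t, NN γ f g τ ≤ ENNReal.ofReal (δ ^ (-(1/4):ℝ)) * (C + C) := fun t ht => by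
    calc _ ≤ ∫⁻ τ in Ioc δ t, ENNReal.ofReal (δ ^ (-(1/4):ℝ)) * (ENNReal.ofReal (τ ^ (1/4:ℝ)) * NN γ f g τ) :=
          setLIntegral_mono' measurableSet_Ioc fun τ hτ => hNδ τ ⟨hτ.1, hτ.2.trans ht.2⟩
      _ = ENNReal.ofReal (δ ^ (-(1/4):ℝ)) * ∫⁻ τ in Ioc δ t, (ENNReal.ofReal (τ ^ (1/4:ℝ)) * NN γ f g τ) := lintegral_const_mul' _ _ ENNReal.ofReal_ne_top
      _ ≤ _ := by
        gcongr
        exact (lintegral_mono_set (hsub t ht)).trans hN2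
  have hYZ : ∀ τ ∈ Icc 0 (ρ ^ 12), YZ f g τ ≤ YY f g 0 + 4 * (KJ b * E) * m * ENNReal.ofReal τ := fun τ hτ => by
    refine (M0I hγ0 hγ2 hb hB hB hf hg le_rfl hτ.1).trans (add_le_add (YZ_le_YY f g 0) ?_)
    calc _ ≤ ∫⁻ s in Ioc 0 τ, 4 * (KJ b * E) * m := setLIntegral_mono' measurableSet_Ioc fun s hs => by
          have h1 := diff0_abs hγ0 hγ2 hb hB (hf.uf s) (hg.uf s) (hf.fin s hs.1.le) (hg.fin s hs.1.le)
          refine h1.trans ?_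
          have h2 : Mom 1 (fun v => max (f s v) (g s v)) ≤ E := by
            refine (Mom_max_le (hf.uf s) (hg.uf s) 1).trans ?_
            rw [hf.en hs.1.le, hg.en hs.1.le]; exact hEE
          have h3 := hle s ⟨hs.1.le, hs.2.trans hτ.2⟩
          rw [YY] at h3
          calc _ ≤ 4 * (KJ b * (E * m)) := by gcongr
            _ = _ := by ring
      _ = _ := by simp
  have main : ∀ t ∈ Icc δ (ρ ^ 12), YY f g t ≤ ω + A * YY f g 0 + m / 2 := fun t ht => by
    have h1 := MI hγ0 hγ2 hb hB hB hf hg hδ.le ht.1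
      ((hNt t ht).trans_lt (ENNReal.mul_lt_top ENNReal.ofReal_lt_top hCC)) (fun τ => τ ^ (-(1/3):ℝ))
      (fun τ hτ => rpow_pos_of_pos (hδ.trans hτ.1) _)
    refine h1.trans ?_
    have h2 := hω δ ⟨hδ.le, le_rfl⟩
    have hint : ∫⁻ τ in Ioc δ t, (2 * (KJ b * ((ENNReal.ofReal (1 + (τ ^ (-(1/3):ℝ)) ^ 2) * EE f g + ENNReal.ofReal (τ ^ (-(1/3):ℝ))⁻¹ * NN γ f g τ) * YY f g τ
      + NN γ f g τ * YZ f g τ)) + Yp (fun v => Qk (BO γ b) (g τ) v - Qk (BO γ b) (g τ) v)) ≤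
        ∫⁻ τ in Ioc δ t, (ENNReal.ofReal ρ * m * (2 * (KJ b * (2 * E * ENNReal.ofReal (τ ^ (-(3/4):ℝ)) + (1 + 4 * (KJ b * E)) *
          (ENNReal.ofReal (τ ^ (1/4:ℝ)) * NN γ f g τ)))) + 2 * (KJ b * (NN γ f g τ * YY f g 0))) := by
      refine setLIntegral_mono' measurableSet_Ioc fun τ hτ => ?_
      have hτ0 : 0 < τ := hδ.trans hτ.1
      have hτt : τ ≤ ρ ^ 12 := hτ.2.trans ht.2
      have hτρ : τ ^ (1/12:ℝ) ≤ ρ := by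
        calc τ ^ (1/12:ℝ) ≤ (ρ ^ 12) ^ (1/12:ℝ) := rpow_le_rpow hτ0.le hτt (by norm_num)
          _ = ρ := by
            rw [← rpow_natCast, ← rpow_mul hρ0.le]; norm_num
      obtain ⟨q1, q2, q3⟩ := tau_facts hτ0 (hτt.trans ht11) hτρ
      have r1 : ENNReal.ofReal (1 + (τ ^ (-(1/3):ℝ)) ^ 2) ≤ ENNReal.ofReal ρ * (2 * ENNReal.ofReal (τ ^ (-(3/4):ℝ))) := by
        refine (ENNReal.ofReal_le_ofReal q1).trans (le_of_eq ?_)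
        rw [ENNReal.ofReal_mul hρ0.le, ENNReal.ofReal_mul (by norm_num), ENNReal.ofReal_ofNat]
      have r2 : ENNReal.ofReal (τ ^ (-(1/3):ℝ))⁻¹ ≤ ENNReal.ofReal ρ * ENNReal.ofReal (τ ^ (1/4:ℝ)) := by
        refine (ENNReal.ofReal_le_ofReal q2).trans (le_of_eq ?_)
        rw [ENNReal.ofReal_mul hρ0.le]
      have r3 : ENNReal.ofReal τ ≤ ENNReal.ofReal ρ * ENNReal.ofReal (τ ^ (1/4:ℝ)) := by
        refine (ENNReal.ofReal_le_ofReal q3).trans (le_of_eq ?_)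
        rw [ENNReal.ofReal_mul hρ0.le]
      have hz : Yp (fun v => Qk (BO γ b) (g τ) v - Qk (BO γ b) (g τ) v) = 0 := by simp [Yp]
      have hY := hle τ ⟨hτ0.le, hτt⟩
      have hZ := hYZ τ ⟨hτ0.le, hτt⟩
      rw [hz, add_zero]
      calc _ ≤ 2 * (KJ b * (((ENNReal.ofReal ρ * (2 * ENNReal.ofReal (τ ^ (-(3/4):ℝ)))) * E + (ENNReal.ofReal ρ * ENNReal.ofReal (τ ^ (1/4:ℝ))) * NN γ f g τ) * m +
              NN γ f g τ * (YY f g 0 + 4 * (KJ b * E) * m * (ENNReal.ofReal ρ * ENNReal.ofReal (τ ^ (1/4:ℝ)))))) := by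
            refine mul_le_mul_right (mul_le_mul_right (add_le_add (mul_le_mul' (add_le_add (mul_le_mul' r1 hEE) (mul_le_mul_left r2 _)) hY) (mul_le_mul_right (hZ.trans ?_) _)) _) _
            gcongr
        _ = _ := by ring
    have hfin : ∫⁻ τ in Ioc δ t, (ENNReal.ofReal ρ * m * (2 * (KJ b * (2 * E * ENNReal.ofReal (τ ^ (-(3/4):ℝ)) + (1 + 4 * (KJ b * E)) *
          (ENNReal.ofReal (τ ^ (1/4:ℝ)) * NN γ f g τ)))) + 2 * (KJ b * (NN γ f g τ * YY f g 0))) ≤ m / 2 + A * YY f g 0 := by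
      have hY0 : YY f g 0 ≠ ⊤ := ((YY_le_EE hf hg le_rfl).trans_lt (EE_lt_top hf hg)).ne
      rw [lintegral_add_left (by fun_prop)]
      refine add_le_add ?_ ?_
      · rw [lintegral_const_mul' _ _ (ENNReal.mul_lt_top ENNReal.ofReal_lt_top hmt).ne, lintegral_const_mul' _ _ (by simp),
          lintegral_const_mul' _ _ hKJ.ne, lintegral_add_left (by fun_prop),
          lintegral_const_mul' _ _ (ENNReal.mul_lt_top (by simp) hEt).ne, lintegral_const_mul' _ _ h4.ne]
        calc _ ≤ ENNReal.ofReal ρ * m * K := by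
              rw [hK]
              gcongr
              · exact lintegral_mono_set (hsub t ht)
              · exact (lintegral_mono_set (hsub t ht)).trans hN2
          _ = m * (ENNReal.ofReal ρ * K) := by ring
          _ ≤ m * (1 / 2) := by gcongr
          _ = m / 2 := by rw [mul_one_div]
      · rw [lintegral_const_mul' _ _ (by simp), lintegral_const_mul' _ _ hKJ.ne, lintegral_mul_const' _ _ hY0]
        calc _ ≤ 2 * (KJ b * (ENNReal.ofReal (δ ^ (-(1/4):ℝ)) * (C + C) * YY f g 0)) := by
              gcongr; exact hNt t ht
          _ = _ := by rw [hA]; ring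
    calc _ ≤ ω + (m / 2 + A * YY f g 0) := add_le_add h2 (hint.trans hfin)
      _ = _ := by ring
  have hmm : m ≤ ω + A * YY f g 0 + m / 2 := iSup₂_le fun t ht => by
    rcases le_total t δ with h | h
    · refine (hω t ⟨ht.1, h⟩).trans ?_
      rw [add_assoc]; exact le_self_add
    · exact main t ⟨h, ht.2⟩
  have hfin : m ≤ 2 * (ω + A * YY f g 0) := by
    have h5 : m / 2 ≠ ⊤ := (ENNReal.div_lt_top hmt.ne (by simp)).ne
    have h6 : m / 2 ≤ ω + A * YY f g 0 := by
      refine (ENNReal.add_le_add_iff_right h5).1 ?_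
      rwa [ENNReal.add_halves]
    calc m = m / 2 + m / 2 := (ENNReal.add_halves m).symm
      _ ≤ _ := by rw [two_mul]; exact add_le_add h6 h6
  exact fun t ht => (hle t ht).trans hfin

end BFD
end

noncomputable section
open MeasureTheory Real Set Filter
open scoped RealInnerProductSpace ENNReal NNReal Topology

namespace BFD
variable {γ : ℝ} {b : ℝ → ℝ}

/-- energy tail -/
def Tl (R : ℝ) (g : R3 → ℝ) : ℝ≥0∞ := ∫⁻ v, ENNReal.ofReal (if R < phi v then g v * phi v else 0)

lemma meas_Tl (R : ℝ) {g : R3 → ℝ} (hg : Measurable g) : Measurable fun v => (if R < phi v then g v * phi v else 0) :=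
  Measurable.ite (measurableSet_lt measurable_const meas_phi) (by fun_prop) measurable_const

lemma tail_small {g : R3 → ℝ} (hg : UF g) (hfin : Mom 1 g < ⊤) {ε : ℝ≥0∞} (hε : ε ≠ 0) : ∃ R : ℝ, 0 ≤ R ∧ Tl R g ≤ ε := by
  have hm := hg.meas
  have h : Tendsto (fun n : ℕ => Tl n g) atTop (𝓝 (∫⁻ _ : R3, 0)) := by
    refine tendsto_lintegral_of_dominated_convergence (fun v => ENNReal.ofReal (g v * phi v)) (fun n => (meas_Tl n hm).ennreal_ofReal) ?_ ?_ ?_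
    · exact fun n => ae_of_all _ fun v => ENNReal.ofReal_le_ofReal (by
        split_ifs
        · exact le_rfl
        · exact mul_nonneg (hg.nonneg v) (phi_pos v).le)
    · rw [← Mom_one]; exact hfin.ne
    · refine ae_of_all _ fun v => tendsto_const_nhds.congr' ?_
      obtain ⟨n0, hn0⟩ := exists_nat_ge (phi v)
      filter_upwards [eventually_ge_atTop n0] with n hn
      have : (n0 : ℝ) ≤ n := by exact_mod_cast hn
      rw [if_neg (by linarith)]; simp
  rw [lintegral_zero] at h
  obtain ⟨n, hn⟩ := (h.eventually (gt_mem_nhds (pos_iff_ne_zero.2 hε))).exists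
  exact ⟨n, n.cast_nonneg, hn.le⟩

lemma tail_le {f g : R3 → ℝ} (hg : Measurable g) (R : ℝ) : Tl R f ≤ Tl R g + Yp (fun v => f v - g v) := by
  rw [Tl, Tl, Yp, ← lintegral_add_left (meas_Tl R hg).ennreal_ofReal]
  refine lintegral_mono fun v => ?_
  have h := phi_pos v
  split_ifs
  · refine le_trans ?_ ENNReal.ofReal_add_le
    refine ENNReal.ofReal_le_ofReal ?_
    rw [← add_mul]
    exact mul_le_mul_of_nonneg_right (by linarith [le_abs_self (f v - g v)]) h.le
  · simp

lemma mul_small {K η : ℝ≥0∞} (hK : K < ⊤) (hη : η ≠ 0) : ∃ d : ℝ, 0 < d ∧ K * ENNReal.ofReal d ≤ η := by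
  obtain ⟨n, hn, h⟩ := ENNReal.exists_nnreal_pos_mul_lt hK.ne hη
  refine ⟨n, hn, ?_⟩
  rw [mul_comm, ENNReal.ofReal_coe_nnreal]; exact h.le

/-- Cauchy in the energy norm at time `t`. -/
def CauchyAt (g : ℕ → ℝ → R3 → ℝ) (t : ℝ) : Prop := ∀ ε : ℝ≥0∞, ε ≠ 0 → ∃ N, ∀ n ≥ N, ∀ m ≥ N, YY (g n) (g m) t ≤ ε

lemma div_ne {ε : ℝ≥0∞} (h : ε ≠ 0) (n : ℕ) [n.AtLeastTwo] : ε / OfNat.ofNat n ≠ 0 := ENNReal.div_ne_zero.2 ⟨h, by simp⟩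

lemma small_time (hγ0 : 0 ≤ γ) (hγ2 : γ ≤ 2) (hb : GradCutoff b) {m0 E0 : ℝ} {g : ℕ → ℝ → R3 → ℝ} (hg : ∀ n, Adm γ b m0 E0 (g n))
    (hC : CauchyAt g 0) {ε : ℝ≥0∞} (hε : ε ≠ 0) : ∃ N, ∃ δ : ℝ, 0 < δ ∧ ∀ n ≥ N, ∀ t ∈ Icc 0 δ, Yp (fun v => g n t v - g n 0 v) ≤ ε := by
  have hB := CK_B (γ := γ) hb
  obtain ⟨N, hN⟩ := hC (ε / 8) (div_ne hε 8)
  obtain ⟨R, hR, hT⟩ := tail_small ((hg N).1.uf 0) ((hg N).1.fin 0 le_rfl) (div_ne hε 8)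
  set K := 2 * (ENNReal.ofReal R * (24 * Ib b * (ENNReal.ofReal E0 * ENNReal.ofReal E0))) with hK
  have hKt : K < ⊤ := ENNReal.mul_lt_top (by simp) (ENNReal.mul_lt_top (by simp) (ENNReal.mul_lt_top (ENNReal.mul_lt_top (by simp) (Ib_lt_top hb))
    (ENNReal.mul_lt_top (by simp) (by simp))))
  obtain ⟨δ, hδ, hd⟩ := mul_small hKt (div_ne hε 2)
  refine ⟨N, δ, hδ, fun n hn t ht => ?_⟩
  obtain ⟨h1, -, h3⟩ := hg n
  have e1 := Yp_tail (h1.uf t) (h1.uf 0) (h1.en ht.1) (h1.fin 0 le_rfl) hR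
  have e2 : Tl R (g n 0) ≤ ε / 8 + ε / 8 := (tail_le ((hg N).1.uf 0).meas R).trans (add_le_add hT (hN n hn N le_rfl))
  have e3 := time_lip hγ0 hγ2 hb hB h1 ht.1
  have e4 : Y0 (fun v => g n t v - g n 0 v) ≤ 24 * Ib b * (ENNReal.ofReal E0 * ENNReal.ofReal E0) * ENNReal.ofReal δ := by
    refine e3.trans ?_
    have := ENNReal.ofReal_le_ofReal ht.2
    gcongr
  calc _ ≤ 2 * (ENNReal.ofReal R * (24 * Ib b * (ENNReal.ofReal E0 * ENNReal.ofReal E0) * ENNReal.ofReal δ)) + 2 * (ε / 8 + ε / 8) :=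
        e1.trans (add_le_add (mul_le_mul_right (mul_le_mul_right e4 _) _) (mul_le_mul_right e2 _))
    _ = K * ENNReal.ofReal δ + ε / 2 := by
        rw [hK]
        have : 2 * (ε / 8 + ε / 8) = ε / 2 := by
          have e : (2:ℝ≥0∞)⁻¹ = 4 * 8⁻¹ := by
            rw [show (8:ℝ≥0∞) = 4 * 2 by norm_num, ENNReal.mul_inv (by simp) (by simp), ← mul_assoc, ENNReal.mul_inv_cancel (by simp) (by simp), one_mul]
          rw [div_eq_mul_inv, div_eq_mul_inv, e]; ring
        rw [this]; ring
    _ ≤ ε / 2 + ε / 2 := add_le_add hd le_rfl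
    _ = ε := ENNReal.add_halves ε

lemma cauchy_step (hγ0 : 0 ≤ γ) (hγ2 : γ ≤ 2) (hb : GradCutoff b) {m0 E0 : ℝ} (hm0 : 0 < m0) (hE0 : 0 < E0) :
    ∃ t1 : ℝ, 0 < t1 ∧ ∀ g : ℕ → ℝ → R3 → ℝ, (∀ n, Adm γ b m0 E0 (g n)) → CauchyAt g 0 → ∀ ε : ℝ≥0∞, ε ≠ 0 →
      ∃ N, ∀ n ≥ N, ∀ m ≥ N, ∀ t ∈ Icc 0 t1, YY (g n) (g m) t ≤ ε := by
  obtain ⟨t1, ht1, -, H⟩ := stab_step hγ0 hγ2 hb hm0 hE0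
  refine ⟨t1, ht1, fun g hg hC ε hε => ?_⟩
  have hη := div_ne hε 8
  set η := ε / 8 with hη'
  obtain ⟨N1, δ0, hδ0, h1⟩ := small_time hγ0 hγ2 hb hg hC hη
  obtain ⟨A, hA, h2⟩ := H (min δ0 t1) (lt_min hδ0 ht1) (min_le_right _ _)
  obtain ⟨N2, h3⟩ := hC η hη
  obtain ⟨d, hd, h4⟩ := mul_small hA hη
  obtain ⟨N3, h5⟩ := hC (ENNReal.ofReal d) (by simpa using hd)
  refine ⟨max N1 (max N2 N3), fun n hn m hm t ht => ?_⟩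
  simp only [ge_iff_le, max_le_iff] at hn hm
  have hω : ∀ s ∈ Icc 0 (min δ0 t1), YY (g n) (g m) s ≤ η + (η + η) := fun s hs => by
    have hs' : s ∈ Icc 0 δ0 := ⟨hs.1, hs.2.trans (min_le_left _ _)⟩
    have m1 := ((hg n).1.uf s).meas
    have m2 := ((hg n).1.uf 0).meas
    have m3 := ((hg m).1.uf 0).meas
    refine (Yp_tri m1 m2).trans (add_le_add (h1 n hn.1 s hs') ((Yp_tri m2 m3).trans (add_le_add (h3 n hn.2.1 m hm.2.1) ?_)))
    rw [Yp_comm]; exact h1 m hm.1 s hs'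
  refine (h2 (g n) (g m) (hg n) (hg m) _ hω t ht).trans ?_
  calc _ ≤ 2 * (η + (η + η) + η) := by
        gcongr
        exact (mul_le_mul_right (h5 n hn.2.2 m hm.2.2) A).trans h4
    _ = 8 * η := by ring
    _ = ε := ENNReal.mul_div_cancel (by simp) (by simp)

lemma Adm.shift (hγ0 : 0 ≤ γ) (hγ2 : γ ≤ 2) (hb : GradCutoff b) {m0 E0 : ℝ} {f : ℝ → R3 → ℝ} (h : Adm γ b m0 E0 f) {s : ℝ} (hs : 0 ≤ s) :
    Adm γ b m0 E0 (fun t => f (s + t)) := by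
  obtain ⟨h1, h2, h3⟩ := h
  refine ⟨h1.shift hγ0 hγ2 hb (CK_B hb) hs, ?_, ?_⟩
  · simp only [add_zero]; rwa [h1.mass hs]
  · simp only [add_zero]; rwa [h1.en hs]

theorem cauchy_all (hγ0 : 0 ≤ γ) (hγ2 : γ ≤ 2) (hb : GradCutoff b) {m0 E0 : ℝ} (hm0 : 0 < m0) (hE0 : 0 < E0)
    {g : ℕ → ℝ → R3 → ℝ} (hg : ∀ n, Adm γ b m0 E0 (g n)) (hC : CauchyAt g 0) (T : ℝ) {ε : ℝ≥0∞} (hε : ε ≠ 0) :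
      ∃ N, ∀ n ≥ N, ∀ m ≥ N, ∀ t ∈ Icc 0 T, YY (g n) (g m) t ≤ ε := by
  obtain ⟨t1, ht1, H⟩ := cauchy_step hγ0 hγ2 hb hm0 hE0
  have key : ∀ k : ℕ, ∀ ε : ℝ≥0∞, ε ≠ 0 → ∃ N, ∀ n ≥ N, ∀ m ≥ N, ∀ t ∈ Icc 0 (k * t1), YY (g n) (g m) t ≤ ε := by
    intro k
    induction k with
    | zero =>
      intro ε hε
      obtain ⟨N, hN⟩ := hC ε hε
      refine ⟨N, fun n hn m hm t ht => ?_⟩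
      have : t = 0 := le_antisymm (by simpa using ht.2) ht.1
      rw [this]; exact hN n hn m hm
    | succ k ih =>
      intro ε hε
      have hk : 0 ≤ (k:ℝ) * t1 := by positivity
      obtain ⟨N1, h1⟩ := ih ε hε
      obtain ⟨N2, h2⟩ := H (fun n t => g n (k * t1 + t)) (fun n => (hg n).shift hγ0 hγ2 hb hk) (fun ε hε => by
        obtain ⟨N, hN⟩ := ih ε hε
        refine ⟨N, fun n hn m hm => ?_⟩
        have := hN n hn m hm _ ⟨hk, le_rfl⟩
        simpa [YY] using this) ε hε
      refine ⟨max N1 N2, fun n hn m hm t ht => ?_⟩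
      simp only [ge_iff_le, max_le_iff] at hn hm
      rcases le_total t (k * t1) with h | h
      · exact h1 n hn.1 m hm.1 t ⟨ht.1, h⟩
      · have ht2 := ht.2
        push_cast at ht2
        have := h2 n hn.2 m hm.2 (t - k * t1) ⟨by linarith, by linarith⟩
        simpa [YY] using this
  obtain ⟨k, hk⟩ := exists_nat_ge (T / t1)
  obtain ⟨N, hN⟩ := key k ε hε
  exact ⟨N, fun n hn m hm t ht => hN n hn m hm t ⟨ht.1, ht.2.trans ((div_le_iff₀ ht1).1 hk)⟩⟩

/-- Uniqueness for nice solutions. -/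
theorem NS_unique (hγ0 : 0 ≤ γ) (hγ2 : γ ≤ 2) (hb : GradCutoff b) {f g : ℝ → R3 → ℝ} (hf : NS (BO γ b) f) (hg : NS (BO γ b) g)
    (h0 : Mom 0 (f 0) ≠ 0) (hfg : f 0 =ᵐ[volume] g 0) {t : ℝ} (ht : 0 ≤ t) : f t =ᵐ[volume] g t := by
  have hM : ∀ p, Mom p (g 0) = Mom p (f 0) := fun p => lintegral_congr_ae (hfg.mono fun v hv => by simp only [hv])
  have hE := hf.fin 0 le_rfl
  have h0' : Mom 0 (f 0) ≠ ⊤ := ((Mom_mono zero_le_one (hf.nonneg 0)).trans_lt hE).ne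
  have e0 : YY f g 0 = 0 := by
    rw [YY, Yp, lintegral_congr_ae (g := fun _ => 0) (hfg.mono fun v hv => by simp [hv]), lintegral_zero]
  have hd : ∀ n m : ℕ, YY (if Even n then f else g) (if Even m then f else g) 0 = 0 := fun n m => by
    have e0' : YY g f 0 = 0 := by rw [YY, Yp_comm]; exact e0
    split_ifs
    · simp [YY, Yp]
    · exact e0
    · exact e0'
    · simp [YY, Yp]
  have hA : ∀ n : ℕ, Adm γ b (Mom 0 (f 0)).toReal ((Mom 1 (f 0)).toReal + 1) (if Even n then f else g) := fun n => by
    have q1 : ENNReal.ofReal (Mom 0 (f 0)).toReal ≤ Mom 0 (f 0) := (ENNReal.ofReal_toReal h0').le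
    have q2 : Mom 1 (f 0) ≤ ENNReal.ofReal ((Mom 1 (f 0)).toReal + 1) := by
      rw [← ENNReal.ofReal_toReal hE.ne]; refine ENNReal.ofReal_le_ofReal ?_
      rw [ENNReal.toReal_ofReal ENNReal.toReal_nonneg]; linarith
    split_ifs
    · exact ⟨hf, q1, q2⟩
    · exact ⟨hg, by rwa [hM], by rwa [hM]⟩
  have hz : YY f g t = 0 := by
    by_contra hne
    obtain ⟨N, hN⟩ := cauchy_all hγ0 hγ2 hb (ENNReal.toReal_pos h0 h0') (by positivity) hA
      (fun ε _ => ⟨0, fun n _ m _ => by rw [hd]; exact zero_le⟩) t (div_ne hne 2)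
    have := hN (2 * N) (by omega) (2 * N + 1) (by omega) t ⟨ht, le_rfl⟩
    rw [if_pos (by simp), if_neg (by simp)] at this
    have hlt : YY f g t < ⊤ := (YY_le_EE hf hg ht).trans_lt (EE_lt_top hf hg)
    exact absurd this (not_le.2 (ENNReal.half_lt_self hne hlt.ne))
  have m1 := (hf.uf t).meas
  have m2 := (hg.uf t).meas
  have h := Y0_eq_zero (h := fun v => f t v - g t v) (by fun_prop) (le_antisymm ((Y0_le_Yp _).trans hz.le) zero_le)
  exact h.mono fun v hv => sub_eq_zero.1 hv

end BFD
end

noncomputable section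
open MeasureTheory Real Set Filter
open scoped RealInnerProductSpace ENNReal NNReal Topology

namespace BFD
variable {γ : ℝ} {b : ℝ → ℝ}

lemma approx (hγ0 : 0 ≤ γ) (hγ2 : γ ≤ 2) (hb : GradCutoff b) {F : R3 → ℝ} (hF : UF F) (hE : Mom 1 F < ⊤) {ε : ℝ≥0∞} (hε : ε ≠ 0) :
    ∃ g, NS (BO γ b) g ∧ Yp (fun v => F v - g 0 v) ≤ ε := by
  have hFm := hF.meas
  obtain ⟨R, hR, hT⟩ := tail_small hF hE hε
  set G : R3 → ℝ := fun v => if R < phi v then 0 else F v with hG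
  have hGm : Measurable G := Measurable.ite (measurableSet_lt measurable_const meas_phi) measurable_const hFm
  have uG : UF G := ⟨hGm, fun v => by simp only [hG]; split_ifs; exacts [le_rfl, hF.nonneg v],
    fun v => by simp only [hG]; split_ifs; exacts [zero_le_one, hF.le_one v]⟩
  have hM : Mom 3 G < ⊤ := by
    refine lt_of_le_of_lt ?_ (ENNReal.mul_lt_top (ENNReal.ofReal_lt_top (r := R ^ 2)) hE)
    rw [Mom_one, ← lintegral_const_mul' _ _ ENNReal.ofReal_ne_top]
    refine lintegral_mono fun v => ?_
    simp only [hG]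
    rw [← ENNReal.ofReal_mul (by positivity)]
    have hp := phi_pos v
    have h0 := hF.nonneg v
    refine ENNReal.ofReal_le_ofReal ?_
    split_ifs with h
    · rw [zero_mul]; positivity
    · rw [show (3:ℝ) = ((3:ℕ):ℝ) by norm_num, rpow_natCast]
      have h1 : phi v ^ 2 ≤ R ^ 2 := pow_le_pow_left₀ hp.le (not_lt.1 h) 2
      calc F v * phi v ^ 3 = phi v ^ 2 * (F v * phi v) := by ring
        _ ≤ _ := mul_le_mul_of_nonneg_right h1 (by positivity)
  obtain ⟨g, hg, hz⟩ := step1 hγ0 hγ2 hb uG hM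
  refine ⟨g, hg, (Yp_tri hFm hGm).trans ?_⟩
  rw [Yp_comm G, hz, add_zero]
  refine le_trans (le_of_eq (lintegral_congr fun v => ?_)) hT
  simp only [hG]
  split_ifs with h
  · rw [sub_zero, abs_of_nonneg (hF.nonneg v)]
  · simp

lemma NS_zero : NS (BO γ b) (fun _ _ => 0) where
  meas := measurable_const
  nonneg _ _ := le_rfl
  le_one _ _ := zero_le_one
  fin t _ := by simp [Mom]
  cons ψ _ t _ := rfl
  mild := ae_of_all _ fun v t _ => by simp [Qk, GG]

lemma exist_NS (hγ0 : 0 ≤ γ) (hγ2 : γ ≤ 2) (hb : GradCutoff b) {F : R3 → ℝ} (hF : UF F) (hE : Mom 1 F < ⊤) :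
    ∃ f, NS (BO γ b) f ∧ f 0 =ᵐ[volume] F := by
  have hFm := hF.meas
  by_cases h0 : Mom 0 F = 0
  · refine ⟨_, NS_zero, ?_⟩
    rw [Mom_zero, lintegral_eq_zero_iff (by fun_prop)] at h0
    filter_upwards [h0] with v hv
    exact le_antisymm (hF.nonneg v) (ENNReal.ofReal_eq_zero.1 hv)
  have h0' : Mom 0 F ≠ ⊤ := ((Mom_mono zero_le_one hF.nonneg).trans_lt hE).ne
  have hn : ∀ n : ℕ, min (Mom 0 F / 2) (((n:ℝ≥0∞) + 1)⁻¹) ≠ 0 := fun n =>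
    (lt_min (pos_iff_ne_zero.2 (div_ne h0 2)) (ENNReal.inv_pos.2 (by simp))).ne'
  choose g hg hgF using fun n => approx hγ0 hγ2 hb hF hE (hn n)
  have hlim : ∀ ε : ℝ≥0∞, ε ≠ 0 → ∃ N : ℕ, ∀ n ≥ N, Yp (fun v => F v - g n 0 v) ≤ ε := fun ε hε => by
    obtain ⟨N, hN⟩ := ENNReal.exists_inv_nat_lt hε
    refine ⟨N, fun n hn => ((hgF n).trans (min_le_right _ _)).trans (le_trans ?_ hN.le)⟩
    refine ENNReal.inv_le_inv.2 ?_
    have : (N:ℝ≥0∞) ≤ n := by exact_mod_cast hn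
    exact this.trans le_self_add
  have hgm := fun n => ((hg n).uf 0).meas
  have hC : CauchyAt g 0 := fun ε hε => by
    obtain ⟨N, hN⟩ := hlim (ε / 2) (div_ne hε 2)
    refine ⟨N, fun n hn m hm => (Yp_tri (hgm n) hFm).trans ?_⟩
    rw [Yp_comm, ← ENNReal.add_halves ε]
    exact add_le_add (hN n hn) (hN m hm)
  have hgE : ∀ n, Mom 1 (g n 0) ≤ Mom 1 F + 1 := fun n => by
    rw [← Yp_uf hF, ← Yp_uf ((hg n).uf 0)]
    have := Yp_sub_le (f := F) (g := fun v => F v - g n 0 v) hFm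
    simp only [sub_sub_cancel] at this
    refine this.trans (add_le_add le_rfl ((hgF n).trans ((min_le_right _ _).trans ?_)))
    rw [ENNReal.inv_le_one]; exact le_add_self
  have hE1 : Mom 1 F + 1 < ⊤ := ENNReal.add_lt_top.2 ⟨hE, by simp⟩
  have hA : ∀ n, Adm γ b (Mom 0 F / 2).toReal (Mom 1 F + 1).toReal (g n) := fun n => by
    have e2 : Mom 0 F / 2 ≠ ⊤ := (ENNReal.div_lt_top h0' (by simp)).ne
    refine ⟨hg n, ?_, ?_⟩
    · rw [ENNReal.ofReal_toReal e2]
      refine (ENNReal.add_le_add_iff_right e2).1 ?_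
      rw [ENNReal.add_halves]
      calc Mom 0 F ≤ Mom 0 (g n 0) + Y0 (fun v => F v - g n 0 v) := by
            have := hgm n
            rw [Mom_zero, Mom_zero, Y0, ← lintegral_add_left (by fun_prop)]
            refine lintegral_mono fun v => le_trans ?_ ENNReal.ofReal_add_le
            exact ENNReal.ofReal_le_ofReal (by linarith [le_abs_self (F v - g n 0 v)])
        _ ≤ _ := add_le_add le_rfl ((Y0_le_Yp _).trans ((hgF n).trans (min_le_left _ _)))
    · rw [ENNReal.ofReal_toReal hE1.ne]; exact hgE n
  have hpos : 0 < (Mom 0 F / 2).toReal := ENNReal.toReal_pos (div_ne h0 2) (ENNReal.div_lt_top h0' (by simp)).ne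
  have hpos' : 0 < (Mom 1 F + 1).toReal := ENNReal.toReal_pos (by simp) hE1.ne
  obtain ⟨f, hf, hlf⟩ := NS_limit hγ0 hγ2 hb (k := fun _ => BO γ b) (fun _ => CK_B hb) (CK_B hb) hg hE1 hgE
    (fun T ε hε => by
      obtain ⟨N, hN⟩ := cauchy_all hγ0 hγ2 hb hpos hpos' hA hC T hε.ne'
      exact ⟨N, fun n m hn hm => hN n hn m hm⟩)
    (fun T ε hε => ⟨0, fun n _ t _ => by simp [Y0]⟩)
  refine ⟨f, hf, ?_⟩
  have hfm := (hf.uf 0).meas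
  have hz : Yp (fun v => F v - f 0 v) = 0 := zero_of_eps (C := 2) (by simp) fun ε hε _ => by
    obtain ⟨N1, h1⟩ := hlim ε hε.ne'
    obtain ⟨N2, h2⟩ := hlf 0 ε hε
    rw [mul_two]
    exact (Yp_tri hFm (hgm (max N1 N2))).trans (add_le_add (h1 _ (le_max_left _ _)) (h2 _ (le_max_right _ _) 0 ⟨le_rfl, le_rfl⟩))
  have h := Y0_eq_zero (h := fun v => F v - f 0 v) (by fun_prop) (le_antisymm ((Y0_le_Yp _).trans hz.le) zero_le)
  exact h.mono fun v hv => (sub_eq_zero.1 hv).symm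

lemma wt (v : R3) : (1 + ‖v‖ ^ 2) ^ ((2:ℝ) / 2) = phi v := by norm_num [phi]

lemma wnorm_eq {h : R3 → ℝ} (hm : Measurable h) : wnorm 2 h = (Yp h).toReal := by
  unfold wnorm
  simp only [wt]
  rw [integral_eq_lintegral_of_nonneg_ae, Yp]
  · exact ae_of_all _ fun v => mul_nonneg (abs_nonneg _) (phi_pos v).le
  · exact Measurable.aestronglyMeasurable (by fun_prop)

lemma fin_of_mem {f : R3 → ℝ} (h0 : ∀ v, 0 ≤ f v) (h : MemL1s 2 f) : Mom 1 f < ⊤ := by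
  unfold MemL1s at h
  simp only [wt] at h
  rw [Mom_one]
  refine lt_of_eq_of_lt (lintegral_congr fun v => ?_) h.lintegral_lt_top
  rw [abs_of_nonneg (h0 v)]

lemma NS.cont {f : ℝ → R3 → ℝ} (h : NS (BO γ b) f) (hγ0 : 0 ≤ γ) (hγ2 : γ ≤ 2) (hb : GradCutoff b) {t : ℝ} (ht : 0 ≤ t) {ε : ℝ≥0∞} (hε : ε ≠ 0) :
    ∃ δ > 0, ∀ s : ℝ, 0 ≤ s → |s - t| < δ → Yp (fun v => f s v - f t v) ≤ ε := by
  have hB := CK_B (γ := γ) hb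
  obtain ⟨R, hR, hT⟩ := tail_small (h.uf t) (h.fin t ht) (div_ne (div_ne hε 2) 2)
  set C := 24 * Ib b * (Mom 1 (f 0) * Mom 1 (f 0)) with hC
  have hE := h.fin 0 le_rfl
  have hKt : 2 * (ENNReal.ofReal R * C) < ⊤ := ENNReal.mul_lt_top (by simp) (ENNReal.mul_lt_top (by simp) (ENNReal.mul_lt_top (ENNReal.mul_lt_top (by simp) (Ib_lt_top hb))
    (ENNReal.mul_lt_top hE hE)))
  obtain ⟨δ, hδ, hd⟩ := mul_small hKt (div_ne hε 2)
  have lip : ∀ a c, 0 ≤ a → a ≤ c → Y0 (fun v => f c v - f a v) ≤ C * ENNReal.ofReal (c - a) := fun a c ha hac => by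
    have := time_lip hγ0 hγ2 hb hB (h.shift hγ0 hγ2 hb hB ha) (sub_nonneg.2 hac)
    simpa [h.en ha] using this
  refine ⟨δ, hδ, fun s hs hst => ?_⟩
  have e1 := Yp_tail (h.uf s) (h.uf t) ((h.en hs).trans (h.en ht).symm) (h.fin t ht) hR
  have e2 : Y0 (fun v => f s v - f t v) ≤ C * ENNReal.ofReal δ := by
    rcases le_total s t with hh | hh
    · have : Y0 (fun v => f s v - f t v) = Y0 (fun v => f t v - f s v) := by simp only [Y0, abs_sub_comm]
      rw [this]
      exact (lip s t hs hh).trans (mul_le_mul_right (ENNReal.ofReal_le_ofReal (by linarith [neg_abs_le (s - t)])) _)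
    · exact (lip t s ht hh).trans (mul_le_mul_right (ENNReal.ofReal_le_ofReal (by linarith [le_abs_self (s - t)])) _)
  calc _ ≤ 2 * (ENNReal.ofReal R * (C * ENNReal.ofReal δ)) + 2 * (ε / 2 / 2) :=
        e1.trans (add_le_add (mul_le_mul_right (mul_le_mul_right e2 _) _) (mul_le_mul_right hT _))
    _ = 2 * (ENNReal.ofReal R * C) * ENNReal.ofReal δ + ε / 2 := by
        rw [ENNReal.mul_div_cancel (by simp) (by simp)]; ring
    _ ≤ ε / 2 + ε / 2 := add_le_add hd le_rfl
    _ = ε := ENNReal.add_halves ε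

lemma int_vec {f : R3 → ℝ} (hf : UF f) (hE : Mom 1 f < ⊤) : Integrable fun v => f v • v := by
  have hm := hf.meas
  have h := int_of_Mom hf hE (ψ := fun v => ‖v‖) (C := 1) (by fun_prop) fun v => by
    rw [abs_of_nonneg (norm_nonneg v)]; unfold phi; nlinarith [sq_nonneg (‖v‖ - 1)]
  refine h.mono (Measurable.aestronglyMeasurable (by fun_prop)) (ae_of_all _ fun v => ?_)
  simp [norm_smul]

lemma int_coord {f : R3 → ℝ} (hf : UF f) (hE : Mom 1 f < ⊤) (i : Fin 3) : (∫ v, f v • v) i = ∫ v, f v * v i := by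
  have := (EuclideanSpace.proj (𝕜 := ℝ) i : R3 →L[ℝ] ℝ).integral_comp_comm (int_vec hf hE)
  simpa using this.symm

lemma to_FD (hγ0 : 0 ≤ γ) (hγ2 : γ ≤ 2) (hb : GradCutoff b) {f : ℝ → R3 → ℝ} {f₀ : R3 → ℝ} (h : NS (BO γ b) f) (h0 : f 0 =ᵐ[volume] f₀) :
    IsFDSolution γ b f₀ f where
  measurable t := (h.uf t).meas
  nonneg t _ := h.nonneg t
  le_one t _ := h.le_one t
  memL12 t ht := by
    unfold MemL1s
    simp only [wt]
    have := int_of_Mom (h.uf t) (h.fin t ht) meas_phi (C := 1) fun v => by rw [one_mul, abs_of_pos (phi_pos v)]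
    refine this.congr (ae_of_all _ fun v => ?_)
    simp only [abs_of_nonneg (h.nonneg t v)]
  contL12 t ht ε hε := by
    obtain ⟨δ, hδ, H⟩ := h.cont hγ0 hγ2 hb ht (ε := ENNReal.ofReal (ε / 2)) (by simpa using hε)
    refine ⟨δ, hδ, fun s hs hst => ?_⟩
    have m1 := (h.uf s).meas
    have m2 := (h.uf t).meas
    rw [wnorm_eq (by fun_prop)]
    have := ENNReal.toReal_mono ENNReal.ofReal_ne_top (H s hs hst)
    rw [ENNReal.toReal_ofReal (by positivity)] at this
    linarith
  mild := by
    refine ⟨{v | ¬ (f 0 v = f₀ v ∧ ∀ t, 0 ≤ t → f t v = f 0 v + ∫ τ in (0:ℝ)..t, Qk (BO γ b) (f τ) v)}, ?_, fun t ht v hv => ?_⟩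
    · exact ae_iff.1 (h0.and h.mild)
    · simp only [mem_ofPred_eq, not_not] at hv
      rw [hv.2 t ht, hv.1]
      congr 1
      refine intervalIntegral.integral_congr fun τ hτ => ?_
      rw [uIcc_of_le ht] at hτ
      exact (QFD_eq_Qk hγ0 hγ2 hb (h.uf τ) (h.fin τ hτ.1) v).symm
  mass t ht := by
    have := h.cons _ CI_one t ht
    simp only [mul_one] at this
    rw [this]; exact integral_congr_ae h0
  momentum t ht := by
    have e : ∫ v, f₀ v • v = ∫ v, f 0 v • v := integral_congr_ae (h0.mono fun v hv => by simp only [hv])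
    rw [e]
    ext i
    rw [int_coord (h.uf t) (h.fin t ht), int_coord (h.uf 0) (h.fin 0 le_rfl)]
    exact h.cons _ (Or.inr (Or.inr ⟨i, rfl⟩)) t ht
  energy t ht := by
    rw [h.cons _ CI_sq t ht]
    exact integral_congr_ae (h0.mono fun v hv => by simp only [hv])

lemma existence (hγ0 : 0 ≤ γ) (hγ2 : γ ≤ 2) (hb : GradCutoff b) {f₀ : R3 → ℝ} (hm : Measurable f₀)
    (hbd : ∀ᵐ v, 0 ≤ f₀ v ∧ f₀ v ≤ 1) (hL : MemL1s 2 f₀) : ∃ f, IsFDSolution γ b f₀ f := by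
  set F : R3 → ℝ := fun v => max 0 (min (f₀ v) 1) with hF
  have hFf : F =ᵐ[volume] f₀ := hbd.mono fun v hv => by simp [hF, hv.1, hv.2]
  have uF : UF F := ⟨by fun_prop, fun v => le_max_left _ _, fun v => max_le zero_le_one (min_le_right _ _)⟩
  have hE : Mom 1 F < ⊤ := fin_of_mem uF.nonneg (by
    unfold MemL1s at hL ⊢
    exact hL.congr (hFf.mono fun v hv => by simp only [hv]))
  obtain ⟨f, hf, hf0⟩ := exist_NS hγ0 hγ2 hb uF hE
  exact ⟨f, to_FD hγ0 hγ2 hb hf (hf0.trans hFf)⟩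

end BFD
end

noncomputable section
open MeasureTheory Real Set Filter
open scoped RealInnerProductSpace ENNReal NNReal Topology

namespace BFD
variable {γ : ℝ} {b : ℝ → ℝ}

/-- Left continuity of (junk-valued) primitives of bounded, possibly non-measurable functions. -/
lemma left_cont {q : ℝ → ℝ} {M : ℝ} (hM : ∀ τ, 0 ≤ τ → |q τ| ≤ M) {t : ℝ} (ht : 0 < t) {a : ℕ → ℝ} (ha0 : ∀ n, 0 ≤ a n) (hat : ∀ n, a n ≤ t)
    (hlim : Tendsto a atTop (𝓝 t)) : Tendsto (fun n => ∫ τ in (0:ℝ)..(a n), q τ) atTop (𝓝 (∫ τ in (0:ℝ)..t, q τ)) := by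
  have sub : ∀ {s r : ℝ}, 0 ≤ s → s ≤ r → IntervalIntegrable q volume 0 r → IntervalIntegrable q volume 0 s := fun hs hsr h =>
    h.mono_set (by rw [uIcc_of_le hs, uIcc_of_le (hs.trans hsr)]; exact Icc_subset_Icc le_rfl hsr)
  by_cases hi : IntervalIntegrable q volume 0 t
  · have hb : ∀ n, ‖(∫ τ in (0:ℝ)..(a n), q τ) - ∫ τ in (0:ℝ)..t, q τ‖ ≤ M * |t - a n| := fun n => by
      rw [norm_sub_rev, intervalIntegral.integral_interval_sub_left hi (sub (ha0 n) (hat n) hi)]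
      refine intervalIntegral.norm_integral_le_of_norm_le_const fun τ hτ => ?_
      rw [uIoc_of_le (hat n)] at hτ
      exact hM τ ((ha0 n).trans hτ.1.le)
    refine tendsto_iff_norm_sub_tendsto_zero.2 (squeeze_zero (fun _ => norm_nonneg _) hb ?_)
    have : Tendsto (fun n => M * |t - a n|) atTop (𝓝 (M * |t - t|)) := ((tendsto_const_nhds.sub hlim).abs).const_mul M
    simpa using this
  · obtain ⟨s, hs0, hst, hs⟩ : ∃ s, 0 ≤ s ∧ s < t ∧ ¬ IntervalIntegrable q volume 0 s := by
      by_contra! hcon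
      refine hi ?_
      rw [intervalIntegrable_iff_integrableOn_Ioo_of_le ht.le]
      have hm : AEStronglyMeasurable q (volume.restrict (⋃ n : ℕ, Ioc 0 (t * (1 - 1 / ((n:ℝ) + 1))))) := by
        refine AEStronglyMeasurable.iUnion fun n => ?_
        have h1 : 0 < 1 / ((n:ℝ) + 1) := by positivity
        have h2 : 1 / ((n:ℝ) + 1) ≤ 1 := by rw [div_le_one (by positivity)]; linarith [n.cast_nonneg (α := ℝ)]
        exact (hcon _ (mul_nonneg ht.le (by linarith)) (by nlinarith)).1.1
      have hm' := hm.mono_set (s := Ioo 0 t) fun x hx => ?_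
      · exact Integrable.of_bound hm' M ((ae_restrict_iff' measurableSet_Ioo).2 (ae_of_all _ fun x hx => hM x hx.1.le))
      simp only [mem_Ioo] at hx
      obtain ⟨n, hn⟩ := exists_nat_one_div_lt (show 0 < (t - x) / t from div_pos (sub_pos.2 hx.2) ht)
      refine mem_iUnion.2 ⟨n, hx.1, ?_⟩
      rw [lt_div_iff₀ ht] at hn
      nlinarith
    have hz : ∀ r, s ≤ r → ∫ τ in (0:ℝ)..r, q τ = 0 := fun r hr => intervalIntegral.integral_undef fun h => hs (sub hs0 hr h)
    rw [hz t hst.le]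
    refine tendsto_const_nhds.congr' ?_
    filter_upwards [hlim.eventually (lt_mem_nhds hst)] with n hn
    exact (hz _ hn.le).symm

/-- A left-approximating sequence with countable range. -/
def ap (n : ℕ) (t : ℝ) : ℝ := max (((⌈((n:ℝ) + 1) * t⌉ : ℝ) - 1) / ((n:ℝ) + 1)) 0

lemma ap_le (n : ℕ) {t : ℝ} (ht : 0 ≤ t) : ap n t ≤ t := by
  refine max_le ?_ ht
  rw [div_le_iff₀ (by positivity)]
  linarith [Int.ceil_lt_add_one (((n:ℝ) + 1) * t)]

lemma ap_lim {t : ℝ} (ht : 0 ≤ t) : Tendsto (fun n => ap n t) atTop (𝓝 t) := by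
  have h1 : Tendsto (fun n : ℕ => t - 1 / ((n:ℝ) + 1)) atTop (𝓝 (t - 0)) := tendsto_const_nhds.sub tendsto_one_div_add_atTop_nhds_zero_nat
  rw [sub_zero] at h1
  refine tendsto_of_tendsto_of_tendsto_of_le_of_le h1 tendsto_const_nhds (fun n => ?_) fun n => ap_le n ht
  refine le_trans ?_ (le_max_left _ _)
  have hp : (0:ℝ) < (n:ℝ) + 1 := by positivity
  rw [le_div_iff₀ hp, sub_mul, one_div_mul_cancel hp.ne']
  linarith [Int.le_ceil (((n:ℝ) + 1) * t)]

lemma null_coll {Z : Set R3} (hZ : volume Z = 0) :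
    ∀ᵐ v : R3, ∀ᵐ q ∂nu, v ∉ Z ∧ q.1 ∉ Z ∧ Q2 (v, q) ∉ Z ∧ Q3 (v, q) ∉ Z := by
  have h1 : ∀ᵐ p ∂mu0, p.1 ∉ Z := by
    have : ∀ᵐ v : R3, v ∉ Z := measure_eq_zero_iff_ae_notMem.1 hZ
    exact Measure.quasiMeasurePreserving_fst.ae this
  have h2 : ∀ᵐ p ∂mu0, p.2.1 ∉ Z := Sm_mp.quasiMeasurePreserving.ae h1
  have h3 : ∀ᵐ p ∂mu0, Q2 p ∉ Z := Tm_mp.quasiMeasurePreserving.ae h1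
  have h4 : ∀ᵐ p ∂mu0, Q3 p ∉ Z := Tm_mp.quasiMeasurePreserving.ae h2
  have h : ∀ᵐ p ∂mu0, p.1 ∉ Z ∧ p.2.1 ∉ Z ∧ Q2 p ∉ Z ∧ Q3 p ∉ Z := h1.and (h2.and (h3.and h4))
  exact Measure.ae_ae_of_ae_prod h

lemma conv (hγ0 : 0 ≤ γ) (hγ2 : γ ≤ 2) (hb : GradCutoff b) {f₀ : R3 → ℝ} {f : ℝ → R3 → ℝ} (h : IsFDSolution γ b f₀ f) :
    ∃ F, NS (BO γ b) F ∧ ∀ t, 0 ≤ t → F t =ᵐ[volume] f t := by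
  classical
  obtain ⟨Z, hZ, hmild⟩ := h.mild
  set Z' := toMeasurable volume Z with hZ'
  have hZm : MeasurableSet Z' := measurableSet_toMeasurable _ _
  have hZ0 : volume Z' = 0 := by rw [hZ', measure_toMeasurable, hZ]
  have hsub : ∀ v, v ∉ Z' → v ∉ Z := fun v hv hv' => hv (subset_toMeasurable _ _ hv')
  have uf : ∀ t, 0 ≤ t → UF (f t) := fun t ht => ⟨h.measurable t, h.nonneg t ht, h.le_one t ht⟩
  have hfin : ∀ t, 0 ≤ t → Mom 1 (f t) < ⊤ := fun t ht => fin_of_mem (h.nonneg t ht) (h.memL12 t ht)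
  have hcons : ∀ ψ ∈ CI, ∀ t, 0 ≤ t → ∫ v, f t v * ψ v = ∫ v, f 0 v * ψ v := by
    rintro ψ (rfl | rfl | ⟨i, rfl⟩) t ht
    · simp only [mul_one]; rw [h.mass t ht, h.mass 0 le_rfl]
    · rw [h.energy t ht, h.energy 0 le_rfl]
    · rw [← int_coord (uf t ht) (hfin t ht), ← int_coord (uf 0 le_rfl) (hfin 0 le_rfl), h.momentum t ht, h.momentum 0 le_rfl]
  have hen : ∀ t, 0 ≤ t → Mom 1 (f t) = Mom 1 (f 0) := fun t ht => by
    have e : ∀ s, 0 ≤ s → ∫ v, f s v * phi v = (∫ v, f s v * 1) + ∫ v, f s v * ‖v‖ ^ 2 := by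
      intro s hs
      rw [← integral_add (int_of_Mom (uf s hs) (hfin s hs) (C := 1) (CI_meas CI_one) fun v => by rw [one_mul]; exact CI_le CI_one v)
        (int_of_Mom (uf s hs) (hfin s hs) (C := 1) (CI_meas CI_sq) fun v => by rw [one_mul]; exact CI_le CI_sq v)]
      refine integral_congr_ae (ae_of_all _ fun v => ?_)
      simp only [phi]; ring
    rw [NS.Mom_ofReal (uf t ht) (hfin t ht), NS.Mom_ofReal (uf 0 le_rfl) (hfin 0 le_rfl), e t ht, e 0 le_rfl, hcons _ CI_one t ht, hcons _ CI_sq t ht]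
  have hbd : ∀ v τ, 0 ≤ τ → |QFD γ b (f τ) v| ≤ (KJ b * (Mom 1 (f 0) * ENNReal.ofReal (phi v))).toReal := fun v τ hτ => by
    rw [QFD_eq_Qk hγ0 hγ2 hb (uf τ hτ) (hfin τ hτ)]
    have h1 := Qk_abs_le hγ0 hγ2 hb (CK_B hb) (uf τ hτ) v
    rw [hen τ hτ] at h1
    have := ENNReal.toReal_mono (ENNReal.mul_lt_top (KJ_lt_top hb) (ENNReal.mul_lt_top (hfin 0 le_rfl) ENNReal.ofReal_lt_top)).ne h1
    rwa [ENNReal.toReal_ofReal (abs_nonneg _)] at this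
  set F : ℝ → R3 → ℝ := fun t v => if v ∈ Z' then 0 else f (max t 0) v with hF
  have hFe : ∀ t, 0 ≤ t → ∀ v, v ∉ Z' → F t v = f t v := fun t ht v hv => by simp [hF, hv, ht]
  have hae : ∀ᵐ v : R3, v ∉ Z' := measure_eq_zero_iff_ae_notMem.1 hZ0
  have hFf : ∀ t, 0 ≤ t → F t =ᵐ[volume] f t := fun t ht => hae.mono fun v hv => hFe t ht v hv
  have hFm : Measurable (fun p : ℝ × R3 => F p.1 p.2) := by
    refine measurable_of_tendsto_metrizable (f := fun n (p : ℝ × R3) => if p.2 ∈ Z' then 0 else f (ap n (max p.1 0)) p.2) (fun n => ?_)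
      (tendsto_pi_nhds.2 fun p => ?_)
    · refine Measurable.ite (measurable_snd hZm) measurable_const ?_
      have h1 : Measurable fun x : ℤ × R3 => f (max (((x.1 : ℝ) - 1) / ((n:ℝ) + 1)) 0) x.2 :=
        measurable_from_prod_countable_right fun k => h.measurable (max (((k : ℝ) - 1) / ((n:ℝ) + 1)) 0)
      exact h1.comp (f := fun p : ℝ × R3 => (⌈((n:ℝ) + 1) * max p.1 0⌉, p.2)) (by fun_prop)
    · obtain ⟨t, v⟩ := p
      simp only [hF]
      split_ifs with hv
      · exact tendsto_const_nhds
      · have ht : 0 ≤ max t 0 := le_max_right _ _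
        set s := max t 0
        rcases ht.eq_or_lt with hs | hs
        · have : ∀ n, ap n s = s := fun n => le_antisymm (ap_le n ht) (by rw [← hs]; exact le_max_right _ _)
          simp only [this]; exact tendsto_const_nhds
        · rw [hmild s ht v (hsub v hv)]
          have e : ∀ n, f (ap n s) v = f₀ v + ∫ τ in (0:ℝ)..(ap n s), QFD γ b (f τ) v := fun n => hmild _ (le_max_right _ _) v (hsub v hv)
          simp only [e]
          exact (left_cont (hbd v) hs (fun n => le_max_right _ _) (fun n => ap_le n ht) (ap_lim ht)).const_add _
  have hQ : ∀ᵐ v, ∀ τ, 0 ≤ τ → QFD γ b (f τ) v = Qk (BO γ b) (F τ) v := by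
    filter_upwards [null_coll hZ0] with v hv τ hτ
    rw [QFD_eq_Qk hγ0 hγ2 hb (uf τ hτ) (hfin τ hτ), Qk, Qk]
    refine integral_congr_ae (hv.mono fun q ⟨q1, q2, q3, q4⟩ => ?_)
    simp only [GG, hFe τ hτ _ q1, hFe τ hτ _ q2, hFe τ hτ _ q3, hFe τ hτ _ q4]
  refine ⟨F, ⟨hFm, fun t v => ?_, fun t v => ?_, fun t ht => ?_, fun ψ hψ t ht => ?_, ?_⟩, hFf⟩
  · simp only [hF]; split_ifs; exacts [le_rfl, h.nonneg _ (le_max_right _ _) v]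
  · simp only [hF]; split_ifs; exacts [zero_le_one, h.le_one _ (le_max_right _ _) v]
  · refine lt_of_eq_of_lt (lintegral_congr_ae ((hFf t ht).mono fun v hv => ?_)) (hfin t ht)
    simp only [hv]
  · have e : ∀ s, 0 ≤ s → ∫ v, F s v * ψ v = ∫ v, f s v * ψ v := fun s hs =>
      integral_congr_ae ((hFf s hs).mono fun v hv => by simp only [hv])
    rw [e t ht, e 0 le_rfl, hcons ψ hψ t ht]
  · filter_upwards [hQ, hae] with v hv hvZ t ht
    have e0 := hmild 0 le_rfl v (hsub v hvZ)
    rw [intervalIntegral.integral_same, add_zero] at e0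
    rw [hFe t ht v hvZ, hFe 0 le_rfl v hvZ, hmild t ht v (hsub v hvZ), e0]
    congr 1
    refine intervalIntegral.integral_congr fun τ hτ => ?_
    rw [uIcc_of_le ht] at hτ
    exact hv τ hτ.1

lemma init_ae {f₀ : R3 → ℝ} {f : ℝ → R3 → ℝ} (h : IsFDSolution γ b f₀ f) : f 0 =ᵐ[volume] f₀ := by
  obtain ⟨Z, hZ, hmild⟩ := h.mild
  filter_upwards [measure_eq_zero_iff_ae_notMem.1 hZ] with v hv
  simpa using hmild 0 le_rfl v hv

lemma uniqueness (hγ0 : 0 ≤ γ) (hγ2 : γ ≤ 2) (hb : GradCutoff b) {f₀ : R3 → ℝ} {f g : ℝ → R3 → ℝ} (hf : IsFDSolution γ b f₀ f)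
    (hg : IsFDSolution γ b f₀ g) {t : ℝ} (ht : 0 ≤ t) : f t =ᵐ[volume] g t := by
  obtain ⟨F, nF, eF⟩ := conv hγ0 hγ2 hb hf
  obtain ⟨G, nG, eG⟩ := conv hγ0 hγ2 hb hg
  have e0 : F 0 =ᵐ[volume] G 0 := (eF 0 le_rfl).trans ((init_ae hf).trans ((init_ae hg).symm.trans (eG 0 le_rfl).symm))
  refine (eF t ht).symm.trans (EventuallyEq.trans ?_ (eG t ht))
  by_cases h0 : Mom 0 (F 0) = 0
  · have hG0 : Mom 0 (G 0) = 0 := by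
      rw [← h0]; exact lintegral_congr_ae (e0.mono fun v hv => by simp only [hv])
    have key : ∀ {H : ℝ → R3 → ℝ}, NS (BO γ b) H → Mom 0 (H 0) = 0 → ∀ᵐ v, H t v = 0 := fun {H} hH hz => by
      have := (hH.uf t).meas
      rw [← hH.mass ht, Mom_zero, lintegral_eq_zero_iff (by fun_prop)] at hz
      filter_upwards [hz] with v hv
      exact le_antisymm (ENNReal.ofReal_eq_zero.1 hv) (hH.nonneg t v)
    filter_upwards [key nF h0, key nG hG0] with v h1 h2
    rw [h1, h2]
  · exact NS_unique hγ0 hγ2 hb nF nG h0 e0 ht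

end BFD
end

/-- Global existence and uniqueness of conservative mild solutions of the
Boltzmann–Fermi–Dirac equation for hard potentials `0 ≤ γ ≤ 2` under Grad's cutoff. -/
theorem existence_uniqueness_BFD
    (γ : ℝ) (hγ₀ : 0 ≤ γ) (hγ₂ : γ ≤ 2) (b : ℝ → ℝ) (hb : GradCutoff b)
    (f₀ : R3 → ℝ) (hf₀meas : Measurable f₀)
    (hf₀bd : ∀ᵐ v : R3 ∂volume, 0 ≤ f₀ v ∧ f₀ v ≤ 1) (hf₀L12 : MemL1s 2 f₀) :
    (∃ f : ℝ → R3 → ℝ, IsFDSolution γ b f₀ f) ∧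
    (∀ f g : ℝ → R3 → ℝ, IsFDSolution γ b f₀ f → IsFDSolution γ b f₀ g →
      ∀ t : ℝ, 0 ≤ t → ∀ᵐ v : R3 ∂volume, f t v = g t v) := by
  exact ⟨BFD.existence hγ₀ hγ₂ hb hf₀meas hf₀bd hf₀L12,
    fun f g hf hg t ht => BFD.uniqueness hγ₀ hγ₂ hb hf hg ht⟩
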